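/- For any integer n ≥ 3, the restriction map H¹(Cr_{n+1}(ℂ); ℤ) → H¹(Cr_n(ℂ); ℤ) along the stabilization homomorphism has a non-trivial kernel; equivalently, there exists a group homomorphism f : Cr_{n+1}(ℂ) → ℤ with f ≠ 0 such that the composite f ∘ ι_n : Cr_n(ℂ) → ℤ is the zero homomorphism. -/

import Mathlib

/-!
For any integer `n ≥ 3`, the map induced on abelianizations (first integral homology) by the
stabilization homomorphism `ι_n : Cr_n(ℂ) → Cr_{n+1}(ℂ)` has a non-trivial kernel.

Here `Cr_n(K)` is the group of `K`-algebra automorphisms of the rational function field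
`K(x₁, …, xₙ) = FractionRing (MvPolynomial (Fin n) K)`, and the stabilization homomorphism is
characterized by: `ι_n σ` extends `σ` along the natural inclusion
`K(x₁, …, xₙ) ⊆ K(x₁, …, x_{n+1})` and fixes the last variable `x_{n+1}`.
-/

open MvPolynomial

noncomputable section

set_option maxHeartbeats 1000000
set_option synthInstance.maxHeartbeats 400000

/-- The rational function field `K(x₁, …, xₙ)`. -/
abbrev RatFun (K : Type) [Field K] (n : ℕ) : Type := FractionRing (MvPolynomial (Fin n) K)

/-- The natural inclusion `K(x₁, …, xₙ) ⊆ K(x₁, …, x_{n+1})`, induced by the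
inclusion `Fin n ↪ Fin (n+1)` on polynomial variables. -/
def stabAlg (K : Type) [Field K] (n : ℕ) : RatFun K n →ₐ[K] RatFun K (n+1) :=
  IsFractionRing.liftAlgHom (R := K)
    (g := (IsScalarTower.toAlgHom K (MvPolynomial (Fin (n+1)) K) (RatFun K (n+1))).comp
      (MvPolynomial.rename (Fin.castSucc : Fin n → Fin (n+1))))
    (by
      exact (IsFractionRing.injective (MvPolynomial (Fin (n+1)) K) (RatFun K (n+1))).comp
        (MvPolynomial.rename_injective _ (Fin.castSucc_injective n)))

/-- `τ ∈ Cr_{n+1}(K)` is the stabilization of `σ ∈ Cr_n(K)`: it extends `σ` along the natural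
inclusion `K(x₁, …, xₙ) ⊆ K(x₁, …, x_{n+1})` and fixes the last variable `x_{n+1}`. -/
def IsStabilizationOf {K : Type} [Field K] {n : ℕ}
    (τ : RatFun K (n+1) ≃ₐ[K] RatFun K (n+1)) (σ : RatFun K n ≃ₐ[K] RatFun K n) : Prop :=
  (∀ p : RatFun K n, τ (stabAlg K n p) = stabAlg K n (σ p)) ∧
  τ (algebraMap (MvPolynomial (Fin (n+1)) K) (RatFun K (n+1)) (X (Fin.last n))) =
    algebraMap (MvPolynomial (Fin (n+1)) K) (RatFun K (n+1)) (X (Fin.last n))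

namespace CremonaPlaces

section Pregeometry

variable {Ω : Type} [Field Ω] [Algebra ℂ Ω]

/-- The matroid of algebraic independence over `ℂ`. -/
abbrev indepMat (Ω : Type) [Field Ω] [Algebra ℂ Ω] : Matroid Ω := AlgebraicIndependent.matroid ℂ Ω

/-- The relative algebraic closure of the field generated by a set. -/
def acl (S : Set Ω) : IntermediateField ℂ Ω :=
  (algebraicClosure (IntermediateField.adjoin ℂ S) Ω).restrictScalars ℂ

lemma mem_acl {S : Set Ω} {x : Ω} : x ∈ acl S ↔ IsAlgebraic (IntermediateField.adjoin ℂ S) x := by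
  unfold acl
  rw [IntermediateField.mem_restrictScalars, mem_algebraicClosure_iff]

lemma coe_acl (S : Set Ω) : (acl S : Set Ω) = (indepMat Ω).closure S := by
  rw [AlgebraicIndependent.matroid_closure_eq]
  ext x
  rw [SetLike.mem_coe, mem_acl, SetLike.mem_coe, Subalgebra.mem_algebraicClosure]
  exact IntermediateField.isAlgebraic_adjoin_iff

lemma mem_acl_iff {S : Set Ω} {x : Ω} : x ∈ acl S ↔ x ∈ (indepMat Ω).closure S := by
  rw [← coe_acl]; rfl

lemma subset_acl (S : Set Ω) : S ⊆ acl S := by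
  rw [coe_acl]; exact Matroid.subset_closure _ _ (Set.subset_univ _)

lemma acl_mono {S T : Set Ω} (h : S ⊆ T) : acl S ≤ acl T := by
  intro x; rw [mem_acl_iff, mem_acl_iff]; exact fun hx => (indepMat Ω).closure_mono h hx

lemma acl_acl (S : Set Ω) : acl (acl S : Set Ω) = acl S := by
  apply SetLike.coe_injective
  rw [coe_acl (acl S : Set Ω), coe_acl, Matroid.closure_closure]

lemma acl_le_of_subset {S T : Set Ω} (h : S ⊆ acl T) : acl S ≤ acl T := by
  rw [← acl_acl T]; exact acl_mono h

lemma adjoin_le_acl (S : Set Ω) : IntermediateField.adjoin ℂ S ≤ acl S :=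
  IntermediateField.adjoin_le_iff.mpr (subset_acl S)

lemma acl_adjoin (S : Set Ω) : acl (IntermediateField.adjoin ℂ S : Set Ω) = acl S :=
  le_antisymm (acl_le_of_subset (adjoin_le_acl S))
    (acl_mono (IntermediateField.subset_adjoin ℂ S))

lemma acl_exchange {S : Set Ω} {e f : Ω} (he : e ∈ acl (insert f S)) (he' : e ∉ acl S) :
    f ∈ acl (insert e S) := by
  rw [mem_acl_iff] at *
  exact ((indepMat Ω).closure_exchange ⟨he, he'⟩).1

lemma mem_acl_of_isAlgebraic {S : Set Ω} {x : Ω} (h : IsAlgebraic (acl S) x) : x ∈ acl S := by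
  rw [← acl_acl S, mem_acl]
  have : IntermediateField.adjoin ℂ (acl S : Set Ω) = acl S := by
    simp
  rw [this]; exact h

lemma mem_acl_of_root {S : Set Ω} {x : Ω} (p : Polynomial (acl S)) (hp : p ≠ 0)
    (h : Polynomial.aeval x p = 0) : x ∈ acl S := mem_acl_of_isAlgebraic ⟨p, hp, h⟩

lemma mem_acl_of_pow {S : Set Ω} {x : Ω} {n : ℕ} (hn : n ≠ 0) (h : x ^ n ∈ acl S) : x ∈ acl S := by
  refine mem_acl_of_root (Polynomial.X ^ n - Polynomial.C ⟨x ^ n, h⟩)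
    (Polynomial.X_pow_sub_C_ne_zero (Nat.pos_of_ne_zero hn) _) ?_
  simp

instance acl_isAlgClosed [IsAlgClosed Ω] (S : Set Ω) : IsAlgClosed (acl S) := by
  refine IsAlgClosed.of_exists_root _ fun p _ hirr => ?_
  have hd : (p.map (algebraMap (acl S) Ω)).degree ≠ 0 := by
    rw [Polynomial.degree_map]; exact hirr.degree_pos.ne'
  obtain ⟨x, hx⟩ := IsAlgClosed.exists_root _ hd
  have hx' : Polynomial.aeval x p = 0 := by
    rwa [Polynomial.IsRoot, Polynomial.eval_map_algebraMap] at hx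
  refine ⟨⟨x, mem_acl_of_root p hirr.ne_zero hx'⟩, ?_⟩
  have : (algebraMap (acl S) Ω) (p.eval ⟨x, mem_acl_of_root p hirr.ne_zero hx'⟩) = 0 := by
    rw [← Polynomial.eval₂_at_apply]; exact hx'
  exact (map_eq_zero _).mp this

/-- The transcendence degree of the field generated by a set. -/
abbrev rk (S : Set Ω) : ℕ∞ := (indepMat Ω).eRk S

lemma rk_acl (S : Set Ω) : rk (acl S : Set Ω) = rk S := by
  rw [coe_acl]; exact Matroid.eRk_closure_eq _ _

lemma rk_mono {S T : Set Ω} (h : S ⊆ T) : rk S ≤ rk T := (indepMat Ω).eRk_mono h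

lemma rk_le_of_subset_acl {S T : Set Ω} (h : S ⊆ acl T) : rk S ≤ rk T :=
  (rk_mono h).trans (rk_acl T).le

lemma rk_insert_of_notMem {S : Set Ω} {x : Ω} (h : x ∉ acl S) : rk (insert x S) = rk S + 1 :=
  (indepMat Ω).eRk_insert_eq_add_one ⟨Set.mem_univ _, fun h' => h (mem_acl_iff.mpr h')⟩

lemma rk_insert_le (S : Set Ω) (x : Ω) : rk (insert x S) ≤ rk S + 1 :=
  (indepMat Ω).eRk_insert_le_add_one x S

lemma rk_range_of_algebraicIndependent {ι : Type} [Fintype ι] {s : ι → Ω}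
    (h : AlgebraicIndependent ℂ s) : rk (Set.range s) = Fintype.card ι := by
  have h1 : (indepMat Ω).Indep (Set.range s) := by
    rw [AlgebraicIndependent.matroid_indep_iff]
    exact (algebraicIndependent_subtype_range h.injective).mpr h
  rw [rk, h1.eRk_eq_encard, ← Set.image_univ, h.injective.encard_image, Set.encard_univ,
    ENat.card_eq_coe_fintype_card]

lemma algebraicIndependent_of_le_rk {ι : Type} [Fintype ι] {s : ι → Ω}
    (h : (Fintype.card ι : ℕ∞) ≤ rk (Set.range s)) : AlgebraicIndependent ℂ s := by
  have hfin : (Set.range s).Finite := Set.finite_range s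
  have hcard : (Set.range s).encard ≤ Fintype.card ι := by
    rw [← Set.image_univ]
    refine (Set.encard_image_le _ _).trans ?_
    rw [Set.encard_univ, ENat.card_eq_coe_fintype_card]
  have h1 : (indepMat Ω).Indep (Set.range s) := by
    rw [Matroid.indep_iff_eRk_eq_encard_of_finite hfin]
    exact le_antisymm (Matroid.eRk_le_encard _ _) (hcard.trans h)
  have h2 : (Set.range s).encard = Fintype.card ι :=
    le_antisymm hcard (h.trans (Matroid.eRk_le_encard _ _))
  have hinj : Function.Injective s := by
    rw [← Set.injOn_univ]
    apply Set.Finite.injOn_of_encard_image_eq Set.finite_univ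
    rw [Set.image_univ, h2, Set.encard_univ, ENat.card_eq_coe_fintype_card]
  rw [AlgebraicIndependent.matroid_indep_iff] at h1
  exact (algebraicIndependent_subtype_range hinj).mp h1

end Pregeometry

end CremonaPlaces

namespace CremonaPlaces

section FunctionField

variable {k Φ : Type} [Field k] [Field Φ] [Algebra k Φ]

/-- A subring containing the base field. -/
def Over (k : Type) {Φ : Type} [Field k] [Field Φ] [Algebra k Φ] (V : ValuationSubring Φ) : Prop :=
  ∀ c : k, algebraMap k Φ c ∈ V

/-- A derivation preserving all valuation rings over `k`, with field of constants `k`. -/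
structure GoodDer (D : Derivation k Φ Φ) : Prop where
  stable : ∀ V : ValuationSubring Φ, Over k V → ∀ f ∈ V, D f ∈ V
  const : ∀ f, D f = 0 → f ∈ (algebraMap k Φ).range

lemma mem_range_of_forall_mem [IsAlgClosed k] {f : Φ}
    (h : ∀ V : ValuationSubring Φ, Over k V → f ∈ V) : f ∈ (algebraMap k Φ).range := by
  have h1 := iInf_valuationSubring_superset (K := Φ) (s := ((algebraMap k Φ).range : Set Φ))
  have h2 : f ∈ (⨅ V : {V : ValuationSubring Φ // ((algebraMap k Φ).range : Set Φ) ⊆ V.toSubring},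
      V.1.toSubring) := by
    rw [Subring.mem_iInf]
    rintro ⟨V, hV⟩
    exact h V fun c => hV ⟨c, rfl⟩
  rw [h1] at h2
  have h3 : IsIntegral (Subring.closure ((algebraMap k Φ).range : Set Φ)) f := h2
  rw [Subring.closure_eq] at h3
  have h4 : IsIntegral k f := by
    obtain ⟨p, hp, hpf⟩ := h3
    have hs : Function.Surjective (algebraMap k Φ).rangeRestrict :=
      (algebraMap k Φ).rangeRestrict_surjective
    obtain ⟨q, rfl⟩ := Polynomial.map_surjective _ hs p
    refine ⟨q, (Function.Injective.monic_map_iff (RingHom.injective _)).mpr hp, ?_⟩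
    rw [Polynomial.eval₂_map] at hpf
    exact hpf
  exact minpoly.mem_range_of_degree_eq_one k f
    (IsAlgClosed.degree_eq_one_of_irreducible k (minpoly.irreducible h4))

lemma exists_derivation_eq_one [CharZero k] {x : Φ} (hx : Transcendental k x)
    (halg : Algebra.IsAlgebraic (IntermediateField.adjoin k {x}) Φ) :
    ∃ D : Derivation k Φ Φ, D x = 1 := by
  open scoped IntermediateField.algebraAdjoinAdjoin in
  let S := Algebra.adjoin k {x}
  let F := IntermediateField.adjoin k {x}
  have : CharZero F := charZero_of_injective_algebraMap (algebraMap k F).injective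
  have e1 : Algebra.FormallyEtale S F := Algebra.FormallyEtale.of_isLocalization (nonZeroDivisors S)
  have e2 : Algebra.FormallyEtale F Φ := Algebra.FormallyEtale.of_isSeparable F Φ
  have e3 : Algebra.FormallyEtale S Φ := Algebra.FormallyEtale.comp S F Φ
  let e : S ≃ₐ[k] Polynomial k := (Polynomial.algEquivOfTranscendental k x hx).symm
  have he : ∀ s : S, Polynomial.aeval x (e s) = (s : Φ) := by
    intro s
    obtain ⟨p, rfl⟩ := e.symm.surjective s
    rw [AlgEquiv.apply_symm_apply]
    change Polynomial.aeval x p = (Polynomial.algEquivOfTranscendental k x hx p : Φ)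
    rw [Polynomial.algEquivOfTranscendental_apply]
    exact Polynomial.aeval_algHom_apply S.val ⟨x, Algebra.self_mem_adjoin_singleton k x⟩ p
  let d : Derivation k S Φ := Derivation.mk'
    ((Polynomial.aeval x).toLinearMap ∘ₗ Polynomial.derivative ∘ₗ e.toLinearMap) (by
      intro a b
      simp only [LinearMap.comp_apply, AlgEquiv.toLinearMap_apply, map_mul,
        Polynomial.derivative_mul, map_add, AlgHom.toLinearMap_apply, he]
      rw [Algebra.smul_def, Algebra.smul_def]
      change _ = (a : Φ) * _ + (b : Φ) * _
      ring)
  let g : TensorProduct S Φ (Ω[S⁄k]) →ₗ[Φ] Φ := d.liftKaehlerDifferential.liftBaseChange Φ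
  let g' : Ω[Φ⁄k] →ₗ[Φ] Φ :=
    g ∘ₗ (KaehlerDifferential.tensorKaehlerEquivOfFormallyEtale k S Φ).symm.toLinearMap
  refine ⟨g'.compDer (KaehlerDifferential.D k Φ), ?_⟩
  have hxS : algebraMap S Φ ⟨x, Algebra.self_mem_adjoin_singleton k x⟩ = x := rfl
  have hex : e ⟨x, Algebra.self_mem_adjoin_singleton k x⟩ = Polynomial.X := by
    exact Polynomial.algEquivOfTranscendental_symm_gen k x hx
  have hD := KaehlerDifferential.tensorKaehlerEquivOfFormallyEtale_symm_D_algebraMap k S Φ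
    ⟨x, Algebra.self_mem_adjoin_singleton k x⟩
  rw [hxS] at hD
  change g ((KaehlerDifferential.tensorKaehlerEquivOfFormallyEtale k S Φ).symm
    (KaehlerDifferential.D k Φ x)) = 1
  rw [hD]
  simp [g, d, hex]

/-- Constants of a derivation not killing a separating variable. -/
lemma mem_range_of_derivation_eq_zero [IsAlgClosed k] [CharZero k] {x f : Φ}
    (halg : Algebra.IsAlgebraic (IntermediateField.adjoin k {x}) Φ)
    (D : Derivation k Φ Φ) (hDx : D x ≠ 0) (hDf : D f = 0) : f ∈ (algebraMap k Φ).range := by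
  by_contra hf
  let M := AlgebraicIndependent.matroid k Φ
  have hcl : ∀ (s : Set Φ) (a : Φ), a ∈ M.closure s ↔
      IsAlgebraic (IntermediateField.adjoin k s) a := by
    intro s a
    rw [AlgebraicIndependent.matroid_closure_eq, SetLike.mem_coe,
      Subalgebra.mem_algebraicClosure, IntermediateField.isAlgebraic_adjoin_iff]
  have h1 : f ∈ M.closure (insert x ∅) := by
    rw [hcl, insert_empty_eq]; exact halg.isAlgebraic f
  have h2 : f ∉ M.closure ∅ := by
    rw [hcl, IntermediateField.adjoin_empty]
    intro h
    have h' : IsAlgebraic k f := by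
      obtain ⟨p, hp, hpf⟩ := h
      have hs : Function.Surjective (algebraMap k (⊥ : IntermediateField k Φ)) :=
        (IntermediateField.botEquiv k Φ).symm.surjective
      obtain ⟨q, rfl⟩ := Polynomial.map_surjective _ hs p
      refine ⟨q, fun h0 => hp (by rw [h0, Polynomial.map_zero]), ?_⟩
      rwa [Polynomial.aeval_map_algebraMap] at hpf
    exact hf (minpoly.mem_range_of_degree_eq_one k f
      (IsAlgClosed.degree_eq_one_of_irreducible k (minpoly.irreducible h'.isIntegral)))
  have h3 := (M.closure_exchange ⟨h1, h2⟩).1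
  rw [hcl, insert_empty_eq] at h3
  let F := IntermediateField.adjoin k {f}
  have hF : ∀ a : F, D (a : Φ) = 0 := by
    intro a
    obtain ⟨a, ha⟩ := a
    refine IntermediateField.adjoin_induction k (p := fun a _ => D a = 0) ?_ ?_ ?_ ?_ ?_ ha
    · rintro y rfl; exact hDf
    · intro c; simp
    · intro a b _ _ h h'; rw [D.map_add, h, h', add_zero]
    · intro a _ h; rw [D.leibniz_inv, h, smul_zero]
    · intro a b _ _ h h'; rw [D.leibniz, h, h']; simp
  let D' : Derivation F Φ Φ := Derivation.mk'
    { toFun := D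
      map_add' := D.map_add
      map_smul' := by
        intro a b
        rw [Algebra.smul_def, D.leibniz]
        change (a : Φ) • D b + b • D (a : Φ) = _
        rw [hF]; simp [Algebra.smul_def] } (fun a b => D.leibniz a b)
  have : CharZero F := charZero_of_injective_algebraMap (algebraMap k F).injective
  have h4 := D'.map_aeval (minpoly F x) x
  rw [minpoly.aeval, map_zero] at h4
  have h5 : Polynomial.aeval x (Polynomial.derivative (minpoly F x)) ≠ 0 :=
    (minpoly.irreducible h3.isIntegral).separable.aeval_derivative_ne_zero (minpoly.aeval F x)
  exact (smul_ne_zero h5 hDx) h4.symm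

end FunctionField

end CremonaPlaces

namespace CremonaPlaces

section FunctionField

variable {k Φ : Type} [Field k] [Field Φ] [Algebra k Φ]

lemma derivation_mem_adjoin (D : Derivation k Φ Φ) {S : Set Φ}
    (h : ∀ s ∈ S, D s ∈ Algebra.adjoin k S) : ∀ a ∈ Algebra.adjoin k S, D a ∈ Algebra.adjoin k S := by
  intro a ha
  refine Algebra.adjoin_induction (p := fun a _ => D a ∈ Algebra.adjoin k S) h ?_ ?_ ?_ ha
  · intro c; simp
  · intro a b _ _ h h'; rw [D.map_add]; exact add_mem h h'
  · intro a b ha hb h h'; rw [D.leibniz, smul_eq_mul, smul_eq_mul]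
    exact add_mem (mul_mem ha h') (mul_mem hb h)

lemma adjoin_subset_of_over {V : ValuationSubring Φ} (hV : Over k V) {S : Set Φ}
    (hS : ∀ s ∈ S, s ∈ V) : ∀ a ∈ Algebra.adjoin k S, a ∈ V := by
  intro a ha
  refine Algebra.adjoin_induction (p := fun a _ => a ∈ V) hS hV ?_ ?_ ha
  · intro a b _ _ h h'; exact add_mem h h'
  · intro a b _ _ h h'; exact mul_mem h h'

lemma derivation_mem_of_frac (D : Derivation k Φ Φ) (V : ValuationSubring Φ)
    (A : Subalgebra k Φ) (hA : ∀ a ∈ A, a ∈ V) (hD : ∀ a ∈ A, D a ∈ A)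
    (hf : ∀ f ∈ V, ∃ a ∈ A, ∃ b ∈ A, V.valuation b = 1 ∧ f * b = a) :
    ∀ f ∈ V, D f ∈ V := by
  intro f hfV
  obtain ⟨a, ha, b, hb, hb1, hab⟩ := hf f hfV
  have h1 : D f * b = D a - f * D b := by
    rw [← hab, D.leibniz, smul_eq_mul, smul_eq_mul]; ring
  have h2 : D f * b ∈ V := h1 ▸ sub_mem (hA _ (hD _ ha)) (mul_mem hfV (hA _ (hD _ hb)))
  rw [← V.valuation_le_one_iff, map_mul, hb1, mul_one] at h2
  exact (V.valuation_le_one_iff _).mp h2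

lemma val_mul_eq_one {V : ValuationSubring Φ} {a b : Φ} (ha : a ∈ V) (hb : b ∈ V)
    (h : V.valuation (a * b) = 1) : V.valuation b = 1 := by
  refine le_antisymm ((V.valuation_le_one_iff b).mpr hb) ?_
  rw [← h, map_mul]
  exact mul_le_of_le_one_left' ((V.valuation_le_one_iff a).mpr ha)

lemma frac_of_principal {V : ValuationSubring Φ} {S : Set Φ} (hS : S.Finite)
    (hA : ∀ a ∈ Algebra.adjoin k S, a ∈ V) (htop : IntermediateField.adjoin k S = ⊤)
    {π : Φ} (hπ : π ∈ Algebra.adjoin k S) (hπ1 : V.valuation π < 1)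
    (hp : ∀ a ∈ Algebra.adjoin k S, V.valuation a < 1 →
      ∃ b ∈ Algebra.adjoin k S, V.valuation b = 1 ∧ ∃ c ∈ Algebra.adjoin k S, b * a = π * c) :
    ∀ f ∈ V, ∃ a ∈ Algebra.adjoin k S, ∃ b ∈ Algebra.adjoin k S, V.valuation b = 1 ∧ f * b = a := by
  set A := Algebra.adjoin k S with hAdef
  have hfg : A.FG := Subalgebra.fg_def.mpr ⟨S, hS, rfl⟩
  have hN : IsNoetherianRing A := Algebra.FiniteType.isNoetherianRing k A (h := A.fg_iff_finiteType.mp hfg)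
  let i : A →+* V := { toFun := fun a => ⟨a, hA a a.2⟩, map_one' := rfl, map_mul' := fun _ _ => rfl,
                       map_zero' := rfl, map_add' := fun _ _ => rfl }
  let P : Ideal A := (IsLocalRing.maximalIdeal V).comap i
  have hP : P.IsPrime := Ideal.comap_isPrime i _
  have hmem : ∀ a : A, a ∈ P ↔ V.valuation (a : Φ) < 1 := by
    intro a; rw [Ideal.mem_comap]; exact (V.valuation_lt_one_iff (i a))
  have hnot : ∀ a : A, a ∉ P → V.valuation (a : Φ) = 1 := by
    intro a ha; rw [hmem, not_lt] at ha
    exact le_antisymm ((V.valuation_le_one_iff _).mpr (hA a a.2)) ha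
  let R := Localization.AtPrime P
  have hR : IsNoetherianRing R := IsLocalization.isNoetherianRing P.primeCompl R hN
  have hle : P.primeCompl ≤ nonZeroDivisors A := by
    intro a ha; refine mem_nonZeroDivisors_of_ne_zero ?_; rintro rfl; exact ha P.zero_mem
  have hdom : IsDomain R := IsLocalization.isDomain_localization hle
  have hprin : (IsLocalRing.maximalIdeal R).IsPrincipal := by
    refine ⟨algebraMap A R ⟨π, hπ⟩, le_antisymm ?_ ?_⟩
    · intro z hz
      obtain ⟨a, s, rfl⟩ := IsLocalization.exists_mk'_eq P.primeCompl z
      have ha : a ∈ P := by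
        have := (IsLocalization.AtPrime.mk'_mem_maximal_iff R P a s).mp hz
        exact this
      obtain ⟨b, hb, hb1, c, hc, hbc⟩ := hp a a.2 ((hmem a).mp ha)
      have hbP : (⟨b, hb⟩ : A) ∈ P.primeCompl := fun h => by
        have := (hmem _).mp h; simp only [hb1] at this; exact lt_irrefl _ this
      rw [Submodule.mem_span_singleton]
      refine ⟨IsLocalization.mk' R ⟨c, hc⟩ (s * ⟨⟨b, hb⟩, hbP⟩), ?_⟩
      rw [smul_eq_mul, mul_comm, ← IsLocalization.mk'_one (M := P.primeCompl) R (⟨π, hπ⟩ : A),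
        ← IsLocalization.mk'_mul, IsLocalization.mk'_eq_iff_eq]
      congr 1
      apply Subtype.ext
      simp only [Submonoid.coe_one, MulMemClass.coe_mul]
      linear_combination (-(s : A) : Φ) * hbc
    · rw [Submodule.span_singleton_le_iff_mem]
      exact (IsLocalization.AtPrime.to_map_mem_maximal_iff R P _).mpr ((hmem _).mpr hπ1)
  have hval : ValuationRing R :=
    ((tfae_of_isNoetherianRing_of_isLocalRing_of_isDomain R).out 4 1).mp hprin
  intro f hf
  have hft : f ∈ IntermediateField.adjoin k S := htop ▸ IntermediateField.mem_top
  obtain ⟨a, ha, b, hb, rfl⟩ := IntermediateField.mem_adjoin_iff_div.mp hft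
  by_cases hb0 : b = 0
  · exact ⟨0, zero_mem _, 1, one_mem _, map_one _, by simp [hb0]⟩
  by_cases ha0 : a = 0
  · exact ⟨0, zero_mem _, 1, one_mem _, map_one _, by simp [ha0]⟩
  have key : ∀ x y : A, ∀ z : R, algebraMap A R x * z = algebraMap A R y →
      ∃ c : A, ∃ d : A, V.valuation (d : Φ) = 1 ∧ (x : Φ) * c = y * d := by
    intro x y z hz
    obtain ⟨c, d, rfl⟩ := IsLocalization.exists_mk'_eq P.primeCompl z
    refine ⟨c, d, hnot _ d.2, ?_⟩
    rw [IsLocalization.mul_mk'_eq_mk'_of_mul, IsLocalization.mk'_eq_iff_eq_mul, ← map_mul] at hz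
    exact congrArg Subtype.val (IsLocalization.injective R hle hz)
  obtain ⟨z, hz | hz⟩ := hval.cond' (algebraMap A R ⟨a, ha⟩) (algebraMap A R ⟨b, hb⟩)
  · obtain ⟨c, d, hd, h⟩ := key _ _ z hz
    have h1 : a / b * c = d := by
      simp only at h
      field_simp; rw [h]
    refine ⟨d, d.2, c, c.2, val_mul_eq_one hf (hA _ c.2) (h1 ▸ hd), h1⟩
  · obtain ⟨c, d, hd, h⟩ := key _ _ z hz
    refine ⟨c, c.2, d, d.2, hd, ?_⟩
    simp only at h
    field_simp; rw [← h]

lemma frac_of_simple {V : ValuationSubring Φ} {s : Φ}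
    (hA : ∀ a ∈ Algebra.adjoin k {s}, a ∈ V) (htop : IntermediateField.adjoin k {s} = ⊤) :
    ∀ f ∈ V, ∃ a ∈ Algebra.adjoin k {s}, ∃ b ∈ Algebra.adjoin k {s},
      V.valuation b = 1 ∧ f * b = a := by
  classical
  intro f hf
  have hft : f ∈ IntermediateField.adjoin k {s} := htop ▸ IntermediateField.mem_top
  obtain ⟨p, q, hpq⟩ := (IntermediateField.mem_adjoin_simple_iff k f).mp hft
  have hm : ∀ r : Polynomial k, Polynomial.aeval s r ∈ Algebra.adjoin k {s} :=
    fun r => Polynomial.aeval_mem_adjoin_singleton k s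
  by_cases hq : Polynomial.aeval s q = 0
  · exact ⟨0, zero_mem _, 1, one_mem _, map_one _, by simp [hpq, hq]⟩
  have hq0 : q ≠ 0 := by rintro rfl; simp at hq
  obtain ⟨p', hp'⟩ := EuclideanDomain.gcd_dvd_left p q
  obtain ⟨q', hq'⟩ := EuclideanDomain.gcd_dvd_right p q
  have hg : EuclideanDomain.gcd p q ≠ 0 := fun h => hq0 (EuclideanDomain.gcd_eq_zero_iff.mp h).2
  have hb := EuclideanDomain.gcd_eq_gcd_ab p q
  set g := EuclideanDomain.gcd p q
  have hcop : p' * EuclideanDomain.gcdA p q + q' * EuclideanDomain.gcdB p q = 1 := by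
    apply mul_left_cancel₀ hg
    rw [mul_add, ← mul_assoc, ← mul_assoc, ← hp', ← hq', mul_one]; exact hb.symm
  have hfq : f * Polynomial.aeval s q' = Polynomial.aeval s p' := by
    rw [hq', map_mul] at hq
    rw [hpq, hq', map_mul]
    conv_lhs => rw [hp', map_mul]
    have h1 := left_ne_zero_of_mul hq
    have h2 := right_ne_zero_of_mul hq
    field_simp
  refine ⟨_, hm p', _, hm q', ?_, hfq⟩
  have h1 : (f * Polynomial.aeval s (EuclideanDomain.gcdA p q) +
    Polynomial.aeval s (EuclideanDomain.gcdB p q)) * Polynomial.aeval s q' = 1 := by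
    have := congrArg (Polynomial.aeval s) hcop
    rw [map_add, map_mul, map_mul, map_one, ← hfq] at this
    linear_combination this
  exact val_mul_eq_one (add_mem (mul_mem hf (hA _ (hm _))) (hA _ (hm _))) (hA _ (hm _))
    (by rw [h1, map_one])

lemma inv_mem_of_notMem {V : ValuationSubring Φ} {x : Φ} (h : x ∉ V) : x⁻¹ ∈ V :=
  (V.mem_or_inv_mem x).resolve_left h

lemma derivation_inv (D : Derivation k Φ Φ) (x : Φ) : D x⁻¹ = - (x⁻¹ * x⁻¹) * D x := by
  rw [D.leibniz_inv, smul_eq_mul]; ring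

/-- On a purely transcendental simple extension, the derivations `d/du` and `u d/du`. -/
lemma goodDer_of_simple [IsAlgClosed k] [CharZero k] {u : Φ}
    (htop : IntermediateField.adjoin k {u} = ⊤) (D : Derivation k Φ Φ)
    (h : D u = 1 ∨ (D u = u ∧ u ≠ 0)) : GoodDer D := by
  have key : ∀ V : ValuationSubring Φ, Over k V → ∀ s : Φ, s ∈ V →
      IntermediateField.adjoin k {s} = ⊤ → D s ∈ Algebra.adjoin k {s} → ∀ f ∈ V, D f ∈ V := by
    intro V hV s hs htop hD
    have hA := adjoin_subset_of_over hV (S := {s}) (by rintro _ rfl; exact hs)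
    refine derivation_mem_of_frac D V (Algebra.adjoin k {s}) hA ?_ (frac_of_simple hA htop)
    exact derivation_mem_adjoin D (by rintro _ rfl; exact hD)
  constructor
  · intro V hV
    by_cases hu : u ∈ V
    · refine key V hV u hu htop ?_
      rcases h with h | h
      · rw [h]; exact one_mem _
      · rw [h.1]; exact Algebra.self_mem_adjoin_singleton k u
    · refine key V hV u⁻¹ (inv_mem_of_notMem hu) ?_ ?_
      · rw [eq_top_iff, ← htop, IntermediateField.adjoin_le_iff, Set.singleton_subset_iff]
        have := inv_mem (IntermediateField.mem_adjoin_simple_self k u⁻¹)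
        rwa [inv_inv] at this
      · have hm := Algebra.self_mem_adjoin_singleton k u⁻¹
        rw [derivation_inv]
        rcases h with h | h
        · rw [h, mul_one]; exact neg_mem (mul_mem hm hm)
        · rw [h.1, neg_mul, mul_assoc, inv_mul_cancel₀ h.2, mul_one]; exact neg_mem hm
  · intro f hf
    refine mem_range_of_derivation_eq_zero (x := u) ?_ D ?_ hf
    · rw [htop]; exact ⟨fun x => isAlgebraic_algebraMap (⟨x, IntermediateField.mem_top⟩ : (⊤ : IntermediateField k Φ))⟩
    · rcases h with h | h
      · rw [h]; exact one_ne_zero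
      · rw [h.1]; exact h.2

end FunctionField

end CremonaPlaces

namespace CremonaPlaces

section FunctionField

variable {k Φ : Type} [Field k] [Field Φ] [Algebra k Φ]

section Val

variable {V : ValuationSubring Φ}

lemma val_le {a : Φ} (h : a ∈ V) : V.valuation a ≤ 1 := (V.valuation_le_one_iff a).mpr h

lemma mem_of_val_le {a : Φ} (h : V.valuation a ≤ 1) : a ∈ V := (V.valuation_le_one_iff a).mp h

lemma mem_of_lt {a : Φ} (h : V.valuation a < 1) : a ∈ V := mem_of_val_le h.le

lemma mem_of_eq {a : Φ} (h : V.valuation a = 1) : a ∈ V := mem_of_val_le h.le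

lemma lt_or_eq {a : Φ} (h : a ∈ V) : V.valuation a < 1 ∨ V.valuation a = 1 := (val_le h).lt_or_eq

lemma inv_mem_of_eq {a : Φ} (h : V.valuation a = 1) : a⁻¹ ∈ V :=
  mem_of_val_le (by rw [map_inv₀, h, inv_one])

lemma ne_zero_of_eq {a : Φ} (h : V.valuation a = 1) : a ≠ 0 := by rintro rfl; simp at h

lemma lt_inv_of_notMem {a : Φ} (h : a ∉ V) : V.valuation a⁻¹ < 1 := by
  rw [map_inv₀]
  rw [← V.valuation_le_one_iff, not_le] at h
  exact inv_lt_one_of_one_lt₀ h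

lemma notMem_ne_zero {a : Φ} (h : a ∉ V) : a ≠ 0 := by rintro rfl; exact h (zero_mem V)

lemma lt_mul_left {a b : Φ} (ha : a ∈ V) (hb : V.valuation b < 1) : V.valuation (a * b) < 1 := by
  rw [map_mul]; exact (mul_le_of_le_one_left' (val_le ha)).trans_lt hb

lemma lt_mul_right {a b : Φ} (ha : V.valuation a < 1) (hb : b ∈ V) : V.valuation (a * b) < 1 := by
  rw [mul_comm]; exact lt_mul_left hb ha

lemma lt_add {a b : Φ} (ha : V.valuation a < 1) (hb : V.valuation b < 1) :
    V.valuation (a + b) < 1 := (V.valuation.map_add a b).trans_lt (max_lt ha hb)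

lemma lt_sub {a b : Φ} (ha : V.valuation a < 1) (hb : V.valuation b < 1) :
    V.valuation (a - b) < 1 := by
  rw [sub_eq_add_neg]; exact lt_add ha (by rwa [Valuation.map_neg])

lemma eq_add_lt {a b : Φ} (ha : V.valuation a = 1) (hb : V.valuation b < 1) :
    V.valuation (a + b) = 1 := by
  rw [V.valuation.map_add_eq_of_lt_left (by rwa [ha]), ha]

lemma eq_sub_lt {a b : Φ} (ha : V.valuation a = 1) (hb : V.valuation b < 1) :
    V.valuation (a - b) = 1 := by
  rw [sub_eq_add_neg]; exact eq_add_lt ha (by rwa [Valuation.map_neg])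

lemma eq_mul {a b : Φ} (ha : V.valuation a = 1) (hb : V.valuation b = 1) :
    V.valuation (a * b) = 1 := by rw [map_mul, ha, hb, one_mul]

lemma eq_pow {a : Φ} (ha : V.valuation a = 1) (n : ℕ) : V.valuation (a ^ n) = 1 := by
  rw [map_pow, ha, one_pow]

lemma lt_pow {a : Φ} (ha : V.valuation a < 1) {n : ℕ} (hn : n ≠ 0) : V.valuation (a ^ n) < 1 := by
  rw [map_pow]; exact pow_lt_one₀ zero_le ha hn

lemma lt_of_pow_lt {a : Φ} {n : ℕ} (h : V.valuation (a ^ n) < 1) : V.valuation a < 1 := by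
  by_contra h'
  rw [not_lt] at h'
  rw [map_pow] at h
  exact absurd (one_le_pow_of_one_le' h' n) (not_le.mpr h)

lemma mem_of_pow_mem {a : Φ} {n : ℕ} (hn : n ≠ 0) (h : a ^ n ∈ V) : a ∈ V := by
  by_contra h'
  have h1 := lt_inv_of_notMem h'
  have h2 := lt_mul_right (lt_pow h1 hn) h
  rw [inv_pow, inv_mul_cancel₀ (pow_ne_zero _ (notMem_ne_zero h')), map_one] at h2
  exact lt_irrefl _ h2

lemma val_const (hV : Over k V) {c : k} (hc : c ≠ 0) : V.valuation (algebraMap k Φ c) = 1 := by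
  refine le_antisymm (val_le (hV c)) ?_
  have h := val_le (hV c⁻¹)
  rw [map_inv₀, map_inv₀] at h
  have h0 : V.valuation (algebraMap k Φ c) ≠ 0 := by simpa using hc
  exact (inv_le_one₀ (zero_lt_iff.mpr h0)).mp h

lemma val_ratCast [CharZero k] (hV : Over k V) {q : ℚ} (hq : q ≠ 0) :
    V.valuation (q : Φ) = 1 := by
  have := val_const hV (c := (q : k)) (by exact_mod_cast hq)
  rwa [map_ratCast] at this

lemma ratCast_mem [CharZero k] (hV : Over k V) (q : ℚ) : (q : Φ) ∈ V := by
  have := hV (q : k)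
  rwa [map_ratCast] at this

end Val

/-- `a` is a fifth power up to a unit of `V`. -/
def LocFifth (V : ValuationSubring Φ) (a : Φ) : Prop :=
  ∃ u w : Φ, V.valuation u = 1 ∧ a = u * w ^ 5

lemma LocFifth.mul {V : ValuationSubring Φ} {a b : Φ} (ha : LocFifth V a) (hb : LocFifth V b) :
    LocFifth V (a * b) := by
  obtain ⟨u, w, hu, rfl⟩ := ha
  obtain ⟨u', w', hu', rfl⟩ := hb
  exact ⟨u * u', w * w', eq_mul hu hu', by ring⟩

lemma LocFifth.inv {V : ValuationSubring Φ} {a : Φ} (ha : LocFifth V a) : LocFifth V a⁻¹ := by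
  obtain ⟨u, w, hu, rfl⟩ := ha
  exact ⟨u⁻¹, w⁻¹, by rw [map_inv₀, hu, inv_one], by rw [mul_inv, inv_pow]⟩

lemma LocFifth.div {V : ValuationSubring Φ} {a b : Φ} (ha : LocFifth V a) (hb : LocFifth V b) :
    LocFifth V (a / b) := by rw [div_eq_mul_inv]; exact ha.mul hb.inv

lemma LocFifth.of_pow (V : ValuationSubring Φ) (a : Φ) : LocFifth V (a ^ 5) :=
  ⟨1, a, map_one _, by ring⟩

lemma LocFifth.of_unit {V : ValuationSubring Φ} {a : Φ} (h : V.valuation a = 1) : LocFifth V a :=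
  ⟨a, 1, h, by ring⟩

variable [IsAlgClosed k] [CharZero k]

lemma val_ofNat (k : Type) [Field k] [Algebra k Φ] [CharZero k] {V : ValuationSubring Φ}
    (hV : Over k V) (n : ℕ) (hn : n ≠ 0) :
    V.valuation (n : Φ) = 1 := by
  have := val_ratCast hV (q := (n : ℚ)) (by exact_mod_cast hn)
  exact_mod_cast this

lemma mem_range_of_one_add_pow {D : Derivation k Φ Φ} (hD : GoodDer D) {X : Φ}
    (he : 1 + X ^ 5 ≠ 0)
    (hloc : ∀ V : ValuationSubring Φ, Over k V → V.valuation (1 + X ^ 5) < 1 →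
      D (1 + X ^ 5) ^ 2 / (1 + X ^ 5) ∈ V) :
    X ∈ (algebraMap k Φ).range := by
  have key : ∀ V : ValuationSubring Φ, Over k V →
      (X ∈ V → (D X) ^ 2 / (1 + X ^ 5) ∈ V) ∧
      (X ∉ V → V.valuation ((D X) ^ 2 / (1 + X ^ 5)) < 1) := by
    intro V hV
    constructor
    · intro hX
      rcases lt_or_eq (V := V) (a := 1 + X ^ 5) (add_mem (one_mem _) (pow_mem hX 5)) with h | h
      · have h5 := val_ofNat k hV 5 (by norm_num)
        have hX1 : V.valuation X = 1 := by
          rcases lt_or_eq hX with h' | h'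
          · have := eq_add_lt (V := V) (map_one _) (lt_pow h' (n := 5) (by norm_num))
            exact absurd h this.not_lt
          · exact h'
        have h25 := inv_mem_of_eq (eq_pow (eq_mul h5 (eq_pow hX1 4)) 2)
        have h2 := mul_mem (hloc V hV h) h25
        convert h2 using 1
        have : D (1 + X ^ 5) = (5 * X ^ 4) * D X := by
          rw [D.map_add, D.map_one_eq_zero, zero_add, D.leibniz_pow]
          simp [mul_assoc]
        rw [this]
        have hX0 := ne_zero_of_eq hX1
        have h50 : (5 : Φ) ≠ 0 := by have := ne_zero_of_eq h5; exact_mod_cast this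
        push_cast
        field_simp
      · rw [div_eq_mul_inv]
        exact mul_mem (pow_mem (hD.stable V hV X hX) 2) (inv_mem_of_eq h)
    · intro hX
      have hX0 := notMem_ne_zero hX
      have hZ := lt_inv_of_notMem hX
      set Z := X⁻¹ with hZd
      have hXZ : X = Z⁻¹ := by rw [hZd, inv_inv]
      have hZ0 : Z ≠ 0 := inv_ne_zero hX0
      have hu := eq_add_lt (V := V) (map_one _) (lt_pow hZ (n := 5) (by norm_num))
      have e : (D X) ^ 2 / (1 + X ^ 5) = (D Z) ^ 2 * (1 + Z ^ 5)⁻¹ * Z := by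
        have hu0 := ne_zero_of_eq hu
        have he' : Z ^ 5 + 1 ≠ 0 := by rwa [add_comm]
        rw [hXZ, derivation_inv]
        rw [hXZ] at he
        field_simp
        ring
      rw [e]
      exact lt_mul_left (mul_mem (pow_mem (hD.stable V hV Z (mem_of_lt hZ)) 2) (inv_mem_of_eq hu)) hZ
  obtain ⟨q, hq⟩ := mem_range_of_forall_mem (k := k) (f := (D X) ^ 2 / (1 + X ^ 5)) (by
    intro V hV
    by_cases hX : X ∈ V
    · exact (key V hV).1 hX
    · exact mem_of_lt ((key V hV).2 hX))
  by_cases hall : ∀ V : ValuationSubring Φ, Over k V → X ∈ V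
  · exact mem_range_of_forall_mem hall
  · push Not at hall
    obtain ⟨V, hV, hX⟩ := hall
    have h1 := (key V hV).2 hX
    rw [← hq] at h1
    have hq0 : q = 0 := by
      by_contra h0
      rw [val_const hV h0] at h1
      exact lt_irrefl _ h1
    rw [hq0, map_zero, eq_comm, div_eq_zero_iff] at hq
    exact hD.const X (pow_eq_zero_iff (by norm_num) |>.mp (hq.resolve_right he))

lemma mem_range_of_locFifth {D : Derivation k Φ Φ} (hD : GoodDer D) {X : Φ}
    (he : 1 + X ^ 5 ≠ 0)
    (hloc : ∀ V : ValuationSubring Φ, Over k V → LocFifth V (1 + X ^ 5)) :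
    X ∈ (algebraMap k Φ).range := by
  refine mem_range_of_one_add_pow hD he fun V hV hlt => ?_
  obtain ⟨u, w, hu, h⟩ := hloc V hV
  rw [h] at he hlt ⊢
  have huV := mem_of_eq hu
  have hw : w ∈ V := by
    refine mem_of_pow_mem (n := 5) (by norm_num) (mem_of_lt ?_)
    rwa [map_mul, hu, one_mul] at hlt
  have hw0 : w ≠ 0 := by rintro rfl; simp at he
  have hu0 := ne_zero_of_eq hu
  have e : D (u * w ^ 5) ^ 2 / (u * w ^ 5) = u⁻¹ * w ^ 3 * (5 * u * D w + w * D u) ^ 2 := by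
    rw [D.leibniz, D.leibniz_pow]
    simp only [smul_eq_mul, nsmul_eq_mul]
    push_cast
    field_simp
  rw [e]
  have h5 : (5 : Φ) ∈ V := by have := mem_of_eq (val_ofNat k hV 5 (by norm_num)); exact_mod_cast this
  exact mul_mem (mul_mem (inv_mem_of_eq hu) (pow_mem hw 3)) (pow_mem (add_mem
    (mul_mem (mul_mem h5 huV) (hD.stable V hV w hw)) (mul_mem hw (hD.stable V hV u huV))) 2)

end FunctionField

end CremonaPlaces

set_option linter.unusedSectionVars false

namespace CremonaPlaces

/-- The cubic polynomial `X³ + aX² + bX + c` is separable. -/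
def Sep (a b c : ℚ) : Prop :=
  ∃ α β γ δ ε : ℚ, ∀ (F : Type) [Field F] [CharZero F] (X : F),
    (α * X + β) * (X ^ 3 + a * X ^ 2 + b * X + c) +
      (γ * X ^ 2 + δ * X + ε) * (3 * X ^ 2 + 2 * a * X + b) = 1

lemma sep_isogenous : Sep 2 1 (1/4) :=
  ⟨96/11, 140/11, -32/11, -68/11, -24/11, fun F _ _ X => by push_cast; field_simp; ring⟩

lemma sep_short : Sep 0 (-31/3) (-2501/108) :=
  ⟨2976/161051, -10004/161051, -992/161051, 10004/483153, 61504/1449459,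
    fun F _ _ X => by push_cast; field_simp; ring⟩

/-- `(X, Y)` is a point of `Y² = X³ + aX² + bX + c`. -/
def OnCurve {Φ : Type} [Field Φ] (a b c : ℚ) (X Y : Φ) : Prop :=
  Y ^ 2 = X ^ 3 + a * X ^ 2 + b * X + c

lemma charZero_of_base (k Φ : Type) [Field k] [Field Φ] [Algebra k Φ] [CharZero k] : CharZero Φ :=
  charZero_of_injective_algebraMap (algebraMap k Φ).injective

section FunctionField

variable {k Φ : Type} [Field k] [Field Φ] [Algebra k Φ] [IsAlgClosed k] [CharZero k]

lemma derivation_ratCast (D : Derivation k Φ Φ) (q : ℚ) : D (q : Φ) = 0 := by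
  have := D.map_algebraMap (q : k)
  rwa [map_ratCast] at this

lemma OnCurve.derivation {a b c : ℚ} {X Y : Φ} (h : OnCurve a b c X Y) (D : Derivation k Φ Φ) :
    2 * Y * D Y = (3 * X ^ 2 + 2 * a * X + b) * D X := by
  have := congrArg D h
  simp only [D.map_add, D.leibniz, D.leibniz_pow, derivation_ratCast, smul_eq_mul, nsmul_eq_mul] at this
  push_cast at this
  linear_combination this

section Local

variable {V : ValuationSubring Φ} (hV : Over k V) {a b c : ℚ} {X Y : Φ}
include hV

lemma OnCurve.mem (h : OnCurve a b c X Y) (hX : X ∈ V) : Y ∈ V := by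
  refine mem_of_pow_mem (n := 2) (by norm_num) ?_
  rw [h]
  have := ratCast_mem (k := k) hV
  exact add_mem (add_mem (add_mem (pow_mem hX 3) (mul_mem (this a) (pow_mem hX 2)))
    (mul_mem (this b) hX)) (this c)

lemma OnCurve.notMem (h : OnCurve a b c X Y) (hX : X ∉ V) :
    V.valuation (X / Y) < 1 ∧ Y ∉ V ∧
    X⁻¹ = (X / Y) ^ 2 * (1 + a * X⁻¹ + b * X⁻¹ ^ 2 + c * X⁻¹ ^ 3) ∧
    V.valuation (1 + a * X⁻¹ + b * X⁻¹ ^ 2 + c * X⁻¹ ^ 3) = 1 := by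
  have hX0 := notMem_ne_zero hX
  have hZ := lt_inv_of_notMem hX
  have hr := ratCast_mem (k := k) hV
  have hU : V.valuation (1 + a * X⁻¹ + b * X⁻¹ ^ 2 + c * X⁻¹ ^ 3) = 1 := by
    rw [add_assoc, add_assoc]
    refine eq_add_lt (map_one _) (lt_add (lt_mul_left (hr a) hZ) (lt_add
      (lt_mul_left (hr b) (lt_pow hZ (by norm_num))) (lt_mul_left (hr c) (lt_pow hZ (by norm_num)))))
  have hU0 := ne_zero_of_eq hU
  have hY : Y ≠ 0 := by
    rintro rfl
    apply hU0
    unfold OnCurve at h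
    field_simp
    linear_combination -h
  have e : X⁻¹ = (X / Y) ^ 2 * (1 + a * X⁻¹ + b * X⁻¹ ^ 2 + c * X⁻¹ ^ 3) := by
    unfold OnCurve at h
    field_simp
    linear_combination h
  have e2 : (X / Y) ^ 2 = X⁻¹ * (1 + a * X⁻¹ + b * X⁻¹ ^ 2 + c * X⁻¹ ^ 3)⁻¹ := by
    rw [eq_mul_inv_iff_mul_eq₀ hU0]; exact e.symm
  have hW : V.valuation (X / Y) < 1 := by
    apply lt_of_pow_lt (n := 2)
    rw [e2]
    exact lt_mul_right hZ (inv_mem_of_eq hU)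
  refine ⟨hW, fun hYV => hX ?_, e, hU⟩
  have := mul_mem (mem_of_lt hW) hYV
  rwa [div_mul_cancel₀ _ hY] at this

lemma OnCurve.derivation_infty (h : OnCurve a b c X Y) (hX : X ∉ V) (D : Derivation k Φ Φ) :
    D X / (2 * Y) * (1 - (X / Y) ^ 2 * (a + 2 * b * X⁻¹ + 3 * c * X⁻¹ ^ 2)) = - D (X / Y) := by
  have hX0 := notMem_ne_zero hX
  have hY0 := notMem_ne_zero (h.notMem hV hX).2.1
  have hd := h.derivation D
  unfold OnCurve at h
  have := charZero_of_base k Φ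
  have h1 : D (X / Y) = (D X * Y - X * D Y) / Y ^ 2 := by
    rw [div_eq_mul_inv, D.leibniz, derivation_inv]
    simp only [smul_eq_mul]; field_simp; ring
  have h2 : D Y = (3 * X ^ 2 + 2 * a * X + b) * D X / (2 * Y) := by
    rw [eq_div_iff (by simp [hY0])]; linear_combination hd
  rw [h1, h2]
  field_simp
  linear_combination 3 * D X * h

lemma OnCurve.lambda_mem (h : OnCurve a b c X Y) (hs : Sep a b c) (D : Derivation k Φ Φ)
    (hD : ∀ f ∈ V, D f ∈ V) : D X / (2 * Y) ∈ V := by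
  have := charZero_of_base k Φ
  have hr := ratCast_mem (k := k) hV
  have h2V : V.valuation (2 : Φ) = 1 := by exact_mod_cast val_ofNat k hV 2 (by norm_num)
  by_cases hX : X ∈ V
  · have hY := h.mem hV hX
    by_cases hY0 : Y = 0
    · rw [hY0, mul_zero, div_zero]; exact zero_mem V
    rcases lt_or_eq hY with hlt | heq
    · obtain ⟨α, β, γ, δ, ε, hsep⟩ := hs
      have h1 := hsep Φ X
      have hP : V.valuation (3 * X ^ 2 + 2 * a * X + b) = 1 := by
        have h3 : (γ * X ^ 2 + δ * X + ε) * (3 * X ^ 2 + 2 * a * X + b) =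
            1 - (α * X + β) * Y ^ 2 := by
          rw [show Y ^ 2 = _ from h]; linear_combination h1
        have h3V : (3 : Φ) ∈ V := by exact_mod_cast hr 3
        refine val_mul_eq_one (a := γ * X ^ 2 + δ * X + ε) ?_ ?_ ?_
        · exact add_mem (add_mem (mul_mem (hr γ) (pow_mem hX 2)) (mul_mem (hr δ) hX)) (hr ε)
        · exact add_mem (add_mem (mul_mem h3V (pow_mem hX 2))
            (mul_mem (mul_mem (mem_of_eq h2V) (hr a)) hX)) (hr b)
        · rw [h3]
          exact eq_sub_lt (map_one _) (lt_mul_left (add_mem (mul_mem (hr α) hX) (hr β))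
            (lt_pow hlt (by norm_num)))
      have hd := h.derivation D
      have h0 := ne_zero_of_eq hP
      have e : D X / (2 * Y) = D Y * (3 * X ^ 2 + 2 * a * X + b)⁻¹ := by
        rw [← div_eq_mul_inv, div_eq_div_iff (by simp [hY0]) h0]
        linear_combination -hd
      rw [e]
      exact mul_mem (hD Y hY) (inv_mem_of_eq hP)
    · rw [div_eq_mul_inv]
      exact mul_mem (hD X hX) (inv_mem_of_eq (eq_mul h2V heq))
  · obtain ⟨hW, -, -, -⟩ := h.notMem hV hX
    have hd := h.derivation_infty hV hX D
    have hZ := mem_of_lt (lt_inv_of_notMem hX)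
    have hu : V.valuation (1 - (X / Y) ^ 2 * (a + 2 * b * X⁻¹ + 3 * c * X⁻¹ ^ 2)) = 1 := by
      have h3V : (3 : Φ) ∈ V := by exact_mod_cast hr 3
      refine eq_sub_lt (map_one _) (lt_mul_right (lt_pow hW (by norm_num)) ?_)
      exact add_mem (add_mem (hr a) (mul_mem (mul_mem (mem_of_eq h2V) (hr b)) hZ))
        (mul_mem (mul_mem h3V (hr c)) (pow_mem hZ 2))
    have e : D X / (2 * Y) =
        -D (X / Y) * (1 - (X / Y) ^ 2 * (a + 2 * b * X⁻¹ + 3 * c * X⁻¹ ^ 2))⁻¹ := by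
      rw [eq_mul_inv_iff_mul_eq₀ (ne_zero_of_eq hu)]; exact hd
    rw [e]
    exact mul_mem (neg_mem (hD _ (mem_of_lt hW))) (inv_mem_of_eq hu)

end Local

lemma OnCurve.lambda_mem_range {a b c : ℚ} {X Y : Φ} (h : OnCurve a b c X Y) (hs : Sep a b c)
    {D : Derivation k Φ Φ} (hD : GoodDer D) : D X / (2 * Y) ∈ (algebraMap k Φ).range :=
  mem_range_of_forall_mem fun V hV => h.lambda_mem hV hs D (hD.stable V hV)

lemma mem_range_of_pow_mem {x : Φ} {n : ℕ} (hn : n ≠ 0) (h : x ^ n ∈ (algebraMap k Φ).range) :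
    x ∈ (algebraMap k Φ).range := by
  obtain ⟨c, hc⟩ := h
  have h1 : IsIntegral k x := by
    refine ⟨Polynomial.X ^ n - Polynomial.C c, Polynomial.monic_X_pow_sub_C c hn, ?_⟩
    simp [hc]
  exact minpoly.mem_range_of_degree_eq_one k x
    (IsAlgClosed.degree_eq_one_of_irreducible k (minpoly.irreducible h1))

lemma ratCast_mem_range (q : ℚ) : (q : Φ) ∈ (algebraMap k Φ).range := ⟨q, map_ratCast _ q⟩

lemma OnCurve.snd_mem_range {a b c : ℚ} {X Y : Φ} (h : OnCurve a b c X Y)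
    (hX : X ∈ (algebraMap k Φ).range) : Y ∈ (algebraMap k Φ).range := by
  refine mem_range_of_pow_mem (n := 2) (by norm_num) ?_
  rw [h]
  have hr := ratCast_mem_range (k := k) (Φ := Φ)
  exact add_mem (add_mem (add_mem (pow_mem hX 3) (mul_mem (hr a) (pow_mem hX 2)))
    (mul_mem (hr b) hX)) (hr c)

lemma OnCurve.mem_range_of_derivation_eq_zero {a b c : ℚ} {X Y : Φ} (h : OnCurve a b c X Y)
    {D : Derivation k Φ Φ} (hD : GoodDer D) (h0 : D X / (2 * Y) = 0) :
    X ∈ (algebraMap k Φ).range := by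
  have := charZero_of_base k Φ
  rw [div_eq_zero_iff] at h0
  rcases h0 with h0 | h0
  · exact hD.const X h0
  · have hY : Y = 0 := by simpa using h0
    have h1 : IsIntegral k X := by
      refine ⟨Polynomial.X ^ 3 + Polynomial.C (a : k) * Polynomial.X ^ 2 +
        Polynomial.C (b : k) * Polynomial.X + Polynomial.C (c : k), by monicity!, ?_⟩
      unfold OnCurve at h
      rw [hY] at h
      simp [← h]
    exact minpoly.mem_range_of_degree_eq_one k X
      (IsAlgClosed.degree_eq_one_of_irreducible k (minpoly.irreducible h1))

/-- Points of an elliptic curve in a rational function field are constant. -/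
lemma OnCurve.mem_range_of_simple {a b c : ℚ} {X Y u : Φ} (h : OnCurve a b c X Y) (hs : Sep a b c)
    (hu : Transcendental k u) (htop : IntermediateField.adjoin k {u} = ⊤) :
    X ∈ (algebraMap k Φ).range := by
  obtain ⟨D, hD⟩ := exists_derivation_eq_one hu (by
    rw [htop]; exact ⟨fun x => isAlgebraic_algebraMap (⟨x, IntermediateField.mem_top⟩ : (⊤ : IntermediateField k Φ))⟩)
  have hu0 : u ≠ 0 := by rintro rfl; exact hu isAlgebraic_zero
  have g1 := goodDer_of_simple htop D (Or.inl hD)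
  have g2 := goodDer_of_simple htop (u • D) (Or.inr ⟨by simp [hD], hu0⟩)
  obtain ⟨l1, h1⟩ := h.lambda_mem_range hs g1
  obtain ⟨l2, h2⟩ := h.lambda_mem_range hs g2
  refine h.mem_range_of_derivation_eq_zero g1 ?_
  by_contra hne
  have e : algebraMap k Φ l2 = u * algebraMap k Φ l1 := by
    rw [h1, h2]; simp [mul_div_assoc]
  apply hu
  have : u = algebraMap k Φ (l2 / l1) := by
    rw [map_div₀, e, eq_div_iff (by rwa [h1])]
  rw [this]; exact isAlgebraic_algebraMap _

/-- The function with divisor `5(0, 1/2) - 5∞` on `ω² = ξ³ + 2ξ² + ξ + 1/4`. -/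
def gfun {Φ : Type} [Field Φ] (ξ ω : Φ) : Φ := (ω - 1/2 - ξ) * (1 + ξ) - ξ ^ 2

lemma gfun_mul_neg {Φ : Type} [Field Φ] [CharZero Φ] {ξ ω : Φ} (h : OnCurve 2 1 (1/4) ξ ω) :
    gfun ξ ω * gfun ξ (-ω) = - ξ ^ 5 := by
  unfold OnCurve at h
  unfold gfun
  push_cast at h
  field_simp at h ⊢
  linear_combination (-(1+ξ)^2) * h

lemma locFifth_gfun {V : ValuationSubring Φ} (hV : Over k V) {ξ ω : Φ}
    (h : OnCurve 2 1 (1/4) ξ ω) : LocFifth V (gfun ξ ω) := by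
  have := charZero_of_base k Φ
  have hr := ratCast_mem (k := k) hV
  have hhalf : (1/2 : Φ) ∈ V := by have := hr (1/2); push_cast at this; exact this
  by_cases hξ : ξ ∈ V
  · have hω := h.mem hV hξ
    have hg : ∀ ω' ∈ V, gfun ξ ω' ∈ V := fun ω' hω' =>
      sub_mem (mul_mem (sub_mem (sub_mem hω' hhalf) hξ) (add_mem (one_mem _) hξ)) (pow_mem hξ 2)
    rcases lt_or_eq (hg ω hω) with hlt | heq
    · have hm := gfun_mul_neg h
      have hξl : V.valuation ξ < 1 := by
        apply lt_of_pow_lt (n := 5)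
        rw [← Valuation.map_neg, ← hm]
        exact lt_mul_right hlt (hg _ (neg_mem hω))
      have hωu : V.valuation ω = 1 := by
        rcases lt_or_eq hω with hl | he
        · have h4 : V.valuation (1/4 : Φ) = 1 := by
            have := val_ratCast hV (q := 1/4) (by norm_num)
            push_cast at this; exact this
          have h1 : (1/4 : Φ) = ω ^ 2 - (ξ ^ 2 + 2 * ξ + 1) * ξ := by
            unfold OnCurve at h; push_cast at h; linear_combination -h
          have h2 : (2 : Φ) ∈ V := by exact_mod_cast hr 2
          rw [h1] at h4
          have := lt_sub (lt_pow hl (n := 2) (by norm_num)) (lt_mul_left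
            (add_mem (add_mem (pow_mem hξ 2) (mul_mem h2 hξ)) (one_mem V)) hξl)
          exact absurd h4 this.ne
        · exact he
      have hgn : V.valuation (gfun ξ (-ω)) = 1 := by
        have e : gfun ξ (-ω) = (-2 * ω) * (1 + ξ) + gfun ξ ω := by unfold gfun; ring
        rw [e]
        have h2 : V.valuation (-2 : Φ) = 1 := by
          exact_mod_cast val_ratCast hV (q := -2) (by norm_num)
        exact eq_add_lt (eq_mul (eq_mul h2 hωu) (eq_add_lt (map_one _) hξl)) hlt
      refine ⟨-(gfun ξ (-ω))⁻¹, ξ, by rw [Valuation.map_neg, map_inv₀, hgn, inv_one], ?_⟩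
      have := ne_zero_of_eq hgn
      field_simp
      linear_combination hm
    · exact LocFifth.of_unit heq
  · obtain ⟨hW, hωV, e, hU⟩ := h.notMem hV hξ
    have hξ0 := notMem_ne_zero hξ
    have hω0 := notMem_ne_zero hωV
    have hZ := lt_inv_of_notMem hξ
    set U := (1 + ((2:ℚ):Φ) * ξ⁻¹ + ((1:ℚ):Φ) * ξ⁻¹ ^ 2 + ((1/4:ℚ):Φ) * ξ⁻¹ ^ 3) with hUd
    have hU0 := ne_zero_of_eq hU
    have hu : V.valuation ((1 + (-(1/2) * ξ⁻¹ * (ξ / ω) - ξ / ω)) * (1 + ξ⁻¹) - ξ / ω) = 1 := by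
      refine eq_sub_lt (eq_mul (eq_add_lt (map_one _) (lt_sub (lt_mul_left ?_ hW) hW))
        (eq_add_lt (map_one _) hZ)) hW
      exact mul_mem (neg_mem hhalf) (mem_of_lt hZ)
    refine ⟨((1 + (-(1/2) * ξ⁻¹ * (ξ / ω) - ξ / ω)) * (1 + ξ⁻¹) - ξ / ω) * (U⁻¹) ^ 2, ω / ξ,
      eq_mul hu (eq_pow (by rw [map_inv₀, hU, inv_one]) 2), ?_⟩
    have e3 : U = ω ^ 2 / ξ ^ 3 := by
      have : ξ⁻¹ * ω ^ 2 = ξ ^ 2 * U := by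
        conv_lhs => rw [e]
        field_simp
      field_simp at this ⊢
      linear_combination -this
    rw [e3]
    unfold gfun
    field_simp
    ring

end FunctionField

end CremonaPlaces

namespace CremonaPlaces

/-- The polynomials `h₀ = 1`, `hᵢ₊₁ = tᵢ²⁵ + hᵢ⁵`. -/
def hseq {R : Type} [CommRing R] (t : ℕ → R) : ℕ → R
  | 0 => 1
  | i + 1 => t i ^ 25 + hseq t i ^ 5

lemma hseq_congr {R : Type} [CommRing R] {t t' : ℕ → R} {m : ℕ} (h : ∀ i < m, t i = t' i) :
    hseq t m = hseq t' m := by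
  induction m with
  | zero => rfl
  | succ m ih =>
    rw [hseq, hseq, h m (Nat.lt_succ_self m), ih fun i hi => h i (Nat.lt_succ_of_lt hi)]

lemma map_hseq {R S : Type} [CommRing R] [CommRing S] (f : R →+* S) (t : ℕ → R) (m : ℕ) :
    f (hseq t m) = hseq (fun i => f (t i)) m := by
  induction m with
  | zero => simp [hseq]
  | succ m ih => rw [hseq, hseq, map_add, map_pow, map_pow, ih]

lemma hseq_mem {R : Type} [CommRing R] (A : Subring R) {t : ℕ → R} {m : ℕ}
    (h : ∀ i < m, t i ∈ A) : hseq t m ∈ A := by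
  induction m with
  | zero => exact one_mem A
  | succ m ih =>
    exact add_mem (pow_mem (h m (Nat.lt_succ_self m)) _)
      (pow_mem (ih fun i hi => h i (Nat.lt_succ_of_lt hi)) _)

lemma hseq_zero {R : Type} [CommRing R] (m : ℕ) : hseq (fun _ => (0 : R)) m = 1 := by
  induction m with
  | zero => rfl
  | succ m ih => rw [hseq, ih]; simp

lemma OnCurve.of_map {A B : Type} [Field A] [Field B] (f : A →+* B) {a b c : ℚ} {X Y : A}
    (h : OnCurve a b c (f X) (f Y)) : OnCurve a b c X Y := by
  apply f.injective
  simpa [OnCurve] using h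

lemma map_gfun {A B : Type} [Field A] [Field B] (f : A →+* B) (ξ ω : A) :
    f (gfun ξ ω) = gfun (f ξ) (f ω) := by
  simp only [gfun, map_sub, map_mul, map_add, map_pow, map_div₀, map_one, map_ofNat]

section FunctionField

variable {k Φ : Type} [Field k] [Field Φ] [Algebra k Φ] [IsAlgClosed k] [CharZero k]

lemma hseq_descent {D : Derivation k Φ Φ} (hD : GoodDer D) {τ : ℕ → Φ} {m : ℕ}
    (hτ : ∀ i < m, τ i ≠ 0) (hh : ∀ i ≤ m, hseq τ i ≠ 0)
    (hloc : ∀ V : ValuationSubring Φ, Over k V → LocFifth V (hseq τ m)) :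
    ∀ i < m, τ i ∈ (algebraMap k Φ).range := by
  induction m with
  | zero => intro i hi; exact absurd hi (Nat.not_lt_zero i)
  | succ m ih =>
    have hm0 := hh m (Nat.le_succ m)
    have hX : τ m ^ 5 / hseq τ m ∈ (algebraMap k Φ).range := by
      have e : 1 + (τ m ^ 5 / hseq τ m) ^ 5 = hseq τ (m + 1) / hseq τ m ^ 5 := by
        rw [hseq]; field_simp; ring
      refine mem_range_of_locFifth hD ?_ fun V hV => ?_
      · rw [e]; exact div_ne_zero (hh _ le_rfl) (pow_ne_zero _ hm0)
      · rw [e]; exact (hloc V hV).div (LocFifth.of_pow V _)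
    have ht0 := hτ m (Nat.lt_succ_self m)
    have hX0 : τ m ^ 5 / hseq τ m ≠ 0 := div_ne_zero (pow_ne_zero _ ht0) hm0
    have hrec := ih (fun i hi => hτ i (Nat.lt_succ_of_lt hi))
      (fun i hi => hh i (hi.trans (Nat.le_succ m))) (by
        intro V hV
        have e : hseq τ m = τ m ^ 5 / (τ m ^ 5 / hseq τ m) := by field_simp
        rw [e]
        refine (LocFifth.of_pow V _).div (LocFifth.of_unit ?_)
        obtain ⟨c, hc⟩ := hX
        rw [← hc] at hX0 ⊢
        exact val_const hV (by rintro rfl; simp at hX0))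
    intro i hi
    rcases Nat.lt_succ_iff_lt_or_eq.mp hi with h | rfl
    · exact hrec i h
    · refine mem_range_of_pow_mem (n := 5) (by norm_num) ?_
      have h1 := hseq_mem (algebraMap k Φ).range hrec
      have := mul_mem hX h1
      rwa [div_mul_cancel₀ _ hm0] at this

lemma twist_descent {D : Derivation k Φ Φ} (hD : GoodDer D) {τ : ℕ → Φ} {m e : ℕ} {ξ ω y : Φ}
    (hτ : ∀ i < m, τ i ≠ 0) (hh : ∀ i ≤ m, hseq τ i ≠ 0) (he : e = 1 ∨ e = 2)
    (hc : OnCurve 2 1 (1/4) ξ ω) (hg : gfun ξ ω ≠ 0) (hy : y ^ 5 = hseq τ m ^ e * gfun ξ ω) :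
    ∀ i < m, τ i ∈ (algebraMap k Φ).range := by
  refine hseq_descent hD hτ hh fun V hV => ?_
  have hg1 := locFifth_gfun hV hc
  have h0 := hh m le_rfl
  rcases he with rfl | rfl
  · have : hseq τ m = y ^ 5 / gfun ξ ω := by rw [hy]; field_simp
    rw [this]; exact (LocFifth.of_pow V _).div hg1
  · have h1 : LocFifth V (hseq τ m ^ 2) := by
      have : hseq τ m ^ 2 = y ^ 5 / gfun ξ ω := by rw [hy]; field_simp
      rw [this]; exact (LocFifth.of_pow V _).div hg1
    have : hseq τ m = hseq τ m ^ 2 * hseq τ m ^ 2 * hseq τ m ^ 2 / hseq τ m ^ 5 := by field_simp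
    rw [this]; exact ((h1.mul h1).mul h1).div (LocFifth.of_pow V _)

end FunctionField

section Omega

variable {Ω : Type} [Field Ω] [Algebra ℂ Ω]

/-- The fields generated by a transcendence basis `τ`, a generic point `(ξ, ω)` of an elliptic
curve and a fifth root of `h(τ)^e g(ξ, ω)`. -/
structure Twist (m e : ℕ) (τ : ℕ → Ω) (ξ ω y : Ω) : Prop where
  indep : AlgebraicIndependent ℂ (fun i : Fin m => τ i)
  curve : OnCurve 2 1 (1/4) ξ ω
  root : y ^ 5 = hseq τ m ^ e * gfun ξ ω
  generic : ξ ∉ acl (τ '' Set.Iio m)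

/-- The function field attached to a twist. -/
def twistField (m : ℕ) (τ : ℕ → Ω) (ξ ω y : Ω) : IntermediateField ℂ Ω :=
  IntermediateField.adjoin ℂ (τ '' Set.Iio m ∪ {ξ, ω, y})

lemma hseq_eq_aeval (τ : ℕ → Ω) {m i : ℕ} (hi : i ≤ m) :
    hseq τ i = aeval (fun i : Fin m => τ i)
      (hseq (fun j => if h : j < m then (X ⟨j, h⟩ : MvPolynomial (Fin m) ℂ) else 0) i) := by
  have := map_hseq (aeval (R := ℂ) (fun i : Fin m => τ i)).toRingHom
    (fun j => if h : j < m then (X ⟨j, h⟩ : MvPolynomial (Fin m) ℂ) else 0) i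
  refine Eq.trans ?_ this.symm
  refine hseq_congr fun j hj => ?_
  have : j < m := hj.trans_le hi
  simp [this]

lemma hseq_ne_zero {τ : ℕ → Ω} {m i : ℕ} (hτ : AlgebraicIndependent ℂ (fun i : Fin m => τ i))
    (hi : i ≤ m) : hseq τ i ≠ 0 := by
  rw [hseq_eq_aeval τ hi]
  intro h
  have h1 := (injective_iff_map_eq_zero _).mp hτ _ h
  have h2 := congrArg (aeval (R := ℂ) (fun _ : Fin m => (0 : ℂ))) h1
  have h3 := map_hseq (aeval (R := ℂ) (fun _ : Fin m => (0 : ℂ))).toRingHom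
    (fun j => if h : j < m then (X ⟨j, h⟩ : MvPolynomial (Fin m) ℂ) else 0) i
  have h4 : hseq (fun j => (aeval (R := ℂ) (fun _ : Fin m => (0 : ℂ))).toRingHom
    (if h : j < m then (X ⟨j, h⟩ : MvPolynomial (Fin m) ℂ) else 0)) i = hseq (fun _ => 0) i := by
    refine hseq_congr fun j hj => ?_
    have : j < m := hj.trans_le hi
    simp [this]
  rw [h4, hseq_zero] at h3
  rw [map_zero] at h2
  exact one_ne_zero (h3.symm.trans h2)

variable {m e : ℕ} {τ : ℕ → Ω} {ξ ω y : Ω}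

lemma Twist.ne_zero (h : Twist m e τ ξ ω y) {i : ℕ} (hi : i < m) : τ i ≠ 0 :=
  h.indep.ne_zero ⟨i, hi⟩

lemma Twist.xi_ne_zero (h : Twist m e τ ξ ω y) : ξ ≠ 0 := by
  rintro rfl; exact h.generic (zero_mem _)

lemma charZero_omega (Ω : Type) [Field Ω] [Algebra ℂ Ω] : CharZero Ω := charZero_of_base ℂ Ω

lemma Twist.gfun_ne_zero (h : Twist m e τ ξ ω y) : gfun ξ ω ≠ 0 := by
  have := charZero_omega Ω
  intro h0
  have := gfun_mul_neg h.curve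
  rw [h0, zero_mul] at this
  exact h.xi_ne_zero (pow_eq_zero_iff (by norm_num) |>.mp (neg_eq_zero.mp this.symm))

lemma Twist.tau_mem (_ : Twist m e τ ξ ω y) {i : ℕ} (hi : i < m) :
    τ i ∈ twistField m τ ξ ω y :=
  IntermediateField.subset_adjoin _ _ (Or.inl ⟨i, hi, rfl⟩)

lemma xi_mem_twistField : ξ ∈ twistField m τ ξ ω y :=
  IntermediateField.subset_adjoin _ _ (Or.inr (by simp))

lemma omega_mem_twistField : ω ∈ twistField m τ ξ ω y :=
  IntermediateField.subset_adjoin _ _ (Or.inr (by simp))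

lemma y_mem_twistField : y ∈ twistField m τ ξ ω y :=
  IntermediateField.subset_adjoin _ _ (Or.inr (by simp))

lemma adjoin_val_eq_top {k : Type} [Field k] [Algebra k Ω] (S : Set Ω) :
    IntermediateField.adjoin k ((↑) ⁻¹' S : Set (IntermediateField.adjoin k S)) = ⊤ := by
  apply IntermediateField.map_injective (IntermediateField.adjoin k S).val
  rw [IntermediateField.adjoin_map, ← AlgHom.fieldRange_eq_map, IntermediateField.fieldRange_val]
  congr 1
  ext x
  constructor
  · rintro ⟨x, hx, rfl⟩; exact hx
  · intro hx; exact ⟨⟨x, IntermediateField.subset_adjoin k S hx⟩, hx, rfl⟩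

lemma twistField_le (h : Twist m e τ ξ ω y) {S : Set Ω} 
    (hτ : ∀ i < m, τ i ∈ acl S) (hξ : ξ ∈ acl S) : twistField m τ ξ ω y ≤ acl S := by
  have hr : ∀ q : ℚ, (q : Ω) ∈ acl S := fun q => SubfieldClass.ratCast_mem (acl S) q
  have hω : ω ∈ acl S := by
    refine mem_acl_of_pow (n := 2) (by norm_num) ?_
    rw [show ω ^ 2 = _ from h.curve]
    exact add_mem (add_mem (add_mem (pow_mem hξ 3) (mul_mem (hr 2) (pow_mem hξ 2)))
      (mul_mem (hr 1) hξ)) (hr (1/4))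
  unfold twistField
  rw [IntermediateField.adjoin_le_iff]
  rintro x (⟨i, hi, rfl⟩ | hx)
  · exact hτ i hi
  · simp only [Set.mem_insert_iff, Set.mem_singleton_iff] at hx
    rcases hx with rfl | rfl | rfl
    · exact hξ
    · exact hω
    · refine mem_acl_of_pow (n := 5) (by norm_num) ?_
      rw [h.root]
      refine mul_mem (pow_mem (hseq_mem (acl S).toSubring hτ) _) ?_
      have hhalf : (1/2 : Ω) ∈ acl S := by
        have := charZero_omega Ω
        have := hr (1/2); push_cast at this; exact this
      exact sub_mem (mul_mem (sub_mem (sub_mem hω hhalf) hξ) (add_mem (one_mem _) hξ))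
        (pow_mem hξ 2)

theorem Twist.rigid [IsAlgClosed Ω] (h : Twist m e τ ξ ω y) (he : e = 1 ∨ e = 2) {S : Set Ω}
    {u : Ω} (hM : (twistField m τ ξ ω y : Set Ω) ⊆ IntermediateField.adjoin (acl S) {u}) :
    twistField m τ ξ ω y ≤ acl S := by
  by_cases hu : u ∈ acl S
  · intro x hx
    have h1 := hM hx
    have h2 : IntermediateField.adjoin (acl S) {u} = ⊥ := by
      rw [IntermediateField.adjoin_simple_eq_bot_iff, IntermediateField.mem_bot]
      exact ⟨⟨u, hu⟩, rfl⟩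
    rw [h2, SetLike.mem_coe, IntermediateField.mem_bot] at h1
    obtain ⟨c, rfl⟩ := h1
    exact c.2
  · have hcz : CharZero (acl S) := charZero_of_base ℂ _
    let Φ := IntermediateField.adjoin (acl S) {u}
    let u' : Φ := ⟨u, IntermediateField.mem_adjoin_simple_self _ u⟩
    have htop : IntermediateField.adjoin (acl S) {u'} = ⊤ := by
      rw [← adjoin_val_eq_top (k := acl S) {u}]
      congr 1
      ext x; simp [u', Subtype.ext_iff]
    have hu' : Transcendental (acl S) u' := by
      intro h
      apply hu
      apply mem_acl_of_isAlgebraic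
      exact (h.algebraMap : IsAlgebraic (acl S) (algebraMap Φ Ω u'))
    have lift : ∀ x ∈ twistField m τ ξ ω y, x ∈ Φ := hM
    let τ' : ℕ → Φ := fun i => if hi : i < m then ⟨τ i, lift _ (h.tau_mem hi)⟩ else 0
    let ξ' : Φ := ⟨ξ, lift _ xi_mem_twistField⟩
    let ω' : Φ := ⟨ω, lift _ omega_mem_twistField⟩
    let y' : Φ := ⟨y, lift _ y_mem_twistField⟩
    have hτ' : ∀ i < m, (τ' i : Ω) = τ i := by intro i hi; simp [τ', hi]
    have hh : ∀ i ≤ m, ((hseq τ' i : Φ) : Ω) = hseq τ i := by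
      intro i hi
      have := map_hseq (Φ.val : Φ →+* Ω) τ' i
      exact this.trans (hseq_congr fun j hj => hτ' j (hj.trans_le hi))
    have hcurve : OnCurve 2 1 (1/4) ξ' ω' := by
      exact OnCurve.of_map (Φ.val : Φ →+* Ω) h.curve
    have hgf : ((gfun ξ' ω' : Φ) : Ω) = gfun ξ ω := map_gfun (Φ.val : Φ →+* Ω) ξ' ω'
    obtain ⟨D, hD⟩ := exists_derivation_eq_one hu' (by
      rw [htop]
      exact ⟨fun x => isAlgebraic_algebraMap (⟨x, IntermediateField.mem_top⟩ : (⊤ : IntermediateField (acl S) Φ))⟩)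
    have hGD := goodDer_of_simple htop D (Or.inl hD)
    have hdesc := twist_descent (e := e) (y := y') hGD (τ := τ') (m := m) (ξ := ξ') (ω := ω')
      (fun i hi h0 => h.ne_zero hi (by rw [← hτ' i hi, h0]; rfl))
      (fun i hi h0 => hseq_ne_zero h.indep hi (by rw [← hh i hi, h0]; rfl)) he hcurve
      (fun h0 => h.gfun_ne_zero (by rw [← hgf, h0]; rfl))
      (by
        apply Subtype.ext
        have := h.root
        rw [← hh m le_rfl, ← hgf] at this
        simpa using this)
    have hξ := hcurve.mem_range_of_simple sep_isogenous hu' htop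
    refine twistField_le h (fun i hi => ?_) ?_
    · obtain ⟨c, hc⟩ := hdesc i hi
      rw [← hτ' i hi, ← hc]; exact c.2
    · obtain ⟨c, hc⟩ := hξ
      have : (ξ' : Ω) ∈ acl S := by rw [← hc]; exact c.2
      exact this

end Omega

end CremonaPlaces

namespace CremonaPlaces

section FunctionField

variable {k Φ : Type} [Field k] [Field Φ] [Algebra k Φ]

lemma adjoin_pair_decomp {p q : Φ} : ∀ a ∈ Algebra.adjoin k ({p, q} : Set Φ), ∃ c : k,
    ∃ a₁ ∈ Algebra.adjoin k ({p, q} : Set Φ), ∃ a₂ ∈ Algebra.adjoin k ({p, q} : Set Φ),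
      a = algebraMap k Φ c + (p * a₁ + q * a₂) := by
  intro a ha
  refine Algebra.adjoin_induction (p := fun a _ => ∃ c : k,
    ∃ a₁ ∈ Algebra.adjoin k ({p, q} : Set Φ), ∃ a₂ ∈ Algebra.adjoin k ({p, q} : Set Φ),
      a = algebraMap k Φ c + (p * a₁ + q * a₂)) ?_ ?_ ?_ ?_ ha
  · rintro x (rfl | hx)
    · exact ⟨0, 1, one_mem _, 0, zero_mem _, by simp⟩
    · rw [Set.mem_singleton_iff] at hx; subst hx
      exact ⟨0, 0, zero_mem _, 1, one_mem _, by simp⟩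
  · intro c; exact ⟨c, 0, zero_mem _, 0, zero_mem _, by simp⟩
  · rintro _ _ _ _ ⟨c, a₁, h₁, a₂, h₂, rfl⟩ ⟨c', a₁', h₁', a₂', h₂', rfl⟩
    exact ⟨c + c', a₁ + a₁', add_mem h₁ h₁', a₂ + a₂', add_mem h₂ h₂', by rw [map_add]; ring⟩
  · rintro _ y hx hy ⟨c, a₁, h₁, a₂, h₂, rfl⟩ ⟨c', a₁', h₁', a₂', h₂', rfl⟩
    refine ⟨c * c', algebraMap k Φ c * a₁' + a₁ * (algebraMap k Φ c' + (p * a₁' + q * a₂')),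
      add_mem (mul_mem (algebraMap_mem _ c) h₁') (mul_mem h₁ hy),
      algebraMap k Φ c * a₂' + a₂ * (algebraMap k Φ c' + (p * a₁' + q * a₂')),
      add_mem (mul_mem (algebraMap_mem _ c) h₂') (mul_mem h₂ hy), by rw [map_mul]; ring⟩

lemma frac_of_pair {V : ValuationSubring Φ} (hV : Over k V) {p q : Φ}
    (hp : V.valuation p < 1) (hq : V.valuation q < 1)
    (htop : IntermediateField.adjoin k ({p, q} : Set Φ) = ⊤)
    {b c : Φ} (hb : b ∈ Algebra.adjoin k ({p, q} : Set Φ)) (hb1 : V.valuation b = 1)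
    (hc : c ∈ Algebra.adjoin k ({p, q} : Set Φ)) (h : b * p = q * c) :
    (∀ f ∈ V, ∃ a ∈ Algebra.adjoin k ({p, q} : Set Φ), ∃ b ∈ Algebra.adjoin k ({p, q} : Set Φ),
      V.valuation b = 1 ∧ f * b = a) ∧
    (∀ f : Φ, V.valuation f < 1 → ∃ g ∈ V, f = q * g) := by
  have hA : ∀ a ∈ Algebra.adjoin k ({p, q} : Set Φ), a ∈ V := adjoin_subset_of_over hV (by
    rintro x (rfl | hx)
    · exact mem_of_lt hp
    · rw [Set.mem_singleton_iff] at hx; subst hx; exact mem_of_lt hq)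
  have hpA : p ∈ Algebra.adjoin k ({p, q} : Set Φ) := Algebra.subset_adjoin (by simp)
  have hqA : q ∈ Algebra.adjoin k ({p, q} : Set Φ) := Algebra.subset_adjoin (by simp)
  have key : ∀ a ∈ Algebra.adjoin k ({p, q} : Set Φ), V.valuation a < 1 →
      ∃ b ∈ Algebra.adjoin k ({p, q} : Set Φ), V.valuation b = 1 ∧
        ∃ c ∈ Algebra.adjoin k ({p, q} : Set Φ), b * a = q * c := by
    intro a ha hlt
    obtain ⟨c0, a₁, h₁, a₂, h₂, rfl⟩ := adjoin_pair_decomp a ha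
    have hc0 : c0 = 0 := by
      by_contra hne
      have h3 := eq_add_lt (val_const hV hne)
        (lt_add (lt_mul_right hp (hA _ h₁)) (lt_mul_right hq (hA _ h₂)))
      exact absurd h3 hlt.ne
    subst hc0
    refine ⟨b, hb, hb1, c * a₁ + b * a₂, add_mem (mul_mem hc h₁) (mul_mem hb h₂), ?_⟩
    rw [map_zero]
    linear_combination a₁ * h
  have hfr := frac_of_principal (Set.toFinite _) hA htop hqA hq key
  refine ⟨hfr, fun f hf => ?_⟩
  obtain ⟨a, ha, b', hb', hb1', hab⟩ := hfr f (mem_of_lt hf)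
  have halt : V.valuation a < 1 := by rw [← hab]; exact lt_mul_right hf (mem_of_eq hb1')
  obtain ⟨b'', hb'', hb1'', c', hc', e⟩ := key a ha halt
  have h0 := ne_zero_of_eq hb1'
  have h0' := ne_zero_of_eq hb1''
  refine ⟨c' * (b'⁻¹ * b''⁻¹), mul_mem (hA _ hc') (mul_mem (inv_mem_of_eq hb1') (inv_mem_of_eq hb1'')), ?_⟩
  field_simp
  linear_combination e + b'' * hab

/-- Generators `x, y` of an elliptic function field in short Weierstrass form. -/
structure EllGen (k : Type) {Φ : Type} [Field k] [Field Φ] [Algebra k Φ] (b c : ℚ) (x y : Φ) :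
    Prop where
  curve : OnCurve 0 b c x y
  top : IntermediateField.adjoin k ({x, y} : Set Φ) = ⊤
  trans : Transcendental k x

variable [IsAlgClosed k] [CharZero k] {b c : ℚ} {x y : Φ}

lemma EllGen.isAlgebraic (h : EllGen k b c x y) :
    Algebra.IsAlgebraic (IntermediateField.adjoin k {x}) Φ := by
  have hx : x ∈ IntermediateField.adjoin k {x} := IntermediateField.mem_adjoin_simple_self _ _
  have hy : IsAlgebraic (IntermediateField.adjoin k {x}) y := by
    refine IsAlgebraic.of_pow (n := 2) (by norm_num) ?_
    have h1 : y ^ 2 ∈ IntermediateField.adjoin k {x} := by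
      rw [show y ^ 2 = _ from h.curve]
      have hr : ∀ q : ℚ, (q : Φ) ∈ IntermediateField.adjoin k {x} := fun q =>
        SubfieldClass.ratCast_mem _ q
      exact add_mem (add_mem (add_mem (pow_mem hx 3) (mul_mem (hr 0) (pow_mem hx 2)))
        (mul_mem (hr b) hx)) (hr c)
    exact isAlgebraic_algebraMap (⟨y ^ 2, h1⟩ : IntermediateField.adjoin k {x})
  have h2 : (⊤ : IntermediateField k Φ) ≤
      (algebraicClosure (IntermediateField.adjoin k {x}) Φ).restrictScalars k := by
    rw [← h.top, IntermediateField.adjoin_le_iff]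
    rintro z (rfl | hz)
    · exact mem_algebraicClosure_iff.mpr (isAlgebraic_algebraMap
        (⟨z, hx⟩ : IntermediateField.adjoin k {z}))
    · rw [Set.mem_singleton_iff] at hz; subst hz
      exact mem_algebraicClosure_iff.mpr hy
  exact ⟨fun z => mem_algebraicClosure_iff.mp (h2 (IntermediateField.mem_top (x := z)))⟩

lemma EllGen.charZero (_ : EllGen k b c x y) : CharZero Φ := charZero_of_base k Φ

/-- The local structure at a place where `x` has a pole. -/
lemma EllGen.frac_infty (h : EllGen k b c x y) {V : ValuationSubring Φ} (hV : Over k V)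
    (hx : x ∉ V) :
    (∀ f ∈ V, ∃ a ∈ Algebra.adjoin k ({y⁻¹, x / y} : Set Φ),
      ∃ b ∈ Algebra.adjoin k ({y⁻¹, x / y} : Set Φ), V.valuation b = 1 ∧ f * b = a) ∧
    (∀ f : Φ, V.valuation f < 1 → ∃ g ∈ V, f = x / y * g) := by
  obtain ⟨hW, hyV, -, -⟩ := h.curve.notMem hV hx
  have hx0 := notMem_ne_zero hx
  have hy0 := notMem_ne_zero hyV
  have ht := lt_inv_of_notMem hyV
  have htop : IntermediateField.adjoin k ({y⁻¹, x / y} : Set Φ) = ⊤ := by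
    rw [eq_top_iff, ← h.top, IntermediateField.adjoin_le_iff]
    have h1 : y⁻¹ ∈ IntermediateField.adjoin k ({y⁻¹, x / y} : Set Φ) :=
      IntermediateField.subset_adjoin _ _ (by simp)
    have h2 : x / y ∈ IntermediateField.adjoin k ({y⁻¹, x / y} : Set Φ) :=
      IntermediateField.subset_adjoin _ _ (by simp)
    have h3 : y ∈ IntermediateField.adjoin k ({y⁻¹, x / y} : Set Φ) := by
      have := inv_mem h1; rwa [inv_inv] at this
    rintro z (rfl | hz)
    · have := mul_mem h2 h3
      rwa [div_mul_cancel₀ _ hy0] at this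
    · rw [Set.mem_singleton_iff] at hz; subst hz; exact h3
  have hr := ratCast_mem (k := k) hV
  have hpA : y⁻¹ ∈ Algebra.adjoin k ({y⁻¹, x / y} : Set Φ) := Algebra.subset_adjoin (by simp)
  have hqA : x / y ∈ Algebra.adjoin k ({y⁻¹, x / y} : Set Φ) := Algebra.subset_adjoin (by simp)
  have hrA : ∀ q : ℚ, (q : Φ) ∈ Algebra.adjoin k ({y⁻¹, x / y} : Set Φ) := fun q => by
    have := algebraMap_mem (Algebra.adjoin k ({y⁻¹, x / y} : Set Φ)) (q : k)
    rwa [map_ratCast] at this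
  refine frac_of_pair hV ht hW htop
    (b := 1 - b * (x / y * y⁻¹) - c * y⁻¹ ^ 2) (c := (x / y) ^ 2) ?_ ?_ (pow_mem hqA 2) ?_
  · exact sub_mem (sub_mem (one_mem _) (mul_mem (hrA b) (mul_mem hqA hpA)))
      (mul_mem (hrA c) (pow_mem hpA 2))
  · exact eq_sub_lt (eq_sub_lt (map_one _) (lt_mul_left (hr b) (lt_mul_right hW (mem_of_lt ht))))
      (lt_mul_left (hr c) (lt_pow ht (by norm_num)))
  · have := h.curve
    unfold OnCurve at this
    field_simp
    push_cast at this
    linear_combination this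

/-- There is only one place where `x` has a pole. -/
lemma EllGen.le_of_notMem (h : EllGen k b c x y) {V V' : ValuationSubring Φ} (hV : Over k V)
    (hV' : Over k V') (hx : x ∉ V) (hx' : x ∉ V') : V ≤ V' := by
  intro f hf
  obtain ⟨a, ha, b', hb', hb1, hab⟩ := (h.frac_infty hV hx).1 f hf
  obtain ⟨hW, hyV, -, -⟩ := h.curve.notMem hV hx
  obtain ⟨hW', hyV', -, -⟩ := h.curve.notMem hV' hx'
  have ht := lt_inv_of_notMem hyV
  have ht' := lt_inv_of_notMem hyV'
  have hA : ∀ V : ValuationSubring Φ, Over k V → V.valuation (x / y) < 1 → V.valuation y⁻¹ < 1 →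
      ∀ a ∈ Algebra.adjoin k ({y⁻¹, x / y} : Set Φ), a ∈ V := fun V hV h1 h2 =>
    adjoin_subset_of_over hV (by
      rintro z (rfl | hz)
      · exact mem_of_lt h2
      · rw [Set.mem_singleton_iff] at hz; subst hz; exact mem_of_lt h1)
  obtain ⟨c0, a₁, h₁, a₂, h₂, e⟩ := adjoin_pair_decomp b' hb'
  have hc0 : c0 ≠ 0 := by
    rintro rfl
    rw [map_zero, zero_add] at e
    rw [e] at hb1
    exact absurd hb1 (lt_add (lt_mul_right ht (hA V hV hW ht _ h₁))
      (lt_mul_right hW (hA V hV hW ht _ h₂))).ne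
  have hb1' : V'.valuation b' = 1 := by
    rw [e]
    exact eq_add_lt (val_const hV' hc0) (lt_add (lt_mul_right ht' (hA V' hV' hW' ht' _ h₁))
      (lt_mul_right hW' (hA V' hV' hW' ht' _ h₂)))
  have : f = a * b'⁻¹ := by rw [eq_mul_inv_iff_mul_eq₀ (ne_zero_of_eq hb1)]; exact hab
  rw [this]
  exact mul_mem (hA V' hV' hW' ht' _ ha) (inv_mem_of_eq hb1')

lemma EllGen.exists_residue (h : EllGen k b c x y) {V : ValuationSubring Φ} (hV : Over k V)
    (hx : x ∈ V) (hne : V ≠ ⊤) : ∃ x₀ : k, V.valuation (x - algebraMap k Φ x₀) < 1 := by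
  by_contra! hcon
  apply hne
  have hunit : ∀ p : Polynomial k, p ≠ 0 → V.valuation (Polynomial.aeval x p) = 1 := by
    intro p
    have hs := IsAlgClosed.splits p
    intro hp
    rw [Polynomial.Splits.eq_prod_roots hs]
    simp only [map_mul, Polynomial.aeval_C]
    refine eq_mul (val_const hV (by simpa using hp)) ?_
    rw [map_multiset_prod, map_multiset_prod, Multiset.map_map, Multiset.map_map]
    apply Multiset.prod_eq_one
    intro z hz
    obtain ⟨r, -, rfl⟩ := Multiset.mem_map.mp hz
    simp only [Function.comp, map_sub, Polynomial.aeval_X, Polynomial.aeval_C]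
    exact le_antisymm (val_le (sub_mem hx (hV r))) (hcon r)
  have h1 : ∀ z ∈ IntermediateField.adjoin k {x}, z ∈ V := by
    intro z hz
    obtain ⟨p, q, rfl⟩ := (IntermediateField.mem_adjoin_simple_iff k z).mp hz
    by_cases hq : q = 0
    · simp [hq]
    by_cases hp : p = 0
    · simp [hp]
    · exact mem_of_eq (by rw [map_div₀, hunit p hp, hunit q hq, div_one])
  rw [eq_top_iff]
  intro z _
  have := h.isAlgebraic
  have hz := (Algebra.IsAlgebraic.isAlgebraic (R := IntermediateField.adjoin k {x}) z).isIntegral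
  have hle : (algebraMap (IntermediateField.adjoin k {x}) Φ).range ≤ V.toSubring := by
    rintro _ ⟨w, rfl⟩; exact h1 w w.2
  have h2 : IsIntegral V z := by
    let φ : IntermediateField.adjoin k {x} →+* V :=
      (algebraMap (IntermediateField.adjoin k {x}) Φ).codRestrict V.toSubring (fun w => h1 w w.2)
    obtain ⟨p, hp, he⟩ := hz
    refine ⟨p.map φ, hp.map _, ?_⟩
    rw [Polynomial.eval₂_map]
    exact he
  obtain ⟨w, hw⟩ := IsIntegrallyClosed.isIntegral_iff.mp h2
  rw [← hw]; exact w.2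

/-- The invariant derivation of an elliptic function field. -/
theorem EllGen.exists_goodDer (h : EllGen k b c x y) (hs : Sep 0 b c) :
    ∃ D : Derivation k Φ Φ, GoodDer D ∧ D x = 2 * y ∧ D y = 3 * x ^ 2 + b := by
  have hcz := h.charZero
  have hy0 : y ≠ 0 := by
    rintro rfl
    have hc := h.curve
    unfold OnCurve at hc
    refine h.trans ⟨Polynomial.X ^ 3 + Polynomial.C (b : k) * Polynomial.X + Polynomial.C (c : k),
      Polynomial.Monic.ne_zero (by monicity!), ?_⟩
    push_cast at hc
    simp
    linear_combination -hc
  obtain ⟨D₁, hD₁⟩ := exists_derivation_eq_one h.trans h.isAlgebraic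
  let D : Derivation k Φ Φ := (2 * y) • D₁
  have hDx : D x = 2 * y := by simp [D, hD₁]
  have hDy : D y = 3 * x ^ 2 + b := by
    have := h.curve.derivation D
    rw [hDx] at this
    push_cast at this
    have h2 : (2 * y) ≠ 0 := by simp [hy0]
    apply mul_left_cancel₀ h2
    linear_combination this
  have hr' : ∀ (S : Set Φ) (q : ℚ), (q : Φ) ∈ Algebra.adjoin k S := fun S q => by
    have := algebraMap_mem (Algebra.adjoin k S) (q : k)
    rwa [map_ratCast] at this
  have hn' : ∀ (S : Set Φ) (q : ℕ) [q.AtLeastTwo], (OfNat.ofNat q : Φ) ∈ Algebra.adjoin k S :=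
    fun S q _ => by
      have := hr' S (OfNat.ofNat q : ℚ)
      rwa [Rat.cast_ofNat] at this
  refine ⟨D, ⟨fun V hV => ?_, fun f hf => ?_⟩, hDx, hDy⟩
  · by_cases hx : x ∈ V
    · by_cases hne : V = ⊤
      · subst hne; intro f _; trivial
      have hy := h.curve.mem hV hx
      obtain ⟨x₀, hx₀⟩ := h.exists_residue hV hx hne
      obtain ⟨y₀, hy₀⟩ := IsAlgClosed.exists_pow_nat_eq (x₀ ^ 3 + b * x₀ + c) (n := 2) (by norm_num)
      have hcv : y ^ 2 = x ^ 3 + b * x + c := by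
        have := h.curve; unfold OnCurve at this; push_cast at this; linear_combination this
      set X₀ := algebraMap k Φ x₀ with hX₀
      have hX₀V : X₀ ∈ V := hV x₀
      obtain ⟨y₁, hy₁, hsm⟩ : ∃ y₁ : k, y₁ ^ 2 = x₀ ^ 3 + b * x₀ + c ∧
          V.valuation (y - algebraMap k Φ y₁) < 1 := by
        by_contra! hcon
        have h1 := hcon y₀ hy₀
        have h2 := hcon (-y₀) (by rw [neg_sq, hy₀])
        have h3 : V.valuation ((y - algebraMap k Φ y₀) * (y - algebraMap k Φ (-y₀))) < 1 := by
          have e : (y - algebraMap k Φ y₀) * (y - algebraMap k Φ (-y₀)) =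
              (x - X₀) * (x ^ 2 + x * X₀ + X₀ ^ 2 + b) := by
            have := congrArg (algebraMap k Φ) hy₀
            simp only [map_pow, map_add, map_mul, map_ratCast] at this
            rw [map_neg]
            linear_combination hcv - this
          rw [e]
          have hb := ratCast_mem (k := k) hV b
          exact lt_mul_right hx₀ (add_mem (add_mem (add_mem (pow_mem hx 2) (mul_mem hx hX₀V))
            (pow_mem hX₀V 2)) hb)
        rw [map_mul] at h3
        exact absurd h3 (not_lt.mpr (one_le_mul h1 h2))
      set Y₁ := algebraMap k Φ y₁ with hY₁
      have hY₁c : Y₁ ^ 2 = X₀ ^ 3 + b * X₀ + c := by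
        have := congrArg (algebraMap k Φ) hy₁
        simpa only [map_pow, map_add, map_mul, map_ratCast] using this
      have main : ∀ p q : Φ, ({p, q} : Set Φ) = {x - X₀, y - Y₁} → V.valuation p < 1 →
          V.valuation q < 1 → ∀ b₁ c₁ : Φ, b₁ ∈ Algebra.adjoin k ({x - X₀, y - Y₁} : Set Φ) →
          c₁ ∈ Algebra.adjoin k ({x - X₀, y - Y₁} : Set Φ) → V.valuation b₁ = 1 →
          b₁ * p = q * c₁ → ∀ f ∈ V, D f ∈ V := by
        intro p q hpq hp hq b₁ c₁ hb₁ hc₁ hb1 e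
        rw [← hpq] at hb₁ hc₁
        have hX : X₀ ∈ IntermediateField.adjoin k ({p, q} : Set Φ) := algebraMap_mem _ x₀
        have hY : Y₁ ∈ IntermediateField.adjoin k ({p, q} : Set Φ) := algebraMap_mem _ y₁
        have hx' : x - X₀ ∈ ({p, q} : Set Φ) := by rw [hpq]; simp
        have hy' : y - Y₁ ∈ ({p, q} : Set Φ) := by rw [hpq]; simp
        have htop : IntermediateField.adjoin k ({p, q} : Set Φ) = ⊤ := by
          rw [eq_top_iff, ← h.top, IntermediateField.adjoin_le_iff]
          rintro z (rfl | hz)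
          · have := add_mem (IntermediateField.subset_adjoin k _ hx') hX
            rwa [sub_add_cancel] at this
          · rw [Set.mem_singleton_iff] at hz; subst hz
            have := add_mem (IntermediateField.subset_adjoin k _ hy') hY
            rwa [sub_add_cancel] at this
        have hA : ∀ a ∈ Algebra.adjoin k ({p, q} : Set Φ), a ∈ V := adjoin_subset_of_over hV (by
          rintro z (rfl | hz)
          · exact mem_of_lt hp
          · rw [Set.mem_singleton_iff] at hz; subst hz; exact mem_of_lt hq)
        have hXA : X₀ ∈ Algebra.adjoin k ({p, q} : Set Φ) := algebraMap_mem _ x₀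
        have hYA : Y₁ ∈ Algebra.adjoin k ({p, q} : Set Φ) := algebraMap_mem _ y₁
        have hxA : x ∈ Algebra.adjoin k ({p, q} : Set Φ) := by
          have := add_mem (Algebra.subset_adjoin (R := k) hx') hXA
          rwa [sub_add_cancel] at this
        have hyA : y ∈ Algebra.adjoin k ({p, q} : Set Φ) := by
          have := add_mem (Algebra.subset_adjoin (R := k) hy') hYA
          rwa [sub_add_cancel] at this
        refine derivation_mem_of_frac D V _ hA (derivation_mem_adjoin D ?_)
          (frac_of_pair hV hp hq htop hb₁ hb1 hc₁ e).1
        rw [hpq]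
        rw [hpq] at hxA hyA
        rintro z (rfl | hz)
        · rw [map_sub, hDx, hX₀, D.map_algebraMap, sub_zero]
          exact mul_mem (hn' _ 2) hyA
        · rw [Set.mem_singleton_iff] at hz; subst hz
          rw [map_sub, hDy, hY₁, D.map_algebraMap, sub_zero]
          exact add_mem (mul_mem (hn' _ 3) (pow_mem hxA 2)) (hr' _ b)
      have hX0A : X₀ ∈ Algebra.adjoin k ({x - X₀, y - Y₁} : Set Φ) := algebraMap_mem _ x₀
      have hY1A : Y₁ ∈ Algebra.adjoin k ({x - X₀, y - Y₁} : Set Φ) := algebraMap_mem _ y₁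
      have hxA : x ∈ Algebra.adjoin k ({x - X₀, y - Y₁} : Set Φ) := by
        have := add_mem (Algebra.subset_adjoin (R := k)
          (by simp : x - X₀ ∈ ({x - X₀, y - Y₁} : Set Φ))) hX0A
        rwa [sub_add_cancel] at this
      have hyA : y ∈ Algebra.adjoin k ({x - X₀, y - Y₁} : Set Φ) := by
        have := add_mem (Algebra.subset_adjoin (R := k)
          (by simp : y - Y₁ ∈ ({x - X₀, y - Y₁} : Set Φ))) hY1A
        rwa [sub_add_cancel] at this
      by_cases hy1 : y₁ = 0
      · have hY0 : Y₁ = 0 := by rw [hY₁, hy1, map_zero]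
        rw [hY0, sub_zero] at hsm
        refine main (x - X₀) (y - Y₁) rfl hx₀ (by rwa [hY0, sub_zero])
          (x ^ 2 + x * X₀ + X₀ ^ 2 + b) y (add_mem (add_mem (add_mem (pow_mem hxA 2)
            (mul_mem hxA hX0A)) (pow_mem hX0A 2)) (hr' _ b)) hyA ?_ ?_
        · have e : x ^ 2 + x * X₀ + X₀ ^ 2 + b =
            algebraMap k Φ (3 * x₀ ^ 2 + b) + (x - X₀) * (x + 2 * X₀) := by
            simp only [map_add, map_mul, map_pow, map_ofNat, map_ratCast]; rw [← hX₀]; ring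
          have h2V : (2 : Φ) ∈ V := by exact_mod_cast ratCast_mem (k := k) hV 2
          rw [e]
          refine eq_add_lt (val_const hV ?_) (lt_mul_right hx₀ (add_mem hx (mul_mem h2V hX₀V)))
          intro h0
          obtain ⟨α, β, γ, δ, ε, hsep⟩ := hs
          have := hsep k x₀
          push_cast at this
          rw [hy1] at hy₁
          have h5 : x₀ ^ 3 + b * x₀ + c = 0 := by rw [← hy₁]; ring
          have : (1 : k) = 0 := by
            rw [← this]
            linear_combination (γ * x₀ ^ 2 + δ * x₀ + ε) * h0 + (α * x₀ + β) * h5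
          exact one_ne_zero this
        · rw [hY0]
          rw [hY0] at hY₁c
          linear_combination -hcv + hY₁c
      · refine main (y - Y₁) (x - X₀) (Set.pair_comm _ _) hsm hx₀
          (y + Y₁) (x ^ 2 + x * X₀ + X₀ ^ 2 + b) (add_mem hyA hY1A) (add_mem (add_mem (add_mem (pow_mem hxA 2)
            (mul_mem hxA hX0A)) (pow_mem hX0A 2)) (hr' _ b)) ?_ ?_
        · have e : y + Y₁ = algebraMap k Φ (2 * y₁) + (y - Y₁) := by
            rw [map_mul, map_ofNat]; ring
          rw [e]
          exact eq_add_lt (val_const hV (by simp [hy1])) hsm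
        · linear_combination hcv - hY₁c
    · obtain ⟨hW, hyV, -, -⟩ := h.curve.notMem hV hx
      have ht := lt_inv_of_notMem hyV
      refine derivation_mem_of_frac D V _ (adjoin_subset_of_over hV (by
        rintro z (rfl | hz)
        · exact mem_of_lt ht
        · rw [Set.mem_singleton_iff] at hz; subst hz; exact mem_of_lt hW))
        (derivation_mem_adjoin D ?_) (h.frac_infty hV hx).1
      have hpA : y⁻¹ ∈ Algebra.adjoin k ({y⁻¹, x / y} : Set Φ) := Algebra.subset_adjoin (by simp)
      have hqA : x / y ∈ Algebra.adjoin k ({y⁻¹, x / y} : Set Φ) := Algebra.subset_adjoin (by simp)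
      have hDt : D y⁻¹ = -(3 * (x / y) ^ 2 + b * y⁻¹ ^ 2) := by
        rw [derivation_inv, hDy]; field_simp
      rintro z (rfl | hz)
      · rw [hDt]
        exact neg_mem (add_mem (mul_mem (hn' _ 3) (pow_mem hqA 2)) (mul_mem (hr' _ b) (pow_mem hpA 2)))
      · rw [Set.mem_singleton_iff] at hz; subst hz
        have e : D (x / y) = -1 + 2 * b * (x / y * y⁻¹) + 3 * c * y⁻¹ ^ 2 := by
          rw [div_eq_mul_inv, D.leibniz, hDt, hDx]
          simp only [smul_eq_mul]
          have := h.curve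
          unfold OnCurve at this
          push_cast at this
          field_simp
          linear_combination (3 : Φ) * this
        rw [e]
        exact add_mem (add_mem (neg_mem (one_mem _)) (mul_mem (mul_mem (hn' _ 2) (hr' _ b))
          (mul_mem hqA hpA))) (mul_mem (mul_mem (hn' _ 3) (hr' _ c)) (pow_mem hpA 2))
  · exact mem_range_of_derivation_eq_zero h.isAlgebraic D (by rw [hDx]; simp [hy0]) hf

end FunctionField

end CremonaPlaces

namespace CremonaPlaces

section FunctionField

variable {k Φ : Type} [Field k] [Field Φ] [Algebra k Φ]

lemma OnCurve.slope_mul {a b c : ℚ} {X₁ Y₁ X₂ Y₂ s : Φ} (h₁ : OnCurve a b c X₁ Y₁)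
    (h₂ : OnCurve a b c X₂ Y₂) (hne : X₁ ≠ X₂) (hs : s * (X₁ - X₂) = Y₁ - Y₂) :
    s * (Y₁ + Y₂) = X₁ ^ 2 + X₁ * X₂ + X₂ ^ 2 + a * (X₁ + X₂) + b := by
  apply mul_right_cancel₀ (sub_ne_zero.mpr hne)
  unfold OnCurve at h₁ h₂
  linear_combination (Y₁ + Y₂) * hs + h₁ - h₂

/-- The sum of two points with distinct abscissas. -/
lemma OnCurve.add {a b c : ℚ} {X₁ Y₁ X₂ Y₂ s : Φ} (h₁ : OnCurve a b c X₁ Y₁)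
    (h₂ : OnCurve a b c X₂ Y₂) (hne : X₁ ≠ X₂) (hs : s * (X₁ - X₂) = Y₁ - Y₂) :
    OnCurve a b c (s ^ 2 - a - X₁ - X₂) (-(Y₁ + s * (s ^ 2 - a - X₁ - X₂ - X₁))) := by
  have hk := h₁.slope_mul h₂ hne hs
  unfold OnCurve at h₁ ⊢
  linear_combination h₁ + (s ^ 2 - a - X₁ - X₂ - X₁) * hk - (s ^ 2 - a - X₁ - X₂ - X₁) * s * hs

lemma OnCurve.derivation_add {a b c : ℚ} {X₁ Y₁ X₂ Y₂ s c₁ c₂ : Φ} [IsAlgClosed k] [CharZero k]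
    (h₁ : OnCurve a b c X₁ Y₁)
    (h₂ : OnCurve a b c X₂ Y₂) (hne : X₁ ≠ X₂) (hs : s * (X₁ - X₂) = Y₁ - Y₂)
    {D : Derivation k Φ Φ} (hX₁ : D X₁ = 2 * c₁ * Y₁) (hX₂ : D X₂ = 2 * c₂ * Y₂)
    (hY₁ : D Y₁ = c₁ * (3 * X₁ ^ 2 + 2 * a * X₁ + b))
    (hY₂ : D Y₂ = c₂ * (3 * X₂ ^ 2 + 2 * a * X₂ + b)) :
    D (s ^ 2 - a - X₁ - X₂) = 2 * (c₁ + c₂) * (-(Y₁ + s * (s ^ 2 - a - X₁ - X₂ - X₁))) := by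
  have hk := h₁.slope_mul h₂ hne hs
  have hd := congrArg D hs
  rw [D.leibniz, smul_eq_mul, smul_eq_mul, map_sub, map_sub, hX₁, hX₂, hY₁, hY₂] at hd
  have e : D (s ^ 2 - a - X₁ - X₂) = 2 * s * D s - D X₁ - D X₂ := by
    rw [map_sub, map_sub, map_sub, derivation_ratCast, D.leibniz_pow]
    simp; ring
  rw [e, hX₁, hX₂]
  apply mul_right_cancel₀ (sub_ne_zero.mpr hne)
  linear_combination 2 * s * hd - 2 * s * (c₁ - c₂) * hk
    + (2 * s ^ 2 * c₁ + 2 * c₂ * (s ^ 2 - (X₁ - X₂))) * hs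

variable [IsAlgClosed k] [CharZero k] {b c : ℚ} {x₁ y₁ x₂ y₂ : Φ}

lemma EllGen.derivation_infty_eq (h : EllGen k b c x₁ y₁) {V : ValuationSubring Φ}
    (hV : Over k V) (hx : x₁ ∉ V) {D : Derivation k Φ Φ} {κ : Φ} (hκ : κ ∈ V)
    (hD : D x₁ = 2 * κ * y₁) :
    (∃ β ∈ V, D (x₁ / y₁) = - κ + (x₁ / y₁) ^ 4 * β) ∧
    (∃ γ ∈ V, x₁ = (x₁ / y₁)⁻¹ ^ 2 + γ) := by
  have hcz := h.charZero
  obtain ⟨hW, hyV, e, hU⟩ := h.curve.notMem hV hx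
  have hd := h.curve.derivation_infty hV hx D
  have hx0 := notMem_ne_zero hx
  have hy0 := notMem_ne_zero hyV
  have hZ := mem_of_lt (lt_inv_of_notMem hx)
  have hr := ratCast_mem (k := k) hV
  have h2V : (2 : Φ) ∈ V := by exact_mod_cast hr 2
  have h3V : (3 : Φ) ∈ V := by exact_mod_cast hr 3
  push_cast at e hU hd
  set U := (1 + 0 * x₁⁻¹ + (b : Φ) * x₁⁻¹ ^ 2 + c * x₁⁻¹ ^ 3) with hUd
  have hDx : D x₁ / (2 * y₁) = κ := by rw [hD]; field_simp
  rw [hDx] at hd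
  refine ⟨⟨κ * U * (2 * b + 3 * c * x₁⁻¹), mul_mem (mul_mem hκ (mem_of_eq hU)) (add_mem
    (mul_mem h2V (hr b)) (mul_mem (mul_mem h3V (hr c)) hZ)), ?_⟩,
    ⟨-(b * x₁⁻¹ + c * x₁⁻¹ ^ 2), neg_mem (add_mem (mul_mem (hr b) hZ)
      (mul_mem (hr c) (pow_mem hZ 2))), ?_⟩⟩
  · linear_combination hd + κ * (x₁ / y₁) ^ 2 * (2 * b + 3 * c * x₁⁻¹) * e
  · have := h.curve
    unfold OnCurve at this
    push_cast at this
    field_simp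
    linear_combination -this

lemma EllGen.sq_eq_one_of_notMem (h₁ : EllGen k b c x₁ y₁) (h₂ : EllGen k b c x₂ y₂) (hb : b ≠ 0)
    (hc : c ≠ 0) {D : Derivation k Φ Φ} (hD : GoodDer D) {κ : k} (hD₁ : D x₁ = 2 * y₁)
    (hD₂ : D x₂ = 2 * algebraMap k Φ κ * y₂) {V : ValuationSubring Φ} (hV : Over k V)
    (hx₁ : x₁ ∉ V) (hx₂ : x₂ ∉ V) : κ ^ 2 = 1 := by
  have hcz := h₁.charZero
  set K := algebraMap k Φ κ with hK
  have hKV : K ∈ V := hV κ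
  obtain ⟨⟨β₁, hβ₁, hW₁⟩, γ₁, hγ₁, hg₁⟩ := h₁.derivation_infty_eq hV hx₁ (κ := 1) (one_mem V)
    (D := D) (by rw [hD₁]; ring)
  obtain ⟨⟨β₂, hβ₂, hW₂⟩, γ₂, hγ₂, hg₂⟩ := h₂.derivation_infty_eq hV hx₂ hKV hD₂
  obtain ⟨hm₁, hyV₁, -, -⟩ := h₁.curve.notMem hV hx₁
  obtain ⟨hm₂, hyV₂, -, -⟩ := h₂.curve.notMem hV hx₂
  have hW0 : x₁ / y₁ ≠ 0 := div_ne_zero (notMem_ne_zero hx₁) (notMem_ne_zero hyV₁)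
  have hW0' : x₂ / y₂ ≠ 0 := div_ne_zero (notMem_ne_zero hx₂) (notMem_ne_zero hyV₂)
  obtain ⟨u, hu, hWu⟩ := (h₁.frac_infty hV hx₁).2 _ hm₂
  obtain ⟨u', hu', hWu'⟩ := (h₂.frac_infty hV hx₂).2 _ hm₁
  have hprin := (h₁.frac_infty hV hx₁).2
  set W := x₁ / y₁ with hWd
  set W' := x₂ / y₂ with hWd'
  have huu : u * u' = 1 := by
    apply mul_left_cancel₀ hW0
    rw [← mul_assoc, ← hWu, ← hWu', mul_one]
  have hu0 : u ≠ 0 := left_ne_zero_of_mul_eq_one huu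
  have hDW : V.valuation (D W) = 1 := by
    rw [hW₁]
    exact eq_add_lt (by rw [Valuation.map_neg, map_one]) (lt_mul_right (lt_pow hm₁ (by norm_num)) hβ₁)
  have hsub : ∀ f : Φ, f ∈ V → V.valuation (f * D W) < 1 → V.valuation f < 1 := by
    intro f hf h
    rcases lt_or_eq hf with h1 | h1
    · exact h1
    · exact absurd (eq_mul h1 hDW) h.ne
  have hDV : ∀ f ∈ V, D f ∈ V := hD.stable V hV
  have hDf : D (K * W - W') = W * (W ^ 3 * (K * β₁ - u ^ 4 * β₂)) := by
    rw [map_sub, D.leibniz, hK, D.map_algebraMap, ← hK, hW₁, hW₂, hWu]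
    simp only [smul_eq_mul]; ring
  have hBV : K * β₁ - u ^ 4 * β₂ ∈ V := sub_mem (mul_mem hKV hβ₁) (mul_mem (pow_mem hu 4) hβ₂)
  have hWV := mem_of_lt hm₁
  obtain ⟨f₁, hf₁, e₁⟩ := hprin (K * W - W') (lt_sub (lt_mul_left hKV hm₁) hm₂)
  have hf₁' : V.valuation f₁ < 1 := by
    apply hsub _ hf₁
    have h1 := hDf
    rw [e₁, D.leibniz, smul_eq_mul, smul_eq_mul] at h1
    have : f₁ * D W = W * (W ^ 3 * (K * β₁ - u ^ 4 * β₂) - D f₁) := by linear_combination h1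
    rw [this]
    exact lt_mul_right hm₁ (sub_mem (mul_mem (pow_mem hWV 3) hBV) (hDV _ hf₁))
  obtain ⟨f₂, hf₂, e₂⟩ := hprin f₁ hf₁'
  have hf₂' : V.valuation f₂ < 1 := by
    have h2 : V.valuation (2 : Φ) = 1 := by exact_mod_cast val_ofNat k hV 2 (by norm_num)
    apply hsub _ hf₂
    have h1 := hDf
    rw [e₁, e₂, D.leibniz, D.leibniz W f₂, smul_eq_mul, smul_eq_mul, smul_eq_mul, smul_eq_mul] at h1
    have : 2 * (f₂ * D W) = W * (W ^ 2 * (K * β₁ - u ^ 4 * β₂) - D f₂) := by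
      apply mul_left_cancel₀ hW0
      linear_combination h1
    have h3 : V.valuation (2 * (f₂ * D W)) < 1 := by
      rw [this]
      exact lt_mul_right hm₁ (sub_mem (mul_mem (pow_mem hWV 2) hBV) (hDV _ hf₂))
    rwa [map_mul, h2, one_mul] at h3
  obtain ⟨f₃, hf₃, e₃⟩ := hprin f₂ hf₂'
  have hZV : K ^ 2 * x₂ - x₁ ∈ V := by
    have e : K ^ 2 * x₂ - x₁ = f₃ * (K + u) * u' ^ 2 + (K ^ 2 * γ₂ - γ₁) := by
      have h4 : K - u = W ^ 2 * f₃ := by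
        apply mul_left_cancel₀ hW0
        rw [e₂, e₃] at e₁
        rw [hWu] at e₁
        linear_combination e₁
      have h5 : u' = u⁻¹ := eq_inv_of_mul_eq_one_right huu
      rw [hg₁, hg₂, hWu, h5]
      field_simp
      linear_combination (K + u) * h4
    rw [e]
    exact add_mem (mul_mem (mul_mem hf₃ (add_mem hKV hu)) (pow_mem hu' 2))
      (sub_mem (mul_mem (pow_mem hKV 2) hγ₂) hγ₁)
  obtain ⟨e, he⟩ : K ^ 2 * x₂ - x₁ ∈ (algebraMap k Φ).range := by
    refine mem_range_of_forall_mem fun V' hV' => ?_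
    by_cases hx : x₁ ∈ V'
    · have hx' : x₂ ∈ V' := by
        by_contra hcon
        exact hx₁ (h₂.le_of_notMem hV' hV hcon hx₂ hx)
      exact sub_mem (mul_mem (pow_mem (hV' κ) 2) hx') hx
    · exact h₁.le_of_notMem hV hV' hx₁ hx hZV
  have hyy : y₁ = K ^ 3 * y₂ := by
    have := congrArg D he
    rw [D.map_algebraMap, map_sub, D.leibniz, D.leibniz_pow, hK, D.map_algebraMap, ← hK, hD₁, hD₂] at this
    simp only [smul_eq_mul, smul_zero, mul_zero, add_zero] at this
    apply mul_left_cancel₀ (two_ne_zero' Φ)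
    linear_combination this
  have hp0 : (Polynomial.C (κ ^ 2) * Polynomial.X - Polynomial.C e) ^ 3
    + Polynomial.C (b : k) * (Polynomial.C (κ ^ 2) * Polynomial.X - Polynomial.C e) + Polynomial.C (c : k)
    - Polynomial.C (κ ^ 6) * (Polynomial.X ^ 3 + Polynomial.C (b : k) * Polynomial.X + Polynomial.C (c : k)) = 0 := by
    by_contra hne
    apply h₂.trans
    refine ⟨_, hne, ?_⟩
    simp only [map_sub, map_add, map_mul, map_pow, Polynomial.aeval_C, Polynomial.aeval_X, he,
      map_ratCast]
    rw [← hK]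
    have hc1 := h₁.curve
    have hc2 := h₂.curve
    unfold OnCurve at hc1 hc2
    push_cast at hc1 hc2
    rw [hyy] at hc1
    linear_combination K ^ 6 * hc2 - hc1
  have hev : ∀ t : k, (κ ^ 2 * t - e) ^ 3 + b * (κ ^ 2 * t - e) + c - κ ^ 6 * (t ^ 3 + b * t + c) = 0 := by
    intro t
    have := congrArg (Polynomial.eval t) hp0
    simpa using this
  have hκ0 : κ ≠ 0 := by
    rintro h0
    apply h₁.trans
    have : x₁ = algebraMap k Φ (-e) := by
      rw [map_neg, he, hK, h0, map_zero]; ring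
    rw [this]; exact isAlgebraic_algebraMap _
  have t0 := hev 0
  have t1 := hev 1
  have t2 := hev (-1)
  have he0 : e = 0 := by
    have : κ ^ 4 * e = 0 := by linear_combination (-(1:k)/6) * (t1 + t2 - 2 * t0)
    exact (mul_eq_zero.mp this).resolve_left (pow_ne_zero _ hκ0)
  subst he0
  have hb' : (b : k) ≠ 0 := by exact_mod_cast hb
  have hc' : (c : k) ≠ 0 := by exact_mod_cast hc
  have h6 : κ ^ 6 = 1 := by
    apply mul_left_cancel₀ hc'; linear_combination -t0
  have h4 : κ ^ 4 = 1 := by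
    apply mul_left_cancel₀ hb'
    apply mul_left_cancel₀ (pow_ne_zero 2 hκ0)
    linear_combination -(t1 - t0)
  linear_combination h6 - κ ^ 2 * h4

lemma EllGen.snd_ne_zero (h : EllGen k b c x₁ y₁) : y₁ ≠ 0 := by
  rintro rfl
  have hc := h.curve
  unfold OnCurve at hc
  refine h.trans ⟨Polynomial.X ^ 3 + Polynomial.C (b : k) * Polynomial.X + Polynomial.C (c : k),
    Polynomial.Monic.ne_zero (by monicity!), ?_⟩
  push_cast at hc
  simp
  linear_combination -hc

/-- Translating the generic point of an elliptic function field, a place with finite abscissa is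
moved to the place at infinity. -/
lemma EllGen.exists_translate (hs : Sep 0 b c) (h : EllGen k b c x₁ y₁) {V : ValuationSubring Φ}
    (hV : Over k V) (hx : x₁ ∈ V) (hne : V ≠ ⊤) {D : Derivation k Φ Φ} {κ : k}
    (hD : D x₁ = 2 * algebraMap k Φ κ * y₁) :
    ∃ x y : Φ, EllGen k b c x y ∧ x ∉ V ∧ D x = 2 * algebraMap k Φ κ * y := by
  have hcz := h.charZero
  obtain ⟨p, hp⟩ := h.exists_residue hV hx hne
  obtain ⟨q, hq⟩ := IsAlgClosed.exists_pow_nat_eq (p ^ 3 + b * p + c) (n := 2) (by norm_num)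
  have hcv := h.curve
  have hy := hcv.mem hV hx
  have hP : ∀ q : k, q ^ 2 = p ^ 3 + b * p + c →
      OnCurve 0 b c (algebraMap k Φ p) (algebraMap k Φ q) := by
    intro q hq
    have := congrArg (algebraMap k Φ) hq
    simp only [map_pow, map_add, map_mul, map_ratCast] at this
    unfold OnCurve; push_cast; linear_combination this
  have hxp : x₁ ≠ algebraMap k Φ p := by
    rintro rfl; exact h.trans (isAlgebraic_algebraMap _)
  have hd0 := sub_ne_zero.mpr hxp
  obtain ⟨q₁, hq₁, hsV⟩ : ∃ q₁ : k, q₁ ^ 2 = p ^ 3 + b * p + c ∧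
      (y₁ - algebraMap k Φ q₁) / (x₁ - algebraMap k Φ p) ∉ V := by
    by_contra! hcon
    have hcon' : ∀ q : k, q ^ 2 = p ^ 3 + b * p + c → V.valuation (y₁ - algebraMap k Φ q) < 1 := by
      intro q hq
      have := lt_mul_left (hcon q hq) hp
      rwa [div_mul_cancel₀ _ hd0] at this
    have h1 := hcon' q hq
    have h2 := hcon' (-q) (by rw [neg_sq, hq])
    have h3 := lt_sub h2 h1
    have h4 : y₁ - algebraMap k Φ (-q) - (y₁ - algebraMap k Φ q) = algebraMap k Φ (2 * q) := by
      rw [map_neg, map_mul, map_ofNat]; ring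
    rw [h4] at h3
    have hq0 : q = 0 := by
      by_contra hq0
      exact absurd (val_const hV (c := 2 * q) (by simp [hq0])) h3.ne
    subst hq0
    have h5 := hcon 0 hq
    have hq' := hP 0 hq
    have h6 : V.valuation (x₁ ^ 2 + x₁ * algebraMap k Φ p + algebraMap k Φ p ^ 2 + b) < 1 := by
      have e : x₁ ^ 2 + x₁ * algebraMap k Φ p + algebraMap k Φ p ^ 2 + b =
          (y₁ - algebraMap k Φ 0) * ((y₁ - algebraMap k Φ 0) / (x₁ - algebraMap k Φ p)) := by
        unfold OnCurve at hcv hq'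
        push_cast at hcv hq'
        rw [map_zero]
        field_simp
        linear_combination -hcv + hq'
      rw [e]
      exact lt_mul_right h1 h5
    have h2V : (2 : Φ) ∈ V := by exact_mod_cast ratCast_mem (k := k) hV 2
    have h7 := lt_sub h6 (lt_mul_right hp (add_mem hx (mul_mem h2V (hV p))))
    have h8 : x₁ ^ 2 + x₁ * algebraMap k Φ p + algebraMap k Φ p ^ 2 + b -
        (x₁ - algebraMap k Φ p) * (x₁ + 2 * algebraMap k Φ p) = algebraMap k Φ (3 * p ^ 2 + b) := by
      simp only [map_add, map_mul, map_pow, map_ofNat, map_ratCast]; ring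
    rw [h8] at h7
    refine absurd (val_const hV (c := 3 * p ^ 2 + b) ?_) h7.ne
    intro h0
    obtain ⟨α, β, γ, δ, ε, hsep⟩ := hs
    have := hsep k p
    push_cast at this
    have h5 : p ^ 3 + b * p + c = 0 := by rw [← hq]; ring
    have : (1 : k) = 0 := by
      rw [← this]
      linear_combination (γ * p ^ 2 + δ * p + ε) * h0 + (α * p + β) * h5
    exact one_ne_zero this
  have hPq := hP q₁ hq₁
  set P := algebraMap k Φ p with hPd
  set Q := algebraMap k Φ q₁ with hQd
  set s := (y₁ - Q) / (x₁ - P) with hsd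
  have hs1 : s * (x₁ - P) = y₁ - Q := div_mul_cancel₀ _ hd0
  have hX : s ^ 2 - ((0 : ℚ) : Φ) - x₁ - P ∉ V := by
    intro hcon
    apply hsV
    refine mem_of_pow_mem (n := 2) (by norm_num) ?_
    have := add_mem (add_mem hcon hx) (hV p)
    push_cast at this
    rwa [← hPd, sub_zero, sub_right_comm, sub_add_cancel, sub_add_cancel] at this
  have hDy : D y₁ = algebraMap k Φ κ * (3 * x₁ ^ 2 + 2 * ((0 : ℚ) : Φ) * x₁ + b) := by
    have h1 := hcv.derivation D
    rw [hD] at h1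
    have h2 : 2 * y₁ ≠ 0 := by simp [h.snd_ne_zero]
    apply mul_left_cancel₀ h2
    linear_combination h1
  have hadd := hcv.derivation_add hPq hxp hs1 (D := D) (c₁ := algebraMap k Φ κ) (c₂ := 0) hD
    (by rw [hPd, D.map_algebraMap]; ring) hDy (by rw [hQd, D.map_algebraMap]; ring)
  refine ⟨_, _, ⟨hcv.add hPq hxp hs1, ?_, ?_⟩, hX, by rw [hadd]; ring⟩
  · set X := s ^ 2 - ((0 : ℚ) : Φ) - x₁ - P with hXd
    set Y := -(y₁ + s * (X - x₁)) with hYd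
    have hXP : X ≠ P := by rintro h; rw [h] at hX; exact hX (hV p)
    set A := IntermediateField.adjoin k ({X, Y} : Set Φ) with hA
    have hXA : X ∈ A := IntermediateField.subset_adjoin _ _ (by simp)
    have hYA : Y ∈ A := IntermediateField.subset_adjoin _ _ (by simp)
    have hPA : P ∈ A := algebraMap_mem A p
    have hQA : Q ∈ A := algebraMap_mem A q₁
    have hsA : s ∈ A := by
      have : s = (-Y - Q) / (X - P) := by
        rw [eq_div_iff (sub_ne_zero.mpr hXP), hYd]
        linear_combination hs1
      rw [this]
      exact div_mem (sub_mem (neg_mem hYA) hQA) (sub_mem hXA hPA)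
    have hxA : x₁ ∈ A := by
      have : x₁ = s ^ 2 - X - P := by rw [hXd]; push_cast; ring
      rw [this]
      exact sub_mem (sub_mem (pow_mem hsA 2) hXA) hPA
    have hyA : y₁ ∈ A := by
      have : y₁ = Q + s * (x₁ - P) := by rw [hs1]; ring
      rw [this]
      exact add_mem hQA (mul_mem hsA (sub_mem hxA hPA))
    rw [eq_top_iff, ← h.top, IntermediateField.adjoin_le_iff]
    rintro z (rfl | hz)
    · exact hxA
    · rw [Set.mem_singleton_iff] at hz; subst hz; exact hyA
  · intro halg
    have h1 := minpoly.mem_range_of_degree_eq_one k _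
      (IsAlgClosed.degree_eq_one_of_irreducible k (minpoly.irreducible halg.isIntegral))
    obtain ⟨t, ht⟩ := h1
    exact hX (ht ▸ hV t)

/-- The multiplier of an automorphism of an elliptic function field without extra automorphisms. -/
theorem EllGen.sq_eq_one (hs : Sep 0 b c) (h₁ : EllGen k b c x₁ y₁) (h₂ : EllGen k b c x₂ y₂)
    (hb : b ≠ 0) (hc : c ≠ 0) {D : Derivation k Φ Φ} (hD : GoodDer D) {κ : k} (hD₁ : D x₁ = 2 * y₁)
    (hD₂ : D x₂ = 2 * algebraMap k Φ κ * y₂) : κ ^ 2 = 1 := by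
  have hcz := h₁.charZero
  obtain ⟨V, hV, hx₁⟩ : ∃ V : ValuationSubring Φ, Over k V ∧ x₁ ∉ V := by
    by_contra! hcon
    obtain ⟨t, rfl⟩ := mem_range_of_forall_mem hcon
    exact h₁.trans (isAlgebraic_algebraMap _)
  by_cases hx₂ : x₂ ∉ V
  · exact h₁.sq_eq_one_of_notMem h₂ hb hc hD hD₁ hD₂ hV hx₁ hx₂
  rw [not_not] at hx₂
  have hne : V ≠ ⊤ := by rintro rfl; exact hx₁ trivial
  obtain ⟨x, y, h₃, hx, hD₃⟩ := h₂.exists_translate hs hV hx₂ hne hD₂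
  exact h₁.sq_eq_one_of_notMem h₃ hb hc hD hD₁ hD₃ hV hx₁ hx

end FunctionField

end CremonaPlaces

namespace CremonaPlaces

section QuinticModel

variable {Φ : Type} [Field Φ] [CharZero Φ]

lemma quintic_to_curve {x₁ x₂ x₃ x₄ : Φ} (q0 : 1 + x₂ * x₃ - x₁ * x₄ = 0)
    (q1 : x₁ ^ 2 + x₃ * x₄ - x₂ = 0) (q2 : x₂ ^ 2 + x₄ - x₃ * x₁ = 0)
    (q3 : x₃ ^ 2 + x₁ - x₄ * x₂ = 0) (q4 : x₄ ^ 2 + x₁ * x₂ - x₃ = 0) :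
    ∃ x y : Φ, OnCurve 0 (-31/3) (-2501/108) x y ∧
      x₁ * (-90 * x ^ 2 - 150 * x + 482) = 36 * x ^ 2 + 18 * x * y + 159 * x - 84 * y + 652 ∧
      x₃ * (-90 * x ^ 2 - 150 * x + 482) = 18 * x ^ 2 + 18 * x * y - 267 * x + 114 * y - 235 ∧
      x₄ * (-90 * x ^ 2 - 150 * x + 482) = 36 * x ^ 2 - 18 * x * y + 159 * x + 84 * y + 652 := by
  obtain ⟨A, hA⟩ : ∃ A, A = 14 + 15 * x₁ + 5 * x₂ + 5 * x₃ + 15 * x₄ := ⟨_, rfl⟩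
  obtain ⟨B, hB⟩ : ∃ B, B = -68/3 - 7 * x₁ - 128/3 * (x₂ + x₃) - 7 * x₄ := ⟨_, rfl⟩
  obtain ⟨C, hC⟩ : ∃ C, C = 121/2 * (-x₁ - x₂ + x₃ + x₄) := ⟨_, rfl⟩
  obtain ⟨D, hD⟩ : ∃ D, D = -1381/9 + 92 * x₁ + 881/9 * (x₂ + x₃) + 92 * x₄ := ⟨_, rfl⟩
  obtain ⟨E, hE⟩ : ∃ E, E = 2299/6 * x₁ - 847/3 * x₂ + 847/3 * x₃ - 2299/6 * x₄ := ⟨_, rfl⟩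
  have hAD : A * D = B ^ 2 := by
    rw [hA, hB, hD]
    linear_combination -2662 * q0 + 1331 * q1 - 1331 * q2 - 1331 * q3 + 1331 * q4
  have hAE : A * E = B * C := by
    rw [hA, hB, hC, hE]
    linear_combination 5324 * q1 - 3993 * q2 + 3993 * q3 - 5324 * q4
  have hCC : C ^ 2 = B * D + (-31/3) * A * B + (-2501/108) * A ^ 2 := by
    rw [hA, hB, hC, hD]
    linear_combination -6655/3 * q0 + 25289/3 * q1 + 18634/3 * q2 + 18634/3 * q3 + 25289/3 * q4
  have hEC : E * C = D ^ 2 + (-31/3) * B ^ 2 + (-2501/108) * A * B := by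
    rw [hA, hB, hC, hD, hE]
    linear_combination -230263/9 * q0 - 302137/9 * q1 + 384659/18 * q2 + 384659/18 * q3 -
      302137/9 * q4
  have h0 : (23958 : Φ) = D * -90 + B * -150 + A * 482 := by rw [hA, hB, hD]; ring
  have h1 : 23958 * x₁ = D * 36 + E * 18 + B * 159 - C * 84 + A * 652 := by
    rw [hA, hB, hC, hD, hE]; ring
  have h3 : 23958 * x₃ = D * 18 + E * 18 - B * 267 + C * 114 - A * 235 := by
    rw [hA, hB, hC, hD, hE]; ring
  have h4 : 23958 * x₄ = D * 36 - E * 18 + B * 159 + C * 84 + A * 652 := by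
    rw [hA, hB, hC, hD, hE]; ring
  have hA0 : A ≠ 0 := by
    intro h
    rw [h] at hAD hCC hEC h0
    have hB0 : B = 0 := by
      have : B ^ 2 = 0 := by rw [← hAD]; ring
      exact pow_eq_zero_iff (by norm_num) |>.1 this
    rw [hB0] at hCC hEC h0
    have hC0 : C = 0 := by
      have : C ^ 2 = 0 := by rw [hCC]; ring
      exact pow_eq_zero_iff (by norm_num) |>.1 this
    rw [hC0] at hEC
    have hD0 : D = 0 := by
      have : D ^ 2 = 0 := by linear_combination -hEC
      exact pow_eq_zero_iff (by norm_num) |>.1 this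
    rw [hD0] at h0
    norm_num at h0
  have hD' : D = B ^ 2 / A := by rw [← hAD]; field_simp
  have hE' : E = B * C / A := by rw [← hAE]; field_simp
  have hN : (23958 : Φ) ≠ 0 := by norm_num
  refine ⟨B / A, C / A, ?_, ?_, ?_, ?_⟩
  · unfold OnCurve
    push_cast
    rw [hD'] at hCC
    field_simp at hCC ⊢
    linear_combination hCC
  all_goals
    apply mul_left_cancel₀ hN
    apply mul_left_cancel₀ hA0
  · have e : A * (23958 * (x₁ * (-90 * (B / A) ^ 2 - 150 * (B / A) + 482))) =
      (23958 * x₁) * (D * -90 + B * -150 + A * 482) := by rw [hD']; field_simp; ring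
    rw [e, ← h0, h1, hD', hE']
    field_simp
  · have e : A * (23958 * (x₃ * (-90 * (B / A) ^ 2 - 150 * (B / A) + 482))) =
      (23958 * x₃) * (D * -90 + B * -150 + A * 482) := by rw [hD']; field_simp; ring
    rw [e, ← h0, h3, hD', hE']
    field_simp
  · have e : A * (23958 * (x₄ * (-90 * (B / A) ^ 2 - 150 * (B / A) + 482))) =
      (23958 * x₄) * (D * -90 + B * -150 + A * 482) := by rw [hD']; field_simp; ring
    rw [e, ← h0, h4, hD', hE']
    field_simp

/-- The curve point `(x, y)` parametrizes the point `(ξ, ω)` of the isogenous curve together with a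
fifth root `w` of `gfun ξ ω`. -/
structure Param (x y ξ ω w : Φ) : Prop where
  curve : OnCurve 0 (-31/3) (-2501/108) x y
  p0_ne : -90 * x ^ 2 - 150 * x + 482 ≠ 0
  root : w * (-90 * x ^ 2 - 150 * x + 482) = 36 * x ^ 2 + 18 * x * y + 159 * x - 84 * y + 652
  xi : 3 * ξ * (-90 * x ^ 2 - 150 * x + 482) ^ 2 =
    972 * x ^ 5 - 12960 * x ^ 4 - 23220 * x ^ 3 - 145440 * x ^ 2 - 630660 * x - 1765508
  omega : ω * (-90 * x ^ 2 - 150 * x + 482) ^ 3 = y * (5832 * x ^ 6 + 29160 * x ^ 5 -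
    276048 * x ^ 4 + 3178872 * x ^ 3 + 13590288 * x ^ 2 + 58025736 * x + 55575368)

lemma exists_param {ξ ω w : Φ} (h : OnCurve 2 1 (1/4) ξ ω) (hw : w ^ 5 = gfun ξ ω) (hξ : ξ ≠ 0)
    (hξ' : ξ + 1 ≠ 0) (hg : gfun ξ ω ≠ 0) : ∃ x y : Φ, Param x y ξ ω w := by
  obtain ⟨Y, hY⟩ : ∃ Y, Y = ω - 1/2 - ξ := ⟨_, rfl⟩
  have hω : ω = Y + 1/2 + ξ := by rw [hY]; ring
  have hE : Y ^ 2 + 2 * Y * ξ + Y = ξ ^ 3 + ξ ^ 2 := by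
    unfold OnCurve at h
    push_cast at h
    rw [hω] at h
    linear_combination h
  have hw' : w ^ 5 = Y * (1 + ξ) - ξ ^ 2 := by rw [hw, gfun, hY]
  have hw0 : w ≠ 0 := by
    rintro rfl
    rw [← hw] at hg
    norm_num at hg
  have hY0 : Y ≠ 0 := by
    intro h0
    rw [h0] at hE
    have : ξ ^ 2 * (ξ + 1) = 0 := by linear_combination -hE
    simp [hξ, hξ'] at this
  clear hg hw h
  subst hω
  obtain ⟨x, y, hc, h1, h3, h4⟩ := quintic_to_curve (x₁ := w) (x₂ := -(ξ + 1) * w ^ 2 / Y)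
    (x₃ := Y / w ^ 2) (x₄ := -ξ / w) (by field_simp; ring)
    (by field_simp; linear_combination (Y + ξ + 1) * hw' + hE)
    (by field_simp; linear_combination (ξ + 1) ^ 2 * hw' + (-Y + ξ + 1) * hE)
    (by field_simp; linear_combination (Y - ξ * (ξ + 1)) * hw' + (Y - ξ) * hE)
    (by field_simp; linear_combination -(ξ + 1) * hw' - hE)
  have hp0 : -90 * x ^ 2 - 150 * x + 482 ≠ 0 := by
    intro h0
    rw [h0] at h1 h4
    have h2 : 72 * x ^ 2 + 318 * x + 1304 = 0 := by linear_combination -h1 - h4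
    have h3 : x = -128/15 := by linear_combination 5/990 * h2 + 4/990 * h0
    rw [h3] at h0
    norm_num at h0
  have hc' := hc
  unfold OnCurve at hc'
  push_cast at hc'
  refine ⟨x, y, hc, hp0, h1, ?_, ?_⟩
  · have e : 3 * ξ * (-90 * x ^ 2 - 150 * x + 482) ^ 2 = -3 * ((w * (-90 * x ^ 2 - 150 * x + 482)) *
      (-ξ / w * (-90 * x ^ 2 - 150 * x + 482))) := by field_simp
    rw [e, h1, h4]
    linear_combination 3 * (18 * x - 84) ^ 2 * hc'
  · have e : (Y + 1/2 + ξ) * (-90 * x ^ 2 - 150 * x + 482) ^ 3 =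
        (w * (-90 * x ^ 2 - 150 * x + 482)) ^ 2 * (Y / w ^ 2 * (-90 * x ^ 2 - 150 * x + 482)) -
        (-90 * x ^ 2 - 150 * x + 482) * ((w * (-90 * x ^ 2 - 150 * x + 482)) *
      (-ξ / w * (-90 * x ^ 2 - 150 * x + 482))) + (-90 * x ^ 2 - 150 * x + 482) ^ 3 / 2 := by
      field_simp
      ring
    rw [e, h1, h3, h4]
    linear_combination ((18 * x - 84) ^ 2 * (18 * x ^ 2 - 267 * x - 235) +
      2 * (36 * x ^ 2 + 159 * x + 652) * (18 * x - 84) * (18 * x + 114) +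
      (18 * x - 84) ^ 2 * (18 * x + 114) * y +
      (-90 * x ^ 2 - 150 * x + 482) * (18 * x - 84) ^ 2) * hc'

/-- The multiplier relation between the two models. -/
lemma Param.derivation {k : Type} [Field k] [Algebra k Φ] {x y ξ ω w : Φ} (h : Param x y ξ ω w)
    {D : Derivation k Φ Φ} {c : Φ} (hD : D x = 2 * c * y) : D ξ = -10 * c * ω := by
  have n (n : ℕ) [n.AtLeastTwo] : D (OfNat.ofNat n : Φ) = 0 := by
    have := D.map_natCast (OfNat.ofNat n)
    rwa [Nat.cast_ofNat] at this
  have h1 := congrArg D h.xi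
  simp only [map_add, map_sub, map_neg, D.leibniz, D.leibniz_pow, n, smul_eq_mul, nsmul_eq_mul,
    hD] at h1
  push_cast at h1
  have hp := h.p0_ne
  apply mul_left_cancel₀ (pow_ne_zero 3 hp)
  linear_combination ((-90 * x ^ 2 - 150 * x + 482) / 3) * h1 + 10 * c * h.omega -
    2 / 3 * (-180 * x - 150) * 2 * c * y * h.xi

end QuinticModel

end CremonaPlaces

namespace CremonaPlaces

section FunctionField

variable {k Φ : Type} [Field k] [Field Φ] [Algebra k Φ] [IsAlgClosed k] [CharZero k] {b c : ℚ}
  {x y : Φ}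

lemma EllGen.exists_residue_infty (h : EllGen k b c x y) {V : ValuationSubring Φ} (hV : Over k V)
    (hx : x ∉ V) {f : Φ} (hf : f ∈ V) : ∃ t : k, V.valuation (f - algebraMap k Φ t) < 1 := by
  obtain ⟨hW, hyV, -, -⟩ := h.curve.notMem hV hx
  have hy := lt_inv_of_notMem hyV
  obtain ⟨a, ha, d, hd, hd1, had⟩ := (h.frac_infty hV hx).1 f hf
  have hA : ∀ a ∈ Algebra.adjoin k ({y⁻¹, x / y} : Set Φ), a ∈ V :=
    adjoin_subset_of_over hV (by
      rintro z (rfl | hz)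
      · exact mem_of_lt hy
      · rw [Set.mem_singleton_iff] at hz; subst hz; exact mem_of_lt hW)
  have hres : ∀ a ∈ Algebra.adjoin k ({y⁻¹, x / y} : Set Φ), ∃ t : k,
      V.valuation (a - algebraMap k Φ t) < 1 := by
    intro a ha
    obtain ⟨t, a₁, h₁, a₂, h₂, e⟩ := adjoin_pair_decomp a ha
    refine ⟨t, ?_⟩
    rw [e]
    have : algebraMap k Φ t + (y⁻¹ * a₁ + x / y * a₂) - algebraMap k Φ t =
      y⁻¹ * a₁ + x / y * a₂ := by ring
    rw [this]; exact lt_add (lt_mul_right hy (hA _ h₁)) (lt_mul_right hW (hA _ h₂))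
  obtain ⟨t, ht⟩ := hres a ha
  obtain ⟨u, hu⟩ := hres d hd
  have hu0 : u ≠ 0 := by
    rintro rfl
    rw [map_zero, sub_zero] at hu
    exact hu.ne hd1
  refine ⟨t / u, ?_⟩
  have hd0 := ne_zero_of_eq hd1
  have hu0' : algebraMap k Φ u ≠ 0 := by simpa using hu0
  have e : f - algebraMap k Φ (t / u) = ((a - algebraMap k Φ t) -
      (d - algebraMap k Φ u) * algebraMap k Φ (t / u)) * d⁻¹ := by
    rw [map_div₀, ← had]; field_simp; ring
  rw [e]
  exact lt_mul_right (lt_sub ht (lt_mul_right hu (hV _))) (inv_mem_of_eq hd1)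

/-- An elliptic function field has no function with a single simple pole. -/
lemma EllGen.no_simple_pole (hs : Sep 0 b c) (h : EllGen k b c x y) {r : Φ}
    (hr : ∀ V : ValuationSubring Φ, Over k V → x ∈ V → r ∈ V)
    (hr' : ∀ V : ValuationSubring Φ, Over k V → x ∉ V → V.valuation (r * (x / y)) = 1) :
    False := by
  obtain ⟨V, hV, hx⟩ : ∃ V : ValuationSubring Φ, Over k V ∧ x ∉ V := by
    by_contra! hcon
    obtain ⟨t, rfl⟩ := mem_range_of_forall_mem hcon
    exact h.trans (isAlgebraic_algebraMap _)
  have huniq : ∀ V' : ValuationSubring Φ, Over k V' → x ∉ V' → V' = V := fun V' hV' hx' =>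
    le_antisymm (h.le_of_notMem hV' hV hx' hx) (h.le_of_notMem hV hV' hx hx')
  have hru := hr' V hV hx
  have hrq0 := ne_zero_of_eq hru
  have hr0 : r ≠ 0 := by rintro rfl; simp at hrq0
  have hq0 : x / y ≠ 0 := by intro h0; rw [h0] at hrq0; simp at hrq0
  have hrmem : r ∈ IntermediateField.adjoin k {r} := IntermediateField.mem_adjoin_simple_self _ _
  have key : ∀ n : ℕ, ∀ f : Φ, (∀ V' : ValuationSubring Φ, Over k V' → x ∈ V' → f ∈ V') →
      f * (x / y) ^ n ∈ V → f ∈ IntermediateField.adjoin k {r} := by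
    intro n
    induction n with
    | zero =>
      intro f hf hfV
      rw [pow_zero, mul_one] at hfV
      obtain ⟨t, rfl⟩ := mem_range_of_forall_mem (f := f) (fun V' hV' => by
        by_cases hx' : x ∈ V'
        · exact hf V' hV' hx'
        · rw [huniq V' hV' hx']; exact hfV)
      exact (IntermediateField.adjoin k {r}).algebraMap_mem t
    | succ n ih =>
      intro f hf hfV
      have hu := eq_pow (n := n + 1) hru
      obtain ⟨t, ht⟩ := h.exists_residue_infty hV hx (mul_mem hfV (inv_mem_of_eq hu))
      obtain ⟨g, hg, hgq⟩ := (h.frac_infty hV hx).2 _ ht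
      have hf' := ih (f - algebraMap k Φ t * r ^ (n + 1)) (fun V' hV' hx' =>
        sub_mem (hf V' hV' hx') (mul_mem (hV' t) (pow_mem (hr V' hV' hx') _))) (by
        have e : (f - algebraMap k Φ t * r ^ (n + 1)) * (x / y) ^ n =
            g * (r * (x / y)) ^ (n + 1) := by
          apply mul_left_cancel₀ hq0
          conv_rhs => rw [← mul_assoc (x / y) g, ← hgq, sub_mul,
            mul_assoc _ _⁻¹, inv_mul_cancel₀ (ne_zero_of_eq hu)]
          ring
        rw [e]
        exact mul_mem hg (mem_of_eq hu))
      have := add_mem hf' (mul_mem ((IntermediateField.adjoin k {r}).algebraMap_mem t)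
        (pow_mem hrmem (n + 1)))
      rwa [sub_add_cancel] at this
  have hx0 := notMem_ne_zero hx
  obtain ⟨hW, hyV, e, hU⟩ := h.curve.notMem hV hx
  have hy0 := notMem_ne_zero hyV
  have hxq : x * (x / y) ^ 2 ∈ V := by
    have : x * (x / y) ^ 2 = (1 + ((0 : ℚ) : Φ) * x⁻¹ + b * x⁻¹ ^ 2 + c * x⁻¹ ^ 3)⁻¹ := by
      apply mul_right_cancel₀ (ne_zero_of_eq hU)
      rw [inv_mul_cancel₀ (ne_zero_of_eq hU), mul_assoc, ← e, mul_inv_cancel₀ hx0]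
    rw [this]; exact inv_mem_of_eq hU
  have hx1 := key 2 x (fun _ _ h => h) hxq
  have hy1 := key 3 y (fun V' hV' h' => h.curve.mem hV' h') (by
    have : y * (x / y) ^ 3 = x * (x / y) ^ 2 := by field_simp
    rwa [this])
  have htop : IntermediateField.adjoin k {r} = ⊤ := by
    rw [eq_top_iff, ← h.top, IntermediateField.adjoin_le_iff]
    rintro z (rfl | hz)
    · exact hx1
    · rw [Set.mem_singleton_iff] at hz; subst hz; exact hy1
  refine h.trans ?_
  by_cases hrt : Transcendental k r
  · obtain ⟨t, rfl⟩ := h.curve.mem_range_of_simple hs hrt htop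
    exact isAlgebraic_algebraMap t
  · rw [Transcendental, not_not] at hrt
    have := IntermediateField.isAlgebraic_adjoin_simple hrt.isIntegral
    rw [htop] at this
    exact (this.isAlgebraic ⟨x, IntermediateField.mem_top⟩).algebraMap (A := Φ)

lemma val_eq_one_of_pow {V : ValuationSubring Φ} {a : Φ} {n : ℕ} (hn : n ≠ 0)
    (h : V.valuation (a ^ n) = 1) : V.valuation a = 1 :=
  (lt_or_eq (mem_of_pow_mem hn (mem_of_eq h))).resolve_left fun hl => (lt_pow hl hn).ne h

lemma sep_isogenous_short : Sep 0 (-1/3) (19/108) :=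
  ⟨96/11, 76/11, -32/11, -76/33, 64/99, fun F _ _ X => by push_cast; field_simp; ring⟩

/-- `gfun` is not a fifth power on the generic elliptic curve. -/
lemma not_fifth_power {ξ ω : Φ} (hc : OnCurve 2 1 (1/4) ξ ω) (hξ : Transcendental k ξ)
    (htop : IntermediateField.adjoin k ({ξ, ω} : Set Φ) = ⊤) (r : Φ) : r ^ 5 ≠ gfun ξ ω := by
  intro hr
  have hcz := charZero_of_base k Φ
  obtain ⟨x, hx⟩ : ∃ x, x = ξ + 2/3 := ⟨_, rfl⟩
  have hξx : ξ = x - 2/3 := by rw [hx]; ring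
  have hR : ∀ T : IntermediateField k Φ, (2/3 : Φ) ∈ T := fun T => by
    have := SubfieldClass.ratCast_mem T (2/3); push_cast at this; exact this
  have hgen : EllGen k (-1/3) (19/108) x ω := by
    refine ⟨?_, ?_, fun h => hξ ?_⟩
    · unfold OnCurve at hc ⊢
      push_cast at hc ⊢
      rw [hc, hξx]; ring
    · rw [eq_top_iff, ← htop, IntermediateField.adjoin_le_iff]
      have h1 : x ∈ IntermediateField.adjoin k ({x, ω} : Set Φ) :=
        IntermediateField.subset_adjoin _ _ (by simp)
      rintro z (rfl | hz)
      · rw [hξx]; exact sub_mem h1 (hR _)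
      · rw [Set.mem_singleton_iff] at hz; subst hz
        exact IntermediateField.subset_adjoin _ _ (by simp)
    · rw [hξx]
      refine h.sub ?_
      have : (2/3 : Φ) = algebraMap k Φ (2/3) := by rw [map_div₀, map_ofNat, map_ofNat]
      rw [this]; exact isAlgebraic_algebraMap _
  refine hgen.no_simple_pole (r := r) sep_isogenous_short (fun V hV hxV => ?_)
    (fun V hV hxV => ?_)
  all_goals
    have hr' := ratCast_mem (k := k) hV
    have hhalf : (1/2 : Φ) ∈ V := by have := hr' (1/2); push_cast at this; exact this
    have h23 : (2/3 : Φ) ∈ V := by have := hr' (2/3); push_cast at this; exact this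
    have h13 : (1/3 : Φ) ∈ V := by have := hr' (1/3); push_cast at this; exact this
  · have hξV : ξ ∈ V := by rw [hξx]; exact sub_mem hxV h23
    have hω := hc.mem hV hξV
    refine mem_of_pow_mem (n := 5) (by norm_num) ?_
    rw [hr]
    exact sub_mem (mul_mem (sub_mem (sub_mem hω hhalf) hξV) (add_mem (one_mem _) hξV))
      (pow_mem hξV 2)
  · obtain ⟨hW, hωV, e, hU⟩ := hgen.curve.notMem hV hxV
    have hx0 := notMem_ne_zero hxV
    have hω0 := notMem_ne_zero hωV
    have hZ := lt_inv_of_notMem hxV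
    have hT := lt_inv_of_notMem hωV
    refine val_eq_one_of_pow (n := 5) (by norm_num) ?_
    have hu1 : V.valuation (x * (x / ω) ^ 2) = 1 := by
      have : x * (x / ω) ^ 2 * (1 + ((0 : ℚ) : Φ) * x⁻¹ + ((-1/3 : ℚ) : Φ) * x⁻¹ ^ 2 +
          ((19/108 : ℚ) : Φ) * x⁻¹ ^ 3) = 1 := by
        rw [mul_assoc, ← e, mul_inv_cancel₀ hx0]
      have h2 := congrArg V.valuation this
      rwa [map_mul, hU, mul_one, map_one] at h2
    have e2 : (r * (x / ω)) ^ 5 = (x * (x / ω) ^ 2) ^ 2 * (1 + (x⁻¹ * (1/3) -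
        (ω⁻¹ * (1/2) + x / ω - ω⁻¹ * (2/3)) * (1 + x⁻¹ * (1/3)) -
        (x / ω - ω⁻¹ * (2/3)) * (1 - x⁻¹ * (2/3)))) := by
      rw [mul_pow, hr, gfun, hξx]
      field_simp
      ring
    rw [e2]
    refine eq_mul (eq_pow hu1 2) (eq_add_lt (map_one _) ?_)
    have hZV := mem_of_lt hZ
    exact lt_sub (lt_sub (lt_mul_right hZ h13) (lt_mul_right
      (lt_sub (lt_add (lt_mul_right hT hhalf) hW) (lt_mul_right hT h23))
      (add_mem (one_mem _) (mul_mem hZV h13)))) (lt_mul_right (lt_sub hW (lt_mul_right hT h23))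
      (sub_mem (one_mem _) (mul_mem hZV h23)))

end FunctionField

end CremonaPlaces

namespace CremonaPlaces

section Omega

variable {Ω : Type} [Field Ω] [Algebra ℂ Ω]

lemma mem_of_mem_adjoin_transcendental {K : IntermediateField ℂ Ω} {s e : Ω}
    (hs : s ∉ acl (K : Set Ω)) (he : e ∈ acl (K : Set Ω))
    (h : e ∈ IntermediateField.adjoin ℂ ((K : Set Ω) ∪ {s})) : e ∈ K := by
  rw [← IntermediateField.restrictScalars_adjoin, IntermediateField.mem_restrictScalars,
    IntermediateField.mem_adjoin_simple_iff] at h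
  obtain ⟨r, q, hrq⟩ := h
  have hKk : K ≤ acl (K : Set Ω) := subset_acl _
  by_cases hq : Polynomial.aeval s q = 0
  · rw [hrq, hq, div_zero]; exact zero_mem _
  have hq0 : q ≠ 0 := by rintro rfl; simp at hq
  let φ : K →+* acl (K : Set Ω) := (IntermediateField.inclusion hKk : K →ₐ[ℂ] acl (K : Set Ω))
  have hφ : (algebraMap (acl (K : Set Ω)) Ω).comp φ = algebraMap K Ω := by ext; rfl
  let P : Polynomial (acl (K : Set Ω)) := r.map φ - Polynomial.C ⟨e, he⟩ * q.map φ
  have hP : Polynomial.aeval s P = 0 := by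
    simp only [P, map_sub, map_mul, Polynomial.aeval_def, Polynomial.eval₂_C,
      Polynomial.eval₂_map, hφ]
    rw [← Polynomial.aeval_def, ← Polynomial.aeval_def]
    rw [eq_div_iff hq] at hrq
    rw [← hrq, sub_eq_zero]; rfl
  have hP0 : P = 0 := by
    by_contra h0
    exact hs (by have := mem_acl_of_root P h0 hP; exact this)
  have hc := congrArg (fun p => ((p.coeff q.natDegree : acl (K : Set Ω)) : Ω)) hP0
  simp only [P, Polynomial.coeff_sub, Polynomial.coeff_map, Polynomial.coeff_C_mul,
    Polynomial.coeff_zero] at hc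
  have hlc : (q.coeff q.natDegree : Ω) ≠ 0 := by
    simpa using hq0
  have hc' : (r.coeff q.natDegree : Ω) - e * (q.coeff q.natDegree : Ω) = 0 := hc
  have : e = (r.coeff q.natDegree : Ω) / (q.coeff q.natDegree : Ω) := by
    rw [eq_div_iff hlc]; linear_combination -hc'
  rw [this]
  exact div_mem (SetLike.coe_mem _) (SetLike.coe_mem _)

lemma kummer_descent {F F' : IntermediateField ℂ Ω} (hF : F ≤ F') {y e : Ω} {p : ℕ} (hp : p.Prime)
    (hy : y ^ p ∈ F) (hn : ∀ b ∈ F', b ^ p ≠ y ^ p) (he' : e ∈ F')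
    (h : e ∈ IntermediateField.adjoin ℂ ((F : Set Ω) ∪ {y})) : e ∈ F := by
  rw [← IntermediateField.restrictScalars_adjoin, IntermediateField.mem_restrictScalars] at h
  let φ : F →+* F' := (IntermediateField.inclusion hF : F →ₐ[ℂ] F')
  have hφ : (algebraMap F' Ω).comp φ = algebraMap F Ω := by ext; rfl
  let g : Polynomial F := Polynomial.X ^ p - Polynomial.C ⟨y ^ p, hy⟩
  have hgm : g.Monic := Polynomial.monic_X_pow_sub_C _ hp.ne_zero
  have hgy : Polynomial.aeval y g = 0 := by simp [g]
  have hintg : IsIntegral F y := ⟨g, hgm, hgy⟩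
  have h2 : e ∈ (IntermediateField.adjoin F {y}).toSubalgebra := h
  rw [IntermediateField.adjoin_simple_toSubalgebra_of_isAlgebraic hintg.isAlgebraic,
    Algebra.adjoin_singleton_eq_range_aeval] at h2
  obtain ⟨f, hf⟩ := h2
  replace hf : Polynomial.aeval y f = e := hf
  have hfm : Polynomial.aeval y (f %ₘ g) = e := by
    rw [← hf, Polynomial.aeval_modByMonic_eq_self_of_root hgy]
  have hirr : Irreducible (g.map φ) := by
    simp only [g, Polynomial.map_sub, Polynomial.map_pow, Polynomial.map_X, Polynomial.map_C]
    refine X_pow_sub_C_irreducible_of_prime hp fun b hb => hn b b.2 ?_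
    exact congrArg Subtype.val hb
  have hgy' : Polynomial.aeval y (g.map φ) = 0 := by
    rw [Polynomial.aeval_def, Polynomial.eval₂_map, hφ, ← Polynomial.aeval_def, hgy]
  have hmin := minpoly.eq_of_irreducible_of_monic hirr hgy' (hgm.map φ)
  let P : Polynomial F' := (f %ₘ g).map φ - Polynomial.C ⟨e, he'⟩
  have hP : Polynomial.aeval y P = 0 := by
    simp only [P, map_sub, Polynomial.aeval_def, Polynomial.eval₂_C, Polynomial.eval₂_map, hφ]
    rw [← Polynomial.aeval_def, hfm, sub_eq_zero]; rfl
  have hgd : (g.map φ).degree = p := by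
    rw [Polynomial.degree_map]
    exact Polynomial.degree_X_pow_sub_C hp.pos _
  have hP0 : P = 0 := by
    refine Polynomial.eq_zero_of_dvd_of_degree_lt (hmin ▸ minpoly.dvd F' y hP) ?_
    rw [hgd]
    refine lt_of_le_of_lt (Polynomial.degree_sub_le _ _) (max_lt ?_ ?_)
    · rw [Polynomial.degree_map]
      have := Polynomial.degree_modByMonic_lt f hgm
      rwa [Polynomial.degree_X_pow_sub_C hp.pos] at this
    · exact lt_of_le_of_lt Polynomial.degree_C_le (by exact_mod_cast hp.pos)
  have hc := congrArg (fun p => ((p.coeff 0 : F') : Ω)) hP0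
  simp only [P, Polynomial.coeff_sub, Polynomial.coeff_map, Polynomial.coeff_C_zero,
    Polynomial.coeff_zero] at hc
  have hc' : ((f %ₘ g).coeff 0 : Ω) - e = 0 := hc
  rw [← sub_eq_zero.mp hc']
  exact SetLike.coe_mem _

lemma ratCast_mem_field (T : IntermediateField ℂ Ω) (q : ℚ) : (q : Ω) ∈ T :=
  SubfieldClass.ratCast_mem T q

lemma OnCurve.sq_mem {T : IntermediateField ℂ Ω} {a b c : ℚ} {ξ ω : Ω} (h : OnCurve a b c ξ ω)
    (hξ : ξ ∈ T) : ω ^ 2 ∈ T := by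
  rw [show ω ^ 2 = _ from h]
  have hr := ratCast_mem_field T
  exact add_mem (add_mem (add_mem (pow_mem hξ 3) (mul_mem (hr a) (pow_mem hξ 2)))
    (mul_mem (hr b) hξ)) (hr c)

lemma gfun_mem {T : IntermediateField ℂ Ω} {ξ ω : Ω} (hξ : ξ ∈ T) (hω : ω ∈ T) :
    gfun ξ ω ∈ T := by
  have hhalf : (1/2 : Ω) ∈ T := by
    have := charZero_omega Ω
    have := ratCast_mem_field T (1/2); push_cast at this; exact this
  exact sub_mem (mul_mem (sub_mem (sub_mem hω hhalf) hξ) (add_mem (one_mem _) hξ)) (pow_mem hξ 2)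

lemma transcendental_of_notMem_acl {S : Set Ω} {x : Ω} (h : x ∉ acl S) :
    Transcendental (acl S) x := fun h' => h (mem_acl_of_isAlgebraic h')

variable {m e : ℕ} {τ : ℕ → Ω} {ξ ω y : Ω}

lemma hseq_mem_adjoin (m : ℕ) (τ : ℕ → Ω) :
    hseq τ m ∈ IntermediateField.adjoin ℂ (τ '' Set.Iio m) :=
  hseq_mem (IntermediateField.adjoin ℂ (τ '' Set.Iio m)).toSubring
    fun i hi => IntermediateField.subset_adjoin _ _ ⟨i, hi, rfl⟩

/-- The field generated by `τ` is algebraically closed in the function field of the twist. -/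
lemma Twist.mem_adjoin [IsAlgClosed Ω] (h : Twist m e τ ξ ω y) {x : Ω}
    (hx : x ∈ twistField m τ ξ ω y) (hx' : x ∈ acl (τ '' Set.Iio m)) :
    x ∈ IntermediateField.adjoin ℂ (τ '' Set.Iio m) := by
  set K := IntermediateField.adjoin ℂ (τ '' Set.Iio m) with hK
  set k := acl (τ '' Set.Iio m) with hk
  have hcz := charZero_omega Ω
  have hKk : K ≤ k := adjoin_le_acl _
  have haclK : acl (K : Set Ω) = k := acl_adjoin _
  let F₁ := IntermediateField.adjoin ℂ ((K : Set Ω) ∪ {ξ})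
  let F₁' := IntermediateField.adjoin ℂ ((k : Set Ω) ∪ {ξ})
  let F₂ := IntermediateField.adjoin ℂ ((F₁ : Set Ω) ∪ {ω})
  let F₂' := IntermediateField.adjoin ℂ ((F₁' : Set Ω) ∪ {ω})
  have h1 : F₁ ≤ F₁' := IntermediateField.adjoin.mono _ _ _ (Set.union_subset_union_left _ hKk)
  have h2 : F₂ ≤ F₂' := IntermediateField.adjoin.mono _ _ _ (Set.union_subset_union_left _ h1)
  have hkF1 : k ≤ F₁' := Set.subset_union_left.trans (IntermediateField.subset_adjoin _ _)
  have hKF1 : K ≤ F₁ := Set.subset_union_left.trans (IntermediateField.subset_adjoin _ _)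
  have hF12 : F₁ ≤ F₂ := Set.subset_union_left.trans (IntermediateField.subset_adjoin _ _)
  have hF12' : F₁' ≤ F₂' := Set.subset_union_left.trans (IntermediateField.subset_adjoin _ _)
  have hξ1 : ξ ∈ F₁ := IntermediateField.subset_adjoin _ _ (by simp)
  have hω2 : ω ∈ F₂ := IntermediateField.subset_adjoin _ _ (by simp)
  have hyF : y ^ 5 ∈ F₂ := by
    rw [h.root]
    exact mul_mem (pow_mem (hF12 (hKF1 (hseq_mem_adjoin m τ))) _) (gfun_mem (hF12 hξ1) hω2)
  have hxM : x ∈ IntermediateField.adjoin ℂ ((F₂ : Set Ω) ∪ {y}) := by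
    refine (IntermediateField.adjoin_le_iff.mpr ?_ : twistField m τ ξ ω y ≤ _) hx
    have hF2 : F₂ ≤ IntermediateField.adjoin ℂ ((F₂ : Set Ω) ∪ {y}) :=
      Set.subset_union_left.trans (IntermediateField.subset_adjoin _ _)
    rintro z (⟨i, hi, rfl⟩ | hz)
    · exact hF2 (hF12 (hKF1 (IntermediateField.subset_adjoin _ _ ⟨i, hi, rfl⟩)))
    · simp only [Set.mem_insert_iff, Set.mem_singleton_iff] at hz
      rcases hz with rfl | rfl | rfl
      · exact hF2 (hF12 hξ1)
      · exact hF2 hω2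
      · exact IntermediateField.subset_adjoin _ _ (by simp)
  have hckz : CharZero k := charZero_of_base ℂ _
  have hac : IsAlgClosed k := acl_isAlgClosed _
  have hξt : Transcendental k ξ := transcendental_of_notMem_acl h.generic
  have hx2 : x ∈ F₂ := by
    refine kummer_descent h2 Nat.prime_five hyF ?_ (hF12' (hkF1 hx')) hxM
    intro r hr hry
    obtain ⟨z, hz⟩ := IsAlgClosed.exists_pow_nat_eq
      (⟨hseq τ m ^ e, pow_mem (hKk (hseq_mem_adjoin m τ)) _⟩ : k) (n := 5) (by norm_num)
    have hz' : (z : Ω) ^ 5 = hseq τ m ^ e := congrArg Subtype.val hz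
    let E : IntermediateField k Ω := IntermediateField.adjoin k {ξ, ω}
    have hξE : ξ ∈ E := IntermediateField.subset_adjoin _ _ (by simp)
    have hωE : ω ∈ E := IntermediateField.subset_adjoin _ _ (by simp)
    have hF2E : F₂' ≤ E.restrictScalars ℂ := by
      rw [IntermediateField.adjoin_le_iff]
      rintro a (ha | rfl)
      · refine (?_ : F₁' ≤ E.restrictScalars ℂ) ha
        rw [IntermediateField.adjoin_le_iff]
        rintro a (ha | rfl)
        · exact E.algebraMap_mem ⟨a, ha⟩
        · exact hξE
      · exact hωE
    refine not_fifth_power (k := k) (Φ := E) (ξ := ⟨ξ, hξE⟩) (ω := ⟨ω, hωE⟩)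
      (h.curve.of_map (algebraMap E Ω)) (fun hal => hξt ?_) ?_
      (⟨r, hF2E hr⟩ / algebraMap k E z) ?_
    · exact (isAlgebraic_algebraMap_iff (algebraMap E Ω).injective).mpr hal
    · refine Eq.trans ?_ (adjoin_val_eq_top (k := k) ({ξ, ω} : Set Ω))
      congr 1
      ext a; simp [E, Subtype.ext_iff]
    · have hz0 : (z : Ω) ≠ 0 := by
        rintro h0
        rw [h0, zero_pow (by norm_num)] at hz'
        exact pow_ne_zero e (hseq_ne_zero h.indep le_rfl) hz'.symm
      apply Subtype.ext
      have h1 := map_gfun (E.val : E →+* Ω) ⟨ξ, hξE⟩ ⟨ω, hωE⟩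
      refine Eq.trans ?_ h1.symm
      change (r / (z : Ω)) ^ 5 = gfun ξ ω
      rw [div_pow, hry, hz', h.root, ← hz']
      field_simp
  have hx1 : x ∈ F₁ := by
    refine kummer_descent h1 Nat.prime_two (h.curve.sq_mem hξ1) ?_ (hkF1 hx') hx2
    intro r hr hry
    let E : IntermediateField k Ω := IntermediateField.adjoin k {ξ}
    have hξE : ξ ∈ E := IntermediateField.subset_adjoin _ _ (by simp)
    have hF1E : F₁' ≤ E.restrictScalars ℂ := by
      rw [IntermediateField.adjoin_le_iff]
      rintro a (ha | rfl)
      · exact E.algebraMap_mem ⟨a, ha⟩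
      · exact hξE
    have hc : OnCurve 2 1 (1/4) ξ r := by
      unfold OnCurve; rw [hry]; exact h.curve
    obtain ⟨c, hc⟩ := OnCurve.mem_range_of_simple (k := k) (Φ := E) (X := ⟨ξ, hξE⟩)
      (Y := ⟨r, hF1E hr⟩) (u := ⟨ξ, hξE⟩) (hc.of_map (algebraMap E Ω)) sep_isogenous
      (fun hal => hξt ((isAlgebraic_algebraMap_iff (algebraMap E Ω).injective).mpr hal)) (by
        refine Eq.trans ?_ (adjoin_val_eq_top (k := k) ({ξ} : Set Ω))
        congr 1
        ext a; simp [E, Subtype.ext_iff])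
    refine h.generic ?_
    have : ξ = c := (congrArg Subtype.val hc).symm
    rw [this]; exact c.2
  exact mem_of_mem_adjoin_transcendental (haclK ▸ h.generic) (haclK ▸ hx') hx1

end Omega

end CremonaPlaces

namespace CremonaPlaces

section Omega

variable {Ω : Type} [Field Ω] [Algebra ℂ Ω]

variable {m e : ℕ} {τ : ℕ → Ω} {ξ ω y : Ω}

lemma Param.mem_of_mem {k Φ : Type} [Field k] [Field Φ] [Algebra k Φ] [CharZero Φ]
    {x y ξ ω w : Φ} (h : Param x y ξ ω w) (T : IntermediateField k Φ) (hx : x ∈ T) (hy : y ∈ T) :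
    ξ ∈ T ∧ ω ∈ T ∧ w ∈ T := by
  have hn : ∀ n : ℕ, (OfNat.ofNat (n + 2) : Φ) ∈ T := fun n => natCast_mem T (n + 2)
  have hp : -90 * x ^ 2 - 150 * x + 482 ∈ T := by
    refine add_mem (sub_mem (mul_mem (neg_mem (hn 88)) (pow_mem hx 2)) (mul_mem (hn 148) hx)) (hn 480)
  refine ⟨?_, ?_, ?_⟩
  · have e : ξ = (972 * x ^ 5 - 12960 * x ^ 4 - 23220 * x ^ 3 - 145440 * x ^ 2 - 630660 * x -
        1765508) / (3 * (-90 * x ^ 2 - 150 * x + 482) ^ 2) := by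
      rw [eq_div_iff (mul_ne_zero (by norm_num) (pow_ne_zero _ h.p0_ne))]
      linear_combination h.xi
    rw [e]
    refine div_mem (sub_mem (sub_mem (sub_mem (sub_mem (sub_mem (mul_mem (hn 970) (pow_mem hx _))
      (mul_mem (hn 12958) (pow_mem hx _))) (mul_mem (hn 23218) (pow_mem hx _)))
      (mul_mem (hn 145438) (pow_mem hx _))) (mul_mem (hn 630658) hx)) (hn 1765506))
      (mul_mem (hn 1) (pow_mem hp 2))
  · have e : ω = y * (5832 * x ^ 6 + 29160 * x ^ 5 - 276048 * x ^ 4 + 3178872 * x ^ 3 +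
        13590288 * x ^ 2 + 58025736 * x + 55575368) / (-90 * x ^ 2 - 150 * x + 482) ^ 3 := by
      rw [eq_div_iff (pow_ne_zero _ h.p0_ne)]; exact h.omega
    rw [e]
    refine div_mem (mul_mem hy (add_mem (add_mem (add_mem (add_mem (sub_mem (add_mem
      (mul_mem (hn 5830) (pow_mem hx _)) (mul_mem (hn 29158) (pow_mem hx _)))
      (mul_mem (hn 276046) (pow_mem hx _))) (mul_mem (hn 3178870) (pow_mem hx _)))
      (mul_mem (hn 13590286) (pow_mem hx _))) (mul_mem (hn 58025734) hx)) (hn 55575366)))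
      (pow_mem hp 3)
  · have e : w = (36 * x ^ 2 + 18 * x * y + 159 * x - 84 * y + 652) /
        (-90 * x ^ 2 - 150 * x + 482) := by
      rw [eq_div_iff h.p0_ne]; exact h.root
    rw [e]
    exact div_mem (add_mem (sub_mem (add_mem (add_mem (mul_mem (hn 34) (pow_mem hx _))
      (mul_mem (mul_mem (hn 16) hx) hy)) (mul_mem (hn 157) hx)) (mul_mem (hn 82) hy)) (hn 650)) hp

lemma Twist.exists_ellGen [IsAlgClosed Ω] (h : Twist m e τ ξ ω y) {S : Set Ω}
    (hS : acl S = acl (τ '' Set.Iio m)) {M : IntermediateField ℂ Ω}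
    (hM : twistField m τ ξ ω y = M)
    (hξ : ξ ∈ IntermediateField.adjoin (acl S) (M : Set Ω))
    (hω : ω ∈ IntermediateField.adjoin (acl S) (M : Set Ω)) :
    ∃ x y w : IntermediateField.adjoin (acl S) (M : Set Ω),
      EllGen (acl S) (-31/3) (-2501/108) x y ∧ Param x y ⟨ξ, hξ⟩ ⟨ω, hω⟩ w := by
  have hcz : CharZero (acl S) := charZero_of_base ℂ _
  have hac : IsAlgClosed (acl S) := acl_isAlgClosed _
  set Φ := IntermediateField.adjoin (acl S) (M : Set Ω) with hΦ
  have hcz' : CharZero Φ := charZero_of_base (acl S) _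
  have hτS : ∀ i < m, τ i ∈ acl S := fun i hi => hS ▸ subset_acl _ ⟨i, hi, rfl⟩
  have hhS : hseq τ m ∈ acl S := hseq_mem (acl S).toSubring hτS
  have hyΦ : y ∈ Φ := IntermediateField.subset_adjoin _ _ (hM ▸ y_mem_twistField)
  obtain ⟨z, hz⟩ := IsAlgClosed.exists_pow_nat_eq
      (⟨hseq τ m ^ e, pow_mem hhS _⟩ : acl S) (n := 5) (by norm_num)
  have hz' : (z : Ω) ^ 5 = hseq τ m ^ e := congrArg Subtype.val hz
  have hz0 : (z : Ω) ≠ 0 := by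
    rintro h0
    rw [h0, zero_pow (by norm_num)] at hz'
    exact pow_ne_zero e (hseq_ne_zero h.indep le_rfl) hz'.symm
  have hgf : ((gfun (⟨ξ, hξ⟩ : Φ) ⟨ω, hω⟩ : Φ) : Ω) = gfun ξ ω :=
    map_gfun (Φ.val : Φ →+* Ω) ⟨ξ, hξ⟩ ⟨ω, hω⟩
  have hξS : ξ ∉ acl S := hS ▸ h.generic
  obtain ⟨x, v, hp⟩ := exists_param (ξ := (⟨ξ, hξ⟩ : Φ)) (ω := ⟨ω, hω⟩)
    (w := ⟨y, hyΦ⟩ / algebraMap _ Φ z) (h.curve.of_map (algebraMap Φ Ω)) (by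
      apply Subtype.ext
      rw [hgf]
      change (y / (z : Ω)) ^ 5 = gfun ξ ω
      rw [div_pow, hz', h.root, ← hz']
      field_simp)
    (fun h0 => h.xi_ne_zero (congrArg Subtype.val h0))
    (fun h0 => hξS (by
      have : ξ + 1 = 0 := congrArg Subtype.val h0
      rw [eq_neg_of_add_eq_zero_left this]
      exact neg_mem (one_mem _)))
    (fun h0 => h.gfun_ne_zero (by rw [← hgf, h0]; rfl))
  refine ⟨x, v, _, ⟨hp.curve, ?_, ?_⟩, hp⟩
  · set T := IntermediateField.adjoin (acl S) ({x, v} : Set Φ) with hT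
    obtain ⟨h1, h2, h3⟩ := hp.mem_of_mem T (IntermediateField.subset_adjoin _ _ (by simp))
      (IntermediateField.subset_adjoin _ _ (by simp))
    have h4 : (⟨y, hyΦ⟩ : Φ) ∈ T := by
      have := mul_mem h3 (T.algebraMap_mem z)
      rwa [div_mul_cancel₀] at this
      intro h0
      exact hz0 (congrArg Subtype.val h0)
    rw [eq_top_iff, ← adjoin_val_eq_top (k := acl S) (M : Set Ω), IntermediateField.adjoin_le_iff]
    have hMT : M ≤ (T.map Φ.val).restrictScalars ℂ := by
      rw [← hM, twistField, IntermediateField.adjoin_le_iff]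
      rintro a (⟨i, hi, rfl⟩ | ha)
      · exact (T.map Φ.val).algebraMap_mem ⟨τ i, hτS i hi⟩
      · simp only [Set.mem_insert_iff, Set.mem_singleton_iff] at ha
        rcases ha with rfl | rfl | rfl
        · exact ⟨_, h1, rfl⟩
        · exact ⟨_, h2, rfl⟩
        · exact ⟨_, h4, rfl⟩
    intro a ha
    obtain ⟨b, hb, hba⟩ := hMT ha
    rwa [← Subtype.ext hba]
  · by_contra hal
    rw [Transcendental, not_not] at hal
    have hxr : x ∈ (algebraMap (acl S) Φ).range := by
      have := mem_acl_of_isAlgebraic (S := S) (x := (x : Ω)) (hal.algebraMap (A := Ω))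
      exact ⟨⟨x, this⟩, rfl⟩
    have hvr := hp.curve.snd_mem_range hxr
    obtain ⟨h1, -, -⟩ := hp.mem_of_mem (⊥ : IntermediateField (acl S) Φ)
      (IntermediateField.mem_bot.mpr hxr) (IntermediateField.mem_bot.mpr hvr)
    obtain ⟨c, hc⟩ := IntermediateField.mem_bot.mp h1
    refine hξS ?_
    have : ξ = c := (congrArg Subtype.val hc).symm
    rw [this]; exact c.2

/-- The parameters of any twist presentation are algebraic over those of any other. -/
lemma Twist.tau_mem_acl [IsAlgClosed Ω] (h : Twist m e τ ξ ω y) {e' : ℕ} {τ' : ℕ → Ω}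
    {ξ' ω' y' : Ω} (h' : Twist m e' τ' ξ' ω' y') (he : e' = 1 ∨ e' = 2)
    (hM : twistField m τ' ξ' ω' y' = twistField m τ ξ ω y) :
    ∀ i < m, τ' i ∈ acl (τ '' Set.Iio m) := by
  set S := τ '' Set.Iio m with hS
  have hcz : CharZero (acl S) := charZero_of_base ℂ _
  have hac : IsAlgClosed (acl S) := acl_isAlgClosed _
  have hsub := IntermediateField.subset_adjoin (acl S) (twistField m τ ξ ω y : Set Ω)
  obtain ⟨x, v, w, hE, -⟩ := h.exists_ellGen (S := S) rfl rfl (hsub xi_mem_twistField)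
    (hsub omega_mem_twistField)
  obtain ⟨D, hD, -, -⟩ := hE.exists_goodDer sep_short
  set Φ := IntermediateField.adjoin (acl S) (twistField m τ ξ ω y : Set Ω) with hΦ
  have lift : ∀ x ∈ twistField m τ' ξ' ω' y', x ∈ Φ := fun x hx => hsub (hM ▸ hx)
  let τ₁ : ℕ → Φ := fun i => if hi : i < m then ⟨τ' i, lift _ (h'.tau_mem hi)⟩ else 0
  have hτ₁ : ∀ i < m, (τ₁ i : Ω) = τ' i := by intro i hi; simp [τ₁, hi]
  have hh : ∀ i ≤ m, ((hseq τ₁ i : Φ) : Ω) = hseq τ' i := by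
    intro i hi
    exact (map_hseq (Φ.val : Φ →+* Ω) τ₁ i).trans (hseq_congr fun j hj => hτ₁ j (hj.trans_le hi))
  have hgf := map_gfun (Φ.val : Φ →+* Ω) ⟨ξ', lift _ xi_mem_twistField⟩
    ⟨ω', lift _ omega_mem_twistField⟩
  have hdesc := twist_descent (e := e') (y := ⟨y', lift _ y_mem_twistField⟩) hD (τ := τ₁) (m := m)
    (ξ := ⟨ξ', lift _ xi_mem_twistField⟩) (ω := ⟨ω', lift _ omega_mem_twistField⟩)
    (fun i hi h0 => h'.ne_zero hi (by rw [← hτ₁ i hi, h0]; rfl))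
    (fun i hi h0 => hseq_ne_zero h'.indep hi (by rw [← hh i hi, h0]; rfl)) he
    (h'.curve.of_map (algebraMap Φ Ω))
    (fun h0 => h'.gfun_ne_zero (by refine hgf.symm.trans ?_; rw [h0]; rfl))
    (by
      apply Subtype.ext
      refine h'.root.trans ?_
      refine (congrArg₂ (fun a b => a ^ e' * b) (hh m le_rfl) hgf).symm.trans ?_
      rfl)
  intro i hi
  obtain ⟨c, hc⟩ := hdesc i hi
  rw [← hτ₁ i hi, ← hc]; exact c.2

end Omega

end CremonaPlaces

namespace CremonaPlaces

section Collinear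

variable {Φ : Type} [Field Φ] [CharZero Φ]

lemma gfun_collinear {ξ₁ ω₁ ξ₂ ω₂ s : Φ} (h₁ : OnCurve 2 1 (1/4) ξ₁ ω₁)
    (h₂ : OnCurve 2 1 (1/4) ξ₂ ω₂) (hne : ξ₁ ≠ ξ₂) (hs : s * (ξ₁ - ξ₂) = ω₁ - ω₂) :
    gfun ξ₁ ω₁ * gfun ξ₂ ω₂ *
      gfun (s ^ 2 - 2 - ξ₁ - ξ₂) (ω₁ + s * (s ^ 2 - 2 - ξ₁ - ξ₂ - ξ₁)) =
      (ω₁ - s * ξ₁ - 1/2) ^ 5 ∧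
    (s ^ 2 - 2 - ξ₁ - ξ₂ = 0 → ω₁ - s * ξ₁ = 1/2 →
      gfun ξ₁ ω₁ * gfun ξ₂ ω₂ = (-(s - 1)) ^ 5) := by
  have hk := h₁.slope_mul h₂ hne hs
  obtain ⟨c, hc⟩ : ∃ c, c = ω₁ - s * ξ₁ := ⟨_, rfl⟩
  have hw1 : ω₁ = s * ξ₁ + c := by rw [hc]; ring
  have hw2 : ω₂ = s * ξ₂ + c := by linear_combination hw1 + hs
  unfold OnCurve at h₁
  push_cast at h₁ hk
  obtain ⟨r, hr⟩ : ∃ r, r = s ^ 2 - 2 - ξ₁ - ξ₂ := ⟨_, rfl⟩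
  have E1 : ξ₁ + ξ₂ + r = s ^ 2 - 2 := by rw [hr]; ring
  have E2 : ξ₁ * ξ₂ + ξ₁ * r + ξ₂ * r = 1 - 2 * s * c := by
    rw [hw1, hw2] at hk
    linear_combination (ξ₁ + ξ₂) * hr + hk
  have E3 : ξ₁ * ξ₂ * r = c ^ 2 - 1/4 := by
    rw [hw1] at h₁
    linear_combination ξ₁ * E2 - ξ₁ ^ 2 * E1 - h₁
  rw [← hr, ← hc]
  constructor
  · have e : gfun ξ₁ ω₁ * gfun ξ₂ ω₂ * gfun r (ω₁ + s * (r - ξ₁)) =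
        (s - 2) ^ 3 * (ξ₁ * ξ₂ * r) ^ 2 +
        (s - 2) ^ 2 * (s + c - 3/2) * (ξ₁ * ξ₂ + ξ₁ * r + ξ₂ * r) * (ξ₁ * ξ₂ * r) +
        (s - 2) ^ 2 * (c - 1/2) * ((ξ₁ * ξ₂ + ξ₁ * r + ξ₂ * r) ^ 2 -
          2 * (ξ₁ + ξ₂ + r) * (ξ₁ * ξ₂ * r)) +
        (s - 2) * (s + c - 3/2) ^ 2 * (ξ₁ + ξ₂ + r) * (ξ₁ * ξ₂ * r) +
        (s - 2) * (s + c - 3/2) * (c - 1/2) * ((ξ₁ + ξ₂ + r) * (ξ₁ * ξ₂ + ξ₁ * r + ξ₂ * r) -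
          3 * (ξ₁ * ξ₂ * r)) +
        (s + c - 3/2) ^ 3 * (ξ₁ * ξ₂ * r) +
        (s - 2) * (c - 1/2) ^ 2 * ((ξ₁ + ξ₂ + r) ^ 2 - 2 * (ξ₁ * ξ₂ + ξ₁ * r + ξ₂ * r)) +
        (s + c - 3/2) ^ 2 * (c - 1/2) * (ξ₁ * ξ₂ + ξ₁ * r + ξ₂ * r) +
        (s + c - 3/2) * (c - 1/2) ^ 2 * (ξ₁ + ξ₂ + r) + (c - 1/2) ^ 3 := by
      rw [hw1, hw2]; unfold gfun; ring
    rw [e, E1, E2, E3]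
    ring
  · intro h0 hc2
    rw [h0] at E1 E2
    have e : gfun ξ₁ ω₁ * gfun ξ₂ ω₂ = ξ₁ * ξ₂ * ((s - 2) ^ 2 * (ξ₁ * ξ₂) +
        (s - 2) * (s - 1) * (ξ₁ + ξ₂) + (s - 1) ^ 2) := by
      rw [hw1, hw2, hc2]; unfold gfun; ring
    have E1' : ξ₁ + ξ₂ = s ^ 2 - 2 := by linear_combination E1
    have E2' : ξ₁ * ξ₂ = 1 - s := by rw [hc2] at E2; linear_combination E2
    rw [e, E1', E2']
    ring

end Collinear

section Omega

variable {Ω : Type} [Field Ω] [Algebra ℂ Ω]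

variable {m : ℕ} {τ₁ τ₂ : ℕ → Ω} {e₁ e₂ : ℕ} {ξ₁ ω₁ y₁ ξ₂ ω₂ y₂ : Ω}

lemma OnCurve.derivation_snd {k Φ : Type} [Field k] [Field Φ] [Algebra k Φ] [IsAlgClosed k]
    [CharZero k] {a b c : ℚ} {X Y l : Φ}
    (h : OnCurve a b c X Y) (hY : Y ≠ 0) {D : Derivation k Φ Φ} (hX : D X = 2 * l * Y) :
    D Y = l * (3 * X ^ 2 + 2 * a * X + b) := by
  have := charZero_of_base k Φ
  have hd := h.derivation D
  rw [hX] at hd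
  apply mul_left_cancel₀ (mul_ne_zero two_ne_zero hY)
  linear_combination hd

lemma Twist.collinear [IsAlgClosed Ω] (h₁ : Twist m e₁ τ₁ ξ₁ ω₁ y₁) (h₂ : Twist m e₂ τ₂ ξ₂ ω₂ y₂)
    {S : Set Ω} (hS₁ : acl S = acl (τ₁ '' Set.Iio m)) (hS₂ : acl S = acl (τ₂ '' Set.Iio m))
    (hM : twistField m τ₂ ξ₂ ω₂ y₂ = twistField m τ₁ ξ₁ ω₁ y₁) :
    ∃ ω : Ω, (ω = ω₂ ∨ ω = -ω₂) ∧ ((ξ₁ = ξ₂ ∧ ω = -ω₁) ∨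
      (ξ₁ ≠ ξ₂ ∧ ((ω₁ - ω) / (ξ₁ - ξ₂)) ^ 2 - 2 - ξ₁ - ξ₂ ∈ acl S)) := by
  have hcz : CharZero (acl S) := charZero_of_base ℂ _
  have hac : IsAlgClosed (acl S) := acl_isAlgClosed _
  let Φ := IntermediateField.adjoin (acl S) (twistField m τ₁ ξ₁ ω₁ y₁ : Set Ω)
  have hsub : ∀ z ∈ twistField m τ₁ ξ₁ ω₁ y₁, z ∈ Φ :=
    IntermediateField.subset_adjoin (acl S) (twistField m τ₁ ξ₁ ω₁ y₁ : Set Ω)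
  have hξ₁ : ξ₁ ∈ Φ := hsub _ xi_mem_twistField
  have hω₁ : ω₁ ∈ Φ := hsub _ omega_mem_twistField
  have hξ₂ : ξ₂ ∈ Φ := hsub _ (hM ▸ xi_mem_twistField)
  have hω₂ : ω₂ ∈ Φ := hsub _ (hM ▸ omega_mem_twistField)
  obtain ⟨x, v, w, hE, hp⟩ := h₁.exists_ellGen hS₁ rfl hξ₁ hω₁
  obtain ⟨x', v', w', hE', hp'⟩ := h₂.exists_ellGen hS₂ hM hξ₂ hω₂
  have hcz' : CharZero Φ := charZero_of_base (acl S) _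
  obtain ⟨D, hD, hDx, -⟩ := hE.exists_goodDer sep_short
  obtain ⟨κ, hκ⟩ := hE'.curve.lambda_mem_range sep_short hD
  have hv' : v' ≠ 0 := by
    intro h0
    obtain ⟨c, hc⟩ := hE'.curve.mem_range_of_derivation_eq_zero hD (by rw [h0]; simp)
    exact hE'.trans (hc ▸ isAlgebraic_algebraMap c)
  have hDx' : D x' = 2 * algebraMap (acl S) Φ κ * v' := by rw [hκ]; field_simp
  have hκ2 := hE.sq_eq_one sep_short hE' (by norm_num) (by norm_num) hD hDx hDx'
  have hD1 := hp.derivation (c := 1) (by rw [hDx]; ring)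
  have hD2 := hp'.derivation hDx'
  have hc1 : OnCurve 2 1 (1/4) (⟨ξ₁, hξ₁⟩ : Φ) ⟨ω₁, hω₁⟩ := h₁.curve.of_map (algebraMap Φ Ω)
  have hc2 : OnCurve 2 1 (1/4) (⟨ξ₂, hξ₂⟩ : Φ) ⟨ω₂, hω₂⟩ := h₂.curve.of_map (algebraMap Φ Ω)
  have hκ2' : algebraMap (acl S) Φ κ ^ 2 = 1 := by rw [← map_pow, hκ2, map_one]
  generalize algebraMap (acl S) Φ κ = K at hκ2' hD2
  have hnr : ∀ {ξ : Ω} (hξ : ξ ∈ Φ), ξ ∉ acl S → (⟨ξ, hξ⟩ : Φ) ∉ (algebraMap (acl S) Φ).range := by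
    rintro ξ hξ hn ⟨c, hc⟩
    have : ξ = c := (congrArg Subtype.val hc).symm
    exact hn (this ▸ c.2)
  have hn1 := hnr hξ₁ (hS₁ ▸ h₁.generic)
  have hn2 := hnr hξ₂ (hS₂ ▸ h₂.generic)
  have hK0 : K ≠ 0 := by rintro rfl; norm_num at hκ2'
  have hω1 : (⟨ω₁, hω₁⟩ : Φ) ≠ 0 := fun h0 =>
    hn1 (hc1.mem_range_of_derivation_eq_zero hD (by rw [h0]; simp))
  have hω2 : (⟨ω₂, hω₂⟩ : Φ) ≠ 0 := fun h0 =>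
    hn2 (hc2.mem_range_of_derivation_eq_zero hD (by rw [h0]; simp))
  have hc3 : OnCurve 2 1 (1/4) (⟨ξ₂, hξ₂⟩ : Φ) (-K * ⟨ω₂, hω₂⟩) := by
    unfold OnCurve at hc2 ⊢
    rw [← hc2]; linear_combination (⟨ω₂, hω₂⟩ : Φ) ^ 2 * hκ2'
  have hKc : K = 1 ∨ K = -1 := sq_eq_one_iff.mp hκ2'
  have hDξ1 : D ⟨ξ₁, hξ₁⟩ = 2 * (-5) * ⟨ω₁, hω₁⟩ := by rw [hD1]; ring
  have hDξ2 : D ⟨ξ₂, hξ₂⟩ = 2 * 5 * (-K * ⟨ω₂, hω₂⟩) := by rw [hD2]; ring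
  have hω3 : -K * ⟨ω₂, hω₂⟩ ≠ 0 := mul_ne_zero (neg_ne_zero.mpr hK0) hω2
  refine ⟨((-K * ⟨ω₂, hω₂⟩ : Φ) : Ω), ?_, ?_⟩
  · rcases hKc with rfl | rfl
    · right; simp
    · left; simp
  by_cases hne : ξ₁ = ξ₂
  · left
    refine ⟨hne, ?_⟩
    subst hne
    have : (-K * ⟨ω₂, hω₂⟩ : Φ) = -⟨ω₁, hω₁⟩ := by
      rw [hDξ1] at hDξ2
      linear_combination -(1/10) * hDξ2
    rw [this]; rfl
  · right
    refine ⟨hne, ?_⟩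
    have hne' : (⟨ξ₁, hξ₁⟩ : Φ) ≠ ⟨ξ₂, hξ₂⟩ := fun h0 => hne (congrArg Subtype.val h0)
    obtain ⟨s, hs⟩ : ∃ s : Φ, s = (⟨ω₁, hω₁⟩ - (-K * ⟨ω₂, hω₂⟩)) / (⟨ξ₁, hξ₁⟩ - ⟨ξ₂, hξ₂⟩) := ⟨_, rfl⟩
    have hs' : s * (⟨ξ₁, hξ₁⟩ - ⟨ξ₂, hξ₂⟩) = ⟨ω₁, hω₁⟩ - (-K * ⟨ω₂, hω₂⟩) := by
      rw [hs, div_mul_cancel₀ _ (sub_ne_zero.mpr hne')]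
    have hadd := hc1.derivation_add hc3 hne' hs' hDξ1 hDξ2 (hc1.derivation_snd hω1 hDξ1)
      (hc3.derivation_snd hω3 hDξ2)
    obtain ⟨c, hc⟩ := (hc1.add hc3 hne' hs').mem_range_of_derivation_eq_zero hD (by
      rw [hadd]; ring)
    have : ((ω₁ - ((-K * ⟨ω₂, hω₂⟩ : Φ) : Ω)) / (ξ₁ - ξ₂)) ^ 2 - 2 - ξ₁ - ξ₂ = c := by
      refine Eq.trans ?_ (congrArg Subtype.val hc).symm
      rw [hs]
      push_cast
      rfl
    rw [this]; exact c.2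

lemma notMem_acl_image {κ : Type} {s : κ → Ω} (h : AlgebraicIndependent ℂ s) {T : Set κ} {i : κ}
    (hi : i ∉ T) : s i ∉ acl (s '' T) := by
  have h1 : (indepMat Ω).Indep (Set.range s) := by
    rw [AlgebraicIndependent.matroid_indep_iff]
    exact (algebraicIndependent_subtype_range h.injective).mpr h
  rw [mem_acl_iff]
  intro hmem
  refine h1.notMem_closure_sdiff_of_mem ⟨i, rfl⟩ ((indepMat Ω).closure_subset_closure ?_ hmem)
  rintro _ ⟨j, hj, rfl⟩
  exact ⟨⟨j, rfl⟩, fun hji => hi (h.injective hji ▸ hj)⟩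

/-- Elliptic curve points over a purely transcendental field are constant. -/
lemma OnCurve.mem_bot_of_mem_adjoin [IsAlgClosed Ω] {a b c : ℚ} {X Y : Ω} (h : OnCurve a b c X Y)
    (hs : Sep a b c) {τ : ℕ → Ω} (hτ : AlgebraicIndependent ℂ (fun i : Fin m => τ i)) {j : ℕ}
    (hj : j ≤ m) (hX : X ∈ IntermediateField.adjoin ℂ (τ '' Set.Iio j))
    (hY : Y ∈ IntermediateField.adjoin ℂ (τ '' Set.Iio j)) :
    X ∈ (⊥ : IntermediateField ℂ Ω) ∧ Y ∈ (⊥ : IntermediateField ℂ Ω) := by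
  have := charZero_omega Ω
  induction j with
  | zero =>
    have : Set.Iio 0 = (∅ : Set ℕ) := by ext; simp
    rw [this, Set.image_empty, IntermediateField.adjoin_empty] at hX hY
    exact ⟨hX, hY⟩
  | succ j ih =>
    set K := IntermediateField.adjoin ℂ (τ '' Set.Iio j) with hK
    have hs0 : τ j ∉ acl (K : Set Ω) := by
      rw [hK, acl_adjoin]
      have := notMem_acl_image hτ (T := {i : Fin m | (i : ℕ) < j}) (i := ⟨j, hj⟩) (by simp)
      have himg : τ '' Set.Iio j = (fun i : Fin m => τ i) '' {i : Fin m | (i : ℕ) < j} := by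
        ext z
        constructor
        · rintro ⟨i, hi, rfl⟩; exact ⟨⟨i, lt_trans hi hj⟩, hi, rfl⟩
        · rintro ⟨i, hi, rfl⟩; exact ⟨i, hi, rfl⟩
      rw [himg]; exact this
    set k := acl (K : Set Ω) with hk
    have hcz : CharZero k := charZero_of_base ℂ _
    have hac : IsAlgClosed k := acl_isAlgClosed _
    let E : IntermediateField k Ω := IntermediateField.adjoin k {τ j}
    have hjE : τ j ∈ E := IntermediateField.subset_adjoin _ _ (by simp)
    have hsub : IntermediateField.adjoin ℂ (τ '' Set.Iio (j + 1)) ≤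
        IntermediateField.adjoin ℂ ((K : Set Ω) ∪ {τ j}) := by
      rw [IntermediateField.adjoin_le_iff]
      rintro _ ⟨i, hi, rfl⟩
      rcases Nat.lt_succ_iff_lt_or_eq.mp hi with hi | rfl
      · exact IntermediateField.subset_adjoin _ _
          (Or.inl (IntermediateField.subset_adjoin _ _ ⟨i, hi, rfl⟩))
      · exact IntermediateField.subset_adjoin _ _ (Or.inr rfl)
    have hE : IntermediateField.adjoin ℂ ((K : Set Ω) ∪ {τ j}) ≤ E.restrictScalars ℂ := by
      rw [IntermediateField.adjoin_le_iff]
      rintro a (ha | rfl)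
      · exact E.algebraMap_mem ⟨a, subset_acl _ ha⟩
      · exact hjE
    have h' : OnCurve a b c (⟨X, hE (hsub hX)⟩ : E) ⟨Y, hE (hsub hY)⟩ := h.of_map (algebraMap E Ω)
    have hXr := OnCurve.mem_range_of_simple (k := k) (u := ⟨τ j, hjE⟩) h' hs
      (fun hal => hs0 (mem_acl_of_isAlgebraic
        ((isAlgebraic_algebraMap_iff (algebraMap E Ω).injective).mpr hal))) (by
        refine Eq.trans ?_ (adjoin_val_eq_top (k := k) ({τ j} : Set Ω))
        congr 1
        ext a; simp [E, Subtype.ext_iff])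
    have hYr := h'.snd_mem_range hXr
    have hmem : ∀ {z : Ω} (hz : z ∈ E), (⟨z, hz⟩ : E) ∈ (algebraMap k E).range → z ∈ k := by
      rintro z hz ⟨c, hc⟩
      have : z = c := (congrArg Subtype.val hc).symm
      exact this ▸ c.2
    exact ih (by lia) (mem_of_mem_adjoin_transcendental hs0 (hmem _ hXr) (hsub hX))
      (mem_of_mem_adjoin_transcendental hs0 (hmem _ hYr) (hsub hY))

lemma Twist.exists_gfun_mul [IsAlgClosed Ω] (h₁ : Twist m e₁ τ₁ ξ₁ ω₁ y₁)
    (h₂ : Twist m e₂ τ₂ ξ₂ ω₂ y₂)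
    {S : Set Ω} (hS₁ : acl S = acl (τ₁ '' Set.Iio m)) (hS₂ : acl S = acl (τ₂ '' Set.Iio m))
    (hM : twistField m τ₂ ξ₂ ω₂ y₂ = twistField m τ₁ ξ₁ ω₁ y₁) :
    ∃ ω : Ω, (ω = ω₂ ∨ ω = -ω₂) ∧ ∃ γ : ℂ, ∃ ρ ∈ twistField m τ₂ ξ₂ ω₂ y₂,
      gfun ξ₁ ω₁ * gfun ξ₂ ω = (algebraMap ℂ Ω γ * ρ) ^ 5 := by
  have hcz := charZero_omega Ω
  obtain ⟨ω, hω, hcol⟩ := h₁.collinear h₂ hS₁ hS₂ hM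
  refine ⟨ω, hω, ?_⟩
  set M := twistField m τ₂ ξ₂ ω₂ y₂ with hMdef
  have hξ₁M : ξ₁ ∈ M := hM ▸ xi_mem_twistField
  have hω₁M : ω₁ ∈ M := hM ▸ omega_mem_twistField
  have hξ₂M : ξ₂ ∈ M := xi_mem_twistField
  have hω₂M : ω₂ ∈ M := omega_mem_twistField
  have hωM : ω ∈ M := by rcases hω with rfl | rfl; exacts [hω₂M, neg_mem hω₂M]
  have hc : OnCurve 2 1 (1/4) ξ₂ ω := by
    rcases hω with rfl | rfl
    · exact h₂.curve
    · have := h₂.curve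
      unfold OnCurve at this ⊢
      rw [← this]; ring
  rcases hcol with ⟨rfl, rfl⟩ | ⟨hne, hacl⟩
  · refine ⟨1, -ξ₁, neg_mem hξ₁M, ?_⟩
    rw [gfun_mul_neg h₁.curve, map_one]; ring
  · obtain ⟨s, hs⟩ : ∃ s, s = (ω₁ - ω) / (ξ₁ - ξ₂) := ⟨_, rfl⟩
    rw [← hs] at hacl
    have hsM : s ∈ M := hs ▸ div_mem (sub_mem hω₁M hωM) (sub_mem hξ₁M hξ₂M)
    have hs' : s * (ξ₁ - ξ₂) = ω₁ - ω := by
      rw [hs, div_mul_cancel₀ _ (sub_ne_zero.mpr hne)]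
    have hadd := h₁.curve.add hc hne hs'
    obtain ⟨hp, hq⟩ := gfun_collinear h₁.curve hc hne hs'
    push_cast at hadd
    have h2M : (2 : Ω) ∈ M := natCast_mem M 2
    obtain ⟨X, hX⟩ : ∃ X, X = s ^ 2 - 2 - ξ₁ - ξ₂ := ⟨_, rfl⟩
    obtain ⟨Y, hY⟩ : ∃ Y, Y = ω₁ + s * (X - ξ₁) := ⟨_, rfl⟩
    have hXM : X ∈ M := by
      rw [hX]; exact sub_mem (sub_mem (sub_mem (pow_mem hsM 2) h2M) hξ₁M) hξ₂M
    have hYM : Y ∈ M := by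
      rw [hY]; exact add_mem hω₁M (mul_mem hsM (sub_mem hXM hξ₁M))
    rw [← hX] at hadd hacl hp hq
    rw [← hY] at hadd hp
    have hXY : OnCurve 2 1 (1/4) X Y := by
      unfold OnCurve at hadd ⊢
      push_cast at hadd ⊢
      rw [← hadd]; ring
    have hXa : X ∈ acl (τ₂ '' Set.Iio m) := hS₂ ▸ hacl
    have hYa : Y ∈ acl (τ₂ '' Set.Iio m) :=
      mem_acl_of_pow (n := 2) (by norm_num) (hXY.sq_mem hXa)
    obtain ⟨hXb, hYb⟩ := hXY.mem_bot_of_mem_adjoin sep_isogenous h₂.indep le_rfl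
      (h₂.mem_adjoin hXM hXa) (h₂.mem_adjoin hYM hYa)
    obtain ⟨a, ha⟩ := IntermediateField.mem_bot.mp (gfun_mem hXb hYb)
    have hhalf : (1/2 : Ω) ∈ M := by
      have := ratCast_mem_field M (1/2); push_cast at this; exact this
    by_cases ha0 : a = 0
    · have hg0 : gfun X Y = 0 := by rw [← ha, ha0, map_zero]
      have hX0 : X = 0 := by
        have := gfun_mul_neg hXY
        rw [hg0, zero_mul] at this
        exact pow_eq_zero_iff (n := 5) (by norm_num) |>.mp (by linear_combination this)
      have hc0 : ω₁ - s * ξ₁ = 1/2 := by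
        rw [hg0, mul_zero] at hp
        exact sub_eq_zero.mp (pow_eq_zero_iff (n := 5) (by norm_num) |>.mp hp.symm)
      refine ⟨1, -(s - 1), neg_mem (sub_mem hsM (one_mem _)), ?_⟩
      rw [hq hX0 hc0, map_one, one_mul]
    · obtain ⟨b, hb⟩ := IsAlgClosed.exists_pow_nat_eq a⁻¹ (n := 5) (by norm_num)
      refine ⟨b, ω₁ - s * ξ₁ - 1/2, sub_mem (sub_mem hω₁M (mul_mem hsM hξ₁M)) hhalf, ?_⟩
      have ha' : algebraMap ℂ Ω a ≠ 0 := by simpa using ha0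
      rw [mul_pow, ← hp, ← ha, ← map_pow, hb, map_inv₀]
      field_simp

lemma Twist.exists_hseq_relation [IsAlgClosed Ω] (h₁ : Twist m 1 τ₁ ξ₁ ω₁ y₁)
    (h₂ : Twist m 2 τ₂ ξ₂ ω₂ y₂) (hM : twistField m τ₂ ξ₂ ω₂ y₂ = twistField m τ₁ ξ₁ ω₁ y₁) :
    (∀ i < m, τ₁ i ∈ IntermediateField.adjoin ℂ (τ₂ '' Set.Iio m)) ∧
    (∀ i < m, τ₂ i ∈ IntermediateField.adjoin ℂ (τ₁ '' Set.Iio m)) ∧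
    ∃ δ ∈ IntermediateField.adjoin ℂ (τ₂ '' Set.Iio m),
      hseq τ₁ m * hseq τ₂ m ^ 2 = δ ^ 5 ∨ hseq τ₁ m = hseq τ₂ m ^ 2 * δ ^ 5 := by
  have hcz := charZero_omega Ω
  have h12 := h₂.tau_mem_acl h₁ (Or.inl rfl) hM.symm
  have h21 := h₁.tau_mem_acl h₂ (Or.inr rfl) hM
  have hS : acl (τ₂ '' Set.Iio m) = acl (τ₁ '' Set.Iio m) := by
    apply le_antisymm
    · refine acl_le_of_subset ?_
      rintro _ ⟨i, hi, rfl⟩; exact h21 i hi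
    · refine acl_le_of_subset ?_
      rintro _ ⟨i, hi, rfl⟩; exact h12 i hi
  refine ⟨fun i hi => h₂.mem_adjoin (hM ▸ h₁.tau_mem hi) (h12 i hi),
    fun i hi => h₁.mem_adjoin (hM ▸ h₂.tau_mem hi) (h21 i hi), ?_⟩
  obtain ⟨ω, hω, γ, ρ, hρ, hg⟩ := h₁.exists_gfun_mul h₂ hS rfl hM
  have hy₁ := h₁.root
  have hy₂ := h₂.root
  have hg₁ := h₁.gfun_ne_zero
  have hg₂ := h₂.gfun_ne_zero
  have hh₁ := hseq_ne_zero h₁.indep le_rfl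
  have hh₂ := hseq_ne_zero h₂.indep le_rfl
  have hk₁ : hseq τ₁ m ∈ acl (τ₂ '' Set.Iio m) :=
    hseq_mem (acl (τ₂ '' Set.Iio m)).toSubring h12
  have hk₂ : hseq τ₂ m ∈ acl (τ₂ '' Set.Iio m) :=
    hseq_mem (acl (τ₂ '' Set.Iio m)).toSubring fun i hi => subset_acl _ ⟨i, hi, rfl⟩
  set M := twistField m τ₂ ξ₂ ω₂ y₂ with hMdef
  have hy₁M : y₁ ∈ M := hM ▸ y_mem_twistField
  have hy₂M : y₂ ∈ M := y_mem_twistField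
  have hξ₂M : ξ₂ ∈ M := xi_mem_twistField
  have hγM : algebraMap ℂ Ω γ * ρ ∈ M := mul_mem (M.algebraMap_mem γ) hρ
  have hneg := gfun_mul_neg h₂.curve
  have hξ₂0 := h₂.xi_ne_zero
  have hgω : gfun ξ₂ ω ≠ 0 := by
    rcases hω with rfl | rfl
    · exact hg₂
    · intro h0
      rw [h0, mul_zero] at hneg
      exact hξ₂0 (pow_eq_zero_iff (n := 5) (by norm_num) |>.mp (by linear_combination hneg))
  have hR0 : algebraMap ℂ Ω γ * ρ ≠ 0 := by
    intro h0
    rw [h0] at hg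
    exact mul_ne_zero hg₁ hgω (by rw [hg]; norm_num)
  generalize algebraMap ℂ Ω γ * ρ = R at hγM hg hR0
  have hy₂0 : y₂ ≠ 0 := by
    rintro rfl
    exact mul_ne_zero (pow_ne_zero 2 hh₂) hg₂ (by rw [← hy₂]; norm_num)
  rcases hω with rfl | rfl
  · have e : hseq τ₁ m * hseq τ₂ m ^ 2 = (y₁ * y₂ / R) ^ 5 := by
      rw [div_pow, eq_div_iff (pow_ne_zero 5 hR0), ← hg, mul_pow, hy₁, hy₂]; ring
    refine ⟨_, h₂.mem_adjoin (div_mem (mul_mem hy₁M hy₂M) hγM)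
      (mem_acl_of_pow (n := 5) (by norm_num) ?_), Or.inl e⟩
    rw [← e]
    exact mul_mem hk₁ (pow_mem hk₂ 2)
  · have e : hseq τ₁ m = hseq τ₂ m ^ 2 * (-y₁ * ξ₂ / (R * y₂)) ^ 5 := by
      rw [div_pow, mul_div_assoc', eq_div_iff (pow_ne_zero 5 (mul_ne_zero hR0 hy₂0))]
      have e1 : (-y₁ * ξ₂) ^ 5 = -(y₁ ^ 5) * ξ₂ ^ 5 := by ring
      rw [e1, mul_pow, ← hg, hy₁, hy₂]
      linear_combination hseq τ₁ m * hseq τ₂ m ^ 2 * gfun ξ₁ ω₁ * hneg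
    refine ⟨_, h₂.mem_adjoin (div_mem (mul_mem (neg_mem hy₁M) hξ₂M) (mul_mem hγM hy₂M))
      (mem_acl_of_pow (n := 5) (by norm_num) ?_), Or.inr e⟩
    have : (-y₁ * ξ₂ / (R * y₂)) ^ 5 = hseq τ₁ m / hseq τ₂ m ^ 2 := by
      rw [eq_div_iff (pow_ne_zero 2 hh₂)]; linear_combination -e
    rw [this]
    exact div_mem hk₁ (pow_mem hk₂ 2)

end Omega

end CremonaPlaces

namespace CremonaPlaces

section FunctionField

variable {k Φ : Type} [Field k] [Field Φ] [Algebra k Φ]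

lemma derivation_fifth_pow (D : Derivation k Φ Φ) (w : Φ) : D (w ^ 5) = 5 * w ^ 4 * D w := by
  rw [D.leibniz_pow]; simp only [smul_eq_mul, nsmul_eq_mul]; push_cast; ring

lemma derivation_sq (D : Derivation k Φ Φ) (w : Φ) : D (w ^ 2) = 2 * w * D w := by
  rw [D.leibniz_pow]; simp only [smul_eq_mul, nsmul_eq_mul]; push_cast; ring

lemma derivation_cube (D : Derivation k Φ Φ) (w : Φ) : D (w ^ 3) = 3 * w ^ 2 * D w := by
  rw [D.leibniz_pow]; simp only [smul_eq_mul, nsmul_eq_mul]; push_cast; ring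

variable [IsAlgClosed k] [CharZero k]

lemma LocFifth.sq_div_mem {D : Derivation k Φ Φ} (hD : GoodDer D) {V : ValuationSubring Φ}
    (hV : Over k V) {a : Φ} (ha : LocFifth V a) (ha0 : a ≠ 0) (hlt : V.valuation a < 1) :
    D a ^ 2 / a ∈ V := by
  obtain ⟨u, w, hu, rfl⟩ := ha
  have huV := mem_of_eq hu
  have hw : w ∈ V := by
    refine mem_of_pow_mem (n := 5) (by norm_num) (mem_of_lt ?_)
    rwa [map_mul, hu, one_mul] at hlt
  have hw0 : w ≠ 0 := by rintro rfl; simp at ha0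
  have hu0 := ne_zero_of_eq hu
  have e : D (u * w ^ 5) ^ 2 / (u * w ^ 5) = u⁻¹ * w ^ 3 * (5 * u * D w + w * D u) ^ 2 := by
    rw [D.leibniz, derivation_fifth_pow]
    simp only [smul_eq_mul]
    field_simp
  rw [e]
  have h5 : (5 : Φ) ∈ V := natCast_mem V 5
  exact mul_mem (mul_mem (inv_mem_of_eq hu) (pow_mem hw 3)) (pow_mem (add_mem
    (mul_mem (mul_mem h5 huV) (hD.stable V hV w hw)) (mul_mem hw (hD.stable V hV u huV))) 2)

lemma sq_div_mem_of_eq_sq_mul {D : Derivation k Φ Φ} (hD : GoodDer D) {V : ValuationSubring Φ}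
    (hV : Over k V) {h r : Φ} (hh : V.valuation h < 1) (hDh : V.valuation (D h) = 1)
    (h0 : h ≠ 0) (hlt : V.valuation (h ^ 2 * r ^ 5) < 1) :
    D (h ^ 2 * r ^ 5) ^ 2 / (h ^ 2 * r ^ 5) ∈ V := by
  have hhV := mem_of_lt hh
  have hr : r ∈ V := by
    by_contra hr
    have hs := lt_inv_of_notMem hr
    have hr0 := notMem_ne_zero hr
    have hsV := mem_of_lt hs
    have hE := mem_of_lt hlt
    obtain ⟨s, rfl⟩ : ∃ s, r = s⁻¹ := ⟨r⁻¹, by rw [inv_inv]⟩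
    rw [inv_inv] at hs hsV
    have hs0 : s ≠ 0 := by simpa using hr0
    generalize hEdef : h ^ 2 * s⁻¹ ^ 5 = E at hE hlt
    have e : h ^ 2 = E * s ^ 5 := by rw [← hEdef]; field_simp
    have e1 := congrArg D e
    rw [D.leibniz, derivation_sq, derivation_fifth_pow] at e1
    simp only [smul_eq_mul] at e1
    have h2 := val_ofNat k hV 2 (by norm_num)
    push_cast at h2
    have hDh0 := ne_zero_of_eq hDh
    have h20 := ne_zero_of_eq h2
    have e2 : h = s ^ 4 * ((5 * E * D s + s * D E) / (2 * D h)) := by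
      field_simp
      linear_combination e1
    have hq : (5 * E * D s + s * D E) / (2 * D h) ∈ V := by
      rw [div_eq_mul_inv]
      refine mul_mem (add_mem (mul_mem (mul_mem (natCast_mem V 5) hE) (hD.stable V hV s hsV))
        (mul_mem hsV (hD.stable V hV E hE))) (inv_mem_of_eq (eq_mul h2 hDh))
    generalize (5 * E * D s + s * D E) / (2 * D h) = q at e2 hq
    have e3 : D h = s * (s ^ 3 * D q + q * (4 * s ^ 2 * D s)) := by
      conv_lhs => rw [e2]
      rw [D.leibniz, D.leibniz_pow]
      simp only [smul_eq_mul, nsmul_eq_mul]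
      push_cast
      ring
    have : V.valuation (D h) < 1 := by
      rw [e3]
      exact lt_mul_right hs (add_mem (mul_mem (pow_mem hsV 3) (hD.stable V hV q hq))
        (mul_mem hq (mul_mem (mul_mem (natCast_mem V 4) (pow_mem hsV 2)) (hD.stable V hV s hsV))))
    exact this.ne hDh
  rcases eq_or_ne r 0 with rfl | hr0
  · simp
  have e : D (h ^ 2 * r ^ 5) ^ 2 / (h ^ 2 * r ^ 5) = r ^ 3 * (2 * D h * r + 5 * h * D r) ^ 2 := by
    rw [D.leibniz, derivation_fifth_pow, derivation_sq]
    simp only [smul_eq_mul]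
    field_simp
    ring
  rw [e]
  exact mul_mem (pow_mem hr 3) (pow_mem (add_mem
    (mul_mem (mul_mem (natCast_mem V 2) (mem_of_eq hDh)) hr)
    (mul_mem (mul_mem (natCast_mem V 5) hhV) (hD.stable V hV r hr))) 2)

lemma sq_div_mem_of_mul_sq_eq {D : Derivation k Φ Φ} (hD : GoodDer D) {V : ValuationSubring Φ}
    (hV : Over k V) {h r E : Φ} (hh : V.valuation h < 1) (hDh : V.valuation (D h) = 1)
    (h0 : h ≠ 0) (hE0 : E ≠ 0) (hlt : V.valuation E < 1) (hE : E * h ^ 2 = r ^ 5) :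
    D E ^ 2 / E ∈ V := by
  have hhV := mem_of_lt hh
  have hr0 : r ≠ 0 := by
    rintro rfl
    exact mul_ne_zero hE0 (pow_ne_zero 2 h0) (by rw [hE]; norm_num)
  have hrlt : V.valuation r < 1 := by
    refine lt_of_pow_lt (n := 5) ?_
    rw [← hE]; exact lt_mul_right hlt (pow_mem hhV 2)
  have hr := mem_of_lt hrlt
  have hrh : r / h ∈ V := by
    by_contra hn
    have hs := lt_inv_of_notMem hn
    rw [inv_div] at hs
    have e : h = h / r * r := by field_simp
    have hsV := mem_of_lt hs
    generalize h / r = s at hs e hsV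
    have : V.valuation (D h) < 1 := by
      rw [e, D.leibniz]
      exact lt_add (lt_mul_right hs (hD.stable V hV r hr))
        (lt_mul_right hrlt (hD.stable V hV s hsV))
    exact this.ne hDh
  obtain ⟨q, rfl⟩ : ∃ q, r = h * q := ⟨r / h, by field_simp⟩
  rw [mul_div_cancel_left₀ _ h0] at hrh
  have hq0 : q ≠ 0 := right_ne_zero_of_mul hr0
  have e : E = h ^ 3 * q ^ 5 := by
    refine mul_right_cancel₀ (pow_ne_zero 2 h0) ?_
    rw [hE]; ring
  have e1 : D E ^ 2 / E = h * q ^ 3 * (3 * D h * q + 5 * h * D q) ^ 2 := by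
    rw [e, D.leibniz, derivation_fifth_pow, derivation_cube]
    simp only [smul_eq_mul]
    field_simp
    ring
  rw [e1]
  exact mul_mem (mul_mem hhV (pow_mem hrh 3)) (pow_mem (add_mem
    (mul_mem (mul_mem (natCast_mem V 3) (mem_of_eq hDh)) hrh)
    (mul_mem (mul_mem (natCast_mem V 5) hhV) (hD.stable V hV q hrh))) 2)

lemma false_of_fifth_power {D : Derivation k Φ Φ} (hD : GoodDer D) {u : Φ} (hDu : D u = 1) {c : k}
    (hc : c ≠ 0) {X r : Φ} (he : 1 + X ^ 5 ≠ 0) (hh0 : u ^ 25 + algebraMap k Φ c ≠ 0)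
    (h : 1 + X ^ 5 = (u ^ 25 + algebraMap k Φ c) ^ 2 * r ^ 5 ∨
      (1 + X ^ 5) * (u ^ 25 + algebraMap k Φ c) ^ 2 = r ^ 5) : False := by
  have hcΦ : algebraMap k Φ c ≠ 0 := by simpa using hc
  have hu0 : u ∉ (algebraMap k Φ).range := by
    rintro ⟨a, rfl⟩
    rw [D.map_algebraMap] at hDu
    exact zero_ne_one hDu
  set H := u ^ 25 + algebraMap k Φ c with hH
  have hX : X ∈ (algebraMap k Φ).range := by
    refine mem_range_of_one_add_pow hD he fun V hV hlt => ?_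
    have hcV := val_const hV hc
    by_cases hloc : LocFifth V (H ^ 2)
    · refine LocFifth.sq_div_mem hD hV ?_ he hlt
      rcases h with h | h
      · rw [h]; exact hloc.mul (LocFifth.of_pow V r)
      · rw [← eq_div_iff (pow_ne_zero 2 hh0)] at h
        rw [h]; exact (LocFifth.of_pow V r).div hloc
    · have huV : u ∈ V := by
        by_contra huV
        apply hloc
        have h1 := lt_inv_of_notMem huV
        have h0 := notMem_ne_zero huV
        have e : H ^ 2 = (1 + u⁻¹ ^ 25 * algebraMap k Φ c) ^ 2 * (u ^ 10) ^ 5 := by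
          rw [hH]; field_simp
        exact ⟨_, _, eq_pow (eq_add_lt (map_one _)
          (lt_mul_right (lt_pow h1 (by norm_num)) (mem_of_eq hcV))) 2, e⟩
      have hHlt : V.valuation H < 1 := by
        rcases lt_or_eq (V := V) (a := H) (add_mem (pow_mem huV 25) (hV c)) with h | h
        · exact h
        · exact absurd (LocFifth.of_unit (eq_pow h 2)) hloc
      have hu1 : V.valuation u = 1 := by
        rcases lt_or_eq huV with h | h
        · have := lt_sub hHlt (lt_pow h (n := 25) (by norm_num))
          rw [hH, add_sub_cancel_left, hcV] at this
          exact absurd this (lt_irrefl _)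
        · exact h
      have hDH : V.valuation (D H) = 1 := by
        have e : D H = ((25 : ℕ) : Φ) * u ^ 24 := by
          rw [hH, map_add, D.map_algebraMap, D.leibniz_pow, hDu]
          simp
        rw [e]
        exact eq_mul (val_ofNat k hV 25 (by norm_num)) (eq_pow hu1 24)
      rcases h with h | h
      · rw [h] at hlt ⊢
        exact sq_div_mem_of_eq_sq_mul hD hV hHlt hDH hh0 hlt
      · exact sq_div_mem_of_mul_sq_eq hD hV hHlt hDH hh0 he hlt h
  obtain ⟨x, hx⟩ := hX
  obtain ⟨b, hb⟩ := IsAlgClosed.exists_pow_nat_eq (1 + x ^ 5) (n := 5) (by norm_num)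
  have hb' : 1 + X ^ 5 = algebraMap k Φ b ^ 5 := by rw [← map_pow, hb, ← hx]; simp
  have hb0 : algebraMap k Φ b ≠ 0 := by
    intro h0
    rw [hb', h0] at he
    norm_num at he
  rw [hb'] at h
  obtain ⟨s, hs⟩ : ∃ s, H ^ 2 = s ^ 5 := by
    rcases h with h | h
    · have hr0 : r ≠ 0 := by
        rintro rfl
        exact pow_ne_zero 5 hb0 (by rw [h]; norm_num)
      exact ⟨algebraMap k Φ b / r, by rw [div_pow, h]; field_simp⟩
    · exact ⟨r / algebraMap k Φ b, by rw [div_pow, ← h]; field_simp⟩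
  obtain ⟨d, hd⟩ := IsAlgClosed.exists_pow_nat_eq c (n := 5) (by norm_num)
  have hd0 : algebraMap k Φ d ≠ 0 := by
    intro h0
    apply hcΦ
    rw [← hd, map_pow, h0]; norm_num
  have hH5 : H = (s ^ 3 / H) ^ 5 := by
    rw [div_pow, eq_div_iff (pow_ne_zero 5 hh0)]
    linear_combination (H ^ 4 + H ^ 2 * s ^ 5 + s ^ 10) * hs
  have e : 1 + (u ^ 5 / algebraMap k Φ d) ^ 5 = (s ^ 3 / H / algebraMap k Φ d) ^ 5 := by
    rw [div_pow (s ^ 3 / H), ← hH5, hH, ← hd, map_pow]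
    field_simp
    ring
  have : u ^ 5 / algebraMap k Φ d ∈ (algebraMap k Φ).range := by
    refine mem_range_of_locFifth hD ?_ fun V hV => ?_
    · rw [e, div_pow, ← hH5]; exact div_ne_zero hh0 (pow_ne_zero 5 hd0)
    · rw [e]; exact LocFifth.of_pow V _
  refine hu0 (mem_range_of_pow_mem (n := 5) (by norm_num) ?_)
  have := mul_mem this ⟨d, rfl⟩
  rwa [div_mul_cancel₀ _ hd0] at this

end FunctionField

section Omega

variable {Ω : Type} [Field Ω] [Algebra ℂ Ω]

variable {m : ℕ} {τ₁ τ₂ : ℕ → Ω} {ξ₁ ω₁ y₁ ξ₂ ω₂ y₂ : Ω}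

lemma Iio_succ_image (τ : ℕ → Ω) (m : ℕ) :
    τ '' Set.Iio (m + 1) = τ '' Set.Iio m ∪ {τ m} := by
  ext x
  simp only [Set.mem_image, Set.mem_Iio, Set.mem_union, Set.mem_singleton_iff]
  constructor
  · rintro ⟨i, hi, rfl⟩
    rcases Nat.lt_succ_iff_lt_or_eq.mp hi with h | rfl
    · exact Or.inl ⟨i, h, rfl⟩
    · exact Or.inr rfl
  · rintro (⟨i, hi, rfl⟩ | rfl)
    · exact ⟨i, Nat.lt_succ_of_lt hi, rfl⟩
    · exact ⟨m, Nat.lt_succ_self m, rfl⟩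

lemma notMem_acl_last {τ : ℕ → Ω} (h : AlgebraicIndependent ℂ (fun i : Fin (m + 1) => τ i)) :
    τ m ∉ acl (τ '' Set.Iio m) := by
  have := notMem_acl_image h (i := Fin.last m) (T := {i | i ≠ Fin.last m}) (by simp)
  have e : (fun i : Fin (m + 1) => τ i) '' {i | i ≠ Fin.last m} = τ '' Set.Iio m := by
    ext x
    constructor
    · rintro ⟨i, hi, rfl⟩
      exact ⟨i, Fin.val_lt_last hi, rfl⟩
    · rintro ⟨i, hi, rfl⟩
      refine ⟨⟨i, Nat.lt_succ_of_lt hi⟩, ?_, rfl⟩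
      have hi' : i < m := hi
      simp only [Set.mem_ofPred_eq, ne_eq, Fin.ext_iff, Fin.val_last]
      omega
  rw [e] at this
  exact this

theorem Twist.false_of_eq [IsAlgClosed Ω] (h₁ : Twist (m + 1) 1 τ₁ ξ₁ ω₁ y₁)
    (h₂ : Twist (m + 1) 2 τ₂ ξ₂ ω₂ y₂)
    (hM : twistField (m + 1) τ₂ ξ₂ ω₂ y₂ = twistField (m + 1) τ₁ ξ₁ ω₁ y₁) : False := by
  obtain ⟨h12, -, δ, hδ, hrel⟩ := h₁.exists_hseq_relation h₂ hM
  set L := acl (τ₂ '' Set.Iio m) with hL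
  have huL : τ₂ m ∉ L := notMem_acl_last h₂.indep
  have hczΩ := charZero_omega Ω
  let E := IntermediateField.adjoin L ({τ₂ m} : Set Ω)
  have hsub : ∀ x ∈ IntermediateField.adjoin ℂ (τ₂ '' Set.Iio (m + 1)), x ∈ E := by
    have : IntermediateField.adjoin ℂ (τ₂ '' Set.Iio (m + 1)) ≤ E.restrictScalars ℂ := by
      rw [IntermediateField.adjoin_le_iff, Iio_succ_image]
      rintro x (hx | rfl)
      · exact E.algebraMap_mem (⟨x, subset_acl _ hx⟩ : L)
      · exact IntermediateField.subset_adjoin L _ rfl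
    exact this
  let Φ := E
  let u : Φ := ⟨τ₂ m, IntermediateField.subset_adjoin L _ rfl⟩
  have htop : IntermediateField.adjoin L ({u} : Set Φ) = ⊤ := by
    refine Eq.trans ?_ (adjoin_val_eq_top (k := L) ({τ₂ m} : Set Ω))
    congr 1; ext a; simp [Φ, E, u, Subtype.ext_iff]
  have hutr : Transcendental L u := by
    have h := transcendental_of_notMem_acl huL
    intro h'
    exact h ((isAlgebraic_algebraMap_iff (R := L) (A := Ω) (algebraMap Φ Ω).injective).mpr h')
  obtain ⟨D, hDu⟩ := exists_derivation_eq_one hutr (by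
    rw [htop]
    exact ⟨fun x => isAlgebraic_algebraMap (⟨x, IntermediateField.mem_top⟩ :
      (⊤ : IntermediateField L Φ))⟩)
  have hD := goodDer_of_simple htop D (Or.inl hDu)
  have hk₁ := hseq_ne_zero h₁.indep (Nat.le_succ m)
  have hk₁' := hseq_ne_zero h₁.indep le_rfl
  have hk₂ := hseq_ne_zero h₂.indep (Nat.le_succ m)
  have hk₂' := hseq_ne_zero h₂.indep le_rfl
  have hm1 : hseq τ₁ m ∈ E := hseq_mem E.toSubring fun i hi =>
    hsub _ (h12 i (Nat.lt_succ_of_lt hi))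
  have hm2 : hseq τ₂ m ∈ L := hseq_mem L.toSubring fun i hi => subset_acl _ ⟨i, hi, rfl⟩
  have hτ : τ₁ m ∈ E := hsub _ (h12 m (Nat.lt_succ_self m))
  have hδE := hsub _ hδ
  rw [hseq] at hk₁' hk₂'
  have e : 1 + (τ₁ m ^ 5 / hseq τ₁ m) ^ 5 = (τ₁ m ^ 25 + hseq τ₁ m ^ 5) / hseq τ₁ m ^ 5 := by
    field_simp; ring
  let X : Φ := ⟨τ₁ m ^ 5 / hseq τ₁ m, div_mem (pow_mem hτ 5) hm1⟩
  let r : Φ := ⟨δ / hseq τ₁ m, div_mem hδE hm1⟩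
  let c : L := ⟨hseq τ₂ m ^ 5, pow_mem hm2 5⟩
  have hcΩ : ((algebraMap L Φ c : Φ) : Ω) = hseq τ₂ m ^ 5 := rfl
  refine false_of_fifth_power hD hDu (c := c) (X := X) (r := r) ?_ ?_ ?_ ?_
  · intro h0; exact pow_ne_zero 5 hk₂ (congrArg Subtype.val h0)
  · intro h0
    have := congrArg Subtype.val h0
    change 1 + (τ₁ m ^ 5 / hseq τ₁ m) ^ 5 = 0 at this
    rw [e] at this
    exact div_ne_zero hk₁' (pow_ne_zero 5 hk₁) this
  · intro h0
    exact hk₂' (congrArg Subtype.val h0)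
  · rcases hrel with h | h
    · right
      apply Subtype.ext
      change (1 + (τ₁ m ^ 5 / hseq τ₁ m) ^ 5) * (τ₂ m ^ 25 + hseq τ₂ m ^ 5) ^ 2 =
        (δ / hseq τ₁ m) ^ 5
      rw [e, div_pow, ← h, hseq, hseq]
      field_simp
    · left
      apply Subtype.ext
      change 1 + (τ₁ m ^ 5 / hseq τ₁ m) ^ 5 = (τ₂ m ^ 25 + hseq τ₂ m ^ 5) ^ 2 *
        (δ / hseq τ₁ m) ^ 5
      rw [e, div_pow]
      rw [hseq, hseq] at h
      rw [h]
      field_simp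

lemma Twist.le_of_adjoin_le [IsAlgClosed Ω] {m e : ℕ} {τ : ℕ → Ω} {ξ ω y : Ω}
    (h : Twist m e τ ξ ω y) (he : e = 1 ∨ e = 2) {K : IntermediateField ℂ Ω} {s : Ω}
    (hs : s ∉ acl (K : Set Ω))
    (hM : twistField m τ ξ ω y ≤ IntermediateField.adjoin ℂ ((K : Set Ω) ∪ {s})) :
    twistField m τ ξ ω y ≤ K := by
  have h1 : twistField m τ ξ ω y ≤ acl (K : Set Ω) := by
    refine h.rigid he (u := s) ?_
    intro x hx
    let E := IntermediateField.adjoin (acl (K : Set Ω)) ({s} : Set Ω)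
    have : IntermediateField.adjoin ℂ ((K : Set Ω) ∪ {s}) ≤ E.restrictScalars ℂ := by
      rw [IntermediateField.adjoin_le_iff]
      rintro x (hx | rfl)
      · exact E.algebraMap_mem (⟨x, subset_acl _ hx⟩ : acl (K : Set Ω))
      · exact IntermediateField.subset_adjoin (acl (K : Set Ω)) _ rfl
    exact this (hM hx)
  exact fun x hx => mem_of_mem_adjoin_transcendental hs (h1 hx) (hM hx)

theorem Twist.false_of_adjoin_eq [IsAlgClosed Ω] (h₁ : Twist (m + 1) 1 τ₁ ξ₁ ω₁ y₁)
    (h₂ : Twist (m + 1) 2 τ₂ ξ₂ ω₂ y₂) {s₁ s₂ : Ω}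
    (hs₁ : s₁ ∉ acl (twistField (m + 1) τ₁ ξ₁ ω₁ y₁ : Set Ω))
    (hs₂ : s₂ ∉ acl (twistField (m + 1) τ₂ ξ₂ ω₂ y₂ : Set Ω))
    (hM : IntermediateField.adjoin ℂ ((twistField (m + 1) τ₁ ξ₁ ω₁ y₁ : Set Ω) ∪ {s₁}) =
      IntermediateField.adjoin ℂ ((twistField (m + 1) τ₂ ξ₂ ω₂ y₂ : Set Ω) ∪ {s₂})) : False := by
  refine h₁.false_of_eq h₂ (le_antisymm ?_ ?_)
  · refine h₂.le_of_adjoin_le (Or.inr rfl) hs₁ (le_trans ?_ hM.ge)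
    exact fun x hx => IntermediateField.subset_adjoin _ _ (Or.inl hx)
  · refine h₁.le_of_adjoin_le (Or.inl rfl) hs₂ (le_trans ?_ hM.le)
    exact fun x hx => IntermediateField.subset_adjoin _ _ (Or.inl hx)

end Omega

end CremonaPlaces

namespace CremonaPlaces

section Gauss

lemma ker_le_span_of_irreducible {B Ω : Type} [CommRing B] [IsDomain B] [UniqueFactorizationMonoid B]
    [Field Ω] (φ : Polynomial B →+* Ω) (hinj : Function.Injective (φ.comp Polynomial.C))
    {q : Polynomial B} (hq : Irreducible q) (hφ : φ q = 0) {f : Polynomial B} (hf : φ f = 0) :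
    q ∣ f := by
  let K := FractionRing B
  have : NormalizedGCDMonoid B := Classical.choice inferInstance
  have hdeg : q.natDegree ≠ 0 := by
    intro h
    rw [Polynomial.eq_C_of_natDegree_eq_zero h] at hφ hq
    have h0 : q.coeff 0 = 0 := hinj (by simpa using hφ)
    rw [h0, Polynomial.C_0] at hq
    exact hq.ne_zero rfl
  have hprim := hq.isPrimitive hdeg
  have hirr : Irreducible (q.map (algebraMap B K)) :=
    (hprim.irreducible_iff_irreducible_map_fraction_map (K := K)).mp hq
  let j : K →+* Ω := IsFractionRing.lift hinj
  have hj : ∀ g : Polynomial B, (g.map (algebraMap B K)).eval₂ j (φ Polynomial.X) = φ g := by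
    intro g
    rw [Polynomial.eval₂_map]
    have e : j.comp (algebraMap B K) = φ.comp Polynomial.C := by
      ext b; simp [j, IsFractionRing.lift_algebraMap]
    rw [e, ← Polynomial.hom_eval₂]
    simp
  refine hprim.dvd_of_fraction_map_dvd_fraction_map (K := K) ?_
  by_contra hnd
  obtain ⟨a, b, hab⟩ := (hirr.coprime_iff_not_dvd).mpr hnd
  have := congrArg (Polynomial.eval₂ j (φ Polynomial.X)) hab
  simp only [Polynomial.eval₂_add, Polynomial.eval₂_mul, hj, hφ, hf, mul_zero, add_zero,
    Polynomial.eval₂_one] at this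
  exact zero_ne_one this

/-- Regard a polynomial as a polynomial in the `i`-th variable. -/
def polyEquiv {n : ℕ} (i : Fin (n + 1)) :
    MvPolynomial (Fin (n + 1)) ℂ ≃ₐ[ℂ] Polynomial (MvPolynomial (Fin n) ℂ) :=
  (renameEquiv ℂ (_root_.finSuccEquiv' i)).trans (optionEquivLeft ℂ (Fin n))

lemma polyEquiv_succAbove {n : ℕ} (i : Fin (n + 1)) (j : Fin n) :
    polyEquiv i (X (i.succAbove j)) = Polynomial.C (X j) := by
  simp [polyEquiv, finSuccEquiv'_succAbove]

lemma polyEquiv_symm_C {n : ℕ} (i : Fin (n + 1)) (p : MvPolynomial (Fin n) ℂ) :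
    (polyEquiv i).symm (Polynomial.C p) = rename i.succAbove p := by
  rw [AlgEquiv.symm_apply_eq]
  let f : MvPolynomial (Fin n) ℂ →ₐ[ℂ] Polynomial (MvPolynomial (Fin n) ℂ) :=
    Algebra.ofId (MvPolynomial (Fin n) ℂ) (Polynomial (MvPolynomial (Fin n) ℂ)) |>.restrictScalars ℂ
  let g : MvPolynomial (Fin n) ℂ →ₐ[ℂ] Polynomial (MvPolynomial (Fin n) ℂ) :=
    (polyEquiv i).toAlgHom.comp (rename i.succAbove)
  have : f = g := by
    ext j : 1
    simp only [g, AlgHom.comp_apply, rename_X]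
    exact (polyEquiv_succAbove i j).symm
  exact DFunLike.congr_fun this p

lemma ker_aeval_le_span {Ω : Type} [Field Ω] [Algebra ℂ Ω] {n : ℕ} (t : Fin (n + 1) → Ω)
    (i : Fin (n + 1)) (ht : AlgebraicIndependent ℂ (fun j => t (i.succAbove j)))
    {q : MvPolynomial (Fin (n + 1)) ℂ} (hq : Irreducible q) (h : aeval t q = 0)
    {f : MvPolynomial (Fin (n + 1)) ℂ} (hf : aeval t f = 0) : q ∣ f := by
  have h1 := ker_le_span_of_irreducible
    ((aeval (R := ℂ) t).toRingHom.comp (polyEquiv i).symm.toAlgHom.toRingHom) (q := polyEquiv i q)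
    (f := polyEquiv i f) ?_ ((MulEquiv.irreducible_iff (polyEquiv i)).mpr hq) (by simpa using h)
    (by simpa using hf)
  · exact (map_dvd_iff (polyEquiv i)).mp h1
  · intro a b hab
    have e : ∀ p : MvPolynomial (Fin n) ℂ, aeval t ((polyEquiv i).symm (Polynomial.C p)) =
        aeval (fun j => t (i.succAbove j)) p := by
      intro p; rw [polyEquiv_symm_C, aeval_rename]; rfl
    apply ht
    rw [← e, ← e]
    exact hab

lemma exists_degree_ne_zero {n : ℕ} {p : MvPolynomial (Fin (n + 1)) ℂ} (hp : p ≠ 0)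
    (hu : ¬ IsUnit p) : ∃ i : Fin (n + 1), (polyEquiv i p).natDegree ≠ 0 := by
  by_contra hcon
  push Not at hcon
  apply hu
  have key : ∀ i, ∀ m ∈ p.support, m i = 0 := by
    intro i m hm
    obtain ⟨b, hb⟩ : ∃ b, polyEquiv i p = Polynomial.C b :=
      ⟨_, Polynomial.eq_C_of_natDegree_eq_zero (hcon i)⟩
    have e : p = rename i.succAbove b := by
      rw [← polyEquiv_symm_C, ← hb, AlgEquiv.symm_apply_apply]
    rw [e] at hm
    obtain ⟨u, rfl, -⟩ := coeff_rename_ne_zero _ _ _ (mem_support_iff.mp hm)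
    exact Finsupp.mapDomain_of_notMem_range _ _ (by simp)
  have : p.totalDegree = 0 := by
    rw [totalDegree_eq_zero_iff]
    exact fun m hm i => key i m hm
  rw [totalDegree_eq_zero_iff_eq_C] at this
  rw [this] at hp ⊢
  refine (isUnit_iff_ne_zero.mpr ?_).map C
  intro h0
  rw [h0, C_0] at hp
  exact hp rfl

lemma exists_independent_mod {Ω : Type} [Field Ω] [Algebra ℂ Ω] {n : ℕ} (t : Fin (n + 1) → Ω)
    {p : MvPolynomial (Fin (n + 1)) ℂ} (hp : p ≠ 0) (hu : ¬ IsUnit p)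
    (h : ∀ f, aeval t f = 0 → p ∣ f) :
    ∃ i : Fin (n + 1), AlgebraicIndependent ℂ (fun j => t (i.succAbove j)) := by
  obtain ⟨i, hi⟩ := exists_degree_ne_zero hp hu
  refine ⟨i, ?_⟩
  rw [algebraicIndependent_iff]
  intro f hf
  have hd := h (rename i.succAbove f) (by rw [aeval_rename]; exact hf)
  have hd' := map_dvd (polyEquiv i) hd
  rw [← polyEquiv_symm_C, AlgEquiv.apply_symm_apply] at hd'
  by_contra hf0
  have := Polynomial.natDegree_le_of_dvd hd' (by simpa using hf0)
  rw [Polynomial.natDegree_C] at this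
  omega

end Gauss

section Rank

variable {Ω : Type} [Field Ω] [Algebra ℂ Ω]

lemma algebraicIndependent_of_forall_notMem {n : ℕ} {t : Fin n → Ω}
    (h : ∀ i, t i ∉ acl (t '' {i}ᶜ)) : AlgebraicIndependent ℂ t := by
  classical
  have key : ∀ s : Finset (Fin n), (s.card : ℕ∞) ≤ rk (t '' (s : Set (Fin n))) := by
    intro s
    induction s using Finset.induction_on with
    | empty => simp
    | insert a s has ih =>
      rw [Finset.coe_insert, Set.image_insert_eq, rk_insert_of_notMem, Finset.card_insert_of_notMem has]
      · push_cast
        gcongr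
      · intro h'
        refine h a (acl_mono (Set.image_mono ?_) h')
        intro b hb hba
        exact has (by rw [Set.mem_singleton_iff] at hba; subst hba; exact hb)
  apply algebraicIndependent_of_le_rk
  have := key Finset.univ
  rwa [Finset.coe_univ, Set.image_univ, Finset.card_univ] at this

lemma exists_succAbove_independent {n : ℕ} {t : Fin (n + 1) → Ω}
    (h : (n : ℕ∞) ≤ rk (Set.range t)) :
    ∃ i : Fin (n + 1), AlgebraicIndependent ℂ (fun j => t (i.succAbove j)) := by
  by_cases hall : ∀ i, t i ∉ acl (t '' {i}ᶜ)
  · exact ⟨0, (algebraicIndependent_of_forall_notMem hall).comp _ Fin.succAbove_right_injective⟩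
  · push Not at hall
    obtain ⟨i, hi⟩ := hall
    refine ⟨i, algebraicIndependent_of_le_rk ?_⟩
    rw [Fintype.card_fin]
    refine h.trans (rk_le_of_subset_acl ?_)
    have e : Set.range (fun j => t (i.succAbove j)) = t '' {i}ᶜ := by
      rw [← Fin.range_succAbove, ← Set.range_comp]; rfl
    rw [e]
    rintro _ ⟨j, rfl⟩
    rcases eq_or_ne j i with rfl | hj
    · exact hi
    · exact subset_acl _ ⟨j, hj, rfl⟩

end Rank

section PrimeValuation

variable {A F : Type} [CommRing A] [IsDomain A] [UniqueFactorizationMonoid A] [Field F]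
  [Algebra A F] [IsFractionRing A F]

lemma exists_fraction_isRelPrime (A : Type) {F : Type} [CommRing A] [IsDomain A]
    [UniqueFactorizationMonoid A] [Field F] [Algebra A F] [IsFractionRing A F] (f : F) :
    ∃ a b : A, b ≠ 0 ∧ IsRelPrime a b ∧ f = algebraMap A F a / algebraMap A F b := by
  refine ⟨IsFractionRing.num A f, IsFractionRing.den A f, ?_, IsFractionRing.num_den_reduced A f, ?_⟩
  · exact nonZeroDivisors.ne_zero (IsFractionRing.den A f).2
  · exact (IsFractionRing.mk'_num_den' A f).symm

/-- The valuation subring attached to a prime element of a factorial ring. -/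
def primeVal (F : Type) [Field F] [Algebra A F] [IsFractionRing A F] (p : A) (hp : Prime p) :
    ValuationSubring F where
  carrier := {f | ∃ a b : A, ¬ p ∣ b ∧ f * algebraMap A F b = algebraMap A F a}
  mul_mem' := by
    rintro f g ⟨a, b, hb, h⟩ ⟨a', b', hb', h'⟩
    refine ⟨a * a', b * b', fun hd => (hp.dvd_or_dvd hd).elim hb hb', ?_⟩
    rw [map_mul, map_mul, ← h, ← h']; ring
  one_mem' := ⟨1, 1, hp.not_dvd_one, by simp⟩
  add_mem' := by
    rintro f g ⟨a, b, hb, h⟩ ⟨a', b', hb', h'⟩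
    refine ⟨a * b' + a' * b, b * b', fun hd => (hp.dvd_or_dvd hd).elim hb hb', ?_⟩
    rw [map_mul, map_add, map_mul, map_mul, ← h, ← h']; ring
  zero_mem' := ⟨0, 1, hp.not_dvd_one, by simp⟩
  neg_mem' := by
    rintro f ⟨a, b, hb, h⟩
    exact ⟨-a, b, hb, by rw [map_neg, ← h]; ring⟩
  mem_or_inv_mem' := by
    intro f
    obtain ⟨a, b, hb, hab, rfl⟩ := exists_fraction_isRelPrime A f
    have hb' : algebraMap A F b ≠ 0 := by simpa using hb
    by_cases hpb : p ∣ b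
    · have hpa : ¬ p ∣ a := fun h => hp.not_isUnit (hab h hpb)
      have ha' : algebraMap A F a ≠ 0 := by
        rw [Ne, FaithfulSMul.algebraMap_eq_zero_iff]; rintro rfl; exact hpa (dvd_zero p)
      exact Or.inr ⟨b, a, hpa, by field_simp⟩
    · exact Or.inl ⟨a, b, hpb, by field_simp⟩

lemma mem_primeVal {p : A} {hp : Prime p} {f : F} :
    f ∈ primeVal F p hp ↔ ∃ a b : A, ¬ p ∣ b ∧ f * algebraMap A F b = algebraMap A F a := Iff.rfl

lemma algebraMap_mem_primeVal {p : A} {hp : Prime p} (a : A) :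
    algebraMap A F a ∈ primeVal F p hp := ⟨a, 1, hp.not_dvd_one, by simp⟩

lemma inv_mem_primeVal {p : A} {hp : Prime p} {b : A} (hb : ¬ p ∣ b) :
    (algebraMap A F b)⁻¹ ∈ primeVal F p hp := by
  refine ⟨1, b, hb, ?_⟩
  have : algebraMap A F b ≠ 0 := by
    rw [Ne, FaithfulSMul.algebraMap_eq_zero_iff]; rintro rfl; exact hb (dvd_zero p)
  rw [inv_mul_cancel₀ this, map_one]

lemma inv_notMem_primeVal {p : A} {hp : Prime p} {b : A} (hb : p ∣ b) (hb0 : b ≠ 0) :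
    (algebraMap A F b)⁻¹ ∉ primeVal F p hp := by
  rintro ⟨a, c, hc, h⟩
  have hb' : algebraMap A F b ≠ 0 := by simpa using hb0
  have : c = b * a := by
    apply IsFractionRing.injective A F
    rw [map_mul, ← h]; field_simp
  exact hc (this ▸ hb.mul_right a)

lemma primeVal_congr {p q : A} (hp : Prime p) (hq : Prime q) (h : Associated p q) :
    primeVal F p hp = primeVal F q hq := by
  ext f
  simp only [mem_primeVal, h.dvd_iff_dvd_left]

lemma primeVal_ne_top {p : A} (hp : Prime p) : primeVal F p hp ≠ ⊤ := fun h =>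
  inv_notMem_primeVal (F := F) (hp := hp) dvd_rfl hp.ne_zero (h ▸ trivial)

lemma eq_primeVal_of_dominates {W : ValuationSubring F} (hW : ∀ a : A, algebraMap A F a ∈ W)
    {p : A} (hp : Prime p) (hinv : ∀ a : A, a ≠ 0 → ((algebraMap A F a)⁻¹ ∈ W ↔ ¬ p ∣ a)) :
    W = primeVal F p hp := by
  apply le_antisymm
  · intro f hf
    obtain ⟨a, b, hb, hab, rfl⟩ := exists_fraction_isRelPrime A f
    have hb' : algebraMap A F b ≠ 0 := by simpa using hb
    by_cases hpb : p ∣ b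
    · exfalso
      have hpa : ¬ p ∣ a := fun h => hp.not_isUnit (hab h hpb)
      have ha : a ≠ 0 := by rintro rfl; exact hpa (dvd_zero p)
      have ha' : algebraMap A F a ≠ 0 := by simpa using ha
      refine (hinv b hb).not.mpr (not_not.mpr hpb) ?_
      have := mul_mem hf ((hinv a ha).mpr hpa)
      convert this using 1
      field_simp
    · exact ⟨a, b, hpb, by field_simp⟩
  · rintro f ⟨a, b, hb, h⟩
    have hb0 : b ≠ 0 := by rintro rfl; exact hb (dvd_zero p)
    have hb' : algebraMap A F b ≠ 0 := by simpa using hb0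
    rw [← eq_div_iff hb'] at h
    rw [h, div_eq_mul_inv]
    exact mul_mem (hW a) ((hinv b hb0).mpr hb)

end PrimeValuation

end CremonaPlaces

namespace CremonaPlaces

section Commensuration

lemma ncard_sub_ncard_eq {Y : Type} {S T U : Set Y} (hU : U.Finite) (h₁ : S \ T ⊆ U)
    (h₂ : T \ S ⊆ U) :
    ((S \ T).ncard : ℤ) - (T \ S).ncard = (S ∩ U).ncard - (T ∩ U).ncard := by
  have e : ∀ A B : Set Y, A \ B ⊆ U → ((A ∩ U).ncard : ℤ) = (A \ B).ncard + (A ∩ B ∩ U).ncard := by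
    intro A B hAB
    have : A ∩ U = (A \ B) ∪ (A ∩ B ∩ U) := by
      ext x
      have := @hAB x
      simp only [Set.mem_inter_iff, Set.mem_union, Set.mem_sdiff] at *
      tauto
    rw [this, Set.ncard_union_eq _ (hU.subset hAB) (hU.subset Set.inter_subset_right)]
    · push_cast; rfl
    · rw [Set.disjoint_left]
      rintro x ⟨-, hx⟩ ⟨⟨-, hx'⟩, -⟩
      exact hx hx'
  rw [e S T h₁, e T S h₂, Set.inter_comm T S]
  ring

open Pointwise in
/-- A commensurated subset of a `G`-set yields a homomorphism from `G` to the integers. -/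
lemma exists_hom_of_commensurated {G Y : Type} [Group G] [MulAction G Y] (S : Set Y)
    (h : ∀ g : G, {x ∈ S | g • x ∉ S}.Finite) :
    ∃ f : G →* Multiplicative ℤ, ∀ g, f g =
      Multiplicative.ofAdd (((g • S \ S).ncard : ℤ) - (S \ g • S).ncard) := by
  have h1 : ∀ g : G, (g • S \ S).Finite := by
    intro g
    refine ((h g).image (fun x => g • x)).subset ?_
    rintro _ ⟨⟨x, hx, rfl⟩, hx'⟩
    exact ⟨x, ⟨hx, hx'⟩, rfl⟩
  have h2 : ∀ g : G, (S \ g • S).Finite := by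
    intro g
    refine (h g⁻¹).subset ?_
    rintro x ⟨hx, hx'⟩
    exact ⟨hx, fun h => hx' (Set.mem_smul_set_iff_inv_smul_mem.mpr h)⟩
  refine ⟨MonoidHom.mk' (fun g => Multiplicative.ofAdd (((g • S \ S).ncard : ℤ) -
    (S \ g • S).ncard)) ?_, fun g => rfl⟩
  intro g k
  rw [← ofAdd_add]
  congr 1
  have e1 : ((k • S \ S).ncard : ℤ) - (S \ k • S).ncard =
      (((g * k) • S \ g • S).ncard : ℤ) - (g • S \ (g * k) • S).ncard := by
    rw [mul_smul, ← Set.smul_set_sdiff, ← Set.smul_set_sdiff, Set.ncard_smul_set, Set.ncard_smul_set]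
  have f1 : ((g * k) • S \ g • S).Finite := by
    rw [mul_smul, ← Set.smul_set_sdiff]; exact (h1 k).image _
  have f2 : (g • S \ (g * k) • S).Finite := by
    rw [mul_smul, ← Set.smul_set_sdiff]; exact (h2 k).image _
  rw [e1]
  let U := ((g * k) • S \ S) ∪ (S \ (g * k) • S) ∪ (g • S \ S) ∪ (S \ g • S) ∪
    ((g * k) • S \ g • S) ∪ (g • S \ (g * k) • S)
  have hU : U.Finite := ((((((h1 _).union (h2 _)).union (h1 _)).union (h2 _)).union f1).union f2)
  rw [ncard_sub_ncard_eq hU (S := (g * k) • S) (T := S), ncard_sub_ncard_eq hU (S := g • S) (T := S),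
    ncard_sub_ncard_eq hU (S := (g * k) • S) (T := g • S)]
  · ring
  all_goals
    intro x hx
    simp only [U, Set.mem_union]
    tauto

end Commensuration

section Place

variable {F Ω : Type} [Field F] [Algebra ℂ F] [Field Ω] [Algebra ℂ Ω]

/-- `ρ` restricts to a residue map of the valuation subring `V` with values in `Ω`. -/
structure IsPlace (V : ValuationSubring F) (ρ : F → Ω) : Prop where
  base : ∀ c : ℂ, algebraMap ℂ F c ∈ V
  const : ∀ c : ℂ, ρ (algebraMap ℂ F c) = algebraMap ℂ Ω c
  add : ∀ a ∈ V, ∀ b ∈ V, ρ (a + b) = ρ a + ρ b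
  mul : ∀ a ∈ V, ∀ b ∈ V, ρ (a * b) = ρ a * ρ b
  eq_zero : ∀ a ∈ V, a⁻¹ ∉ V → ρ a = 0

namespace IsPlace

variable {V : ValuationSubring F} {ρ : F → Ω} (h : IsPlace V ρ)
include h

lemma one : ρ 1 = 1 := by have := h.const 1; rwa [map_one, map_one] at this

lemma zero : ρ 0 = 0 := by have := h.const 0; rwa [map_zero, map_zero] at this

lemma neg {a : F} (ha : a ∈ V) : ρ (-a) = -ρ a := by
  rw [eq_neg_iff_add_eq_zero, ← h.add _ (neg_mem ha) _ ha, neg_add_cancel, h.zero]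

lemma sub {a b : F} (ha : a ∈ V) (hb : b ∈ V) : ρ (a - b) = ρ a - ρ b := by
  rw [sub_eq_add_neg, h.add _ ha _ (neg_mem hb), h.neg hb, sub_eq_add_neg]

lemma pow {a : F} (ha : a ∈ V) (n : ℕ) : ρ (a ^ n) = ρ a ^ n := by
  induction n with
  | zero => rw [pow_zero, pow_zero, h.one]
  | succ n ih => rw [pow_succ, pow_succ, h.mul _ (pow_mem ha n) _ ha, ih]

lemma ne_zero {a : F} (ha : a ∈ V) (ha' : a⁻¹ ∈ V) (h0 : a ≠ 0) : ρ a ≠ 0 := by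
  intro h1
  have := h.mul _ ha _ ha'
  rw [mul_inv_cancel₀ h0, h.one, h1, zero_mul] at this
  exact one_ne_zero this

lemma inv_mem {a : F} (ha : a ∈ V) (h0 : ρ a ≠ 0) : a⁻¹ ∈ V := by
  by_contra h'
  exact h0 (h.eq_zero a ha h')

lemma inv {a : F} (ha : a ∈ V) (h0 : ρ a ≠ 0) : ρ a⁻¹ = (ρ a)⁻¹ := by
  have ha0 : a ≠ 0 := by rintro rfl; exact h0 h.zero
  have := h.mul _ ha _ (h.inv_mem ha h0)
  rw [mul_inv_cancel₀ ha0, h.one] at this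
  exact eq_inv_of_mul_eq_one_right this.symm

lemma div_mem {a b : F} (ha : a ∈ V) (hb : b ∈ V) (h0 : ρ b ≠ 0) : a / b ∈ V := by
  rw [div_eq_mul_inv]; exact mul_mem ha (h.inv_mem hb h0)

lemma div {a b : F} (ha : a ∈ V) (hb : b ∈ V) (h0 : ρ b ≠ 0) : ρ (a / b) = ρ a / ρ b := by
  rw [div_eq_mul_inv, h.mul _ ha _ (h.inv_mem hb h0), h.inv hb h0, div_eq_mul_inv]

lemma aeval_mem {ι : Type} {x : ι → F} (hx : ∀ i, x i ∈ V) (p : MvPolynomial ι ℂ) :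
    aeval x p ∈ V := by
  induction p using MvPolynomial.induction_on with
  | C a => simpa using h.base a
  | add p q hp hq => rw [map_add]; exact add_mem hp hq
  | mul_X p i hp => rw [map_mul, aeval_X]; exact mul_mem hp (hx i)

lemma aeval {ι : Type} {x : ι → F} (hx : ∀ i, x i ∈ V) (p : MvPolynomial ι ℂ) :
    ρ (MvPolynomial.aeval x p) = MvPolynomial.aeval (fun i => ρ (x i)) p := by
  induction p using MvPolynomial.induction_on with
  | C a => simpa using h.const a
  | add p q hp hq => rw [map_add, map_add, h.add _ (h.aeval_mem hx p) _ (h.aeval_mem hx q), hp, hq]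
  | mul_X p i hp =>
    rw [map_mul, map_mul, aeval_X, aeval_X, h.mul _ (h.aeval_mem hx p) _ (hx i), hp]

omit h in
/-- The field of residues of a place. -/
def resField (h : IsPlace V ρ) : IntermediateField ℂ Ω where
  carrier := ρ '' V
  mul_mem' := by
    rintro _ _ ⟨a, ha, rfl⟩ ⟨b, hb, rfl⟩
    exact ⟨a * b, mul_mem ha hb, h.mul a ha b hb⟩
  add_mem' := by
    rintro _ _ ⟨a, ha, rfl⟩ ⟨b, hb, rfl⟩
    exact ⟨a + b, add_mem ha hb, h.add a ha b hb⟩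
  algebraMap_mem' c := ⟨_, h.base c, h.const c⟩
  inv_mem' := by
    rintro _ ⟨a, ha, rfl⟩
    by_cases h0 : ρ a = 0
    · exact ⟨0, zero_mem V, by rw [h0, h.zero, inv_zero]⟩
    · exact ⟨a⁻¹, h.inv_mem ha h0, h.inv ha h0⟩

omit h in
lemma mem_resField {h : IsPlace V ρ} {x : Ω} : x ∈ h.resField ↔ ∃ a ∈ V, ρ a = x := Iff.rfl

lemma res_mem {a : F} (ha : a ∈ V) : ρ a ∈ h.resField := ⟨a, ha, rfl⟩

open Pointwise in
lemma smul (σ : F ≃ₐ[ℂ] F) : IsPlace (σ • V) (fun a => ρ (σ⁻¹ a)) := by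
  have hm : ∀ a, a ∈ σ • V ↔ σ⁻¹ a ∈ V := fun a =>
    ValuationSubring.mem_pointwise_smul_iff_inv_smul_mem
  constructor
  · intro c; rw [hm, AlgEquiv.commutes]; exact h.base c
  · intro c; rw [AlgEquiv.commutes]; exact h.const c
  · intro a ha b hb; rw [map_add]; exact h.add _ ((hm a).mp ha) _ ((hm b).mp hb)
  · intro a ha b hb; rw [map_mul]; exact h.mul _ ((hm a).mp ha) _ ((hm b).mp hb)
  · intro a ha ha'
    rw [hm, map_inv₀] at ha'
    exact h.eq_zero _ ((hm a).mp ha) ha'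

end IsPlace

open Classical in
/-- The extension by zero of a field-valued map on the residue field of a valuation subring. -/
def residueMap (V : ValuationSubring F) (i : IsLocalRing.ResidueField V →+* Ω) (a : F) : Ω :=
  if h : a ∈ V then i (IsLocalRing.residue V ⟨a, h⟩) else 0

lemma residueMap_of_mem {V : ValuationSubring F} (i : IsLocalRing.ResidueField V →+* Ω) {a : F}
    (h : a ∈ V) : residueMap V i a = i (IsLocalRing.residue V ⟨a, h⟩) := dif_pos h

lemma isPlace_residueMap {V : ValuationSubring F} (i : IsLocalRing.ResidueField V →+* Ω)
    (hV : ∀ c : ℂ, algebraMap ℂ F c ∈ V)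
    (hi : ∀ c : ℂ, i (IsLocalRing.residue V ⟨algebraMap ℂ F c, hV c⟩) = algebraMap ℂ Ω c) :
    IsPlace V (residueMap V i) := by
  refine ⟨hV, ?_, ?_, ?_, ?_⟩
  · intro c
    rw [residueMap_of_mem i (hV c), hi]
  · intro a ha b hb
    rw [residueMap_of_mem i ha, residueMap_of_mem i hb, residueMap_of_mem i (add_mem ha hb),
      ← map_add, ← map_add]
    rfl
  · intro a ha b hb
    rw [residueMap_of_mem i ha, residueMap_of_mem i hb, residueMap_of_mem i (mul_mem ha hb),
      ← map_mul, ← map_mul]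
    rfl
  · intro a ha ha'
    rw [residueMap_of_mem i ha]
    have : ¬ IsUnit (⟨a, ha⟩ : V) := by
      rintro ⟨u, hu⟩
      apply ha'
      have h1 : a * ((u⁻¹ : Vˣ) : V) = 1 := by
        have := congrArg Subtype.val u.mul_inv
        rw [hu] at this
        exact this
      rw [← eq_inv_of_mul_eq_one_right h1]
      exact Subtype.mem _
    have h0 : IsLocalRing.residue V ⟨a, ha⟩ = 0 :=
      Ideal.Quotient.eq_zero_iff_mem.mpr ((IsLocalRing.mem_maximalIdeal _).mpr this)
    rw [h0, map_zero]

lemma exists_isPlace {V : ValuationSubring F} (hV : ∀ c : ℂ, algebraMap ℂ F c ∈ V) :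
    ∃ (Ω : Type) (_ : Field Ω) (_ : IsAlgClosed Ω) (_ : Algebra ℂ Ω) (ρ : F → Ω), IsPlace V ρ := by
  let κ := IsLocalRing.ResidueField V
  let j : ℂ →+* V := (algebraMap ℂ F).codRestrict V.toSubring hV
  let i : κ →+* AlgebraicClosure κ := algebraMap κ (AlgebraicClosure κ)
  let _ : Algebra ℂ (AlgebraicClosure κ) := ((i.comp (IsLocalRing.residue V)).comp j).toAlgebra
  exact ⟨AlgebraicClosure κ, inferInstance, inferInstance, inferInstance, _,
    isPlace_residueMap i hV fun c => rfl⟩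

end Place

section RationalFunctions

open Pointwise

/-- The coordinates of the rational function field. -/
abbrev coord {n : ℕ} (i : Fin n) : RatFun ℂ n := algebraMap (MvPolynomial (Fin n) ℂ) _ (X i)

lemma aeval_coord {n : ℕ} (p : MvPolynomial (Fin n) ℂ) :
    aeval (fun i => coord i) p = algebraMap (MvPolynomial (Fin n) ℂ) (RatFun ℂ n) p := by
  have : aeval (R := ℂ) (fun i : Fin n => coord i) =
      IsScalarTower.toAlgHom ℂ (MvPolynomial (Fin n) ℂ) (RatFun ℂ n) := by
    ext i; simp [coord]
  rw [this]; rfl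

/-- The valuation subrings attached to the hypersurfaces of affine space. -/
def IsDiv {n : ℕ} (V : ValuationSubring (RatFun ℂ n)) : Prop :=
  ∃ (p : MvPolynomial (Fin n) ℂ) (hp : Prime p), V = primeVal (RatFun ℂ n) p hp

variable {Ω : Type} [Field Ω] [Algebra ℂ Ω] {n : ℕ}

lemma base_primeVal {p : MvPolynomial (Fin n) ℂ} {hp : Prime p} (c : ℂ) :
    algebraMap ℂ (RatFun ℂ n) c ∈ primeVal (RatFun ℂ n) p hp := by
  have := algebraMap_mem_primeVal (F := RatFun ℂ n) (hp := hp) (C c)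
  rwa [← aeval_coord, aeval_C] at this

lemma coord_mem_primeVal {p : MvPolynomial (Fin n) ℂ} {hp : Prime p} (i : Fin n) :
    coord i ∈ primeVal (RatFun ℂ n) p hp := algebraMap_mem_primeVal _

lemma IsPlace.algebraMap_eq {V : ValuationSubring (RatFun ℂ n)} {ρ : RatFun ℂ n → Ω}
    (h : IsPlace V ρ) (hx : ∀ i, coord i ∈ V) (f : MvPolynomial (Fin n) ℂ) :
    ρ (algebraMap _ _ f) = MvPolynomial.aeval (fun i => ρ (coord i)) f := by
  rw [← aeval_coord, h.aeval hx]

lemma IsPlace.aeval_eq_zero_iff {p : MvPolynomial (Fin n) ℂ} {hp : Prime p} {ρ : RatFun ℂ n → Ω}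
    (h : IsPlace (primeVal (RatFun ℂ n) p hp) ρ) (f : MvPolynomial (Fin n) ℂ) :
    MvPolynomial.aeval (fun i => ρ (coord i)) f = 0 ↔ p ∣ f := by
  rw [← h.algebraMap_eq coord_mem_primeVal]
  constructor
  · intro h0
    by_contra hf
    refine h.ne_zero (algebraMap_mem_primeVal f) (inv_mem_primeVal hf) ?_ h0
    rw [Ne, FaithfulSMul.algebraMap_eq_zero_iff]
    rintro rfl
    exact hf (dvd_zero p)
  · intro hf
    rcases eq_or_ne f 0 with rfl | h0
    · rw [map_zero, h.zero]
    · exact h.eq_zero _ (algebraMap_mem_primeVal f) (inv_notMem_primeVal hf h0)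

lemma IsPlace.resField_primeVal {p : MvPolynomial (Fin n) ℂ} {hp : Prime p} {ρ : RatFun ℂ n → Ω}
    (h : IsPlace (primeVal (RatFun ℂ n) p hp) ρ) :
    h.resField = IntermediateField.adjoin ℂ (Set.range fun i => ρ (coord i)) := by
  apply le_antisymm
  · rintro _ ⟨f, ⟨a, b, hb, hf⟩, rfl⟩
    have hb' : ρ (algebraMap _ _ b) ≠ 0 := by
      rw [h.algebraMap_eq coord_mem_primeVal, Ne, h.aeval_eq_zero_iff]; exact hb
    have hb0 : algebraMap _ (RatFun ℂ n) b ≠ 0 := by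
      intro h0; rw [h0, h.zero] at hb'; exact hb' rfl
    rw [← eq_div_iff hb0] at hf
    rw [hf, h.div (algebraMap_mem_primeVal a) (algebraMap_mem_primeVal b) hb',
      h.algebraMap_eq coord_mem_primeVal, h.algebraMap_eq coord_mem_primeVal]
    have hm : ∀ q : MvPolynomial (Fin n) ℂ, MvPolynomial.aeval (fun i => ρ (coord i)) q ∈
        IntermediateField.adjoin ℂ (Set.range fun i => ρ (coord i)) := fun q =>
      IntermediateField.algebra_adjoin_le_adjoin _ _ (by
        rw [Algebra.adjoin_range_eq_range_aeval]; exact ⟨q, rfl⟩)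
    exact _root_.div_mem (hm a) (hm b)
  · rw [IntermediateField.adjoin_le_iff]
    rintro _ ⟨i, rfl⟩
    exact h.res_mem (coord_mem_primeVal i)

lemma IsPlace.exists_independent {p : MvPolynomial (Fin (n + 1)) ℂ} {hp : Prime p}
    {ρ : RatFun ℂ (n + 1) → Ω} (h : IsPlace (primeVal (RatFun ℂ (n + 1)) p hp) ρ) :
    ∃ i : Fin (n + 1), AlgebraicIndependent ℂ (fun j => ρ (coord (i.succAbove j))) :=
  exists_independent_mod (fun i => ρ (coord i)) hp.ne_zero hp.not_isUnit fun f =>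
    (h.aeval_eq_zero_iff f).mp

lemma IsPlace.le_rk {p : MvPolynomial (Fin (n + 1)) ℂ} {hp : Prime p}
    {ρ : RatFun ℂ (n + 1) → Ω} (h : IsPlace (primeVal (RatFun ℂ (n + 1)) p hp) ρ) :
    (n : ℕ∞) ≤ rk (Set.range fun i => ρ (coord i)) := by
  obtain ⟨i, hi⟩ := h.exists_independent
  have := rk_range_of_algebraicIndependent hi
  rw [Fintype.card_fin] at this
  rw [← this]
  exact rk_mono (by rintro _ ⟨j, rfl⟩; exact ⟨_, rfl⟩)

/-- A nontrivial valuation subring whose coordinate residues have almost full rank is divisorial. -/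
lemma IsPlace.isDiv {W : ValuationSubring (RatFun ℂ (n + 1))} {ρ : RatFun ℂ (n + 1) → Ω}
    (h : IsPlace W ρ) (hx : ∀ i, coord i ∈ W)
    (hrk : (n : ℕ∞) ≤ rk (Set.range fun i => ρ (coord i))) (hW : W ≠ ⊤) : IsDiv W := by
  have hpoly : ∀ f : MvPolynomial (Fin (n + 1)) ℂ, algebraMap _ (RatFun ℂ (n + 1)) f ∈ W := by
    intro f; rw [← aeval_coord]; exact h.aeval_mem hx f
  have hinv : ∀ f : MvPolynomial (Fin (n + 1)) ℂ, f ≠ 0 →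
      ((algebraMap _ (RatFun ℂ (n + 1)) f)⁻¹ ∈ W ↔
        MvPolynomial.aeval (fun i => ρ (coord i)) f ≠ 0) := by
    intro f hf
    rw [← h.algebraMap_eq hx]
    exact ⟨fun h1 => h.ne_zero (hpoly f) h1 (by simpa using hf), fun h1 => h.inv_mem (hpoly f) h1⟩
  obtain ⟨f, hf0, hf⟩ : ∃ f : MvPolynomial (Fin (n + 1)) ℂ, f ≠ 0 ∧
      MvPolynomial.aeval (fun i => ρ (coord i)) f = 0 := by
    by_contra hcon
    push Not at hcon
    apply hW
    rw [eq_top_iff]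
    rintro g -
    obtain ⟨a, b, hb, -, rfl⟩ := exists_fraction_isRelPrime (MvPolynomial (Fin (n + 1)) ℂ) g
    rw [div_eq_mul_inv]
    exact mul_mem (hpoly a) ((hinv b hb).mpr (hcon b hb))
  obtain ⟨q, hq, hq0⟩ : ∃ q : MvPolynomial (Fin (n + 1)) ℂ, Irreducible q ∧
      MvPolynomial.aeval (fun i => ρ (coord i)) q = 0 := by
    induction f using WfDvdMonoid.induction_on_irreducible with
    | zero => exact absurd rfl hf0
    | unit u hu =>
      have := hu.map (MvPolynomial.aeval (R := ℂ) (fun i => ρ (coord i)))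
      rw [hf] at this
      exact absurd this not_isUnit_zero
    | mul a i ha hi ih =>
      rw [map_mul, mul_eq_zero] at hf
      rcases hf with hf | hf
      · exact ⟨i, hi, hf⟩
      · exact ih ha hf
  obtain ⟨i, hi⟩ := exists_succAbove_independent hrk
  have hq' : Prime q := UniqueFactorizationMonoid.irreducible_iff_prime.mp hq
  have hdom : ∀ a : MvPolynomial (Fin (n + 1)) ℂ, a ≠ 0 →
      ((algebraMap _ (RatFun ℂ (n + 1)) a)⁻¹ ∈ W ↔ ¬ q ∣ a) := by
    intro a ha
    rw [hinv a ha, Ne, not_iff_not]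
    constructor
    · exact ker_aeval_le_span (fun i => ρ (coord i)) i hi hq hq0
    · rintro ⟨b, rfl⟩
      rw [map_mul, hq0, zero_mul]
  exact ⟨q, hq', eq_primeVal_of_dominates (F := RatFun ℂ (n + 1))
    (A := MvPolynomial (Fin (n + 1)) ℂ) hpoly hq' hdom⟩

lemma finite_primeVal_dvd {f : MvPolynomial (Fin n) ℂ} (hf : f ≠ 0) :
    {V : ValuationSubring (RatFun ℂ n) | ∃ (p : MvPolynomial (Fin n) ℂ) (hp : Prime p), p ∣ f ∧
      V = primeVal (RatFun ℂ n) p hp}.Finite := by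
  classical
  refine ((UniqueFactorizationMonoid.factors f).toFinset.finite_toSet.image
    (fun q => if h : Prime q then primeVal (RatFun ℂ n) q h else ⊤)).subset ?_
  rintro V ⟨p, hp, hd, rfl⟩
  obtain ⟨q, hq, hpq⟩ := UniqueFactorizationMonoid.exists_mem_factors_of_dvd hf hp.irreducible hd
  have hqp := UniqueFactorizationMonoid.prime_of_factor q hq
  refine ⟨q, by simpa using hq, ?_⟩
  change (if h : Prime q then primeVal (RatFun ℂ n) q h else ⊤) = _
  rw [dif_pos hqp, primeVal_congr hp hqp hpq]

lemma smul_ne_top {F : Type} [Field F] [Algebra ℂ F] {V : ValuationSubring F} (h : V ≠ ⊤)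
    (σ : F ≃ₐ[ℂ] F) : σ • V ≠ ⊤ := by
  intro h'
  apply h
  rw [eq_top_iff]
  rintro a -
  have : σ • a ∈ σ • V := by rw [h']; trivial
  exact ValuationSubring.smul_mem_pointwise_smul_iff.mp this

lemma finite_isDiv_smul_not (σ : RatFun ℂ (n + 1) ≃ₐ[ℂ] RatFun ℂ (n + 1)) :
    {V : ValuationSubring (RatFun ℂ (n + 1)) | IsDiv V ∧ ¬ IsDiv (σ • V)}.Finite := by
  choose num den hden hrel hfrac using
    exists_fraction_isRelPrime (MvPolynomial (Fin (n + 1)) ℂ) (F := RatFun ℂ (n + 1))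
  let y : Fin (n + 1) → RatFun ℂ (n + 1) := fun i => σ⁻¹ (coord i)
  let B : Fin (n + 1) → RatFun ℂ (n + 1) := fun i =>
    σ⁻¹ (algebraMap _ (RatFun ℂ (n + 1)) (den (σ (coord i))))
  have hB0 : ∀ i, B i ≠ 0 := by
    intro i
    simp only [B]
    rw [Ne, map_eq_zero, FaithfulSMul.algebraMap_eq_zero_iff]
    exact hden _
  have hnum : ∀ i, num (B i) ≠ 0 := by
    intro i h0
    apply hB0 i
    rw [hfrac (B i), h0, map_zero, zero_div]
  have hfin := (Set.finite_iUnion fun i => finite_primeVal_dvd (hden (y i))).union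
    (Set.finite_iUnion fun i => finite_primeVal_dvd (hnum i))
  refine hfin.subset ?_
  rintro V ⟨⟨p, hp, rfl⟩, hV⟩
  by_contra hcon
  simp only [Set.mem_union, Set.mem_iUnion, not_or, not_exists] at hcon
  obtain ⟨h1, h2⟩ := hcon
  have hd1 : ∀ i, ¬ p ∣ den (y i) := fun i hd => h1 i ⟨p, hp, hd, rfl⟩
  have hd2 : ∀ i, ¬ p ∣ num (B i) := fun i hd => h2 i ⟨p, hp, hd, rfl⟩
  apply hV
  obtain ⟨Ω, _, _, _, ρ, hρ⟩ := exists_isPlace (base_primeVal (n := n + 1) (hp := hp))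
  have hyV : ∀ i, y i ∈ primeVal (RatFun ℂ (n + 1)) p hp := by
    intro i
    rw [hfrac (y i), div_eq_mul_inv]
    exact mul_mem (algebraMap_mem_primeVal _) (inv_mem_primeVal (hd1 i))
  have haev : ∀ f : MvPolynomial (Fin (n + 1)) ℂ,
      σ⁻¹ (algebraMap _ (RatFun ℂ (n + 1)) f) = aeval y f := by
    intro f
    rw [← aeval_coord]
    exact (comp_aeval_apply (fun i => coord i) (σ⁻¹ : RatFun ℂ (n + 1) ≃ₐ[ℂ] _).toAlgHom f)
  refine (hρ.smul σ).isDiv ?_ ?_ (smul_ne_top (primeVal_ne_top hp) σ)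
  · intro i
    rw [ValuationSubring.mem_pointwise_smul_iff_inv_smul_mem]
    exact hyV i
  · refine hρ.le_rk.trans (rk_le_of_subset_acl ?_)
    rintro _ ⟨i, rfl⟩
    have e1 : coord i * B i = aeval y (num (σ (coord i))) := by
      have e := hfrac (σ (coord i))
      rw [eq_div_iff (by simpa using hden _)] at e
      have := congrArg (σ⁻¹ : RatFun ℂ (n + 1) ≃ₐ[ℂ] _) e
      rw [map_mul] at this
      rw [← haev, ← this]
      congr 1
      exact (σ.symm_apply_apply _).symm
    have hBV : B i ∈ primeVal (RatFun ℂ (n + 1)) p hp := by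
      simp only [B, haev]; exact hρ.aeval_mem hyV _
    have hB : ρ (B i) ≠ 0 := by
      refine hρ.ne_zero hBV ?_ (hB0 i)
      rw [hfrac (B i), inv_div, div_eq_mul_inv]
      exact mul_mem (algebraMap_mem_primeVal _) (inv_mem_primeVal (hd2 i))
    have hm : ∀ f : MvPolynomial (Fin (n + 1)) ℂ, ρ (aeval y f) ∈
        acl (Set.range fun i => ρ (y i)) := by
      intro f
      rw [hρ.aeval hyV]
      refine adjoin_le_acl _ (IntermediateField.algebra_adjoin_le_adjoin _ _ ?_)
      rw [Algebra.adjoin_range_eq_range_aeval]; exact ⟨f, rfl⟩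
    have e2 : ρ (coord i) = ρ (aeval y (num (σ (coord i)))) / ρ (B i) := by
      rw [eq_div_iff hB, ← hρ.mul _ (coord_mem_primeVal i) _ hBV, e1]
    change ρ (coord i) ∈ acl (Set.range fun i => ρ (y i))
    rw [e2]
    refine _root_.div_mem (hm _) ?_
    simp only [B, haev]
    exact hm _

end RationalFunctions

end CremonaPlaces

namespace CremonaPlaces

section Extension

variable {F E Ω : Type} [Field F] [Algebra ℂ F] [Field E] [Algebra ℂ E] [Algebra F E]
  [IsScalarTower ℂ F E] [Field Ω] [Algebra ℂ Ω]

lemma exists_primitive_relation (V : ValuationSubring F) {a : E} (ha : IsAlgebraic F a) :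
    ∃ q : Polynomial V, q.map (IsLocalRing.residue V) ≠ 0 ∧
      Polynomial.aeval a (q.map V.subtype) = 0 := by
  obtain ⟨P, hP, hPa⟩ := ha
  obtain ⟨i, hi, hmax⟩ := P.support.exists_max_image (fun i => V.valuation (P.coeff i))
    (Polynomial.nonempty_support_iff.mpr hP)
  have hi0 : P.coeff i ≠ 0 := Polynomial.mem_support_iff.mp hi
  have hmem : ∀ j, (P.coeff i)⁻¹ * P.coeff j ∈ V := by
    intro j
    by_cases hj : j ∈ P.support
    · rw [← V.valuation_le_one_iff, map_mul, map_inv₀]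
      refine (mul_le_mul_right (hmax j hj) _).trans ?_
      rw [inv_mul_cancel₀ ((Valuation.ne_zero_iff _).mpr hi0)]
    · rw [Polynomial.notMem_support_iff.mp hj, mul_zero]; exact zero_mem V
  let Q : Polynomial F := Polynomial.C (P.coeff i)⁻¹ * P
  have hQ : Q ∈ Polynomial.lifts V.subtype := by
    rw [Polynomial.lifts_iff_coeff_lifts]
    intro j
    refine ⟨⟨_, hmem j⟩, ?_⟩
    simp [Q]
  obtain ⟨q, hq⟩ := (Polynomial.mem_lifts _).mp hQ
  refine ⟨q, ?_, ?_⟩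
  · intro h0
    have h1 : q.coeff i = 1 := by
      apply Subtype.val_injective
      have := congrArg (fun r => Polynomial.coeff r i) hq
      simp only [Polynomial.coeff_map, Q, Polynomial.coeff_C_mul, inv_mul_cancel₀ hi0] at this
      exact this
    have := congrArg (fun r => Polynomial.coeff r i) h0
    simp [h1] at this
  · rw [hq]; simp [Q, hPa]

/-- A place with algebraically closed target extends to every algebraic extension. -/
lemma IsPlace.exists_extension [IsAlgClosed Ω] [Algebra.IsAlgebraic F E]
    {V : ValuationSubring F} {ρ : F → Ω} (h : IsPlace V ρ) :
    ∃ (W : ValuationSubring E) (ψ : E → Ω), IsPlace W ψ ∧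
      (∀ a, algebraMap F E a ∈ W ↔ a ∈ V) ∧ ∀ a ∈ V, ψ (algebraMap F E a) = ρ a := by
  let f : V →+* E := (algebraMap F E).comp V.subtype
  obtain ⟨W, hW, hloc⟩ := IsLocalRing.exists_factor_valuationRing f
  let g : V →+* W := f.codRestrict W.toSubring hW
  have : IsLocalHom g := hloc
  let r : V →+* Ω :=
    { toFun := fun a => ρ a
      map_one' := h.one
      map_zero' := h.zero
      map_add' := fun a b => h.add _ a.2 _ b.2
      map_mul' := fun a b => h.mul _ a.2 _ b.2 }
  have hr : IsLocalHom r := by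
    refine ⟨fun a ha => ?_⟩
    have h0 : ρ a ≠ 0 := ha.ne_zero
    have ha0 : (a : F) ≠ 0 := by intro h'; rw [h', h.zero] at h0; exact h0 rfl
    exact IsUnit.of_mul_eq_one ⟨_, h.inv_mem a.2 h0⟩ (Subtype.ext (mul_inv_cancel₀ ha0))
  let _ : Algebra (IsLocalRing.ResidueField V) (IsLocalRing.ResidueField W) :=
    (IsLocalRing.ResidueField.map g).toAlgebra
  let _ : Algebra (IsLocalRing.ResidueField V) Ω := (IsLocalRing.ResidueField.lift r).toAlgebra
  have halg : Algebra.IsAlgebraic (IsLocalRing.ResidueField V) (IsLocalRing.ResidueField W) := by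
    refine ⟨fun x => ?_⟩
    obtain ⟨a, rfl⟩ := IsLocalRing.residue_surjective x
    obtain ⟨q, hq0, hq⟩ := exists_primitive_relation V (Algebra.IsAlgebraic.isAlgebraic (R := F) (a : E))
    refine ⟨_, hq0, ?_⟩
    have h1 : Polynomial.eval₂ g a q = 0 := by
      apply Subtype.val_injective
      have := Polynomial.hom_eval₂ q g W.subtype a
      change W.subtype _ = 0
      rw [this, ← hq, Polynomial.aeval_def, Polynomial.eval₂_map]
      rfl
    rw [Polynomial.aeval_def, Polynomial.eval₂_map]
    have := Polynomial.hom_eval₂ q g (IsLocalRing.residue W) a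
    rw [h1, map_zero] at this
    rw [this]
    rfl
  let l : IsLocalRing.ResidueField W →ₐ[IsLocalRing.ResidueField V] Ω := IsAlgClosed.lift
  have hl : ∀ a : V, l (IsLocalRing.residue W (g a)) = ρ a := fun a =>
    l.commutes (IsLocalRing.residue V a)
  have hc : ∀ c : ℂ, algebraMap ℂ E c ∈ W := by
    intro c
    rw [IsScalarTower.algebraMap_apply ℂ F E]
    exact hW ⟨_, h.base c⟩
  refine ⟨W, residueMap W l.toRingHom, isPlace_residueMap _ hc ?_, ?_, ?_⟩
  · intro c
    rw [← h.const c]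
    refine Eq.trans ?_ (hl ⟨_, h.base c⟩)
    change l _ = l _
    congr 2
    exact Subtype.ext (IsScalarTower.algebraMap_apply ℂ F E c)
  · intro a
    refine ⟨fun ha => ?_, fun ha => hW ⟨a, ha⟩⟩
    by_contra hcon
    have hinv : a⁻¹ ∈ V := (V.mem_or_inv_mem a).resolve_left hcon
    have ha0 : a ≠ 0 := by rintro rfl; exact hcon (zero_mem V)
    have hu : IsUnit (g ⟨a⁻¹, hinv⟩) := by
      refine IsUnit.of_mul_eq_one ⟨_, ha⟩ (Subtype.ext ?_)
      change algebraMap F E a⁻¹ * algebraMap F E a = 1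
      rw [← map_mul, inv_mul_cancel₀ ha0, map_one]
    obtain ⟨u, hu⟩ := (isUnit_map_iff g _).mp hu
    have h2 : a⁻¹ * ((u⁻¹ : Vˣ) : V) = 1 := by
      have := congrArg Subtype.val u.mul_inv
      rwa [hu] at this
    apply hcon
    rw [← inv_inv a, ← eq_inv_of_mul_eq_one_right h2]
    exact Subtype.mem _
  · intro a ha
    exact (residueMap_of_mem (a := algebraMap F E a) _ (hW ⟨a, ha⟩)).trans (hl ⟨a, ha⟩)

end Extension

section Ruled

variable {E Ω : Type} [Field E] [Algebra ℂ E] [Field Ω] [Algebra ℂ Ω]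

/-- A multiplicative property of elements of `K(x)`, where `K` is algebraically closed. -/
lemma adjoin_induction_linear {K : IntermediateField ℂ E} [IsAlgClosed K] {x : E} {P : E → Prop}
    (hK : ∀ a ∈ K, P a) (hx : ∀ a ∈ K, P (x - a)) (hmul : ∀ a b, P a → P b → P (a * b))
    (hinv : ∀ a, P a → P a⁻¹) {e : E} (he : e ∈ IntermediateField.adjoin ℂ ((K : Set E) ∪ {x})) :
    P e := by
  have hpoly : ∀ p : Polynomial K, P (Polynomial.aeval x p) := by
    intro p
    have hs := IsAlgClosed.splits p
    rw [hs.eq_prod_roots, map_mul, Polynomial.aeval_C]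
    refine hmul _ _ (hK _ (Subtype.mem _)) ?_
    generalize p.roots = R
    induction R using Multiset.induction_on with
    | empty => simpa using hK 1 (one_mem K)
    | cons a R ih =>
      rw [Multiset.map_cons, Multiset.prod_cons, map_mul]
      refine hmul _ _ ?_ ih
      simpa using hx a a.2
  rw [← IntermediateField.restrictScalars_adjoin, IntermediateField.mem_restrictScalars,
    IntermediateField.mem_adjoin_simple_iff] at he
  obtain ⟨r, s, rfl⟩ := he
  rw [div_eq_mul_inv]
  exact hmul _ _ (hpoly r) (hinv _ (hpoly s))

variable {W : ValuationSubring E} {ψ : E → Ω}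

/-- The residues at a place of the elements of a subfield. -/
def IsPlace.res (h : IsPlace W ψ) (K : IntermediateField ℂ E) : IntermediateField ℂ Ω where
  carrier := ψ '' {a | a ∈ K ∧ a ∈ W}
  mul_mem' := by
    rintro _ _ ⟨a, ⟨ha, ha'⟩, rfl⟩ ⟨b, ⟨hb, hb'⟩, rfl⟩
    exact ⟨a * b, ⟨mul_mem ha hb, mul_mem ha' hb'⟩, h.mul a ha' b hb'⟩
  add_mem' := by
    rintro _ _ ⟨a, ⟨ha, ha'⟩, rfl⟩ ⟨b, ⟨hb, hb'⟩, rfl⟩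
    exact ⟨a + b, ⟨add_mem ha hb, add_mem ha' hb'⟩, h.add a ha' b hb'⟩
  algebraMap_mem' c := ⟨_, ⟨K.algebraMap_mem c, h.base c⟩, h.const c⟩
  inv_mem' := by
    rintro _ ⟨a, ⟨ha, ha'⟩, rfl⟩
    by_cases h0 : ψ a = 0
    · exact ⟨0, ⟨zero_mem K, zero_mem W⟩, by rw [h0, h.zero, inv_zero]⟩
    · exact ⟨a⁻¹, ⟨InvMemClass.inv_mem ha, h.inv_mem ha' h0⟩, h.inv ha' h0⟩

lemma IsPlace.mem_res {h : IsPlace W ψ} {K : IntermediateField ℂ E} {a : E} (ha : a ∈ K)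
    (ha' : a ∈ W) : ψ a ∈ h.res K := ⟨a, ⟨ha, ha'⟩, rfl⟩

lemma IsPlace.res_mono (h : IsPlace W ψ) {K L : IntermediateField ℂ E} (hKL : K ≤ L) :
    h.res K ≤ h.res L := by
  rintro _ ⟨a, ⟨ha, ha'⟩, rfl⟩
  exact ⟨a, ⟨hKL ha, ha'⟩, rfl⟩

/-- An element of the form `k y ^ i w`, with `w` a unit whose residue lies in `L`. -/
def Splits (W : ValuationSubring E) (ψ : E → Ω) (K : IntermediateField ℂ E) (y : E)
    (L : IntermediateField ℂ Ω) (e : E) : Prop :=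
  ∃ k ∈ K, ∃ (i : ℤ) (w : E), w ∈ W ∧ w⁻¹ ∈ W ∧ w ≠ 0 ∧ ψ w ∈ L ∧ e = k * y ^ i * w

lemma Splits.mul (h : IsPlace W ψ) {K : IntermediateField ℂ E} {y : E} (hy : y ≠ 0)
    {L : IntermediateField ℂ Ω} {a b : E} (ha : Splits W ψ K y L a) (hb : Splits W ψ K y L b) :
    Splits W ψ K y L (a * b) := by
  obtain ⟨k, hk, i, w, hw, hw', hw0, hwL, rfl⟩ := ha
  obtain ⟨k₂, hk₂, i₂, w₂, hw₂, hw₂', hw₂0, hwL₂, rfl⟩ := hb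
  refine ⟨k * k₂, mul_mem hk hk₂, i + i₂, w * w₂, mul_mem hw hw₂, ?_, mul_ne_zero hw0 hw₂0, ?_, ?_⟩
  · rw [mul_inv]; exact mul_mem hw' hw₂'
  · rw [h.mul _ hw _ hw₂]; exact mul_mem hwL hwL₂
  · rw [zpow_add₀ hy]; ring

lemma Splits.inv (h : IsPlace W ψ) {K : IntermediateField ℂ E} {y : E}
    {L : IntermediateField ℂ Ω} {a : E} (ha : Splits W ψ K y L a) : Splits W ψ K y L a⁻¹ := by
  obtain ⟨k, hk, i, w, hw, hw', hw0, hwL, rfl⟩ := ha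
  refine ⟨k⁻¹, inv_mem hk, -i, w⁻¹, hw', by rwa [inv_inv], inv_ne_zero hw0, ?_, ?_⟩
  · rw [h.inv hw (h.ne_zero hw hw' hw0)]; exact inv_mem hwL
  · rw [mul_inv, mul_inv, zpow_neg]

lemma IsPlace.res_le_of_splits (h : IsPlace W ψ) {K : IntermediateField ℂ E} [IsAlgClosed K]
    {x y : E} (hy : y ≠ 0) {L : IntermediateField ℂ Ω}
    (hx : ∀ a ∈ K, Splits W ψ K y L (x - a))
    (hyL : ∀ k ∈ K, ∀ i : ℤ, k * y ^ i ∈ W → ψ (k * y ^ i) ∈ L) :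
    h.res (IntermediateField.adjoin ℂ ((K : Set E) ∪ {x})) ≤ L := by
  rintro _ ⟨e, ⟨he, heW⟩, rfl⟩
  have : Splits W ψ K y L e := by
    refine adjoin_induction_linear ?_ hx (fun a b => Splits.mul h hy) (fun a => Splits.inv h) he
    intro a ha
    exact ⟨a, ha, 0, 1, one_mem W, by rw [inv_one]; exact one_mem W, one_ne_zero,
      by rw [h.one]; exact one_mem L, by simp⟩
  obtain ⟨k, hk, i, w, hw, hw', hw0, hwL, rfl⟩ := this
  have hkW : k * y ^ i ∈ W := by
    have := mul_mem heW hw'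
    rwa [mul_assoc _ w, mul_inv_cancel₀ hw0, mul_one] at this
  rw [h.mul _ hkW _ hw]
  exact mul_mem (hyL k hk i hkW) hwL

/-- An element of valuation one is a unit. -/
lemma mem_and_inv_mem_of_eq_one {w : E} (hw : W.valuation w = 1) :
    w ∈ W ∧ w⁻¹ ∈ W ∧ w ≠ 0 := by
  refine ⟨?_, ?_, ?_⟩
  · rw [← W.valuation_le_one_iff, hw]
  · rw [← W.valuation_le_one_iff, map_inv₀, hw, inv_one]
  · rintro rfl; rw [map_zero] at hw; exact zero_ne_one hw

lemma IsPlace.eq_zero_of_lt (h : IsPlace W ψ) {a : E} (ha : W.valuation a < 1) : ψ a = 0 := by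
  rcases eq_or_ne a 0 with rfl | h0
  · exact h.zero
  · refine h.eq_zero a ((W.valuation_le_one_iff a).mp ha.le) fun hinv => ?_
    rw [← W.valuation_le_one_iff, map_inv₀] at hinv
    have := mul_lt_mul_of_pos_right ha (zero_lt_iff.mpr (inv_ne_zero ((Valuation.ne_zero_iff W.valuation).mpr h0)))
    rw [mul_inv_cancel₀ ((Valuation.ne_zero_iff W.valuation).mpr h0), one_mul] at this
    exact absurd hinv (not_le.mpr this)

/-- If `b` dominates `a` then `b - a` equals `b` up to a unit of residue one. -/
lemma IsPlace.exists_unit_of_lt (h : IsPlace W ψ) {a b : E} (hab : W.valuation a < W.valuation b) :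
    ∃ w ∈ W, w⁻¹ ∈ W ∧ w ≠ 0 ∧ ψ w = 1 ∧ b - a = b * w := by
  have hb : b ≠ 0 := by rintro rfl; rw [map_zero] at hab; exact not_lt_zero hab
  have hv : W.valuation (a / b) < 1 := by
    rw [map_div₀, div_lt_one₀ (zero_lt_iff.mpr ((Valuation.ne_zero_iff _).mpr hb))]; exact hab
  have hm : a / b ∈ W := (W.valuation_le_one_iff _).mp hv.le
  have hu : W.valuation (1 - a / b) = 1 := W.valuation.map_one_sub_of_lt hv
  obtain ⟨h1, h2, h3⟩ := mem_and_inv_mem_of_eq_one hu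
  refine ⟨1 - a / b, h1, h2, h3, ?_, ?_⟩
  · rw [h.sub (one_mem W) hm, h.one, h.eq_zero_of_lt hv, sub_zero]
  · field_simp

/-- The ruled residue theorem over an algebraically closed field. -/
lemma IsPlace.exists_ruled (h : IsPlace W ψ) (K : IntermediateField ℂ E) [IsAlgClosed K] (x : E) :
    ∃ z, h.res (IntermediateField.adjoin ℂ ((K : Set E) ∪ {x})) ≤
      IntermediateField.adjoin ℂ ((h.res K : Set Ω) ∪ {z}) := by
  have hL : ∀ z, h.res K ≤ IntermediateField.adjoin ℂ ((h.res K : Set Ω) ∪ {z}) := fun z a ha =>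
    IntermediateField.subset_adjoin _ _ (Or.inl ha)
  by_cases hA : ∀ a ∈ K, ∃ b ∈ K, W.valuation (x - b) < W.valuation (x - a)
  · refine ⟨0, h.res_le_of_splits (y := 1) one_ne_zero ?_ ?_⟩
    · intro a ha
      obtain ⟨b, hb, hab⟩ := hA a ha
      have hab' : W.valuation (b - x) < W.valuation (b - a) := by
        rw [show b - a = (x - a) - (x - b) by ring, Valuation.map_sub_eq_of_lt_left _ hab,
          Valuation.map_sub_swap]
        exact hab
      obtain ⟨w, hw, hw', hw0, hw1, he⟩ := h.exists_unit_of_lt hab'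
      refine ⟨b - a, sub_mem hb ha, 0, w, hw, hw', hw0, by rw [hw1]; exact one_mem _, ?_⟩
      rw [zpow_zero, mul_one, ← he]; ring
    · intro k hk i hW
      rw [one_zpow, mul_one] at *
      exact hL 0 (h.mem_res hk hW)
  push Not at hA
  obtain ⟨a, ha, hmin⟩ := hA
  by_cases hxa : x - a = 0
  · refine ⟨0, le_trans (h.res_mono ?_) (hL 0)⟩
    rw [IntermediateField.adjoin_le_iff]
    rintro _ (hb | rfl)
    · exact hb
    · rw [sub_eq_zero] at hxa; rw [hxa]; exact ha
  have hmin' : ∀ c ∈ K, W.valuation (x - a) ≤ W.valuation (x - a - c) := by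
    intro c hc
    rw [sub_sub]; exact hmin _ (add_mem ha hc)
  have hsplit : ∀ b, x - b = (x - a) - (b - a) := fun b => by ring
  by_cases hB : ∃ b ∈ K, W.valuation b = W.valuation (x - a)
  · obtain ⟨b, hb, hbv⟩ := hB
    have hb0 : b ≠ 0 := by
      rintro rfl; rw [map_zero, eq_comm, map_eq_zero] at hbv; exact hxa hbv
    have hbv0 : W.valuation b ≠ 0 := (Valuation.ne_zero_iff _).mpr hb0
    have hz : (x - a) / b ∈ W := by
      rw [← W.valuation_le_one_iff, map_div₀, hbv, div_self (by rwa [hbv] at hbv0)]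
    let z := ψ ((x - a) / b)
    refine ⟨z, h.res_le_of_splits (y := 1) one_ne_zero ?_ ?_⟩
    · intro d hd
      rw [hsplit d]
      have hc : d - a ∈ K := sub_mem hd ha
      rcases lt_or_ge (W.valuation (x - a)) (W.valuation (d - a)) with hlt | hle
      · obtain ⟨w, hw, hw', hw0, hw1, he⟩ := h.exists_unit_of_lt hlt
        refine ⟨-(d - a), neg_mem hc, 0, w, hw, hw', hw0, by rw [hw1]; exact one_mem _, ?_⟩
        rw [zpow_zero, mul_one, neg_mul, ← he]; ring
      · have hcb : (d - a) / b ∈ W := by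
          rw [← W.valuation_le_one_iff, map_div₀, hbv]
          exact div_le_one_of_le₀ hle zero_le
        have hu : W.valuation ((x - a) / b - (d - a) / b) = 1 := by
          apply le_antisymm
          · exact (W.valuation_le_one_iff _).mpr (sub_mem hz hcb)
          · rw [← sub_div, map_div₀, hbv, le_div_iff₀ (zero_lt_iff.mpr (by rwa [hbv] at hbv0)),
              one_mul]
            exact hmin' _ hc
        obtain ⟨h1, h2, h3⟩ := mem_and_inv_mem_of_eq_one hu
        refine ⟨b, hb, 0, _, h1, h2, h3, ?_, ?_⟩
        · rw [h.sub hz hcb]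
          exact sub_mem (IntermediateField.subset_adjoin _ _ (Or.inr rfl))
            (hL z (h.mem_res (_root_.div_mem hc hb) hcb))
        · field_simp
    · intro k hk i hW
      rw [one_zpow, mul_one] at *
      exact hL z (h.mem_res hk hW)
  · push Not at hB
    refine ⟨0, h.res_le_of_splits (y := x - a) hxa ?_ ?_⟩
    · intro d hd
      rw [hsplit d]
      have hc : d - a ∈ K := sub_mem hd ha
      rcases lt_or_gt_of_ne (hB _ hc) with hlt | hlt
      · obtain ⟨w, hw, hw', hw0, hw1, he⟩ := h.exists_unit_of_lt hlt
        exact ⟨1, one_mem K, 1, w, hw, hw', hw0, by rw [hw1]; exact one_mem _, by simpa using he⟩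
      · obtain ⟨w, hw, hw', hw0, hw1, he⟩ := h.exists_unit_of_lt hlt
        refine ⟨-(d - a), neg_mem hc, 0, w, hw, hw', hw0, by rw [hw1]; exact one_mem _, ?_⟩
        rw [zpow_zero, mul_one, neg_mul, ← he]; ring
    · intro k hk i hW
      rcases eq_or_ne i 0 with rfl | hi
      · rw [zpow_zero, mul_one] at *
        exact hL 0 (h.mem_res hk hW)
      · have hlt : W.valuation (k * (x - a) ^ i) < 1 := by
          refine lt_of_le_of_ne ((W.valuation_le_one_iff _).mpr hW) fun heq => ?_
          obtain ⟨r, hr⟩ := IsAlgClosed.exists_pow_nat_eq (⟨k, hk⟩ : K) (Int.natAbs_pos.mpr hi)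
          have hr' : (r : E) ^ i.natAbs = k := congrArg Subtype.val hr
          have hpow : W.valuation ((r : E) * (x - a) ^ i.sign) = 1 := by
            rw [← pow_eq_one_iff_of_nonneg zero_le (Int.natAbs_ne_zero.mpr hi), ← map_pow, mul_pow, hr', ← zpow_natCast,
              ← zpow_mul, Int.sign_mul_natAbs, heq]
          rcases Int.sign_trichotomy i with hs | hs | hs
          · rw [hs, zpow_one, map_mul] at hpow
            refine hB (r : E)⁻¹ (InvMemClass.inv_mem r.2) ?_
            rw [map_inv₀]; exact inv_eq_of_mul_eq_one_right hpow
          · exact hi (Int.sign_eq_zero_iff_zero.mp hs)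
          · rw [hs, zpow_neg, zpow_one, map_mul, map_inv₀] at hpow
            refine hB (r : E) r.2 ?_
            rwa [mul_inv_eq_one₀ ((Valuation.ne_zero_iff _).mpr hxa)] at hpow
        rw [h.eq_zero_of_lt hlt]
        exact zero_mem _

end Ruled

end CremonaPlaces

namespace CremonaPlaces

section Abhyankar

variable {E Ω : Type} [Field E] [Algebra ℂ E] [Field Ω] [Algebra ℂ Ω]
  {W : ValuationSubring E} {ψ : E → Ω}

lemma aeval_mem_acl {ι : Type} {Y : ι → E} (p : MvPolynomial ι ℂ) :
    aeval Y p ∈ acl (Set.range Y) := by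
  refine adjoin_le_acl _ (IntermediateField.algebra_adjoin_le_adjoin _ _ ?_)
  rw [Algebra.adjoin_range_eq_range_aeval]
  exact ⟨p, rfl⟩

/-- A place is injective on polynomials in elements with independent residues. -/
lemma IsPlace.algebraicIndependent_of_res (h : IsPlace W ψ) {ι : Type} {Y : ι → E}
    (hW : ∀ i, Y i ∈ W) (hY : AlgebraicIndependent ℂ (fun i => ψ (Y i))) :
    AlgebraicIndependent ℂ Y := by
  rw [algebraicIndependent_iff] at *
  intro p hp
  refine hY p ?_
  rw [← h.aeval hW, hp, h.zero]

lemma IsPlace.algebraicIndependent_res (h : IsPlace W ψ) {ι : Type} {Y : ι → E}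
    (hY : AlgebraicIndependent ℂ Y) (hW : ∀ a ∈ acl (Set.range Y), a ∈ W) :
    AlgebraicIndependent ℂ (fun i => ψ (Y i)) := by
  rw [algebraicIndependent_iff] at *
  intro p hp
  refine hY p ?_
  by_contra hne
  rw [← h.aeval fun i => hW _ (subset_acl _ ⟨i, rfl⟩)] at hp
  exact h.ne_zero (hW _ (aeval_mem_acl p)) (hW _ (InvMemClass.inv_mem (aeval_mem_acl p))) hne hp

lemma IsPlace.adjoin_subset (h : IsPlace W ψ) {ι : Type} {Y : ι → E}
    (hW : ∀ i, Y i ∈ W) (hY : AlgebraicIndependent ℂ (fun i => ψ (Y i))) {a : E}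
    (ha : a ∈ IntermediateField.adjoin ℂ (Set.range Y)) : a ∈ W := by
  rw [IntermediateField.mem_adjoin_range_iff] at ha
  obtain ⟨p, q, rfl⟩ := ha
  rcases eq_or_ne q 0 with rfl | hq
  · rw [map_zero, div_zero]; exact zero_mem W
  · refine h.div_mem (h.aeval_mem hW p) (h.aeval_mem hW q) fun h0 => hq ?_
    rw [h.aeval hW] at h0
    exact (algebraicIndependent_iff.mp hY) q h0

/-- A place whose residue field has maximal rank is trivial. -/
lemma IsPlace.mem_of_le_rk (h : IsPlace W ψ) {r : ℕ} {Y : Fin r → E}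
    (hr : (r : ℕ∞) ≤ rk (h.res (acl (Set.range Y)) : Set Ω)) :
    ∀ a ∈ acl (Set.range Y), a ∈ W := by
  obtain ⟨I, hI⟩ := (indepMat Ω).exists_isBasis (h.res (acl (Set.range Y)) : Set Ω)
  rw [rk, ← hI.encard_eq_eRk] at hr
  obtain ⟨T, hT, hTr⟩ := Set.exists_subset_encard_eq hr
  have hTI : (indepMat Ω).Indep T := hI.indep.subset hT
  rw [AlgebraicIndependent.matroid_indep_iff] at hTI
  have hTfin : T.Finite := Set.finite_of_encard_eq_coe hTr
  have := hTfin.fintype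
  have hlift : ∀ t : T, ∃ a, (a ∈ acl (Set.range Y) ∧ a ∈ W) ∧ ψ a = t := fun t =>
    hI.subset (hT t.2)
  choose e he hψ using hlift
  have hind : AlgebraicIndependent ℂ (fun t => ψ (e t)) := by
    simp_rw [hψ]; exact hTI
  have hrk : rk (Set.range e) = r := by
    rw [rk_range_of_algebraicIndependent (h.algebraicIndependent_of_res (fun t => (he t).2) hind),
      ← hTr, Set.encard_eq_coe_toFinset_card, Set.toFinset_card]
  have hYr : rk (Set.range Y) ≤ r := by
    refine (Matroid.eRk_le_encard _ _).trans ?_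
    rw [← Set.image_univ]
    refine (Set.encard_image_le _ _).trans ?_
    rw [Set.encard_univ, ENat.card_eq_coe_fintype_card, Fintype.card_fin]
  intro a ha
  have ha' : a ∈ acl (Set.range e) := by
    by_contra hcon
    have h1 := rk_insert_of_notMem hcon
    have h2 : rk (insert a (Set.range e)) ≤ rk (Set.range Y) := by
      refine rk_le_of_subset_acl ?_
      rintro _ (rfl | ⟨t, rfl⟩)
      · exact ha
      · exact (he t).1
    rw [h1, hrk] at h2
    have h3 := h2.trans hYr
    norm_cast at h3
    omega
  rw [mem_acl] at ha'
  have hintg : IsIntegral W a := by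
    obtain ⟨p, hp, hpa⟩ := ha'.isIntegral
    let i : IntermediateField.adjoin ℂ (Set.range e) →+* W :=
      (algebraMap (IntermediateField.adjoin ℂ (Set.range e)) E).codRestrict W.toSubring
        fun x => h.adjoin_subset (fun t => (he t).2) hind x.2
    refine ⟨p.map i, hp.map i, ?_⟩
    rw [Polynomial.eval₂_map]
    exact hpa
  obtain ⟨b, hb⟩ := IsIntegrallyClosed.isIntegral_iff.mp hintg
  rw [← hb]; exact b.2

/-- Residue fields containing a twisted function field are not ruled in two directions. -/
lemma Twist.false_of_ruled [IsAlgClosed Ω] {m : ℕ} {τ : ℕ → Ω} {ξ ω y s z t : Ω}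
    (h : Twist m 1 τ ξ ω y) {k₀ : IntermediateField ℂ Ω} {q : ℕ}
    (hk : rk (k₀ : Set Ω) < (q + 1 : ℕ))
    (hr : ((q + 2 : ℕ) : ℕ∞) ≤
      rk (IntermediateField.adjoin ℂ ((twistField m τ ξ ω y : Set Ω) ∪ {s}) : Set Ω))
    (hle : IntermediateField.adjoin ℂ ((twistField m τ ξ ω y : Set Ω) ∪ {s}) ≤
      IntermediateField.adjoin ℂ ((k₀ : Set Ω) ∪ {z, t})) : False := by
  have hfin : rk (k₀ : Set Ω) ≠ ⊤ := (hk.trans_le le_top).ne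
  obtain ⟨d, hd⟩ := ENat.ne_top_iff_exists.mp hfin
  rw [← hd] at hk
  norm_cast at hk
  have key : ∀ u v : Ω, ({u, v} : Set Ω) = {z, t} →
      twistField m τ ξ ω y ≤ acl (insert v (k₀ : Set Ω)) := by
    intro u v huv
    refine h.rigid (Or.inl rfl) (S := insert v (k₀ : Set Ω)) (u := u) ?_
    intro x hx
    have hx' := hle (IntermediateField.subset_adjoin _ _ (Or.inl hx))
    let E' := IntermediateField.adjoin (acl (insert v (k₀ : Set Ω))) ({u} : Set Ω)
    have hsub : IntermediateField.adjoin ℂ ((k₀ : Set Ω) ∪ {z, t}) ≤ E'.restrictScalars ℂ := by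
      rw [IntermediateField.adjoin_le_iff, ← huv]
      have hacl : ∀ a ∈ acl (insert v (k₀ : Set Ω)), a ∈ E' := fun a ha =>
        E'.algebraMap_mem ⟨a, ha⟩
      intro a ha
      change a ∈ E'
      rcases ha with ha | ha | ha
      · exact hacl a (subset_acl _ (Or.inr ha))
      · exact IntermediateField.subset_adjoin _ _ ha
      · exact hacl a (subset_acl _ (Or.inl ha))
    exact hsub hx'
  have h1 := key z t rfl
  have h2 := key t z (Set.pair_comm t z)
  have ht : t ∉ acl (insert z (k₀ : Set Ω)) := by
    intro ht
    have h3 : rk (IntermediateField.adjoin ℂ ((twistField m τ ξ ω y : Set Ω) ∪ {s}) : Set Ω) ≤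
        rk (insert z (k₀ : Set Ω)) := by
      refine rk_le_of_subset_acl ?_
      refine le_trans (SetLike.coe_subset_coe.mpr hle) ?_
      rw [SetLike.coe_subset_coe, IntermediateField.adjoin_le_iff]
      rintro x (hx | rfl | rfl)
      · exact subset_acl _ (Or.inr hx)
      · exact subset_acl _ (Or.inl rfl)
      · exact ht
    have h4 := (hr.trans h3).trans (rk_insert_le _ _)
    rw [← hd] at h4
    norm_cast at h4
    omega
  have h5 : (twistField m τ ξ ω y : Set Ω) ⊆ acl (k₀ : Set Ω) := by
    intro x hx
    by_contra hcon
    apply ht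
    have := acl_exchange (h1 hx) hcon
    refine acl_le_of_subset ?_ this
    rintro a (rfl | ha)
    · exact h2 hx
    · exact subset_acl _ (Or.inr ha)
  have h6 : rk (IntermediateField.adjoin ℂ ((twistField m τ ξ ω y : Set Ω) ∪ {s}) : Set Ω) ≤
      rk (insert s (k₀ : Set Ω)) := by
    refine rk_le_of_subset_acl ?_
    rw [SetLike.coe_subset_coe, IntermediateField.adjoin_le_iff]
    rintro x (hx | rfl)
    · exact acl_mono (Set.subset_insert _ _) (h5 hx)
    · exact subset_acl _ (Or.inl rfl)
  have h7 := (hr.trans h6).trans (rk_insert_le _ _)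
  rw [← hd] at h7
  norm_cast at h7
  omega

end Abhyankar

section Stabilization

open Pointwise

lemma map_mem_adjoin_range {n : ℕ} {E : Type} [Field E] [Algebra ℂ E] (f : RatFun ℂ n →ₐ[ℂ] E)
    (g : RatFun ℂ n) : f g ∈ IntermediateField.adjoin ℂ (Set.range fun i => f (coord i)) := by
  obtain ⟨a, b, hb, -, rfl⟩ := exists_fraction_isRelPrime (MvPolynomial (Fin n) ℂ) g
  have key : ∀ p : MvPolynomial (Fin n) ℂ, f (algebraMap _ _ p) = aeval (fun i => f (coord i)) p := by
    intro p
    rw [← aeval_coord]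
    exact comp_aeval_apply (fun i => coord i) f p
  rw [map_div₀, key, key, IntermediateField.mem_adjoin_range_iff]
  exact ⟨a, b, rfl⟩

lemma algebraicIndependent_coord (n : ℕ) : AlgebraicIndependent ℂ (coord : Fin n → RatFun ℂ n) := by
  rw [algebraicIndependent_iff]
  intro p hp
  rw [aeval_coord] at hp
  simpa using hp

lemma stabAlg_coord {n : ℕ} (i : Fin n) : stabAlg ℂ n (coord i) = coord i.castSucc := by
  have h := IsFractionRing.lift_algebraMap (A := MvPolynomial (Fin n) ℂ) (K := RatFun ℂ n)
    (L := RatFun ℂ (n + 1))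
    (g := (((IsScalarTower.toAlgHom ℂ (MvPolynomial (Fin (n+1)) ℂ) (RatFun ℂ (n+1))).comp
      (MvPolynomial.rename (Fin.castSucc : Fin n → Fin (n+1)))) : _ →+* _))
    ((IsFractionRing.injective (MvPolynomial (Fin (n+1)) ℂ) (RatFun ℂ (n+1))).comp
        (MvPolynomial.rename_injective _ (Fin.castSucc_injective n))) (X i)
  refine h.trans ?_
  simp [coord]

/-- Stabilizations preserve divisorial places with a twisted residue field. -/
lemma isDiv_smul_of_isStabilizationOf {Ω : Type} [Field Ω] [Algebra ℂ Ω] [IsAlgClosed Ω] {q m : ℕ}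
    {σ : RatFun ℂ (q + 2) ≃ₐ[ℂ] RatFun ℂ (q + 2)} {τ : RatFun ℂ (q + 3) ≃ₐ[ℂ] RatFun ℂ (q + 3)}
    (hτ : IsStabilizationOf τ σ) {V : ValuationSubring (RatFun ℂ (q + 3))} (hV : IsDiv V)
    {ρ : RatFun ℂ (q + 3) → Ω} (hρ : IsPlace V ρ) {θ : ℕ → Ω} {ξ ω y s : Ω}
    (hT : Twist m 1 θ ξ ω y)
    (hres : hρ.resField = IntermediateField.adjoin ℂ ((twistField m θ ξ ω y : Set Ω) ∪ {s})) :
    IsDiv (τ • V) := by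
  obtain ⟨p, hp, rfl⟩ := hV
  set V := primeVal (RatFun ℂ (q + 3)) p hp with hVdef
  obtain ⟨W, ψ, hψ, hWV, hψρ⟩ := hρ.exists_extension (E := AlgebraicClosure (RatFun ℂ (q + 3)))
  let c : RatFun ℂ (q + 3) →ₐ[ℂ] AlgebraicClosure (RatFun ℂ (q + 3)) :=
    IsScalarTower.toAlgHom ℂ _ _
  have hWV' : ∀ a, c a ∈ W ↔ a ∈ V := hWV
  have hψc : ∀ a ∈ V, ψ (c a) = ρ a := hψρ
  let X : Fin (q + 2) → RatFun ℂ (q + 3) := fun i => τ⁻¹ (coord i.castSucc)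
  let Y : Fin (q + 2) → AlgebraicClosure (RatFun ℂ (q + 3)) := fun i => c (X i)
  have hYind : AlgebraicIndependent ℂ Y := by
    have h1 := (algebraicIndependent_coord (q + 3)).comp _ (Fin.castSucc_injective (q + 2))
    exact h1.map' (f := c.comp (τ⁻¹ : RatFun ℂ (q + 3) ≃ₐ[ℂ] RatFun ℂ (q + 3)).toAlgHom)
      (c.injective.comp (τ⁻¹ : RatFun ℂ (q + 3) ≃ₐ[ℂ] RatFun ℂ (q + 3)).injective)
  have hlast : τ⁻¹ (coord (Fin.last (q + 2))) = coord (Fin.last (q + 2)) := by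
    change τ.symm _ = _
    rw [AlgEquiv.symm_apply_eq]; exact hτ.2.symm
  have hcY : ∀ i : Fin (q + 2), c (coord i.castSucc) ∈ IntermediateField.adjoin ℂ (Set.range Y) := by
    intro i
    let f : RatFun ℂ (q + 2) →ₐ[ℂ] AlgebraicClosure (RatFun ℂ (q + 3)) :=
      (c.comp (τ⁻¹ : RatFun ℂ (q + 3) ≃ₐ[ℂ] RatFun ℂ (q + 3)).toAlgHom).comp (stabAlg ℂ (q + 2))
    have h1 := map_mem_adjoin_range f (σ (coord i))
    have h2 : f (σ (coord i)) = c (coord i.castSucc) := by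
      change c (τ⁻¹ (stabAlg ℂ (q + 2) (σ (coord i)))) = _
      rw [← hτ.1, stabAlg_coord]
      congr 1
      exact τ.symm_apply_apply _
    have h3 : (fun i => f (coord i)) = Y := by
      funext j
      change c (τ⁻¹ (stabAlg ℂ (q + 2) (coord j))) = _
      rw [stabAlg_coord]
    rwa [h2, h3] at h1
  have hcV : ∀ i, coord i ∈ V := coord_mem_primeVal
  have hrk : ((q + 2 : ℕ) : ℕ∞) ≤ rk (Set.range fun i => ρ (coord i)) := hρ.le_rk
  have hrk' : ((q + 2 : ℕ) : ℕ∞) ≤ rk (hρ.resField : Set Ω) :=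
    hrk.trans (rk_mono (by rintro _ ⟨i, rfl⟩; exact hρ.res_mem (hcV i)))
  have hK : ∀ j : Fin (q + 2), ∀ a ∈ acl (Set.range fun i => Y (j.succAbove i)), a ∈ W := by
    intro j
    by_contra hcon
    have hlt := not_le.mp (mt hψ.mem_of_le_rk hcon)
    obtain ⟨z, hz⟩ := hψ.exists_ruled (acl (Set.range fun i => Y (j.succAbove i))) (Y j)
    refine hT.false_of_ruled (s := s) (z := z) (t := ρ (coord (Fin.last (q + 2)))) hlt ?_ ?_
    · rw [← hres]; exact hrk'
    · rw [← hres, hρ.resField_primeVal, IntermediateField.adjoin_le_iff]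
      rintro _ ⟨i, rfl⟩
      refine Fin.lastCases ?_ (fun i => ?_) i
      · exact IntermediateField.subset_adjoin _ _ (Or.inr (Or.inr rfl))
      · have h1 : c (coord i.castSucc) ∈ IntermediateField.adjoin ℂ
            ((acl (Set.range fun i => Y (j.succAbove i)) : Set _) ∪ {Y j}) := by
          refine IntermediateField.adjoin_le_iff.mpr ?_ (hcY i)
          rintro _ ⟨l, rfl⟩
          refine IntermediateField.subset_adjoin _ _ ?_
          rcases eq_or_ne l j with rfl | hlj
          · exact Or.inr rfl
          · obtain ⟨l', rfl⟩ := Fin.exists_succAbove_eq hlj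
            exact Or.inl (subset_acl _ ⟨l', rfl⟩)
        have h2 := hz (hψ.mem_res h1 ((hWV' _).mpr (hcV _)))
        rw [hψc _ (hcV _)] at h2
        refine IntermediateField.adjoin.mono _ _ _ ?_ h2
        exact Set.union_subset_union_right _ (by simp)
  have hYW : ∀ i, Y i ∈ W := by
    intro i
    obtain ⟨j, hj⟩ := exists_ne i
    obtain ⟨l, hl⟩ := Fin.exists_succAbove_eq hj.symm
    rw [← hl]
    exact hK j _ (subset_acl _ ⟨l, rfl⟩)
  have hXV : ∀ i, X i ∈ V := fun i => (hWV' _).mp (hYW i)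
  have hψY : ∀ i, ψ (Y i) = ρ (X i) := fun i => hψc _ (hXV i)
  refine (hρ.smul τ).isDiv ?_ ?_ (smul_ne_top (primeVal_ne_top hp) τ)
  · intro i
    rw [ValuationSubring.mem_pointwise_smul_iff_inv_smul_mem]
    refine Fin.lastCases ?_ (fun i => ?_) i
    · change τ⁻¹ _ ∈ V
      rw [hlast]; exact hcV _
    · exact hXV i
  · have hsub : Set.range (fun i => ψ (Y i)) ⊆ Set.range fun i => ρ (τ⁻¹ (coord i)) := by
      rintro _ ⟨i, rfl⟩
      exact ⟨i.castSucc, (hψY i).symm⟩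
    by_cases hA : ∀ a ∈ acl (Set.range Y), a ∈ W
    · have h1 := rk_range_of_algebraicIndependent (hψ.algebraicIndependent_res hYind hA)
      rw [Fintype.card_fin] at h1
      rw [← h1]
      exact rk_mono hsub
    · have hlt := not_le.mp (mt hψ.mem_of_le_rk hA)
      have ht : ρ (coord (Fin.last (q + 2))) ∉ acl (hψ.res (acl (Set.range Y)) : Set Ω) := by
        intro ht
        refine absurd (hrk.trans (rk_le_of_subset_acl ?_)) (not_le.mpr hlt)
        rintro _ ⟨i, rfl⟩
        refine Fin.lastCases ht (fun i => ?_) i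
        have := hψ.mem_res (adjoin_le_acl _ (hcY i)) ((hWV' _).mpr (hcV _))
        rw [hψc _ (hcV _)] at this
        exact subset_acl _ this
      have hind : AlgebraicIndependent ℂ (fun i => ψ (Y ((0 : Fin (q + 2)).succAbove i))) :=
        hψ.algebraicIndependent_res (hYind.comp _ Fin.succAbove_right_injective) (hK 0)
      have h1 := rk_range_of_algebraicIndependent hind
      have h2 : ρ (coord (Fin.last (q + 2))) ∉
          acl (Set.range fun i => ψ (Y ((0 : Fin (q + 2)).succAbove i))) := by
        refine fun h => ht (acl_mono ?_ h)
        rintro _ ⟨i, rfl⟩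
        exact hψ.mem_res (subset_acl _ ⟨_, rfl⟩) (hYW _)
      have h3 := rk_insert_of_notMem h2
      rw [h1, Fintype.card_fin] at h3
      have h4 : ((q + 2 : ℕ) : ℕ∞) = ((q + 1 : ℕ) : ℕ∞) + 1 := by push_cast; rw [add_assoc]; rfl
      rw [h4, ← h3]
      refine rk_mono ?_
      rintro _ (rfl | ⟨i, rfl⟩)
      · exact ⟨Fin.last (q + 2), by simp only [hlast]⟩
      · exact hsub ⟨_, rfl⟩

end Stabilization

end CremonaPlaces

namespace CremonaPlaces

section Cubics

variable {R S : Type} [CommRing R] [CommRing S]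

/-- The twisted quadrics through the quintic, in the chart `(1 : u : v : w)`. -/
def quad (H u v w : R) : Fin 4 → R :=
  ![H * (H * u ^ 2 + v * w) ^ 2 - H * u * v + w, v ^ 2 + u - (H * u ^ 2 + v * w) * w,
    H * u * (H * u ^ 2 + v * w) + w ^ 2 - v, H * ((H * u ^ 2 + v * w) * v - u * w) + 1]

/-- The twisted cubics inverting the quadrics. -/
def cub (H a b c d : R) : Fin 5 → R :=
  ![-a ^ 2 * c + H * a * b ^ 2 - b * d ^ 2 + c ^ 2 * d,
    -a ^ 3 + a * c * d - H * b ^ 2 * d + H * b * c ^ 2,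
    -a ^ 2 * d + H * a * b * c - H ^ 2 * b ^ 3 + c * d ^ 2,
    H * a ^ 2 * b - a * d ^ 2 + H * b * c * d - H * c ^ 3,
    H * a * b * d - H * a * c ^ 2 + H ^ 2 * b ^ 2 * c - d ^ 3]

lemma map_quad (f : R →+* S) (H u v w : R) (i : Fin 4) :
    f (quad H u v w i) = quad (f H) (f u) (f v) (f w) i := by
  fin_cases i <;> simp [quad]

lemma map_cub (f : R →+* S) (H a b c d : R) (i : Fin 5) :
    f (cub H a b c d i) = cub (f H) (f a) (f b) (f c) (f d) i := by
  fin_cases i <;> simp [cub]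

lemma cub_quad (H u v w : R) (i : Fin 5) :
    cub H (quad H u v w 0) (quad H u v w 1) (quad H u v w 2) (quad H u v w 3) i =
      (![u, H * u ^ 2 + v * w, v, w, 1] : Fin 5 → R) i *
      cub H (quad H u v w 0) (quad H u v w 1) (quad H u v w 2) (quad H u v w 3) 4 := by
  fin_cases i <;> simp [quad, cub] <;> ring

lemma quad_linear_u (H u v w : R) :
    u * quad H u v w 3 = v * quad H u v w 2 + quad H u v w 1 := by
  simp [quad]; ring

lemma quad_linear_w (H u v w : R) :
    w * quad H u v w 3 = quad H u v w 0 - H * u * quad H u v w 2 := by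
  simp [quad]; ring

lemma cub_smul (H a b c d l : R) (i : Fin 5) :
    cub H (l * a) (l * b) (l * c) (l * d) i = l ^ 3 * cub H a b c d i := by
  fin_cases i <;> simp [cub] <;> ring

end Cubics

section Points

variable {Ω : Type} [Field Ω]

lemma cub_of_curve {ξ Y y s H g : Ω} (hξ : ξ ≠ 0) (hy : y ≠ 0) (hg : g ≠ 0)
    (hH : H = y ^ 5 / g) (hgY : g = Y * (1 + ξ) - ξ ^ 2)
    (hc : Y ^ 2 + 2 * Y * ξ + Y - ξ ^ 3 - ξ ^ 2 = 0) {a b c : Ω}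
    (ha : a = (-Y - ξ * s) / (ξ * y)) (hb : b = (-g + ξ * (Y - ξ ^ 2) * s) / (ξ * y ^ 4))
    (hcc : c = ξ * s / y ^ 2) :
    cub H a b c 1 0 * (-y ^ 4 * ξ / g) = cub H a b c 1 4 ∧
    cub H a b c 1 2 * (-y ^ 4 * ξ / g) = y ^ 2 * (Y - ξ ^ 2) / g * cub H a b c 1 4 ∧
    cub H a b c 1 3 * (-y ^ 4 * ξ / g) = y ^ 3 * Y / g * cub H a b c 1 4 := by
  subst hH ha hb hcc
  refine ⟨?_, ?_, ?_⟩
  · refine sub_eq_zero.mp (Eq.trans (b := ((ξ^7*s^2 + ξ^7*s - ξ^6*Y*s^2 - 2*ξ^6*Y*s - ξ^6*s + ξ^5*Y^2*s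
      - 2*ξ^5*Y*s^2 + ξ^4*Y^2*s^2 + ξ^4*Y^2*s + 2*ξ^4*Y*s + ξ^3*Y^2*s^2 - ξ^3*Y^2*s
      - ξ^2*Y^2*s) / (g ^ 3 * ξ ^ 3)) * (Y ^ 2 + 2 * Y * ξ + Y - ξ ^ 3 - ξ ^ 2)) ?_
      (by rw [hc, mul_zero]))
    simp only [cub, Matrix.cons_val]
    field_simp
    subst hgY
    ring
  · refine sub_eq_zero.mp (Eq.trans (b := (y ^ 2 * (ξ^6*s + ξ^6 - ξ^5*Y*s - 2*ξ^5*Y - ξ^5 + ξ^4*Y^2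
      - 2*ξ^4*Y*s + ξ^3*Y^2*s + ξ^3*Y^2 + 2*ξ^3*Y + ξ^2*Y^2*s - ξ^2*Y^2 - ξ*Y^2)
      / (g ^ 3 * ξ ^ 3)) * (Y ^ 2 + 2 * Y * ξ + Y - ξ ^ 3 - ξ ^ 2)) ?_
      (by rw [hc, mul_zero]))
    simp only [cub, Matrix.cons_val]
    field_simp
    subst hgY
    ring
  · refine sub_eq_zero.mp (Eq.trans (b := (y ^ 3 * (ξ^6*s^3 + ξ^6*s^2 - ξ^5*Y*s^2 - ξ^5*s^2 - ξ^4*Y*s^3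
      + ξ^3*Y*s^2) / (g ^ 3 * ξ ^ 3)) * (Y ^ 2 + 2 * Y * ξ + Y - ξ ^ 3 - ξ ^ 2)) ?_
      (by rw [hc, mul_zero]))
    simp only [cub, Matrix.cons_val]
    field_simp
    subst hgY
    ring

/-- The residual curve of the cubics is again a twisted quintic. -/
lemma curve_of_cub {H a b c : Ω} (hH : H ≠ 0) (ha : a ≠ 0) (hb : b ≠ 0) (hc : c ≠ 0)
    (hac : a ^ 2 - c ≠ 0) (h : ∀ i, cub H a b c 1 i = 0) :
    ∃ ξ Y y : Ω, ξ ≠ 0 ∧ Y ^ 2 + 2 * Y * ξ + Y = ξ ^ 3 + ξ ^ 2 ∧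
      y ^ 5 = H ^ 2 * (Y * (1 + ξ) - ξ ^ 2) ∧ y ≠ 0 ∧
      ξ = a * H * b ^ 2 / (a ^ 2 - c) ^ 2 ∧ Y = - a ^ 2 * c * H ^ 2 * b ^ 3 / (a ^ 2 - c) ^ 3 ∧
      y = - a * H * b / (a ^ 2 - c) ∧
      a = y ^ 2 / (H * ξ) ∧ b = (ξ ^ 2 - Y) / (ξ * y ^ 2) ∧ c = Y / (ξ * y) := by
  have h0 := h 0
  have h1 := h 1
  have h2 := h 2
  have h3 := h 3
  have h4 := h 4
  simp only [cub, Matrix.cons_val] at h0 h1 h2 h3 h4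
  obtain ⟨D, hD⟩ : ∃ D, D = a ^ 2 - c := ⟨_, rfl⟩
  rw [← hD] at hac ⊢
  have hD2 : D = H * b * (a * c - H * b ^ 2) := by linear_combination hD - h2
  have p0 : c * D + b = H * a * b ^ 2 := by linear_combination c * hD - h0
  have p1 : (a ^ 2 + c) * D = H * a * b * c ^ 2 - b := by
    linear_combination (a ^ 2 + c) * hD - h0 - a * h1
  have p2 : a * H * b ^ 2 + D ^ 2 = c * H ^ 2 * b ^ 3 := by
    linear_combination D * hD2 + H * b * a * p0 - H ^ 2 * b ^ 3 * hD
  obtain ⟨ξ, hξ⟩ : ∃ ξ, ξ = a * H * b ^ 2 / D ^ 2 := ⟨_, rfl⟩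
  obtain ⟨Y, hY⟩ : ∃ Y, Y = - a ^ 2 * c * H ^ 2 * b ^ 3 / D ^ 3 := ⟨_, rfl⟩
  obtain ⟨y, hy⟩ : ∃ y, y = - a * H * b / D := ⟨_, rfl⟩
  have hξ0 : ξ ≠ 0 := by
    rw [hξ]
    exact div_ne_zero (mul_ne_zero (mul_ne_zero ha hH) (pow_ne_zero _ hb)) (pow_ne_zero _ hac)
  have hy0 : y ≠ 0 := by
    rw [hy]; exact div_ne_zero (mul_ne_zero (mul_ne_zero (neg_ne_zero.mpr ha) hH) hb) hac
  have e1 : y ^ 5 = -H ^ 2 * (Y ^ 2 + ξ * Y - ξ ^ 3) := by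
    rw [hξ, hY, hy]
    field_simp
    linear_combination -p1
  have e2 : y ^ 5 * (ξ + 1) = -H ^ 2 * (Y * (Y - ξ ^ 2)) := by
    rw [hξ, hY, hy]
    field_simp
    linear_combination -a * p2 + H * b * c * p0
  have hcurve : Y ^ 2 + 2 * Y * ξ + Y = ξ ^ 3 + ξ ^ 2 := by
    refine mul_left_cancel₀ (mul_ne_zero (pow_ne_zero 2 hH) hξ0) ?_
    linear_combination (ξ + 1) * e1 - e2
  refine ⟨ξ, Y, y, hξ0, hcurve, ?_, hy0, hξ, hY, hy, ?_, ?_, ?_⟩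
  · linear_combination e1 - H ^ 2 * hcurve
  · rw [hξ, hy]; field_simp
  · rw [hξ, hy, hY]; field_simp
    linear_combination -p0
  · rw [hξ, hy, hY]; field_simp

lemma cub_degenerate {H a b c : Ω} (hH : H ≠ 0) (h : ∀ i, cub H a b c 1 i = 0)
    (hd : a = 0 ∨ b = 0 ∨ c = 0 ∨ a ^ 2 - c = 0) {K : Subfield Ω}
    (hK : ∀ x, x ^ 5 ∈ K → x ∈ K) (hHK : H ∈ K) : a ∈ K ∧ b ∈ K ∧ c ∈ K := by
  have h0 := h 0
  have h1 := h 1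
  have h2 := h 2
  have h3 := h 3
  have h4 := h 4
  simp only [cub, Matrix.cons_val] at h0 h1 h2 h3 h4
  by_cases hb0 : b = 0
  · subst hb0
    have hc : c = a ^ 2 := by linear_combination h2
    subst hc
    have ha : a ∈ K := by
      refine hK a ?_
      have : a ^ 5 = - H⁻¹ := by field_simp; linear_combination -h4
      rw [this]; exact neg_mem (inv_mem hHK)
    exact ⟨ha, zero_mem K, pow_mem ha 2⟩
  by_cases ha0 : a = 0
  · subst ha0
    have hc : c = H ^ 2 * b ^ 3 := by linear_combination h2
    have hb : b ∈ K := by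
      refine hK b ?_
      have : b ^ 5 = (H ^ 4)⁻¹ := by field_simp; rw [hc] at h4; linear_combination h4
      rw [this]; exact inv_mem (pow_mem hHK 4)
    exact ⟨zero_mem K, hb, by rw [hc]; exact mul_mem (pow_mem hHK 2) (pow_mem hb 3)⟩
  by_cases hc0 : c = 0
  · subst hc0
    have ha : a = (H * b)⁻¹ := by
      field_simp; linear_combination h4
    have hb : b ∈ K := by
      refine hK b ?_
      have : b ^ 5 = -(H ^ 4)⁻¹ := by
        rw [ha] at h2
        field_simp at h2 ⊢; linear_combination -h2
      rw [this]; exact neg_mem (inv_mem (pow_mem hHK 4))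
    exact ⟨by rw [ha]; exact inv_mem (mul_mem hHK hb), hb, zero_mem K⟩
  have hc : c = a ^ 2 := by
    rcases hd with hd | hd | hd | hd
    · exact absurd hd ha0
    · exact absurd hd hb0
    · exact absurd hd hc0
    · linear_combination -hd
  subst hc
  have e : H * a * b = 1 := by
    have : b * (H * a * b - 1) = 0 := by linear_combination h0
    rcases mul_eq_zero.mp this with h | h
    · exact absurd h hb0
    · linear_combination h
  have hb : b = a ^ 4 := by
    have : H * b * (a ^ 3 - H * b ^ 2) = 0 := by linear_combination h2
    rcases mul_eq_zero.mp this with h | h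
    · exact absurd h (mul_ne_zero hH hb0)
    · linear_combination -b * e - a * h
  subst hb
  have ha : a ∈ K := by
    refine hK a ?_
    have : a ^ 5 = H⁻¹ := by field_simp; linear_combination e
    rw [this]; exact inv_mem hHK
  exact ⟨ha, pow_mem ha 4, pow_mem ha 2⟩

end Points

end CremonaPlaces

namespace CremonaPlaces

section PlaceOfPoint

variable {Ω : Type} [Field Ω] [Algebra ℂ Ω] {n : ℕ}

open Classical in
/-- Evaluation of rational functions at a point. -/
def evalPt (p : MvPolynomial (Fin n) ℂ) (x : Fin n → Ω) (f : RatFun ℂ n) : Ω :=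
  if h : ∃ ab : MvPolynomial (Fin n) ℂ × MvPolynomial (Fin n) ℂ, ¬ p ∣ ab.2 ∧
      f * algebraMap _ (RatFun ℂ n) ab.2 = algebraMap _ (RatFun ℂ n) ab.1 then
    aeval x h.choose.1 / aeval x h.choose.2 else 0

lemma evalPt_eq {p : MvPolynomial (Fin n) ℂ} {x : Fin n → Ω} (hx : ∀ f, aeval x f = 0 ↔ p ∣ f)
    {f : RatFun ℂ n} {a b : MvPolynomial (Fin n) ℂ} (hb : ¬ p ∣ b)
    (hf : f * algebraMap _ (RatFun ℂ n) b = algebraMap _ (RatFun ℂ n) a) :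
    evalPt p x f = aeval x a / aeval x b := by
  have h : ∃ ab : MvPolynomial (Fin n) ℂ × MvPolynomial (Fin n) ℂ, ¬ p ∣ ab.2 ∧
      f * algebraMap _ (RatFun ℂ n) ab.2 = algebraMap _ (RatFun ℂ n) ab.1 := ⟨(a, b), hb, hf⟩
  rw [evalPt, dif_pos h]
  obtain ⟨h1, h2⟩ := h.choose_spec
  generalize h.choose = ab at h1 h2
  have e : ab.1 * b = a * ab.2 := by
    apply IsFractionRing.injective (MvPolynomial (Fin n) ℂ) (RatFun ℂ n)
    rw [map_mul, map_mul, ← h2, ← hf]; ring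
  rw [div_eq_div_iff (fun h => h1 ((hx _).mp h)) (fun h => hb ((hx _).mp h)), ← map_mul, e, map_mul]

lemma isPlace_evalPt {p : MvPolynomial (Fin n) ℂ} (hp : Prime p) {x : Fin n → Ω}
    (hx : ∀ f, aeval x f = 0 ↔ p ∣ f) : IsPlace (primeVal (RatFun ℂ n) p hp) (evalPt p x) where
  base := base_primeVal
  const c := by
    rw [evalPt_eq hx (a := C c) (b := 1) hp.not_dvd_one]
    · simp
    · rw [map_one, mul_one, IsScalarTower.algebraMap_apply ℂ (MvPolynomial (Fin n) ℂ)]; rfl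
  add := by
    rintro f ⟨a, b, hb, hf⟩ g ⟨a', b', hb', hg⟩
    have hbb : ¬ p ∣ b * b' := fun h => (hp.dvd_or_dvd h).elim hb hb'
    have h1 : aeval x b ≠ 0 := fun h => hb ((hx _).mp h)
    have h2 : aeval x b' ≠ 0 := fun h => hb' ((hx _).mp h)
    rw [evalPt_eq hx hb hf, evalPt_eq hx hb' hg, evalPt_eq hx hbb (a := a * b' + a' * b)]
    · rw [map_add, map_mul, map_mul, map_mul]; field_simp
    · rw [map_add, map_mul, map_mul, map_mul, ← hf, ← hg]; ring
  mul := by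
    rintro f ⟨a, b, hb, hf⟩ g ⟨a', b', hb', hg⟩
    have hbb : ¬ p ∣ b * b' := fun h => (hp.dvd_or_dvd h).elim hb hb'
    rw [evalPt_eq hx hb hf, evalPt_eq hx hb' hg, evalPt_eq hx hbb (a := a * a')]
    · rw [map_mul, map_mul, div_mul_div_comm]
    · rw [map_mul, map_mul, ← hf, ← hg]; ring
  eq_zero := by
    rintro f ⟨a, b, hb, hf⟩ hinv
    rw [evalPt_eq hx hb hf]
    by_cases ha : p ∣ a
    · rw [(hx a).mpr ha, zero_div]
    · refine absurd ⟨b, a, ha, ?_⟩ hinv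
      have hf0 : f ≠ 0 := by
        rintro rfl
        exact hinv (by rw [inv_zero]; exact zero_mem _)
      rw [← hf, inv_mul_cancel_left₀ hf0]

/-- A point of corank one determines a divisorial place. -/
lemma exists_isPlace_of_point {x : Fin (n + 1) → Ω} (hrk : (n : ℕ∞) ≤ rk (Set.range x))
    (hdep : rk (Set.range x) < (n + 1 : ℕ)) :
    ∃ (p : MvPolynomial (Fin (n + 1)) ℂ) (hp : Prime p) (ρ : RatFun ℂ (n + 1) → Ω),
      IsPlace (primeVal (RatFun ℂ (n + 1)) p hp) ρ ∧ ∀ i, ρ (coord i) = x i := by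
  obtain ⟨f, hf0, hf⟩ : ∃ f : MvPolynomial (Fin (n + 1)) ℂ, f ≠ 0 ∧ aeval x f = 0 := by
    by_contra hcon
    push Not at hcon
    have : AlgebraicIndependent ℂ x := by
      rw [algebraicIndependent_iff]
      intro p hp
      by_contra h0
      exact hcon p h0 hp
    rw [rk_range_of_algebraicIndependent this, Fintype.card_fin] at hdep
    exact lt_irrefl _ hdep
  obtain ⟨q, hq, hq0⟩ : ∃ q : MvPolynomial (Fin (n + 1)) ℂ, Irreducible q ∧ aeval x q = 0 := by
    induction f using WfDvdMonoid.induction_on_irreducible with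
    | zero => exact absurd rfl hf0
    | unit u hu =>
      have := hu.map (MvPolynomial.aeval (R := ℂ) x)
      rw [hf] at this
      exact absurd this not_isUnit_zero
    | mul a i ha hi ih =>
      rw [map_mul, mul_eq_zero] at hf
      rcases hf with hf | hf
      · exact ⟨i, hi, hf⟩
      · exact ih ha hf
  obtain ⟨i, hi⟩ := exists_succAbove_independent hrk
  have hq' : Prime q := UniqueFactorizationMonoid.irreducible_iff_prime.mp hq
  have hx : ∀ f, aeval x f = 0 ↔ q ∣ f := by
    refine fun f => ⟨ker_aeval_le_span x i hi hq hq0, ?_⟩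
    rintro ⟨b, rfl⟩
    rw [map_mul, hq0, zero_mul]
  refine ⟨q, hq', evalPt q x, isPlace_evalPt hq' hx, fun i => ?_⟩
  rw [evalPt_eq hx (a := X i) (b := 1) hq'.not_dvd_one (by simp)]
  simp

end PlaceOfPoint

section Automorphism

lemma exists_algEquiv_of_mem_adjoin {n : ℕ} {x : Fin n → RatFun ℂ n}
    (h : ∀ i, coord i ∈ IntermediateField.adjoin ℂ (Set.range x)) :
    ∃ φ : RatFun ℂ n ≃ₐ[ℂ] RatFun ℂ n, ∀ i, φ (coord i) = x i := by
  have hx : AlgebraicIndependent ℂ x := by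
    apply algebraicIndependent_of_le_rk
    rw [← rk_range_of_algebraicIndependent (algebraicIndependent_coord n)]
    refine rk_le_of_subset_acl ?_
    rintro _ ⟨i, rfl⟩
    exact adjoin_le_acl _ (h i)
  let φ : RatFun ℂ n →ₐ[ℂ] RatFun ℂ n := IsFractionRing.liftAlgHom (R := ℂ) (g := aeval x) hx
  have hφ : ∀ i, φ (coord i) = x i := fun i => by
    have hinj : Function.Injective
        ((aeval x : MvPolynomial (Fin n) ℂ →ₐ[ℂ] RatFun ℂ n) : MvPolynomial (Fin n) ℂ →+* RatFun ℂ n) :=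
      fun a b h => hx h
    have := IsFractionRing.lift_algebraMap (K := RatFun ℂ n) hinj (X i)
    refine this.trans ?_
    simp
  have hsurj : Function.Surjective φ := by
    have hmem : ∀ f : RatFun ℂ n, f ∈ IntermediateField.adjoin ℂ (Set.range x) := by
      intro f
      have := map_mem_adjoin_range (AlgHom.id ℂ (RatFun ℂ n)) f
      refine IntermediateField.adjoin_le_iff.mpr ?_ this
      rintro _ ⟨i, rfl⟩
      exact h i
    intro f
    have h1 : IntermediateField.adjoin ℂ (Set.range x) ≤ φ.fieldRange := by
      rw [IntermediateField.adjoin_le_iff]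
      rintro _ ⟨i, rfl⟩
      exact ⟨coord i, hφ i⟩
    exact h1 (hmem f)
  exact ⟨AlgEquiv.ofBijective φ ⟨φ.injective, hsurj⟩, hφ⟩

/-- Extend a tuple by three further values. -/
def pt {R : Type} (m : ℕ) (t : ℕ → R) (u v w : R) (j : ℕ) : R :=
  if j < m then t j else if j = m then u else if j = m + 1 then v else w

lemma range_pt {R : Type} (m : ℕ) (t : ℕ → R) (u v w : R) :
    (Set.range fun j : Fin (m + 3) => pt m t u v w j) = t '' Set.Iio m ∪ {u, v, w} := by
  ext x
  constructor
  · rintro ⟨⟨j, hj⟩, rfl⟩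
    simp only [pt]
    split_ifs with h1 h2 h3
    · exact Or.inl ⟨j, h1, rfl⟩
    · simp
    · simp
    · simp
  · rintro (⟨j, hj, rfl⟩ | rfl | rfl | rfl)
    · exact ⟨⟨j, by simp only [Set.mem_Iio] at hj; omega⟩, by simp only [Set.mem_Iio] at hj; simp [pt, hj]⟩
    · exact ⟨⟨m, by omega⟩, by simp [pt]⟩
    · exact ⟨⟨m + 1, by omega⟩, by simp [pt]⟩
    · exact ⟨⟨m + 2, by omega⟩, by simp [pt]⟩

/-- Coordinate polynomials indexed by natural numbers. -/
def polyCoord (m : ℕ) (j : ℕ) : MvPolynomial (Fin (m + 3)) ℂ :=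
  if h : j < m + 3 then X ⟨j, h⟩ else 0

/-- Coordinates indexed by natural numbers. -/
def natCoord (m : ℕ) (j : ℕ) : RatFun ℂ (m + 3) := algebraMap _ _ (polyCoord m j)

lemma coord_eq_natCoord {m : ℕ} (i : Fin (m + 3)) : coord i = natCoord m i := by
  simp [natCoord, polyCoord, coord]

lemma natCoord_eq_pt {m j : ℕ} (hj : j < m + 3) : natCoord m j =
    pt m (natCoord m) (natCoord m m) (natCoord m (m + 1)) (natCoord m (m + 2)) j := by
  simp only [pt]
  split_ifs with h1 h2 h3
  · rfl
  · rw [h2]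
  · rw [h3]
  · congr 1; omega

/-- The quadrics and cubics define mutually inverse Cremona transformations. -/
lemma exists_cremona (m : ℕ) : ∃ φ : RatFun ℂ (m + 3) ≃ₐ[ℂ] RatFun ℂ (m + 3),
    (∀ j < m, φ (natCoord m j) = natCoord m j) ∧
    (∀ Q : Fin 4 → RatFun ℂ (m + 3), Q = quad (hseq (natCoord m) m) (natCoord m m)
        (natCoord m (m + 1)) (natCoord m (m + 2)) →
      φ (natCoord m m) = Q 0 / Q 3 ∧ φ (natCoord m (m + 1)) = Q 1 / Q 3 ∧
      φ (natCoord m (m + 2)) = Q 2 / Q 3) ∧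
    (∀ R : Fin 5 → RatFun ℂ (m + 3), R = cub (hseq (natCoord m) m) (natCoord m m)
        (natCoord m (m + 1)) (natCoord m (m + 2)) 1 →
      φ.symm (natCoord m m) = R 0 / R 4 ∧ φ.symm (natCoord m (m + 1)) = R 2 / R 4 ∧
      φ.symm (natCoord m (m + 2)) = R 3 / R 4) := by
  obtain ⟨H, hH⟩ : ∃ H, H = hseq (natCoord m) m := ⟨_, rfl⟩
  obtain ⟨u, hu⟩ : ∃ u, u = natCoord m m := ⟨_, rfl⟩
  obtain ⟨v, hv⟩ : ∃ v, v = natCoord m (m + 1) := ⟨_, rfl⟩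
  obtain ⟨w, hw⟩ : ∃ w, w = natCoord m (m + 2) := ⟨_, rfl⟩
  rw [← hH, ← hu, ← hv, ← hw]
  obtain ⟨Q, hQ⟩ : ∃ Q, Q = quad H u v w := ⟨_, rfl⟩
  have hne : Q 3 ≠ 0 ∧ cub H (Q 0) (Q 1) (Q 2) (Q 3) 4 ≠ 0 := by
    let H' : MvPolynomial (Fin (m + 3)) ℂ := hseq (polyCoord m) m
    let Q' := quad H' (polyCoord m m) (polyCoord m (m + 1)) (polyCoord m (m + 2))
    let i : MvPolynomial (Fin (m + 3)) ℂ →+* RatFun ℂ (m + 3) := algebraMap _ _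
    have hi : ∀ z, z ≠ 0 → i z ≠ 0 := fun z hz => by
      rw [Ne, FaithfulSMul.algebraMap_eq_zero_iff]; exact hz
    have hH' : i H' = H := by rw [hH]; exact map_hseq i _ _
    have hQ' : ∀ j, i (Q' j) = Q j := fun j => by
      rw [hQ, map_quad, hH', hu, hv, hw]; rfl
    let e : MvPolynomial (Fin (m + 3)) ℂ →+* ℂ := (aeval (R := ℂ) fun _ => (0 : ℂ)).toRingHom
    have he : ∀ j, e (polyCoord m j) = 0 := fun j => by
      simp only [polyCoord]; split_ifs <;> simp [e]
    have heH : e H' = 1 := by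
      rw [map_hseq]; simp_rw [he]; exact hseq_zero m
    have heQ : ∀ j, e (Q' j) = ![0, 0, 0, 1] j := fun j => by
      rw [map_quad, he, he, he, heH]; fin_cases j <;> simp [quad]
    constructor
    · rw [← hQ']
      refine hi _ fun h0 => ?_
      have := heQ 3
      rw [h0] at this
      simp at this
    · rw [← hH', ← hQ', ← hQ', ← hQ', ← hQ', ← map_cub]
      refine hi _ fun h0 => ?_
      have := congrArg e h0
      rw [map_cub, heQ, heQ, heQ, heQ, heH] at this
      simp [cub] at this
  obtain ⟨hne3, hne4⟩ := hne
  let x : Fin (m + 3) → RatFun ℂ (m + 3) := fun j =>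
    pt m (natCoord m) (Q 0 / Q 3) (Q 1 / Q 3) (Q 2 / Q 3) j
  have hcub : ∀ i, cub H (Q 0 / Q 3) (Q 1 / Q 3) (Q 2 / Q 3) 1 i =
      (Q 3)⁻¹ ^ 3 * cub H (Q 0) (Q 1) (Q 2) (Q 3) i := fun i => by
    rw [← cub_smul, inv_mul_cancel₀ hne3, inv_mul_eq_div, inv_mul_eq_div, inv_mul_eq_div]
  have hne4' : cub H (Q 0 / Q 3) (Q 1 / Q 3) (Q 2 / Q 3) 1 4 ≠ 0 := by
    rw [hcub]; exact mul_ne_zero (pow_ne_zero _ (inv_ne_zero hne3)) hne4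
  have hinv : ∀ i, (![u, H * u ^ 2 + v * w, v, w, 1] : Fin 5 → _) i =
      cub H (Q 0 / Q 3) (Q 1 / Q 3) (Q 2 / Q 3) 1 i /
        cub H (Q 0 / Q 3) (Q 1 / Q 3) (Q 2 / Q 3) 1 4 := fun i => by
    rw [eq_div_iff hne4', hcub, hcub]
    have := cub_quad H u v w i
    rw [← hQ] at this
    rw [this]; ring
  have hrange := range_pt m (natCoord m) (Q 0 / Q 3) (Q 1 / Q 3) (Q 2 / Q 3)
  obtain ⟨φ, hφ⟩ := exists_algEquiv_of_mem_adjoin (x := x) (by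
    let L := IntermediateField.adjoin ℂ (Set.range x)
    have hxs : ∀ z ∈ natCoord m '' Set.Iio m ∪ {Q 0 / Q 3, Q 1 / Q 3, Q 2 / Q 3}, z ∈ L := by
      intro z hz
      rw [← hrange] at hz
      exact IntermediateField.subset_adjoin _ _ hz
    have hcubL : ∀ i, cub H (Q 0 / Q 3) (Q 1 / Q 3) (Q 2 / Q 3) 1 i ∈ L := by
      have hHL : H ∈ L := by
        rw [hH]
        exact hseq_mem L.toSubring fun i hi => hxs _ (Or.inl ⟨i, hi, rfl⟩)
      intro i
      have := map_cub (L.val : L →+* RatFun ℂ (m + 3)) ⟨H, hHL⟩ ⟨_, hxs (Q 0 / Q 3) (by simp)⟩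
        ⟨_, hxs (Q 1 / Q 3) (by simp)⟩ ⟨_, hxs (Q 2 / Q 3) (by simp)⟩ 1 i
      rw [map_one] at this
      rw [show cub H (Q 0 / Q 3) (Q 1 / Q 3) (Q 2 / Q 3) 1 i = _ from this.symm]
      exact (cub _ _ _ _ _ i : L).2
    have hall : ∀ j < m + 3, natCoord m j ∈ L := by
      intro j hj
      rw [natCoord_eq_pt hj]
      simp only [pt, ← hu, ← hv, ← hw]
      split_ifs with h1 h2 h3
      · exact hxs _ (Or.inl ⟨j, h1, rfl⟩)
      · rw [show u = _ from hinv 0]; exact div_mem (hcubL _) (hcubL _)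
      · rw [show v = _ from hinv 2]; exact div_mem (hcubL _) (hcubL _)
      · rw [show w = _ from hinv 3]; exact div_mem (hcubL _) (hcubL _)
    intro i
    rw [coord_eq_natCoord]
    exact hall i i.2)
  have hφn : ∀ j, j < m + 3 → φ (natCoord m j) = pt m (natCoord m) (Q 0 / Q 3) (Q 1 / Q 3)
      (Q 2 / Q 3) j := fun j hj => by
    have := hφ ⟨j, hj⟩
    rwa [coord_eq_natCoord] at this
  have h0 : ∀ j < m, φ (natCoord m j) = natCoord m j := fun j hj => by
    rw [hφn j (by omega)]; simp [pt, hj]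
  have h1 : φ u = Q 0 / Q 3 := by rw [hu, hφn m (by omega)]; simp [pt]
  have h2 : φ v = Q 1 / Q 3 := by rw [hv, hφn (m + 1) (by omega)]; simp [pt]
  have h3 : φ w = Q 2 / Q 3 := by rw [hw, hφn (m + 2) (by omega)]; simp [pt]
  have hφH : φ H = H := by
    rw [hH]
    refine (map_hseq (φ : RatFun ℂ (m + 3) →+* RatFun ℂ (m + 3)) _ _).trans ?_
    exact hseq_congr h0
  have hφc : ∀ i, φ (cub H u v w 1 i) = cub H (Q 0 / Q 3) (Q 1 / Q 3) (Q 2 / Q 3) 1 i := fun i => by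
    rw [← h1, ← h2, ← h3]
    conv_rhs => rw [← hφH, ← map_one φ]
    exact map_cub (φ : RatFun ℂ (m + 3) →+* RatFun ℂ (m + 3)) _ _ _ _ _ _
  refine ⟨φ, h0, ?_, ?_⟩
  · rintro Q' rfl
    rw [← hQ]
    exact ⟨h1, h2, h3⟩
  · rintro R rfl
    refine ⟨?_, ?_, ?_⟩ <;> rw [AlgEquiv.symm_apply_eq, map_div₀, hφc, hφc]
    · exact hinv 0
    · exact hinv 2
    · exact hinv 3

end Automorphism

end CremonaPlaces

namespace CremonaPlaces

section ImagePlace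

variable {Ω : Type} [Field Ω] [Algebra ℂ Ω]

lemma quad_mem {L : IntermediateField ℂ Ω} {H u v w : Ω} (hH : H ∈ L) (hu : u ∈ L) (hv : v ∈ L)
    (hw : w ∈ L) (i : Fin 4) : quad H u v w i ∈ L := by
  have := map_quad (L.val : L →+* Ω) ⟨H, hH⟩ ⟨u, hu⟩ ⟨v, hv⟩ ⟨w, hw⟩ i
  rw [show quad H u v w i = _ from this.symm]
  exact (quad _ _ _ _ i : L).2

lemma cub_mem {L : IntermediateField ℂ Ω} {H a b c : Ω} (hH : H ∈ L) (ha : a ∈ L) (hb : b ∈ L)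
    (hc : c ∈ L) (i : Fin 5) : cub H a b c 1 i ∈ L := by
  have := map_cub (L.val : L →+* Ω) ⟨H, hH⟩ ⟨a, ha⟩ ⟨b, hb⟩ ⟨c, hc⟩ 1 i
  rw [map_one] at this
  rw [show cub H a b c 1 i = _ from this.symm]
  exact (cub _ _ _ _ _ i : L).2

lemma rk_image_Iio_le (m : ℕ) (t : ℕ → Ω) : rk (t '' Set.Iio m) ≤ (m : ℕ∞) := by
  refine ((indepMat Ω).eRk_le_encard _).trans ((Set.encard_image_le _ _).trans ?_)
  rw [← Finset.coe_Iio, Set.encard_coe_eq_coe_finsetCard, Nat.card_Iio]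

lemma algebraicIndependent_of_le_rk_image {m : ℕ} {t : ℕ → Ω}
    (h : (m : ℕ∞) ≤ rk (t '' Set.Iio m)) : AlgebraicIndependent ℂ (fun i : Fin m => t i) := by
  apply algebraicIndependent_of_le_rk
  rw [Fintype.card_fin]
  refine h.trans (rk_mono ?_)
  rintro _ ⟨i, hi, rfl⟩
  exact ⟨⟨i, hi⟩, rfl⟩

lemma mem_acl_of_curve {S : Set Ω} {ξ Y : Ω} (hξ : ξ ∈ acl S)
    (h : Y ^ 2 + 2 * Y * ξ + Y = ξ ^ 3 + ξ ^ 2) : Y ∈ acl S := by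
  have : CharZero Ω := charZero_omega Ω
  have h2 : (2 : Ω) * Y + (2 * ξ + 1) ∈ acl S := by
    refine mem_acl_of_pow two_ne_zero ?_
    have e : ((2 : Ω) * Y + (2 * ξ + 1)) ^ 2 = 4 * ξ ^ 3 + 8 * ξ ^ 2 + 4 * ξ + 1 := by
      linear_combination 4 * h
    rw [e]
    exact add_mem (add_mem (add_mem (mul_mem (ofNat_mem _ _) (pow_mem hξ _))
      (mul_mem (ofNat_mem _ _) (pow_mem hξ _))) (mul_mem (ofNat_mem _ _) hξ)) (one_mem _)
  have e : Y = (((2 : Ω) * Y + (2 * ξ + 1)) - (2 * ξ + 1)) / 2 := by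
    rw [add_sub_cancel_right, mul_div_cancel_left₀ _ two_ne_zero]
  rw [e]
  exact div_mem (sub_mem h2 (add_mem (mul_mem (ofNat_mem _ _) hξ) (one_mem _))) (ofNat_mem _ _)

/-- The residues of a ruled place over a twisted quintic stay generic under the quadrics. -/
lemma Twist.le_rk_quad [IsAlgClosed Ω] {k : ℕ} {τ t : ℕ → Ω} {ξ ω y s u v w : Ω}
    (hT : Twist (k + 1) 1 τ ξ ω y) (hs : s ∉ acl (twistField (k + 1) τ ξ ω y : Set Ω))
    (hM : IntermediateField.adjoin ℂ (t '' Set.Iio (k + 1) ∪ {u, v, w}) =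
      IntermediateField.adjoin ℂ ((twistField (k + 1) τ ξ ω y : Set Ω) ∪ {s}))
    (hrk : ((k + 3 : ℕ) : ℕ∞) ≤ rk (t '' Set.Iio (k + 1) ∪ {u, v, w}))
    {Q : Fin 4 → Ω} (hQ : Q = quad (hseq t (k + 1)) u v w) :
    Q 3 ≠ 0 ∧ ((k + 3 : ℕ) : ℕ∞) ≤
      rk (t '' Set.Iio (k + 1) ∪ {Q 0 / Q 3, Q 1 / Q 3, Q 2 / Q 3}) := by
  obtain ⟨T, hTdef⟩ : ∃ T, T = t '' Set.Iio (k + 1) := ⟨_, rfl⟩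
  have hrkT : rk T ≤ ((k + 1 : ℕ) : ℕ∞) := hTdef ▸ rk_image_Iio_le _ _
  obtain ⟨d, hd⟩ := ENat.ne_top_iff_exists.mp (ne_top_of_le_ne_top (ENat.natCast_ne_top _) hrkT)
  rw [← hd] at hrkT
  norm_cast at hrkT
  rw [← hTdef] at hM hrk
  have hr : ((k + 1 + 2 : ℕ) : ℕ∞) ≤
      rk (IntermediateField.adjoin ℂ ((twistField (k + 1) τ ξ ω y : Set Ω) ∪ {s}) : Set Ω) := by
    rw [← hM]
    exact hrk.trans (rk_mono (IntermediateField.subset_adjoin _ _))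
  -- the first residues are independent
  have hdk : k + 1 ≤ d := by
    by_contra hcon
    refine hT.false_of_ruled (k₀ := IntermediateField.adjoin ℂ (insert w T)) (q := k + 1)
      (z := u) (t := v) ?_ hr ?_
    · rw [← rk_acl, acl_adjoin, rk_acl]
      refine (rk_insert_le _ _).trans_lt ?_
      rw [← hd]
      norm_cast
      omega
    · rw [← hM, IntermediateField.adjoin_le_iff]
      have h1 : insert w T ⊆ (IntermediateField.adjoin ℂ (insert w T) : Set Ω) :=
        IntermediateField.subset_adjoin _ _
      rintro x (hx | hx)
      · exact IntermediateField.subset_adjoin _ _ (Or.inl (h1 (Or.inr hx)))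
      · refine IntermediateField.subset_adjoin _ _ ?_
        rcases hx with rfl | rfl | rfl
        · simp
        · simp
        · exact Or.inl (h1 (Or.inl rfl))
  have hdk : d = k + 1 := le_antisymm hrkT hdk
  subst hdk
  have hind : AlgebraicIndependent ℂ (fun i : Fin (k + 1) => t i) :=
    algebraicIndependent_of_le_rk_image (by rw [← hTdef, ← hd])
  obtain ⟨H, hH⟩ : ∃ H, H = hseq t (k + 1) := ⟨_, rfl⟩
  have hH0 : H ≠ 0 := hH ▸ hseq_ne_zero hind le_rfl
  have hHmem : ∀ L : IntermediateField ℂ Ω, T ⊆ L → H ∈ L := by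
    intro L hL
    rw [hH]
    exact hseq_mem L.toSubring fun i hi => hL (hTdef ▸ ⟨i, hi, rfl⟩)
  have hHT : H ∈ acl T := hHmem _ (subset_acl T)
  rw [← hH] at hQ
  have hlow : ∀ {x}, T ∪ {u, v, w} ⊆ acl (insert x T) → False := by
    intro x hx
    have := hrk.trans ((rk_le_of_subset_acl hx).trans (rk_insert_le _ _))
    rw [← hd] at this
    norm_cast at this
    omega
  have hsub : ∀ x, T ⊆ acl (insert x T) := fun x => (Set.subset_insert _ _).trans (subset_acl _)
  have hle : ∀ x, acl T ≤ acl (insert x T) := fun x => acl_mono (Set.subset_insert _ _)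
  have h3 : Q 3 ≠ 0 := by
    intro h0
    have e : H * w * (v ^ 2 - u) = -(1 + H ^ 2 * u ^ 2 * v) := by
      rw [hQ] at h0
      simp only [quad, Matrix.cons_val] at h0
      linear_combination h0
    by_cases hvu : v ^ 2 - u = 0
    · have hu : u = v ^ 2 := by linear_combination -hvu
      have hv : v ∈ acl T := by
        refine mem_acl_of_pow (n := 5) (by norm_num) ?_
        have : v ^ 5 = -(H ^ 2)⁻¹ := by
          field_simp
          rw [hvu, hu] at e
          linear_combination e
        rw [this]
        exact neg_mem (inv_mem (pow_mem hHT _))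
      refine hlow (x := w) ?_
      rintro x (hx | rfl | rfl | rfl)
      · exact hsub _ hx
      · rw [hu]; exact pow_mem (hle _ hv) _
      · exact hle _ hv
      · exact subset_acl _ (Or.inl rfl)
    · refine hT.false_of_ruled (k₀ := IntermediateField.adjoin ℂ T) (q := k + 1)
        (z := u) (t := v) ?_ hr ?_
      · rw [← rk_acl, acl_adjoin, rk_acl, ← hd]
        norm_cast
        omega
      · rw [← hM, IntermediateField.adjoin_le_iff]
        obtain ⟨L, hL⟩ : ∃ L, L = IntermediateField.adjoin ℂ
          ((IntermediateField.adjoin ℂ T : Set Ω) ∪ {u, v}) := ⟨_, rfl⟩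
        rw [← hL]
        have hLs : (IntermediateField.adjoin ℂ T : Set Ω) ∪ {u, v} ⊆ L :=
          hL ▸ IntermediateField.subset_adjoin _ _
        have hTL : T ⊆ L := fun x hx =>
          hLs (Or.inl (IntermediateField.subset_adjoin _ _ hx))
        have hu : u ∈ L := hLs (by simp)
        have hv : v ∈ L := hLs (by simp)
        have hHL := hHmem L hTL
        rintro x (hx | rfl | rfl | rfl)
        · exact hTL hx
        · exact hu
        · exact hv
        · have : x = -(1 + H ^ 2 * u ^ 2 * v) / (H * (v ^ 2 - u)) := by
            rw [eq_div_iff (mul_ne_zero hH0 hvu)]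
            linear_combination e
          rw [this]
          exact div_mem (neg_mem (add_mem (one_mem _) (mul_mem (mul_mem (pow_mem hHL _)
            (pow_mem hu _)) hv))) (mul_mem hHL (sub_mem (pow_mem hv _) hu))
  refine ⟨h3, ?_⟩
  rw [← hTdef]
  obtain ⟨a, ha⟩ : ∃ a, a = Q 0 / Q 3 := ⟨_, rfl⟩
  obtain ⟨b, hb⟩ : ∃ b, b = Q 1 / Q 3 := ⟨_, rfl⟩
  obtain ⟨c, hc⟩ : ∃ c, c = Q 2 / Q 3 := ⟨_, rfl⟩
  rw [← ha, ← hb, ← hc]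
  by_contra hlt
  have hu : u = v * c + b := by
    rw [hc, hb]; field_simp; rw [hQ]; linear_combination quad_linear_u H u v w
  have hw : w = a - H * u * c := by
    rw [ha, hc]; field_simp; rw [hQ]; linear_combination quad_linear_w H u v w
  have hgen : ∀ L : IntermediateField ℂ Ω, T ⊆ L → a ∈ L → b ∈ L → c ∈ L → v ∈ L →
      T ∪ {u, v, w} ⊆ L := by
    intro L hTL haL hbL hcL hvL
    have huL : u ∈ L := by rw [hu]; exact add_mem (mul_mem hvL hcL) hbL
    have hwL : w ∈ L := by
      rw [hw]; exact sub_mem haL (mul_mem (mul_mem (hHmem L hTL) huL) hcL)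
    rintro x (hx | rfl | rfl | rfl)
    · exact hTL hx
    · exact huL
    · exact hvL
    · exact hwL
  obtain ⟨Θ, hΘ⟩ : ∃ Θ, Θ = IntermediateField.adjoin ℂ (T ∪ {a, b, c}) := ⟨_, rfl⟩
  have hΘs : T ∪ {a, b, c} ⊆ Θ := hΘ ▸ IntermediateField.subset_adjoin _ _
  have hTΘ : T ⊆ Θ := fun x hx => hΘs (Or.inl hx)
  have haΘ : a ∈ Θ := hΘs (by simp)
  have hbΘ : b ∈ Θ := hΘs (by simp)
  have hcΘ : c ∈ Θ := hΘs (by simp)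
  have hHΘ := hHmem Θ hTΘ
  have hvΘ : v ∉ acl (Θ : Set Ω) := by
    intro hv
    refine hlt (hrk.trans ?_)
    rw [hΘ, acl_adjoin] at hv
    exact rk_le_of_subset_acl (hgen _ (fun x hx => subset_acl _ (Or.inl hx))
      (subset_acl _ (by simp)) (subset_acl _ (by simp)) (subset_acl _ (by simp)) hv)
  have hcub : ∀ i, cub H a b c 1 i =
      (![u, H * u ^ 2 + v * w, v, w, 1] : Fin 5 → Ω) i * cub H a b c 1 4 := by
    have hc' : ∀ i, cub H a b c 1 i = (Q 3)⁻¹ ^ 3 * cub H (Q 0) (Q 1) (Q 2) (Q 3) i := fun i => by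
      rw [← cub_smul, inv_mul_cancel₀ h3, inv_mul_eq_div, inv_mul_eq_div, inv_mul_eq_div,
        ha, hb, hc]
    intro i
    have := cub_quad H u v w i
    rw [← hQ] at this
    rw [hc', hc', this]; ring
  have hc4 : cub H a b c 1 4 = 0 := by
    by_contra h4
    apply hvΘ
    have := hcub 2
    simp only [Matrix.cons_val] at this
    rw [eq_div_of_mul_eq h4 this.symm]
    exact subset_acl _ (div_mem (cub_mem hHΘ haΘ hbΘ hcΘ 2) (cub_mem hHΘ haΘ hbΘ hcΘ 4))
  have hcub0 : ∀ i, cub H a b c 1 i = 0 := fun i => by rw [hcub, hc4, mul_zero]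
  have hlowΘ : a ∈ acl T → b ∈ acl T → c ∈ acl T → False := fun ha hb hc =>
    hlow (hgen _ (hsub v) (hle v ha) (hle v hb) (hle v hc) (subset_acl _ (Or.inl rfl)))
  by_cases hdeg : a = 0 ∨ b = 0 ∨ c = 0 ∨ a ^ 2 - c = 0
  · obtain ⟨h1, h2, h3⟩ := cub_degenerate hH0 hcub0 hdeg (K := (acl T).toSubfield)
      (fun x hx => mem_acl_of_pow (n := 5) (by norm_num) hx) hHT
    exact hlowΘ h1 h2 h3
  push Not at hdeg
  obtain ⟨ξ', Y, y', hξ0, hcurve, hy5, hy0, hξ', hY, hy', ha', hb', hc'⟩ :=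
    curve_of_cub hH0 hdeg.1 hdeg.2.1 hdeg.2.2.1 hdeg.2.2.2 hcub0
  have : CharZero Ω := charZero_omega Ω
  have hg : gfun ξ' (Y + 1 / 2 + ξ') = Y * (1 + ξ') - ξ' ^ 2 := by
    simp only [gfun]; ring
  have hT' : Twist (k + 1) 2 t ξ' (Y + 1 / 2 + ξ') y' :=
    { indep := hind
      curve := by
        simp only [OnCurve]
        linear_combination hcurve
      root := by rw [hg, hy5, hH]
      generic := by
        rw [← hTdef]
        intro hξT
        have hYT := mem_acl_of_curve hξT hcurve
        have hyT : y' ∈ acl T := by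
          refine mem_acl_of_pow (n := 5) (by norm_num) ?_
          rw [hy5]
          exact mul_mem (pow_mem hHT _) (sub_mem (mul_mem hYT (add_mem (one_mem _) hξT))
            (pow_mem hξT _))
        refine hlowΘ ?_ ?_ ?_
        · rw [ha']; exact div_mem (pow_mem hyT _) (mul_mem hHT hξT)
        · rw [hb']
          exact div_mem (sub_mem (pow_mem hξT _) hYT) (mul_mem hξT (pow_mem hyT _))
        · rw [hc']; exact div_mem hYT (mul_mem hξT hyT) }
  have hΘT : Θ = twistField (k + 1) t ξ' (Y + 1 / 2 + ξ') y' := by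
    apply le_antisymm
    · obtain ⟨L, hL⟩ : ∃ L, L = twistField (k + 1) t ξ' (Y + 1 / 2 + ξ') y' := ⟨_, rfl⟩
      have hξL : ξ' ∈ L := hL ▸ xi_mem_twistField
      have hyL : y' ∈ L := hL ▸ y_mem_twistField
      have hYL : Y ∈ L := by
        have h1 : Y + 1 / 2 + ξ' ∈ L := hL ▸ omega_mem_twistField
        have e : Y = (Y + 1 / 2 + ξ') - ξ' - 1 / 2 := by ring
        rw [e]
        exact sub_mem (sub_mem h1 hξL) (div_mem (one_mem _) (ofNat_mem _ _))
      have hTL : T ⊆ L := by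
        rw [hL, hTdef]
        exact fun x hx => IntermediateField.subset_adjoin _ _ (Or.inl hx)
      have hHL := hHmem L hTL
      rw [← hL, hΘ, IntermediateField.adjoin_le_iff]
      rintro x (hx | rfl | rfl | rfl)
      · exact hTL hx
      · rw [ha']; exact div_mem (pow_mem hyL _) (mul_mem hHL hξL)
      · rw [hb']
        exact div_mem (sub_mem (pow_mem hξL _) hYL) (mul_mem hξL (pow_mem hyL _))
      · rw [hc']; exact div_mem hYL (mul_mem hξL hyL)
    · have hD : a ^ 2 - c ∈ Θ := sub_mem (pow_mem haΘ _) hcΘ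
      have hξL : ξ' ∈ Θ := by
        rw [hξ']; exact div_mem (mul_mem (mul_mem haΘ hHΘ) (pow_mem hbΘ _)) (pow_mem hD _)
      have hYL : Y ∈ Θ := by
        rw [hY]
        exact div_mem (mul_mem (mul_mem (mul_mem (neg_mem (pow_mem haΘ _)) hcΘ) (pow_mem hHΘ _))
          (pow_mem hbΘ _)) (pow_mem hD _)
      have hyL : y' ∈ Θ := by
        rw [hy']; exact div_mem (mul_mem (mul_mem (neg_mem haΘ) hHΘ) hbΘ) hD
      rw [twistField, IntermediateField.adjoin_le_iff]
      rintro x (hx | rfl | rfl | rfl)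
      · exact hTΘ (hTdef ▸ hx)
      · exact hξL
      · exact add_mem (add_mem hYL (div_mem (one_mem _) (ofNat_mem _ _))) hξL
      · exact hyL
  refine hT.false_of_adjoin_eq hT' hs (s₂ := v) (hΘT ▸ hvΘ) ?_
  rw [← hΘT, ← hM]
  apply le_antisymm
  · rw [IntermediateField.adjoin_le_iff]
    exact hgen _ (fun x hx => IntermediateField.subset_adjoin _ _ (Or.inl (hTΘ hx)))
      (IntermediateField.subset_adjoin _ _ (Or.inl haΘ))
      (IntermediateField.subset_adjoin _ _ (Or.inl hbΘ))
      (IntermediateField.subset_adjoin _ _ (Or.inl hcΘ))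
      (IntermediateField.subset_adjoin _ _ (Or.inr rfl))
  · obtain ⟨L, hL⟩ : ∃ L, L = IntermediateField.adjoin ℂ (T ∪ {u, v, w}) := ⟨_, rfl⟩
    have hLs : T ∪ {u, v, w} ⊆ L := hL ▸ IntermediateField.subset_adjoin _ _
    have hTL : T ⊆ L := fun x hx => hLs (Or.inl hx)
    have hq : ∀ i, Q i ∈ L := fun i => by
      rw [hQ]
      exact quad_mem (hHmem L hTL) (hLs (by simp)) (hLs (by simp)) (hLs (by simp)) i
    rw [← hL, IntermediateField.adjoin_le_iff]
    rintro x (hx | rfl)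
    · have : Θ ≤ L := by
        rw [hΘ, IntermediateField.adjoin_le_iff]
        rintro x (hx | rfl | rfl | rfl)
        · exact hTL hx
        · rw [ha]; exact div_mem (hq _) (hq _)
        · rw [hb]; exact div_mem (hq _) (hq _)
        · rw [hc]; exact div_mem (hq _) (hq _)
      exact this hx
    · exact hLs (by simp)

end ImagePlace

end CremonaPlaces

namespace CremonaPlaces

section RuledPoint

lemma rk_image_of_independent {Ω : Type} [Field Ω] [Algebra ℂ Ω] {m : ℕ} {t : ℕ → Ω}
    (h : AlgebraicIndependent ℂ (fun i : Fin m => t i)) : rk (t '' Set.Iio m) = (m : ℕ∞) := by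
  have e : (t '' Set.Iio m) = Set.range (fun i : Fin m => t i) := by
    ext x
    constructor
    · rintro ⟨i, hi, rfl⟩; exact ⟨⟨i, hi⟩, rfl⟩
    · rintro ⟨i, rfl⟩; exact ⟨i, i.2, rfl⟩
  rw [e, rk_range_of_algebraicIndependent h, Fintype.card_fin]

/-- Twisted quintic function fields exist, with room for a ruling. -/
lemma exists_twist (m : ℕ) : ∃ (Ω : Type) (_ : Field Ω) (_ : Algebra ℂ Ω) (_ : IsAlgClosed Ω)
    (τ : ℕ → Ω) (ξ ω y s : Ω), Twist m 1 τ ξ ω y ∧ s ∉ acl (twistField m τ ξ ω y : Set Ω) := by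
  let Ω := AlgebraicClosure (RatFun ℂ (m + 2))
  let t : ℕ → Ω := fun j => if h : j < m + 2 then
    algebraMap (RatFun ℂ (m + 2)) Ω (coord ⟨j, h⟩) else 0
  have hind : AlgebraicIndependent ℂ (fun i : Fin (m + 2) => t i) := by
    have := (algebraicIndependent_coord (m + 2)).map'
      (f := IsScalarTower.toAlgHom ℂ (RatFun ℂ (m + 2)) Ω)
      (algebraMap (RatFun ℂ (m + 2)) Ω).injective
    convert this using 1
    funext i
    simp [t]
  have hrk := rk_image_of_independent hind
  have hind' : AlgebraicIndependent ℂ (fun i : Fin m => t i) :=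
    hind.comp (Fin.castAdd 2) (Fin.castAdd_injective m 2)
  have hrk' := rk_image_of_independent hind'
  have himg : t '' Set.Iio (m + 2) = insert (t (m + 1)) (insert (t m) (t '' Set.Iio m)) := by
    rw [← Set.image_insert_eq, ← Set.image_insert_eq]
    congr 1
    ext j
    simp only [Set.mem_Iio, Set.mem_insert_iff]
    omega
  rw [himg] at hrk
  have hξ : t m ∉ acl (t '' Set.Iio m) := by
    intro h
    have h1 : rk (insert (t m) (t '' Set.Iio m)) ≤ rk (t '' Set.Iio m) :=
      rk_le_of_subset_acl (Set.insert_subset h (subset_acl _))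
    have h2 := rk_insert_le (insert (t m) (t '' Set.Iio m)) (t (m + 1))
    rw [hrk] at h2
    have h3 := h2.trans (add_le_add_left (h1.trans hrk'.le) 1)
    norm_cast at h3
    omega
  have hs : t (m + 1) ∉ acl (insert (t m) (t '' Set.Iio m)) := by
    intro h
    have h1 : rk (insert (t (m + 1)) (insert (t m) (t '' Set.Iio m))) ≤
        rk (insert (t m) (t '' Set.Iio m)) :=
      rk_le_of_subset_acl (Set.insert_subset h (subset_acl _))
    have h2 := h1.trans (rk_insert_le _ _)
    rw [hrk, hrk'] at h2
    norm_cast at h2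
    omega
  obtain ⟨ω, hω⟩ := IsAlgClosed.exists_pow_nat_eq
    ((t m) ^ 3 + (2 : ℚ) * (t m) ^ 2 + (1 : ℚ) * t m + (1 / 4 : ℚ)) (n := 2) (by norm_num)
  obtain ⟨y, hy⟩ := IsAlgClosed.exists_pow_nat_eq (hseq t m ^ 1 * gfun (t m) ω) (n := 5)
    (by norm_num)
  have hT : Twist m 1 t (t m) ω y := ⟨hind', hω, hy, hξ⟩
  refine ⟨Ω, inferInstance, inferInstance, inferInstance, t, t m, ω, y, t (m + 1), hT, ?_⟩
  intro h
  exact hs (acl_le_of_subset (twistField_le hT (fun i hi => subset_acl _ (Or.inr ⟨i, hi, rfl⟩))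
    (subset_acl _ (Or.inl rfl))) h)

variable {Ω : Type} [Field Ω] [Algebra ℂ Ω] {m : ℕ} {τ : ℕ → Ω} {ξ ω y s : Ω}

lemma Twist.le_acl {e : ℕ} (h : Twist m e τ ξ ω y) :
    twistField m τ ξ ω y ≤ acl (insert ξ (τ '' Set.Iio m)) :=
  twistField_le h (fun i hi => subset_acl _ (Or.inr ⟨i, hi, rfl⟩)) (subset_acl _ (Or.inl rfl))

lemma Twist.rk_insert {e : ℕ} (h : Twist m e τ ξ ω y) :
    rk (insert ξ (τ '' Set.Iio m)) = ((m + 1 : ℕ) : ℕ∞) := by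
  rw [rk_insert_of_notMem h.generic, rk_image_of_independent h.indep]
  norm_cast

lemma Twist.rk_adjoin {e : ℕ} (h : Twist m e τ ξ ω y)
    (hs : s ∉ acl (twistField m τ ξ ω y : Set Ω)) :
    rk (IntermediateField.adjoin ℂ ((twistField m τ ξ ω y : Set Ω) ∪ {s}) : Set Ω) =
      ((m + 2 : ℕ) : ℕ∞) := by
  have hsub : insert ξ (τ '' Set.Iio m) ⊆ (twistField m τ ξ ω y : Set Ω) := by
    refine Set.insert_subset xi_mem_twistField ?_
    rintro _ ⟨i, hi, rfl⟩
    exact h.tau_mem hi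
  have hK : rk (twistField m τ ξ ω y : Set Ω) = ((m + 1 : ℕ) : ℕ∞) :=
    le_antisymm ((rk_le_of_subset_acl h.le_acl).trans h.rk_insert.le)
      (h.rk_insert.ge.trans (rk_mono hsub))
  rw [← rk_acl, acl_adjoin, rk_acl, Set.union_singleton, rk_insert_of_notMem hs, hK]
  norm_cast

/-- The cubics contract a ruled divisor over the twisted quintic to the quintic. -/
lemma Twist.exists_point (h : Twist m 1 τ ξ ω y) (hs : s ∉ acl (twistField m τ ξ ω y : Set Ω)) :
    ∃ a b c : Ω, IntermediateField.adjoin ℂ (τ '' Set.Iio m ∪ {a, b, c}) =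
        IntermediateField.adjoin ℂ ((twistField m τ ξ ω y : Set Ω) ∪ {s}) ∧
      ∀ R, R = cub (hseq τ m) a b c 1 → R 4 ≠ 0 ∧ R 0 / R 4 ∈ twistField m τ ξ ω y ∧
        R 2 / R 4 ∈ twistField m τ ξ ω y ∧ R 3 / R 4 ∈ twistField m τ ξ ω y := by
  have : CharZero Ω := charZero_omega Ω
  obtain ⟨K, hK⟩ : ∃ K, K = twistField m τ ξ ω y := ⟨_, rfl⟩
  obtain ⟨H, hH⟩ : ∃ H, H = hseq τ m := ⟨_, rfl⟩
  obtain ⟨g, hg⟩ : ∃ g, g = gfun ξ ω := ⟨_, rfl⟩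
  obtain ⟨Y, hY⟩ : ∃ Y, Y = ω - 1 / 2 - ξ := ⟨_, rfl⟩
  obtain ⟨T, hT⟩ : ∃ T, T = τ '' Set.Iio m := ⟨_, rfl⟩
  have hξ0 : ξ ≠ 0 := h.xi_ne_zero
  have hg0 : g ≠ 0 := hg ▸ h.gfun_ne_zero
  have hH0 : H ≠ 0 := hH ▸ hseq_ne_zero h.indep le_rfl
  have hroot : y ^ 5 = H * g := by rw [h.root, pow_one, hH, hg]
  have hy0 : y ≠ 0 := by
    rintro rfl
    exact mul_ne_zero hH0 hg0 (by rw [← hroot]; simp)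
  have hHy : H = y ^ 5 / g := by rw [hroot, mul_div_cancel_right₀ _ hg0]
  have hgY : g = Y * (1 + ξ) - ξ ^ 2 := by rw [hg, gfun, hY]
  have hω : ω = Y + 1 / 2 + ξ := by rw [hY]; ring
  have hcurve : Y ^ 2 + 2 * Y * ξ + Y - ξ ^ 3 - ξ ^ 2 = 0 := by
    have := h.curve
    unfold OnCurve at this
    push_cast at this
    rw [hω] at this
    linear_combination this
  have hTK : T ⊆ K := by
    rw [hK, hT]
    exact fun x hx => IntermediateField.subset_adjoin _ _ (Or.inl hx)
  have hHmem : ∀ L : IntermediateField ℂ Ω, T ⊆ L → H ∈ L := by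
    intro L hL
    rw [hH]
    exact hseq_mem L.toSubring fun i hi => hL (hT ▸ ⟨i, hi, rfl⟩)
  have hξK : ξ ∈ K := hK ▸ xi_mem_twistField
  have hyK : y ∈ K := hK ▸ y_mem_twistField
  have hYK : Y ∈ K := by
    rw [hY]
    exact sub_mem (sub_mem (hK ▸ omega_mem_twistField) (div_mem (one_mem _) (ofNat_mem _ _))) hξK
  have hgK : g ∈ K := by
    rw [hgY]
    exact sub_mem (mul_mem hYK (add_mem (one_mem _) hξK)) (pow_mem hξK _)
  rw [← hK] at hs ⊢
  rw [← hH, ← hT]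
  obtain ⟨a, ha⟩ : ∃ a, a = (-Y - ξ * s) / (ξ * y) := ⟨_, rfl⟩
  obtain ⟨b, hb⟩ : ∃ b, b = (-g + ξ * (Y - ξ ^ 2) * s) / (ξ * y ^ 4) := ⟨_, rfl⟩
  obtain ⟨c, hc⟩ : ∃ c, c = ξ * s / y ^ 2 := ⟨_, rfl⟩
  obtain ⟨e0, e2, e3⟩ := cub_of_curve hξ0 hy0 hg0 hHy hgY hcurve ha hb hc
  have h4 : cub H a b c 1 4 ≠ 0 := by
    intro h0
    have lift : ∀ x ∈ K, x ∈ acl (K : Set Ω) := fun x hx => subset_acl _ hx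
    let A := acl (K : Set Ω)
    let H' : A := ⟨H, lift _ (hHmem K hTK)⟩
    let a0 : A := ⟨-Y / (ξ * y), lift _ (div_mem (neg_mem hYK) (mul_mem hξK hyK))⟩
    let a1 : A := ⟨-1 / y, lift _ (div_mem (neg_mem (one_mem _)) hyK)⟩
    let b0 : A := ⟨-g / (ξ * y ^ 4), lift _ (div_mem (neg_mem hgK) (mul_mem hξK (pow_mem hyK _)))⟩
    let b1 : A := ⟨(Y - ξ ^ 2) / y ^ 4,
      lift _ (div_mem (sub_mem hYK (pow_mem hξK _)) (pow_mem hyK _))⟩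
    let c1 : A := ⟨ξ / y ^ 2, lift _ (div_mem hξK (pow_mem hyK _))⟩
    let p : Polynomial A := cub (Polynomial.C H') (Polynomial.C a0 + Polynomial.C a1 * Polynomial.X)
      (Polynomial.C b0 + Polynomial.C b1 * Polynomial.X) (Polynomial.C c1 * Polynomial.X) 1 4
    refine hs (mem_acl_of_root p ?_ ?_)
    · intro hp
      have h1 := congrArg (Polynomial.evalRingHom 0) hp
      rw [map_cub, map_zero] at h1
      simp only [Polynomial.coe_evalRingHom, Polynomial.eval_add, Polynomial.eval_mul,
        Polynomial.eval_C, Polynomial.eval_X, Polynomial.eval_one, mul_zero, add_zero] at h1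
      have h2 := congrArg (A.val : A →+* Ω) h1
      rw [map_cub, map_zero, map_one] at h2
      have h3 : cub H (-Y / (ξ * y)) (-g / (ξ * y ^ 4)) 0 1 4 = 0 := h2
      simp only [cub, Matrix.cons_val] at h3
      rw [hHy] at h3
      field_simp at h3
      have hYξ : Y = ξ ^ 2 := by
        refine mul_left_cancel₀ hg0 ?_
        linear_combination h3
      have h5 : ξ ^ 3 * (ξ + 1) = 0 := by
        rw [hYξ] at hcurve
        linear_combination hcurve
      have h6 : ξ + 1 = 0 := (mul_eq_zero.mp h5).resolve_left (pow_ne_zero _ hξ0)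
      refine h.generic ?_
      rw [eq_neg_of_add_eq_zero_left h6]
      exact neg_mem (one_mem _)
    · have h1 := map_cub (Polynomial.aeval (R := A) s).toRingHom (Polynomial.C H')
        (Polynomial.C a0 + Polynomial.C a1 * Polynomial.X)
        (Polynomial.C b0 + Polynomial.C b1 * Polynomial.X) (Polynomial.C c1 * Polynomial.X) 1 4
      refine h1.trans ?_
      simp only [AlgHom.toRingHom_eq_coe, RingHom.coe_coe, map_add, map_mul, map_one,
        Polynomial.aeval_C, Polynomial.aeval_X]
      rw [← h0]
      have eH : algebraMap A Ω H' = H := rfl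
      have ea : algebraMap A Ω a0 + algebraMap A Ω a1 * s = a := by
        rw [ha]
        change -Y / (ξ * y) + -1 / y * s = _
        field_simp
        ring
      have eb : algebraMap A Ω b0 + algebraMap A Ω b1 * s = b := by
        rw [hb]
        change -g / (ξ * y ^ 4) + (Y - ξ ^ 2) / y ^ 4 * s = _
        field_simp
      have ec : algebraMap A Ω c1 * s = c := by
        rw [hc]
        change ξ / y ^ 2 * s = _
        field_simp
      rw [eH, ea, eb, ec]
  obtain ⟨y4, hy4⟩ : ∃ y4, y4 = -y ^ 4 * ξ / g := ⟨_, rfl⟩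
  have hy40 : y4 ≠ 0 := by
    rw [hy4]; exact div_ne_zero (mul_ne_zero (neg_ne_zero.mpr (pow_ne_zero _ hy0)) hξ0) hg0
  have hy4K : y4 ∈ K := by
    rw [hy4]; exact div_mem (mul_mem (neg_mem (pow_mem hyK _)) hξK) hgK
  rw [← hy4] at e0 e2 e3
  have h0 : cub H a b c 1 0 ≠ 0 := fun h0 => h4 (by rw [← e0, h0, zero_mul])
  refine ⟨a, b, c, le_antisymm ?_ ?_, ?_⟩
  · obtain ⟨L, hL⟩ : ∃ L, L = IntermediateField.adjoin ℂ ((K : Set Ω) ∪ {s}) := ⟨_, rfl⟩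
    have hLs : (K : Set Ω) ∪ {s} ⊆ L := hL ▸ IntermediateField.subset_adjoin _ _
    have lift : ∀ x ∈ K, x ∈ L := fun x hx => hLs (Or.inl hx)
    have hsL : s ∈ L := hLs (Or.inr rfl)
    rw [← hL, IntermediateField.adjoin_le_iff]
    rintro x (hx | rfl | rfl | rfl)
    · exact lift _ (hTK hx)
    · rw [ha]
      exact div_mem (sub_mem (neg_mem (lift _ hYK)) (mul_mem (lift _ hξK) hsL))
        (lift _ (mul_mem hξK hyK))
    · rw [hb]
      exact div_mem (add_mem (neg_mem (lift _ hgK)) (mul_mem (lift _ (mul_mem hξK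
        (sub_mem hYK (pow_mem hξK _)))) hsL)) (lift _ (mul_mem hξK (pow_mem hyK _)))
    · rw [hc]
      exact div_mem (mul_mem (lift _ hξK) hsL) (lift _ (pow_mem hyK _))
  · obtain ⟨L, hL⟩ : ∃ L, L = IntermediateField.adjoin ℂ (T ∪ {a, b, c}) := ⟨_, rfl⟩
    have hLs : T ∪ {a, b, c} ⊆ L := hL ▸ IntermediateField.subset_adjoin _ _
    have hTL : T ⊆ L := fun x hx => hLs (Or.inl hx)
    have hHL := hHmem L hTL
    have hcL : c ∈ L := hLs (by simp)
    have hR : ∀ i, cub H a b c 1 i ∈ L :=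
      fun i => cub_mem hHL (hLs (by simp)) (hLs (by simp)) hcL i
    have m4 : y4 ∈ L := by
      rw [eq_div_of_mul_eq h0 ((mul_comm _ _).trans e0)]
      exact div_mem (hR _) (hR _)
    have m2 : y ^ 2 * (Y - ξ ^ 2) / g ∈ L := by
      rw [eq_div_of_mul_eq h4 e2.symm]
      exact div_mem (mul_mem (hR _) m4) (hR _)
    have m3 : y ^ 3 * Y / g ∈ L := by
      rw [eq_div_of_mul_eq h4 e3.symm]
      exact div_mem (mul_mem (hR _) m4) (hR _)
    have myL : y ∈ L := by
      have e : y = (H + (y ^ 2 * (Y - ξ ^ 2) / g) * (y ^ 3 * Y / g)) / y4 := by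
        rw [eq_div_iff hy40, hy4, hHy]
        field_simp
        rw [hgY]
        linear_combination -hcurve
      rw [e]
      exact div_mem (add_mem hHL (mul_mem m2 m3)) m4
    have mξL : ξ ∈ L := by
      have e : ξ = -y4 * y / H := by
        rw [hy4, hHy]; field_simp
      rw [e]
      exact div_mem (mul_mem (neg_mem m4) myL) hHL
    have mYL : Y ∈ L := by
      have e : Y = (y ^ 3 * Y / g) * y ^ 2 / H := by
        rw [hHy]; field_simp
      rw [e]
      exact div_mem (mul_mem m3 (pow_mem myL _)) hHL
    have msL : s ∈ L := by
      have e : s = c * y ^ 2 / ξ := by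
        rw [hc]; field_simp
      rw [e]
      exact div_mem (mul_mem hcL (pow_mem myL _)) mξL
    have hKL : K ≤ L := by
      rw [hK, twistField, IntermediateField.adjoin_le_iff, ← hT]
      rintro x (hx | rfl | rfl | rfl)
      · exact hTL hx
      · exact mξL
      · rw [hω]
        exact add_mem (add_mem mYL (div_mem (one_mem _) (ofNat_mem _ _))) mξL
      · exact myL
    rw [← hL, IntermediateField.adjoin_le_iff]
    rintro x (hx | rfl)
    · exact hKL hx
    · exact msL
  · rintro R rfl
    refine ⟨h4, ?_, ?_, ?_⟩
    · rw [← e0, div_mul_cancel_left₀ h0]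
      exact inv_mem hy4K
    · have e : cub H a b c 1 2 / cub H a b c 1 4 = y ^ 2 * (Y - ξ ^ 2) / g / y4 := by
        rw [div_eq_div_iff h4 hy40, e2]
      rw [e]
      exact div_mem (div_mem (mul_mem (pow_mem hyK _) (sub_mem hYK (pow_mem hξK _))) hgK) hy4K
    · have e : cub H a b c 1 3 / cub H a b c 1 4 = y ^ 3 * Y / g / y4 := by
        rw [div_eq_div_iff h4 hy40, e3]
      rw [e]
      exact div_mem (div_mem (mul_mem (pow_mem hyK _) hYK) hgK) hy4K

end RuledPoint

end CremonaPlaces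

namespace CremonaPlaces

section TwistedPlaces

lemma map_subring_hseq {F Ω : Type} [Field F] [Algebra ℂ F] [Field Ω] [Algebra ℂ Ω]
    {V : ValuationSubring F} {ρ : F → Ω} (h : IsPlace V ρ) {t : ℕ → F} {m : ℕ}
    (ht : ∀ i < m, t i ∈ V) : hseq t m ∈ V ∧ ρ (hseq t m) = hseq (fun i => ρ (t i)) m := by
  induction m with
  | zero => exact ⟨one_mem V, h.one⟩
  | succ m ih =>
    obtain ⟨h1, h2⟩ := ih fun i hi => ht i (Nat.lt_succ_of_lt hi)
    have h3 := ht m (Nat.lt_succ_self m)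
    refine ⟨add_mem (pow_mem h3 _) (pow_mem h1 _), ?_⟩
    rw [hseq, hseq, h.add _ (pow_mem h3 _) _ (pow_mem h1 _), h.pow h3, h.pow h1, h2]

/-- Restriction of a place to its valuation ring. -/
def IsPlace.ringHom {F Ω : Type} [Field F] [Algebra ℂ F] [Field Ω] [Algebra ℂ Ω]
    {V : ValuationSubring F} {ρ : F → Ω} (h : IsPlace V ρ) : V →+* Ω where
  toFun a := ρ a
  map_one' := h.one
  map_zero' := h.zero
  map_add' a b := h.add _ a.2 _ b.2
  map_mul' a b := h.mul _ a.2 _ b.2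

lemma IsPlace.quad {F Ω : Type} [Field F] [Algebra ℂ F] [Field Ω] [Algebra ℂ Ω]
    {V : ValuationSubring F} {ρ : F → Ω} (h : IsPlace V ρ) {H u v w : F} (hH : H ∈ V)
    (hu : u ∈ V) (hv : v ∈ V) (hw : w ∈ V) (i : Fin 4) :
    CremonaPlaces.quad H u v w i ∈ V ∧ ρ (CremonaPlaces.quad H u v w i) =
      CremonaPlaces.quad (ρ H) (ρ u) (ρ v) (ρ w) i := by
  have e : CremonaPlaces.quad H u v w i =
      (CremonaPlaces.quad (⟨H, hH⟩ : V) ⟨u, hu⟩ ⟨v, hv⟩ ⟨w, hw⟩ i : V) :=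
    (map_quad V.subtype ⟨H, hH⟩ ⟨u, hu⟩ ⟨v, hv⟩ ⟨w, hw⟩ i).symm
  rw [e]
  exact ⟨Subtype.property _, map_quad h.ringHom _ _ _ _ i⟩

lemma IsPlace.cub {F Ω : Type} [Field F] [Algebra ℂ F] [Field Ω] [Algebra ℂ Ω]
    {V : ValuationSubring F} {ρ : F → Ω} (h : IsPlace V ρ) {H a b c : F} (hH : H ∈ V)
    (ha : a ∈ V) (hb : b ∈ V) (hc : c ∈ V) (i : Fin 5) :
    CremonaPlaces.cub H a b c 1 i ∈ V ∧ ρ (CremonaPlaces.cub H a b c 1 i) =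
      CremonaPlaces.cub (ρ H) (ρ a) (ρ b) (ρ c) 1 i := by
  have e : CremonaPlaces.cub H a b c 1 i =
      (CremonaPlaces.cub (⟨H, hH⟩ : V) ⟨a, ha⟩ ⟨b, hb⟩ ⟨c, hc⟩ 1 i : V) :=
    (map_cub V.subtype ⟨H, hH⟩ ⟨a, ha⟩ ⟨b, hb⟩ ⟨c, hc⟩ 1 i).symm
  rw [e]
  refine ⟨Subtype.property _, (map_cub h.ringHom _ _ _ _ _ i).trans ?_⟩
  rw [map_one]
  rfl

/-- The residue field is a rational function field over a twisted quintic. -/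
def IsTwisted {F : Type} [Field F] [Algebra ℂ F] (m : ℕ) (V : ValuationSubring F) : Prop :=
  ∃ (Ω : Type) (_ : Field Ω) (_ : Algebra ℂ Ω) (_ : IsAlgClosed Ω) (ρ : F → Ω) (h : IsPlace V ρ)
    (τ : ℕ → Ω) (ξ ω y s : Ω), Twist m 1 τ ξ ω y ∧ s ∉ acl (twistField m τ ξ ω y : Set Ω) ∧
    h.resField = IntermediateField.adjoin ℂ ((twistField m τ ξ ω y : Set Ω) ∪ {s})

open Pointwise in
lemma IsTwisted.smul {F : Type} [Field F] [Algebra ℂ F] {m : ℕ} {V : ValuationSubring F}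
    (h : IsTwisted m V) (σ : F ≃ₐ[ℂ] F) : IsTwisted m (σ • V) := by
  obtain ⟨Ω, i1, i2, i3, ρ, h, τ, ξ, ω, y, s, hT, hs, hres⟩ := h
  refine ⟨Ω, i1, i2, i3, _, h.smul σ, τ, ξ, ω, y, s, hT, hs, ?_⟩
  rw [← hres]
  ext x
  rw [IsPlace.mem_resField, IsPlace.mem_resField]
  constructor
  · rintro ⟨a, ha, rfl⟩
    exact ⟨σ⁻¹ a, ValuationSubring.mem_pointwise_smul_iff_inv_smul_mem.mp ha, rfl⟩
  · rintro ⟨a, ha, rfl⟩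
    refine ⟨σ a, ValuationSubring.smul_mem_pointwise_smul_iff.mpr ha, ?_⟩
    change ρ (σ.symm (σ a)) = ρ a
    rw [AlgEquiv.symm_apply_apply]

lemma natCoord_mem {m j : ℕ} {V : ValuationSubring (RatFun ℂ (m + 3))}
    (hx : ∀ i : Fin (m + 3), coord i ∈ V) (hj : j < m + 3) : natCoord m j ∈ V := by
  have := hx ⟨j, hj⟩
  rwa [coord_eq_natCoord] at this

lemma range_res {Ω : Type} {m : ℕ} (ρ : RatFun ℂ (m + 3) → Ω) :
    (Set.range fun i : Fin (m + 3) => ρ (coord i)) = (fun j => ρ (natCoord m j)) '' Set.Iio m ∪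
      {ρ (natCoord m m), ρ (natCoord m (m + 1)), ρ (natCoord m (m + 2))} := by
  ext x
  constructor
  · rintro ⟨⟨j, hj⟩, rfl⟩
    change ρ (coord _) ∈ _; rw [coord_eq_natCoord]
    by_cases h1 : j < m
    · exact Or.inl ⟨j, h1, rfl⟩
    · right
      obtain rfl | rfl | rfl : j = m ∨ j = m + 1 ∨ j = m + 2 := by omega
      · simp
      · simp
      · simp
  · have key : ∀ j, j < m + 3 → ∃ i : Fin (m + 3), ρ (coord i) = ρ (natCoord m j) :=
      fun j hj => ⟨⟨j, hj⟩, by rw [coord_eq_natCoord]⟩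
    rintro (⟨j, hj, rfl⟩ | rfl | rfl | rfl)
    · exact key j (lt_trans hj (by omega))
    · exact key _ (by omega)
    · exact key _ (by omega)
    · exact key _ (by omega)

open Pointwise in
/-- The cubic transformation preserves divisorial places with twisted residue field, while its
inverse does not. -/
lemma exists_cremona_twisted (k : ℕ) :
    ∃ φ : RatFun ℂ (k + 1 + 3) ≃ₐ[ℂ] RatFun ℂ (k + 1 + 3),
      (∀ V : ValuationSubring (RatFun ℂ (k + 1 + 3)), IsDiv V → IsTwisted (k + 1) V →
        IsDiv (φ⁻¹ • V)) ∧
      ∃ V : ValuationSubring (RatFun ℂ (k + 1 + 3)), IsDiv V ∧ IsTwisted (k + 1) V ∧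
        ¬ IsDiv (φ • V) := by
  obtain ⟨φ, hφ, hquad, hcub⟩ := exists_cremona (k + 1)
  have hφs : ∀ j < k + 1, φ.symm (natCoord (k + 1) j) = natCoord (k + 1) j := fun j hj => by
    rw [AlgEquiv.symm_apply_eq, hφ j hj]
  obtain ⟨Q, hQ⟩ : ∃ Q, Q = quad (hseq (natCoord (k + 1)) (k + 1)) (natCoord (k + 1) (k + 1))
    (natCoord (k + 1) (k + 1 + 1)) (natCoord (k + 1) (k + 1 + 2)) := ⟨_, rfl⟩
  obtain ⟨R, hR⟩ : ∃ R, R = cub (hseq (natCoord (k + 1)) (k + 1)) (natCoord (k + 1) (k + 1))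
    (natCoord (k + 1) (k + 1 + 1)) (natCoord (k + 1) (k + 1 + 2)) 1 := ⟨_, rfl⟩
  obtain ⟨q0, q1, q2⟩ := hquad Q hQ
  obtain ⟨r0, r2, r3⟩ := hcub R hR
  refine ⟨φ, ?_, ?_⟩
  · rintro _ ⟨p, hp, rfl⟩ ⟨Ω, i1, i2, i3, ρ, h, τ, ξ, ω, y, s, hT, hs, hres⟩
    have hx : ∀ j < k + 1 + 3, natCoord (k + 1) j ∈ primeVal (RatFun ℂ (k + 1 + 3)) p hp :=
      fun j hj => natCoord_mem coord_mem_primeVal hj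
    obtain ⟨hHm, hHρ⟩ := map_subring_hseq h (t := natCoord (k + 1)) (m := k + 1)
      fun i hi => hx i (by omega)
    have hQρ := h.quad hHm (hx (k + 1) (by omega)) (hx (k + 1 + 1) (by omega))
      (hx (k + 1 + 2) (by omega))
    rw [hHρ, ← hQ] at hQρ
    rw [h.resField_primeVal, range_res] at hres
    have hrk := h.le_rk
    rw [range_res] at hrk
    obtain ⟨h3, hr⟩ := hT.le_rk_quad hs hres hrk rfl
    rw [← (hQρ 0).2, ← (hQρ 1).2, ← (hQρ 2).2, ← (hQρ 3).2,
      ← h.div (hQρ 0).1 (hQρ 3).1 (by rw [(hQρ 3).2]; exact h3),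
      ← h.div (hQρ 1).1 (hQρ 3).1 (by rw [(hQρ 3).2]; exact h3),
      ← h.div (hQρ 2).1 (hQρ 3).1 (by rw [(hQρ 3).2]; exact h3), ← q0, ← q1, ← q2] at hr
    rw [← (hQρ 3).2] at h3
    have hmem : ∀ j < k + 1 + 3, φ (natCoord (k + 1) j) ∈ primeVal (RatFun ℂ (k + 1 + 3)) p hp := by
      intro j hj
      by_cases h1 : j < k + 1
      · rw [hφ j h1]; exact hx j hj
      · obtain rfl | rfl | rfl : j = k + 1 ∨ j = k + 1 + 1 ∨ j = k + 1 + 2 := by omega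
        · rw [q0]; exact h.div_mem (hQρ 0).1 (hQρ 3).1 h3
        · rw [q1]; exact h.div_mem (hQρ 1).1 (hQρ 3).1 h3
        · rw [q2]; exact h.div_mem (hQρ 2).1 (hQρ 3).1 h3
    refine (h.smul φ⁻¹).isDiv (n := k + 1 + 2) ?_ ?_ (smul_ne_top (primeVal_ne_top hp) _)
    · intro i
      rw [ValuationSubring.mem_pointwise_smul_iff_inv_smul_mem, inv_inv, coord_eq_natCoord]
      exact hmem i i.2
    · rw [range_res fun a => ρ ((φ⁻¹)⁻¹ a)]
      simp only [inv_inv]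
      have e : (fun j => ρ (φ (natCoord (k + 1) j))) '' Set.Iio (k + 1) =
          (fun j => ρ (natCoord (k + 1) j)) '' Set.Iio (k + 1) :=
        Set.image_congr fun j hj => by rw [hφ j hj]
      rw [e]
      exact hr
  · obtain ⟨Ω, i1, i2, i3, τ, ξ, ω, y, s, hT, hs⟩ := exists_twist (k + 1)
    obtain ⟨a, b, c, hadj, hpt⟩ := hT.exists_point hs
    have hrk : rk (τ '' Set.Iio (k + 1) ∪ {a, b, c}) = ((k + 1 + 2 : ℕ) : ℕ∞) := by
      rw [← hT.rk_adjoin hs, ← hadj, ← rk_acl, ← acl_adjoin, rk_acl]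
    obtain ⟨p, hp, ρ, h, hρ⟩ := exists_isPlace_of_point (n := k + 1 + 2)
      (x := fun j => pt (k + 1) τ a b c j) (by rw [range_pt, hrk])
      (by rw [range_pt, hrk]; norm_cast; omega)
    have hρn : ∀ j < k + 1 + 3, ρ (natCoord (k + 1) j) = pt (k + 1) τ a b c j := fun j hj => by
      have := hρ ⟨j, hj⟩
      rwa [coord_eq_natCoord] at this
    have ha : ρ (natCoord (k + 1) (k + 1)) = a := by rw [hρn _ (by omega)]; simp [pt]
    have hb : ρ (natCoord (k + 1) (k + 1 + 1)) = b := by rw [hρn _ (by omega)]; simp [pt]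
    have hc : ρ (natCoord (k + 1) (k + 1 + 2)) = c := by
      rw [hρn _ (by omega)]; simp [pt]; omega
    have ht : ∀ j < k + 1, ρ (natCoord (k + 1) j) = τ j := fun j hj => by
      rw [hρn _ (by omega)]; simp [pt, hj]
    have hx : ∀ j < k + 1 + 3, natCoord (k + 1) j ∈ primeVal (RatFun ℂ (k + 1 + 3)) p hp :=
      fun j hj => natCoord_mem coord_mem_primeVal hj
    obtain ⟨hHm, hHρ⟩ := map_subring_hseq h (t := natCoord (k + 1)) (m := k + 1)
      fun i hi => hx i (by omega)
    have hRρ := h.cub hHm (hx (k + 1) (by omega)) (hx (k + 1 + 1) (by omega))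
      (hx (k + 1 + 2) (by omega))
    rw [hHρ, ← hR, hseq_congr ht, ha, hb, hc] at hRρ
    obtain ⟨h4, m0, m2, m3⟩ := hpt _ rfl
    rw [← (hRρ 4).2] at h4
    rw [← (hRρ 0).2, ← (hRρ 4).2, ← h.div (hRρ 0).1 (hRρ 4).1 h4, ← r0] at m0
    rw [← (hRρ 2).2, ← (hRρ 4).2, ← h.div (hRρ 2).1 (hRρ 4).1 h4, ← r2] at m2
    rw [← (hRρ 3).2, ← (hRρ 4).2, ← h.div (hRρ 3).1 (hRρ 4).1 h4, ← r3] at m3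
    refine ⟨primeVal _ p hp, ⟨p, hp, rfl⟩, ⟨Ω, i1, i2, i3, ρ, h, τ, ξ, ω, y, s, hT, hs, ?_⟩, ?_⟩
    · rw [h.resField_primeVal, ← hadj, ← range_pt]
      simp only [hρ]
    · rintro ⟨p', hp', he⟩
      have h' := h.smul φ
      rw [he] at h'
      have h2 := h'.le_rk (n := k + 1 + 2)
      rw [range_res fun a => ρ (φ⁻¹ a)] at h2
      have h5 := h2.trans ((rk_le_of_subset_acl (T := insert ξ (τ '' Set.Iio (k + 1))) ?_).trans
        hT.rk_insert.le)
      · norm_cast at h5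
        omega
      · rintro x (⟨j, hj, rfl⟩ | rfl | rfl | rfl)
        · refine subset_acl _ (Or.inr ⟨j, hj, ?_⟩)
          change τ j = ρ (φ.symm (natCoord (k + 1) j))
          rw [hφs j hj, ht j hj]
        · exact hT.le_acl m0
        · exact hT.le_acl m2
        · exact hT.le_acl m3

end TwistedPlaces

open Pointwise in
lemma exists_hom_of_stabilization (k : ℕ)
    (ι : (RatFun ℂ (k + 1 + 2) ≃ₐ[ℂ] RatFun ℂ (k + 1 + 2)) →*
      (RatFun ℂ (k + 1 + 3) ≃ₐ[ℂ] RatFun ℂ (k + 1 + 3)))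
    (hι : ∀ σ, IsStabilizationOf (ι σ) σ) :
    ∃ f : (RatFun ℂ (k + 1 + 3) ≃ₐ[ℂ] RatFun ℂ (k + 1 + 3)) →* Multiplicative ℤ,
      f ≠ 1 ∧ f.comp ι = 1 := by
  let S : Set (ValuationSubring (RatFun ℂ (k + 1 + 3))) := {V | IsDiv V ∧ IsTwisted (k + 1) V}
  have hfin : ∀ g : RatFun ℂ (k + 1 + 3) ≃ₐ[ℂ] RatFun ℂ (k + 1 + 3),
      {V ∈ S | g • V ∉ S}.Finite := by
    intro g
    refine (finite_isDiv_smul_not (n := k + 1 + 2) g).subset ?_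
    rintro V ⟨⟨hV, hT⟩, hV'⟩
    exact ⟨hV, fun h => hV' ⟨h, hT.smul g⟩⟩
  obtain ⟨f, hf⟩ := exists_hom_of_commensurated S hfin
  have hsub : ∀ g : RatFun ℂ (k + 1 + 3) ≃ₐ[ℂ] RatFun ℂ (k + 1 + 3),
      (∀ V ∈ S, g • V ∈ S) → g • S ⊆ S := by
    rintro g h _ ⟨V, hV, rfl⟩
    exact h V hV
  refine ⟨f, ?_, ?_⟩
  · obtain ⟨φ, h1, V₀, hV₀, hT₀, h2⟩ := exists_cremona_twisted k
    intro hf1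
    have h3 := hf φ⁻¹
    have h4 : φ⁻¹ • S ⊆ S := hsub _ fun V hV => ⟨h1 V hV.1 hV.2, hV.2.smul _⟩
    have h5 : (S \ φ⁻¹ • S).Finite := by
      refine (hfin φ).subset ?_
      rintro V ⟨hV, hV'⟩
      exact ⟨hV, fun h => hV' (Set.mem_inv_smul_set_iff.mpr h)⟩
    have h6 : (S \ φ⁻¹ • S).ncard ≠ 0 := by
      rw [← Nat.pos_iff_ne_zero, Set.ncard_pos h5]
      exact ⟨V₀, ⟨hV₀, hT₀⟩, fun h => h2 (Set.mem_inv_smul_set_iff.mp h).1⟩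
    rw [hf1, Set.sdiff_eq_empty.mpr h4, Set.ncard_empty] at h3
    have h7 := congrArg Multiplicative.toAdd h3
    simp at h7
    omega
  · ext σ
    have hstab : ∀ σ, ι σ • S ⊆ S := by
      intro σ
      refine hsub _ fun V hV => ⟨?_, hV.2.smul _⟩
      obtain ⟨Ω, i1, i2, i3, ρ, h, τ, ξ, ω, y, s, hT, -, hres⟩ := hV.2
      exact isDiv_smul_of_isStabilizationOf (q := k + 1) (hι σ) hV.1 h hT hres
    have hstab' : S ⊆ ι σ • S := by
      have := hstab σ⁻¹
      rw [map_inv] at this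
      intro V hV
      rw [Set.mem_smul_set_iff_inv_smul_mem]
      exact this ⟨V, hV, rfl⟩
    rw [MonoidHom.comp_apply, hf, Set.sdiff_eq_empty.mpr (hstab σ), Set.sdiff_eq_empty.mpr hstab']
    simp

end CremonaPlaces

/-- For any integer `n ≥ 3`, the restriction map `H¹(Cr_{n+1}(ℂ); ℤ) → H¹(Cr_n(ℂ); ℤ)` along
the stabilization homomorphism has a non-trivial kernel: there is a non-zero homomorphism
`f : Cr_{n+1}(ℂ) → ℤ` whose composite with `ι_n` is zero. (Homomorphisms to `ℤ` are encoded
as monoid homomorphisms to `Multiplicative ℤ`.) -/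
theorem stabilization_restriction_on_H1_has_kernel (n : ℕ) (hn : 3 ≤ n)
    (ι : (RatFun ℂ n ≃ₐ[ℂ] RatFun ℂ n) →* (RatFun ℂ (n+1) ≃ₐ[ℂ] RatFun ℂ (n+1)))
    (hι : ∀ σ, IsStabilizationOf (ι σ) σ) :
    ∃ f : (RatFun ℂ (n+1) ≃ₐ[ℂ] RatFun ℂ (n+1)) →* Multiplicative ℤ,
      f ≠ 1 ∧ f.comp ι = 1 := by
  obtain ⟨k, rfl⟩ : ∃ k, n = k + 1 + 2 := ⟨n - 3, by omega⟩
  exact CremonaPlaces.exists_hom_of_stabilization k ι hι
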